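/- There exists n₀ ∈ ℕ such that the following holds. Suppose H is a 3-graph on n ≥ n₀ vertices where n is divisible by 4. If δ₂(H) ≥ n/2 − 1, then H contains a K₄⁻-factor. -/

import Mathlib

open Finset

/-- `H` is the edge set of a 3-uniform hypergraph (3-graph) on `Fin n`. -/
def Is3Graph (n : ℕ) (H : Finset (Finset (Fin n))) : Prop :=
  ∀ e ∈ H, e.card = 3

/-- `degOn H x y U` : number of `z ∈ U` with `{x,y,z} ∈ H`, i.e. `deg_H(xy, U)`. -/
def degOn {n : ℕ} (H : Finset (Finset (Fin n))) (x y : Fin n) (U : Finset (Fin n)) : ℕ :=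
  (U.filter fun z => ({x, y, z} : Finset (Fin n)) ∈ H).card

/-- The minimum codegree `δ₂(H)` is at least `t`. -/
def CodegLB {n : ℕ} (H : Finset (Finset (Fin n))) (t : ℝ) : Prop :=
  ∀ x y : Fin n, x ≠ y → t ≤ (degOn H x y Finset.univ : ℝ)

/-- `S` spans a copy of `K₄⁻` in `H`: it has 4 vertices and at least 3 of its
four 3-subsets are edges. -/
def SpansK4m {n : ℕ} (H : Finset (Finset (Fin n))) (S : Finset (Fin n)) : Prop :=
  S.card = 4 ∧ 3 ≤ ((S.powersetCard 3).filter (· ∈ H)).card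

/-- `S` spans a copy of `K₄³` (the complete 3-graph on 4 vertices) in `H`. -/
def SpansK43 {n : ℕ} (H : Finset (Finset (Fin n))) (S : Finset (Fin n)) : Prop :=
  S.card = 4 ∧ ((S.powersetCard 3).filter (· ∈ H)).card = 4

/-- The induced subgraph `H[X]` contains a `K₄⁻`-factor. -/
def HasK4mFactorOn {n : ℕ} (H : Finset (Finset (Fin n))) (X : Finset (Fin n)) : Prop :=
  ∃ P : Finset (Finset (Fin n)),
    (∀ S ∈ P, SpansK4m H S) ∧
    (∀ S ∈ P, ∀ T ∈ P, S ≠ T → Disjoint S T) ∧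
    P.biUnion id = X

/-- `S` is an `(x,y)`-connector of length `c` in `H`. -/
def IsConnector {n : ℕ} (H : Finset (Finset (Fin n))) (c : ℕ) (x y : Fin n)
    (S : Finset (Fin n)) : Prop :=
  x ∉ S ∧ y ∉ S ∧ S.card = 4 * c - 1 ∧
    HasK4mFactorOn H (insert x S) ∧ HasK4mFactorOn H (insert y S)

/-- `x` and `y` are `(c,η)`-close in `H` (a 3-graph on `n` vertices). -/
def Close {n : ℕ} (H : Finset (Finset (Fin n))) (c : ℕ) (η : ℝ) (x y : Fin n) : Prop :=
  η * (n : ℝ) ^ (4 * c - 1) ≤ ({S : Finset (Fin n) | IsConnector H c x y S}.ncard : ℝ)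

/-- `U` is `(c,η)`-closed in `H`. -/
def ClosedOn {n : ℕ} (H : Finset (Finset (Fin n))) (c : ℕ) (η : ℝ)
    (U : Finset (Fin n)) : Prop :=
  ∀ x ∈ U, ∀ y ∈ U, x ≠ y → Close H c η x y

/-- The number of `(X,Y)`-bridges `(x,y,S)` of length `c` in `H`. -/
noncomputable def BridgeCount {n : ℕ} (H : Finset (Finset (Fin n))) (c : ℕ)
    (X Y : Finset (Fin n)) : ℕ :=
  {t : Fin n × Fin n × Finset (Fin n) |
    t.1 ∈ X ∧ t.2.1 ∈ Y ∧ IsConnector H c t.1 t.2.1 t.2.2}.ncard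

/-- The 3-graph `𝓑[A,B]`: all triples in `A ∪ B` containing an odd number of
vertices of `A`. -/
def BGraph {n : ℕ} (A B : Finset (Fin n)) : Finset (Finset (Fin n)) :=
  ((A ∪ B).powersetCard 3).filter fun e => (e ∩ A).card % 2 = 1

/-- `H` (a 3-graph on `n` vertices) is `γ`-extremal. -/
def IsExtremal {n : ℕ} (H : Finset (Finset (Fin n))) (γ : ℝ) : Prop :=
  ∃ A B : Finset (Fin n), Disjoint A B ∧ A ∪ B = Finset.univ ∧
    A.card = n / 2 ∧ B.card = n - n / 2 ∧
    ((BGraph A B \ H).card : ℝ) ≤ γ * (n : ℝ) ^ 3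

/-- The number of `V₁V₂V₃`-edges of `H`. -/
def eCount {n : ℕ} (H : Finset (Finset (Fin n))) (A B C : Finset (Fin n)) : ℕ :=
  (H.filter fun e => ∃ a ∈ A, ∃ b ∈ B, ∃ c ∈ C, e = {a, b, c}).card

/-- `Ñ_{c,η}(x)` : the set of vertices `(c,η)`-close to `x` in `H`. -/
def Ntilde {n : ℕ} (H : Finset (Finset (Fin n))) (c : ℕ) (η : ℝ) (x : Fin n) :
    Set (Fin n) :=
  {y | y ≠ x ∧ Close H c η x y}

/-- The triple `{x,x',y}` is `(ρ,X,Y)`-typical. -/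
def TypicalTriple {n : ℕ} (H : Finset (Finset (Fin n))) (ρ : ℝ) (X Y : Finset (Fin n))
    (x x' y : Fin n) : Prop :=
  (Y.card : ℝ) - ρ * n ≤ (degOn H x x' Y : ℝ) ∧
  (((X.filter fun z => ({x, y, z} : Finset (Fin n)) ∈ H ∧
      ({x', y, z} : Finset (Fin n)) ∈ H).card : ℝ) ≤ ρ * n) ∧
  (X.card : ℝ) - ρ * n ≤ (degOn H x y X : ℝ) + (degOn H x' y X : ℝ)

/-- `Q` spans an `(X,Y)`-bridge of length 1, i.e. `Q = {a,b} ∪ S` for some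
`(X,Y)`-bridge `(a,b,S)` of length 1. -/
def SpansBridge1 {n : ℕ} (H : Finset (Finset (Fin n))) (X Y Q : Finset (Fin n)) : Prop :=
  ∃ a ∈ X, ∃ b ∈ Y, ∃ S : Finset (Fin n), IsConnector H 1 a b S ∧
    Q = insert a (insert b S)

open Finset

namespace KF
open Classical

/-- real-valued indicator of a proposition -/
noncomputable def I (p : Prop) : ℝ := if p then 1 else 0

lemma I_true {p : Prop} (h : p) : I p = 1 := by simp [I, h]
lemma I_false {p : Prop} (h : ¬ p) : I p = 0 := by simp [I, h]
lemma I_nonneg (p : Prop) : 0 ≤ I p := by unfold I; split_ifs <;> norm_num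
lemma I_le_one (p : Prop) : I p ≤ 1 := by unfold I; split_ifs <;> norm_num
lemma I_mono {p q : Prop} (h : p → q) : I p ≤ I q := by
  by_cases hp : p
  · rw [I_true hp, I_true (h hp)]
  · rw [I_false hp]; exact I_nonneg q
lemma I_and (p q : Prop) : I (p ∧ q) = I p * I q := by
  by_cases hp : p <;> by_cases hq : q <;> simp [I, hp, hq]
lemma I_not (p : Prop) : I (¬ p) = 1 - I p := by
  by_cases hp : p <;> simp [I, hp]
lemma I_or_le (p q : Prop) : I (p ∨ q) ≤ I p + I q := by
  by_cases hp : p <;> by_cases hq : q <;> simp [I, hp, hq]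
lemma I_congr {p q : Prop} (h : p ↔ q) : I p = I q := by simp [I, h]
lemma I_sq (p : Prop) : I p * I p = I p := by by_cases hp : p <;> simp [I, hp]
lemma I_pos {p : Prop} (h : 0 < I p) : p := by
  by_contra hp; rw [I_false hp] at h; exact lt_irrefl _ h

lemma sum_I {α : Type*} (s : Finset α) (p : α → Prop) :
    ∑ x ∈ s, I (p x) = ((s.filter p).card : ℝ) := by
  simp [I, Finset.sum_ite]

lemma exists_of_sum_I_pos {α : Type*} (s : Finset α) (p : α → Prop)
    (h : 0 < ∑ x ∈ s, I (p x)) : ∃ x ∈ s, p x := by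
  by_contra hc
  push Not at hc
  have : ∑ x ∈ s, I (p x) = 0 := Finset.sum_eq_zero fun x hx => I_false (hc x hx)
  linarith

structure G3 (V : Type) where
  E : V → V → V → Prop
  s1 : ∀ {x y z}, E x y z → E y x z
  s2 : ∀ {x y z}, E x y z → E x z y
  ne : ∀ {x y z}, E x y z → x ≠ y

section
variable {V : Type} (G : G3 V)

lemma G3.c1 (x y z : V) : G.E x y z ↔ G.E y x z := ⟨G.s1, G.s1⟩
lemma G3.c2 (x y z : V) : G.E x y z ↔ G.E x z y := ⟨G.s2, G.s2⟩
lemma G3.c3 (x y z : V) : G.E x y z ↔ G.E z y x :=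
  ⟨fun h => G.s1 (G.s2 (G.s1 h)), fun h => G.s1 (G.s2 (G.s1 h))⟩
lemma G3.rot (x y z : V) : G.E x y z ↔ G.E y z x :=
  ⟨fun h => G.s2 (G.s1 h), fun h => G.s1 (G.s2 h)⟩
lemma G3.ne13 {x y z : V} (h : G.E x y z) : x ≠ z := G.ne (G.s2 h)
lemma G3.ne23 {x y z : V} (h : G.E x y z) : y ≠ z := G.ne (G.s2 (G.s1 h))

/-- at least three of the four triples are edges -/
def G3.K (x y z t : V) : Prop :=
  (G.E x y z ∧ G.E x y t ∧ G.E x z t) ∨ (G.E x y z ∧ G.E x y t ∧ G.E y z t) ∨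
  (G.E x y z ∧ G.E x z t ∧ G.E y z t) ∨ (G.E x y t ∧ G.E x z t ∧ G.E y z t)

lemma G3.K12 (x y z t : V) : G.K x y z t ↔ G.K y x z t := by
  unfold G3.K
  rw [G.c1 x y z, G.c1 x y t]; tauto
lemma G3.K23 (x y z t : V) : G.K x y z t ↔ G.K x z y t := by
  unfold G3.K
  rw [G.c2 x y z, G.c1 y z t]; tauto
lemma G3.K34 (x y z t : V) : G.K x y z t ↔ G.K x y t z := by
  unfold G3.K
  rw [G.c2 x z t, G.c2 y z t]; tauto
lemma G3.K14 (x y z t : V) : G.K x y z t ↔ G.K t y z x := by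
  rw [G.K12 x y, G.K23 y x, G.K34 y z, G.K23 y z, G.K12 y t]
lemma G3.Krot (x y z t : V) : G.K x y z t ↔ G.K y z t x := by
  rw [G.K12 x y, G.K23 y x, G.K34 y z]
lemma G3.Krot' (x y z t : V) : G.K x y z t ↔ G.K t x y z := by
  rw [← G.Krot t x y z]
lemma G3.K24 (x y z t : V) : G.K x y z t ↔ G.K x t z y := by
  rw [G.K23 x y, G.K34 x z, G.K23 x z]
lemma G3.K13 (x y z t : V) : G.K x y z t ↔ G.K z y x t := by
  rw [G.K12 x y, G.K23 y x, G.K12 y z]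

lemma G3.K_ne {x y z t : V} (h : G.K x y z t) :
    x ≠ y ∧ x ≠ z ∧ x ≠ t ∧ y ≠ z ∧ y ≠ t ∧ z ≠ t := by
  rcases h with ⟨a, b, c⟩ | ⟨a, b, c⟩ | ⟨a, b, c⟩ | ⟨a, b, c⟩
  · exact ⟨G.ne a, G.ne13 a, G.ne13 b, G.ne23 a, G.ne23 b, G.ne23 c⟩
  · exact ⟨G.ne a, G.ne13 a, G.ne13 b, G.ne23 a, G.ne23 b, G.ne23 c⟩
  · exact ⟨G.ne a, G.ne13 a, G.ne13 b, G.ne23 a, G.ne13 c, G.ne23 c⟩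
  · exact ⟨G.ne a, G.ne b, G.ne13 b, G.ne c, G.ne13 c, G.ne23 c⟩

variable [Fintype V]

/-- codegree into a predicate -/
noncomputable def G3.d (P : V → Prop) (x y : V) : ℝ := ∑ z, I (G.E x y z ∧ P z)

lemma G3.d_comm (P : V → Prop) (x y : V) : G.d P x y = G.d P y x := by
  unfold G3.d
  exact Finset.sum_congr rfl fun z _ => I_congr (by rw [G.c1])

lemma G3.d_nonneg (P : V → Prop) (x y : V) : 0 ≤ G.d P x y :=
  Finset.sum_nonneg fun _ _ => I_nonneg _

/-- all codegrees at least δ n -/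
def G3.CD (δ : ℝ) : Prop := ∀ x y : V, x ≠ y → δ * (Fintype.card V : ℝ) ≤ ∑ z, I (G.E x y z)

lemma sum_one_card : ∑ _z : V, (1:ℝ) = (Fintype.card V : ℝ) := by simp

/-- the key counting inequality: degrees of the three pairs of an edge into `P` -/
lemma G3.ext_count {x y z : V} (h : G.E x y z) (P : V → Prop) :
    G.d P x y + G.d P x z + G.d P y z ≤ ∑ t, I (P t) + 2 * ∑ t, I (G.K x y z t ∧ P t) := by
  unfold G3.d
  rw [← Finset.sum_add_distrib, ← Finset.sum_add_distrib, Finset.mul_sum, ← Finset.sum_add_distrib]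
  refine Finset.sum_le_sum fun t _ => ?_
  by_cases hP : P t
  · by_cases h1 : G.E x y t <;> by_cases h2 : G.E x z t <;> by_cases h3 : G.E y z t <;>
      simp [I, hP, h1, h2, h3, h, G3.K] <;> norm_num
  · simp [I, hP]

/-- same with a third-degree count -/
lemma G3.ext_count3 {x y z : V} (P : V → Prop) :
    G.d P x y + G.d P x z + G.d P y z ≤ 2 * ∑ t, I (P t) +
      ∑ t, I ((G.E x y t ∧ G.E x z t ∧ G.E y z t) ∧ P t) := by
  unfold G3.d
  rw [← Finset.sum_add_distrib, ← Finset.sum_add_distrib, Finset.mul_sum, ← Finset.sum_add_distrib]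
  refine Finset.sum_le_sum fun t _ => ?_
  by_cases hP : P t
  · by_cases h1 : G.E x y t <;> by_cases h2 : G.E x z t <;> by_cases h3 : G.E y z t <;>
      simp [I, hP, h1, h2, h3] <;> norm_num
  · simp [I, hP]

lemma G3.ext_quarter {ε : ℝ} (hG : G.CD (1/2 - ε)) {x y z : V} (h : G.E x y z) :
    (1/4 - 3/2 * ε) * (Fintype.card V : ℝ) ≤ ∑ t, I (G.K x y z t) := by
  have h0 := G.ext_count h (fun _ => True)
  have e : ∀ a b, G.d (fun _ => True) a b = ∑ t, I (G.E a b t) := by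
    intro a b; simp [G3.d]
  rw [e, e, e] at h0
  simp only [and_true, I_true trivial, sum_one_card] at h0
  have h1 := hG x y (G.ne h)
  have h2 := hG x z (G.ne13 h)
  have h3 := hG y z (G.ne23 h)
  linarith

end

/-- every vertex is in many tiles -/
lemma G3.tiles_at {V : Type} [Fintype V] (G : G3 V) {ε : ℝ} (hε0 : 0 ≤ ε) (hε : ε ≤ 1/400)
    (hn : (400:ℝ) ≤ Fintype.card V) (hG : G.CD (1/2 - ε)) (x : V) :
    (Fintype.card V : ℝ)^3 / 9 ≤ ∑ y, ∑ z, ∑ t, I (G.K x y z t) := by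
  set n : ℝ := (Fintype.card V : ℝ) with hnn
  have h1 : ∀ y z, (1/4 - 3/2 * ε) * n * I (G.E x y z) ≤ ∑ t, I (G.K x y z t) := by
    intro y z
    by_cases h : G.E x y z
    · rw [I_true h, mul_one]; exact G.ext_quarter hG h
    · rw [I_false h, mul_zero]; exact Finset.sum_nonneg fun _ _ => I_nonneg _
  have h2 : ∀ y, (1/4 - 3/2 * ε) * n * ((1/2 - ε) * n * I (y ≠ x)) ≤ ∑ z, ∑ t, I (G.K x y z t) := by
    intro y
    refine le_trans ?_ (Finset.sum_le_sum fun z _ => h1 y z)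
    rw [← Finset.mul_sum]
    refine mul_le_mul_of_nonneg_left ?_ (mul_nonneg (by linarith) (by linarith))
    by_cases h : y ≠ x
    · rw [I_true h, mul_one]; exact hG x y (Ne.symm h)
    · rw [I_false h, mul_zero]; exact Finset.sum_nonneg fun _ _ => I_nonneg _
  refine le_trans ?_ (Finset.sum_le_sum fun y _ => h2 y)
  have h3 : ∑ y, I (y ≠ x) = n - 1 := by
    have : ∀ y, I (y ≠ x) = 1 - (if y = x then (1:ℝ) else 0) := by
      intro y; by_cases h : y = x <;> simp [I, h]
    simp [this, hnn]
  rw [← Finset.mul_sum, ← Finset.mul_sum, h3]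
  have a1 : (1/4 - 3/2*ε) ≥ 98/400 := by linarith
  have a2 : (1/2 - ε) ≥ 199/400 := by linarith
  have a3 : n - 1 ≥ 399/400 * n := by linarith
  have a4 : (98/400 * n) * ((199/400 * n) * (399/400 * n)) ≤ (1/4 - 3/2*ε) * n * ((1/2-ε)*n*(n-1)) := by
    gcongr
  refine le_trans ?_ a4
  have : 0 ≤ n^3 := by positivity
  nlinarith

/-! ### tileable sets -/

inductive Tl {V : Type} (G : G3 V) : Finset V → Prop
  | empty : Tl G ∅
  | cons {S : Finset V} {x y z t : V} (hS : Tl G S) (hK : G.K x y z t)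
      (hd : Disjoint S {x, y, z, t}) : Tl G (S ∪ {x, y, z, t})

section
variable {V : Type} {G : G3 V}

lemma Tl.union {S T : Finset V} (hS : Tl G S) (hT : Tl G T) (hd : Disjoint S T) : Tl G (S ∪ T) := by
  induction hT with
  | empty => simpa using hS
  | @cons T' x y z t hT' hK hd' ih =>
    rw [← Finset.union_assoc]
    refine Tl.cons (ih ?_) hK ?_
    · exact Disjoint.mono_right Finset.subset_union_left hd
    · rw [Finset.disjoint_union_left]
      exact ⟨Disjoint.mono_right Finset.subset_union_right hd, hd'⟩

lemma Tl.of_K {x y z t : V} (h : G.K x y z t) : Tl G {x, y, z, t} := by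
  have := Tl.cons (Tl.empty (G := G)) h (by simp)
  simpa using this

lemma card_K {x y z t : V} (h : G.K x y z t) : ({x, y, z, t} : Finset V).card = 4 := by
  obtain ⟨h1, h2, h3, h4, h5, h6⟩ := G.K_ne h
  rw [Finset.card_insert_of_notMem, Finset.card_insert_of_notMem, Finset.card_insert_of_notMem,
    Finset.card_singleton] <;> simp [*]

lemma Tl.card {S : Finset V} (hS : Tl G S) : 4 ∣ S.card := by
  induction hS with
  | empty => simp
  | cons hS hK hd ih =>
    rw [Finset.card_union_of_disjoint hd, card_K hK]
    omega

lemma Tl.biUnion {ι : Type*} (s : Finset ι) (f : ι → Finset V) (h : ∀ i ∈ s, Tl G (f i))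
    (hd : ∀ i ∈ s, ∀ j ∈ s, i ≠ j → Disjoint (f i) (f j)) : Tl G (s.biUnion f) := by
  induction s using Finset.induction_on with
  | empty => simpa using Tl.empty
  | insert a s ha ih =>
    rw [Finset.biUnion_insert]
    refine Tl.union (h a (by simp)) (ih (fun i hi => h i (by simp [hi]))
      (fun i hi j hj => hd i (by simp [hi]) j (by simp [hj]))) ?_
    rw [Finset.disjoint_biUnion_right]
    intro i hi
    exact hd a (by simp) i (by simp [hi]) (fun e => ha (e ▸ hi))

end

end KF

open Finset

namespace KF
open Classical

lemma sum_comp_inj {V ι κ : Type} [Fintype V] [Fintype ι] [Fintype κ] [DecidableEq ι] [DecidableEq κ] (σ : κ → ι)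
    (hσ : Function.Injective σ) (f : (κ → V) → ℝ) :
    ∑ g : ι → V, f (fun k => g (σ k)) =
      (Fintype.card V : ℝ) ^ (Fintype.card ι - Fintype.card κ) * ∑ h : κ → V, f h := by
  let p : ι → Prop := fun i => i ∈ Set.range σ
  let e1 : (ι → V) ≃ ({i // p i} → V) × ({i // ¬ p i} → V) :=
    Equiv.piEquivPiSubtypeProd p (fun _ => V)
  let e0 : κ ≃ {i // p i} := Equiv.ofInjective σ hσ
  let e2 : ({i // p i} → V) ≃ (κ → V) := Equiv.arrowCongr e0.symm (Equiv.refl V)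
  have h1 : ∑ g : ι → V, f (fun k => g (σ k)) =
      ∑ q : ({i // p i} → V) × ({i // ¬ p i} → V), f (e2 q.1) := by
    refine Fintype.sum_equiv e1 _ _ fun g => ?_
    congr 1
  rw [h1, Fintype.sum_prod_type_right]
  simp only [Finset.sum_const, Finset.card_univ, Fintype.card_pi, Finset.prod_const, nsmul_eq_mul]
  have h2 : ∑ q : {i // p i} → V, f (e2 q) = ∑ h : κ → V, f h :=
    Fintype.sum_equiv e2 _ _ fun _ => rfl
  rw [h2]
  congr 1
  have h3 : Fintype.card {i // p i} = Fintype.card κ := (Fintype.card_congr e0).symm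
  rw [Fintype.card_subtype_compl, h3]
  push_cast
  rfl

lemma sum_fin4 {V : Type} [Fintype V] (f : (Fin 4 → V) → ℝ) :
    ∑ h : Fin 4 → V, f h = ∑ x, ∑ y, ∑ z, ∑ t, f ![x, y, z, t] := by
  rw [← (Fin.consEquiv (fun _ : Fin 4 => V)).sum_comp, Fintype.sum_prod_type]
  refine Finset.sum_congr rfl fun x _ => ?_
  rw [← (Fin.consEquiv (fun _ : Fin 3 => V)).sum_comp, Fintype.sum_prod_type]
  refine Finset.sum_congr rfl fun y _ => ?_
  rw [← (finTwoArrowEquiv V).symm.sum_comp, Fintype.sum_prod_type]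
  refine Finset.sum_congr rfl fun z _ => Finset.sum_congr rfl fun t _ => ?_
  congr 1

lemma sum_fin3 {V : Type} [Fintype V] (f : (Fin 3 → V) → ℝ) :
    ∑ h : Fin 3 → V, f h = ∑ x, ∑ y, ∑ z, f ![x, y, z] := by
  rw [← (Fin.consEquiv (fun _ : Fin 3 => V)).sum_comp, Fintype.sum_prod_type]
  refine Finset.sum_congr rfl fun x _ => ?_
  rw [← (finTwoArrowEquiv V).symm.sum_comp, Fintype.sum_prod_type]
  refine Finset.sum_congr rfl fun z _ => Finset.sum_congr rfl fun t _ => ?_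
  congr 1

lemma sum_fin2 {V : Type} [Fintype V] (f : (Fin 2 → V) → ℝ) :
    ∑ h : Fin 2 → V, f h = ∑ x, ∑ y, f ![x, y] := by
  rw [← (finTwoArrowEquiv V).symm.sum_comp, Fintype.sum_prod_type]
  refine Finset.sum_congr rfl fun z _ => Finset.sum_congr rfl fun t _ => ?_
  congr 1

section Turan
variable {V : Type} [Fintype V] (G : G3 V)

/-- `abc` is the only edge in `abcd` -/
def G3.odd (a b c d : V) : Prop := G.E a b c ∧ ¬ G.E a b d ∧ ¬ G.E a c d ∧ ¬ G.E b c d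

def G3.W1 (y r1 r2 r3 t : V) : Prop :=
  G.odd y r1 t r2 ∨ G.odd y r2 t r1 ∨ G.odd y r1 t r3 ∨ G.odd y r3 t r1 ∨
  G.odd y r2 t r3 ∨ G.odd y r3 t r2 ∨ G.odd r1 r2 t y ∨ G.odd r1 r3 t y ∨ G.odd r2 r3 t y

def G3.W2 (y r2 r3 t t' : V) : Prop := G.odd y r2 t' t ∨ G.odd y r3 t t'

lemma turan_core (hK : ∀ x y z t, ¬ G.K x y z t) (ε b : ℝ) (hε : 0 ≤ ε) (hε1 : ε ≤ 1/1000)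
    (hb : b = 1/2000) (hm : (0:ℝ) < Fintype.card V)
    (hlo : G.CD (1/3 - ε))
    (hhi : ∀ x y, x ≠ y → ∑ z, I (G.E x y z) ≤ (1/3 + 2*ε) * Fintype.card V)
    (y r1 r2 r3 : V) (h12 : ¬ G.E y r1 r2) (h13 : ¬ G.E y r1 r3) (h23 : ¬ G.E y r2 r3)
    (n1 : y ≠ r1) (n2 : y ≠ r2) (n3 : y ≠ r3) (n12 : r1 ≠ r2) (n13 : r1 ≠ r3) (n23 : r2 ≠ r3)
    (hbad : ∑ t, ∑ t', I (G.W1 y r1 r2 r3 t ∨ G.W2 y r2 r3 t t') ≤ b * (Fintype.card V)^2) :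
    (1/6 - 1/20) * Fintype.card V ≤ ∑ t, I (G.E y r1 t ∧ G.E y r2 t ∧ G.E y r3 t) ∧
    (2/3 - 1/20) * Fintype.card V ≤ ∑ t, I (G.E y r1 t ∨ G.E y r2 t ∨ G.E y r3 t) := by
  set m : ℝ := (Fintype.card V : ℝ) with hmdef
  set τ := ∑ t, I (G.E y r1 t ∧ G.E y r2 t ∧ G.E y r3 t) with hτ
  set U := ∑ t, I (G.E y r1 t ∨ G.E y r2 t ∨ G.E y r3 t) with hU
  set c12 := ∑ t, I (G.E y r1 t ∧ G.E y r2 t) with hc12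
  set c13 := ∑ t, I (G.E y r1 t ∧ G.E y r3 t) with hc13
  set c23 := ∑ t, I (G.E y r2 t ∧ G.E y r3 t) with hc23
  set w := ∑ t, I (G.W1 y r1 r2 r3 t) with hw
  have hwb : w ≤ b * m := by
    have : w * m ≤ b * m^2 := by
      refine le_trans ?_ hbad
      rw [hw, Finset.sum_mul]
      refine Finset.sum_le_sum fun t _ => ?_
      rw [hmdef, ← sum_one_card, Finset.mul_sum]
      refine Finset.sum_le_sum fun t' _ => ?_
      rw [mul_one]; exact I_mono Or.inl
    nlinarith
  have hεm : ε * m ≤ m / 1000 := by nlinarith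
  have hwm : w ≤ m / 2000 := by rw [hb] at hwb; linarith
  -- two-sided estimates of the pair intersections
  have key : ∀ i j : V, ¬ G.E y i j → y ≠ i → y ≠ j → i ≠ j →
      (∀ t, G.odd y i t j ∨ G.odd y j t i ∨ G.odd i j t y → G.W1 y r1 r2 r3 t) →
      (1/6 - 1/500) * m - w/2 ≤ ∑ t, I (G.E y i t ∧ G.E y j t) ∧
      ∑ t, I (G.E y i t ∧ G.E y j t) ≤ (1/6 + 1/300) * m + w/2 := by
    intro i j hij hi hj hne hW
    have a1 := hlo y i hi
    have a2 := hlo y j hj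
    have a3 := hlo i j hne
    have b1 := hhi y i hi
    have b2 := hhi y j hj
    have b3 := hhi i j hne
    have u1 : ∑ t, I (G.E i j t) ≤ ∑ t, I (G.E y i t) + ∑ t, I (G.E y j t)
        - 2 * ∑ t, I (G.E y i t ∧ G.E y j t) + w := by
      rw [hw, Finset.mul_sum, ← Finset.sum_add_distrib, ← Finset.sum_sub_distrib,
        ← Finset.sum_add_distrib]
      refine Finset.sum_le_sum fun t _ => ?_
      by_cases p1 : G.E y i t <;> by_cases p2 : G.E y j t <;> by_cases p3 : G.E i j t
      · exact absurd (Or.inr (Or.inr (Or.inr ⟨p1, p2, p3⟩))) (hK y i j t)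
      all_goals first
        | (have := I_nonneg (G.W1 y r1 r2 r3 t)
           simp only [I_true, I_false, p1, p2, p3, and_true, and_false, not_false_eq_true]
           linarith)
        | skip
      have : G.W1 y r1 r2 r3 t := hW t (Or.inr (Or.inr ⟨p3, fun h => hij (by
        rw [G.rot]; exact h), fun h => p1 (by rw [G.rot]; exact h), fun h => p2 (by rw [G.rot]; exact h)⟩))
      rw [I_true this]
      simp only [I_true, I_false, p1, p2, p3, and_false, not_false_eq_true]
      norm_num
    have u2 : ∑ t, I (G.E y i t) + ∑ t, I (G.E y j t)
        - 2 * ∑ t, I (G.E y i t ∧ G.E y j t) ≤ ∑ t, I (G.E i j t) + w := by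
      rw [hw, Finset.mul_sum, ← Finset.sum_add_distrib, ← Finset.sum_sub_distrib,
        ← Finset.sum_add_distrib]
      refine Finset.sum_le_sum fun t _ => ?_
      have hw0 := I_nonneg (G.W1 y r1 r2 r3 t)
      have h0 := I_nonneg (G.E i j t)
      by_cases p1 : G.E y i t <;> by_cases p2 : G.E y j t <;> by_cases p3 : G.E i j t
      all_goals try
          (simp only [I_true, I_false, p1, p2, p3, and_true, and_false, and_self, not_false_eq_true]
           linarith)
      · have : G.W1 y r1 r2 r3 t := hW t (Or.inl ⟨p1, hij, fun h => p2 (by rw [G.c2]; exact h),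
          fun h => p3 (by rw [G.c2]; exact h)⟩)
        rw [I_true this]
        simp only [I_true, I_false, p1, p2, p3, and_false, not_false_eq_true]
        norm_num
      · have : G.W1 y r1 r2 r3 t := hW t (Or.inr (Or.inl ⟨p2, fun h => hij (by rw [G.c2]; exact h),
          fun h => p1 (by rw [G.c2]; exact h), fun h => p3 (by rw [G.c1]; exact G.s2 h)⟩))
        rw [I_true this]
        simp only [I_true, I_false, p1, p2, p3, false_and, not_false_eq_true]
        norm_num
    constructor
    · linarith
    · linarith
  obtain ⟨l12, g12⟩ := key r1 r2 h12 n1 n2 n12 (fun t h => by unfold G3.W1; tauto)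
  obtain ⟨l13, g13⟩ := key r1 r3 h13 n1 n3 n13 (fun t h => by unfold G3.W1; tauto)
  obtain ⟨l23, g23⟩ := key r2 r3 h23 n2 n3 n23 (fun t h => by unfold G3.W1; tauto)
  rw [← hc12] at l12 g12
  rw [← hc13] at l13 g13
  rw [← hc23] at l23 g23
  -- product bound
  have eP : ∑ t, I (G.E y r1 t ∧ G.E y r3 t ∧ ¬ G.E y r2 t) = c13 - τ := by
    rw [hc13, hτ, ← Finset.sum_sub_distrib]
    refine Finset.sum_congr rfl fun t _ => ?_
    by_cases p1 : G.E y r1 t <;> by_cases p2 : G.E y r2 t <;> by_cases p3 : G.E y r3 t <;>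
      simp [I, p1, p2, p3]
  have eQ : ∑ t, I (G.E y r1 t ∧ G.E y r2 t ∧ ¬ G.E y r3 t) = c12 - τ := by
    rw [hc12, hτ, ← Finset.sum_sub_distrib]
    refine Finset.sum_congr rfl fun t _ => ?_
    by_cases p1 : G.E y r1 t <;> by_cases p2 : G.E y r2 t <;> by_cases p3 : G.E y r3 t <;>
      simp [I, p1, p2, p3]
  have hPQ : (c13 - τ) * (c12 - τ) ≤ b * m^2 := by
    refine le_trans ?_ hbad
    rw [← eP, ← eQ, Finset.sum_mul_sum]
    refine Finset.sum_le_sum fun t _ => Finset.sum_le_sum fun t' _ => ?_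
    rw [← I_and]
    refine I_mono ?_
    rintro ⟨⟨p1, p3, p2⟩, ⟨q1, q2, q3⟩⟩
    by_contra hcon
    push Not at hcon
    obtain ⟨hc1, hc2⟩ := hcon
    have ytt : ¬ G.E y t t' := fun h => hK y r1 t t' (Or.inl ⟨p1, q1, h⟩)
    have r2tt : G.E r2 t t' := by
      by_contra h
      refine hc2 (Or.inl ⟨q2, p2, fun h' => ytt (G.s2 h'), fun h' => h (G.s2 h')⟩)
    have r3tt : G.E r3 t t' := by
      by_contra h
      exact hc2 (Or.inr ⟨p3, q3, ytt, h⟩)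
    have r23t : G.E r2 r3 t := by
      by_contra h
      refine hc1 ?_
      unfold G3.W1
      have : G.odd y r3 t r2 := ⟨p3, fun h' => h23 (G.s2 h'), fun h' => p2 (G.s2 h'),
        fun h' => h (by rw [G.c1]; exact G.s2 h')⟩
      tauto
    exact hK r2 r3 t t' (Or.inr (Or.inr (Or.inl ⟨r23t, r2tt, r3tt⟩)))
  have hτl : (1/6 - 1/20) * m ≤ τ := by
    by_contra hlt
    push Not at hlt
    have e1 : (1/30) * m ≤ c13 - τ := by linarith
    have e2 : (1/30) * m ≤ c12 - τ := by linarith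
    have : (1/30*m) * (1/30*m) ≤ (c13 - τ) * (c12 - τ) := by
      apply mul_le_mul e1 e2 (by positivity) (le_trans (by positivity) e1)
    have hm2 : 0 < m^2 := by positivity
    rw [hb] at hPQ
    linarith [this, hPQ, hm2, sq m]
  refine ⟨hτl, ?_⟩
  have hUe : U = ∑ t, I (G.E y r1 t) + ∑ t, I (G.E y r2 t) + ∑ t, I (G.E y r3 t)
      - c12 - c13 - c23 + τ := by
    rw [hU, hc12, hc13, hc23, hτ]
    simp only [← Finset.sum_add_distrib, ← Finset.sum_sub_distrib]
    refine Finset.sum_congr rfl fun t _ => ?_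
    by_cases p1 : G.E y r1 t <;> by_cases p2 : G.E y r2 t <;> by_cases p3 : G.E y r3 t <;>
      simp [I, p1, p2, p3] <;> norm_num
  have a1 := hlo y r1 n1
  have a2 := hlo y r2 n2
  have a3 := hlo y r3 n3
  by_contra hlt
  push Not at hlt
  have e1 : (1/30) * m ≤ c13 - τ := by linarith
  have e2 : (1/30) * m ≤ c12 - τ := by linarith
  have : (1/30*m) * (1/30*m) ≤ (c13 - τ) * (c12 - τ) := by
    apply mul_le_mul e1 e2 (by positivity) (le_trans (by positivity) e1)
  have hm2 : 0 < m^2 := by positivity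
  rw [hb] at hPQ
  linarith [this, hPQ, hm2, sq m]

end Turan

end KF

open Finset

namespace KF
open Classical

lemma I_exists_le {α : Type*} (s : Finset α) (p : α → Prop) :
    I (∃ a ∈ s, p a) ≤ ∑ a ∈ s, I (p a) := by
  by_cases h : ∃ a ∈ s, p a
  · obtain ⟨a, ha, hp⟩ := h
    rw [I_true ⟨a, ha, hp⟩, ← I_true hp]
    exact Finset.single_le_sum (f := fun a => I (p a)) (fun _ _ => I_nonneg _) ha
  · rw [I_false h]; exact Finset.sum_nonneg fun _ _ => I_nonneg _

section Turan2
variable {V : Type} [Fintype V] (G : G3 V)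

lemma sum_odd_le (hK : ∀ x y z t, ¬ G.K x y z t) (ε : ℝ) (hε : 0 ≤ ε) (hlo : G.CD (1/3 - ε)) :
    ∑ a, ∑ b, ∑ c, ∑ d, I (G.odd a b c d) ≤ 3 * ε * (Fintype.card V : ℝ)^4 := by
  set m : ℝ := (Fintype.card V : ℝ) with hm
  have h1 : ∀ a b c, ∑ d, I (G.odd a b c d) ≤ 3 * ε * m := by
    intro a b c
    by_cases h : G.E a b c
    · have h2 : ∑ d, I (G.odd a b c d) ≤ ∑ d, (1 - I (G.E a b d) - I (G.E a c d) - I (G.E b c d)) := by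
        refine Finset.sum_le_sum fun d _ => ?_
        by_cases p1 : G.E a b d <;> by_cases p2 : G.E a c d <;> by_cases p3 : G.E b c d
        all_goals first
          | (exfalso; exact hK a b c d (by unfold G3.K; tauto))
          | (simp [I, p1, p2, p3, h, G3.odd])
      rw [Finset.sum_sub_distrib, Finset.sum_sub_distrib, Finset.sum_sub_distrib, sum_one_card] at h2
      have a1 := hlo a b (G.ne h)
      have a2 := hlo a c (G.ne13 h)
      have a3 := hlo b c (G.ne23 h)
      linarith
    · have : ∑ d, I (G.odd a b c d) = 0 := Finset.sum_eq_zero fun d _ => I_false fun h' => h h'.1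
      rw [this]; positivity
  calc _ ≤ ∑ _a : V, ∑ _b : V, ∑ _c : V, 3 * ε * m :=
        Finset.sum_le_sum fun a _ => Finset.sum_le_sum fun b _ => Finset.sum_le_sum fun c _ => h1 a b c
    _ = 3 * ε * m^4 := by simp [← hm]; ring

abbrev Ix := (Fin 2 ⊕ Fin 3) ⊕ Fin 2

lemma turan : ∃ ε : ℝ, 0 < ε ∧ ε ≤ 1/1000 ∧ ∃ m0 : ℕ, ∀ (V : Type) [Fintype V] (G : G3 V),
    m0 ≤ Fintype.card V → G.CD (1/3 - ε) → ∃ x y z t, G.K x y z t := by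
  refine ⟨1/10^10, by norm_num, by norm_num, 10^10, ?_⟩
  intro V _ G hm hlo
  by_contra hK
  push Not at hK
  set ε : ℝ := 1/10^10 with hε
  set m : ℝ := (Fintype.card V : ℝ) with hmdef
  have hm' : (10:ℝ)^10 ≤ m := by rw [hmdef]; exact_mod_cast hm
  have hmp : 0 < m := by linarith [show (0:ℝ) < 10^10 by norm_num]
  have hhi : ∀ x y, x ≠ y → ∑ z, I (G.E x y z) ≤ (1/3 + 2*ε) * m := by
    intro x y hxy
    have h0 := hlo x y hxy
    obtain ⟨z, -, hz⟩ := exists_of_sum_I_pos univ (fun z => G.E x y z)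
      (lt_of_lt_of_le (mul_pos (by rw [hε]; norm_num) hmp) h0)
    have h1 := G.ext_count hz (fun _ => True)
    have e : ∀ a b, G.d (fun _ => True) a b = ∑ t, I (G.E a b t) := by
      intro a b; simp [G3.d]
    rw [e, e, e] at h1
    have h2 : ∑ t, I (G.K x y z t ∧ True) = 0 :=
      Finset.sum_eq_zero fun t _ => I_false fun h => hK _ _ _ _ h.1
    rw [h2] at h1
    simp only [I_true trivial, sum_one_card] at h1
    have := hlo x z (G.ne13 hz)
    have := hlo y z (G.ne23 hz)
    linarith
  -- the bad event
  let Bad : (Ix → V) → Prop := fun g =>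
    (∃ q ∈ (univ : Finset (Fin 4 → Ix)).filter Function.Injective, G.odd (g (q 0)) (g (q 1)) (g (q 2)) (g (q 3)))
  let Eqr : (Ix → V) → Prop := fun g =>
    ∃ q ∈ (univ : Finset (Fin 2 → Ix)).filter Function.Injective, g (q 0) = g (q 1)
  have hBad : ∑ g, I (Bad g) ≤ 7^4 * (m^3 * (3 * ε * m^4)) := by
    calc ∑ g, I (Bad g) ≤ ∑ g : Ix → V, ∑ q ∈ (univ : Finset (Fin 4 → Ix)).filter Function.Injective,
          I (G.odd (g (q 0)) (g (q 1)) (g (q 2)) (g (q 3))) :=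
          Finset.sum_le_sum fun g _ => I_exists_le _ _
      _ = ∑ q ∈ (univ : Finset (Fin 4 → Ix)).filter Function.Injective, ∑ g : Ix → V,
          I (G.odd (g (q 0)) (g (q 1)) (g (q 2)) (g (q 3))) := Finset.sum_comm
      _ ≤ ∑ q ∈ (univ : Finset (Fin 4 → Ix)).filter Function.Injective, m^3 * (3 * ε * m^4) := by
          refine Finset.sum_le_sum fun q hq => ?_
          have hq' : Function.Injective q := (Finset.mem_filter.mp hq).2
          have := sum_comp_inj (V := V) q hq' (fun h => I (G.odd (h 0) (h 1) (h 2) (h 3)))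
          refine (le_of_eq this).trans ?_
          rw [sum_fin4]
          have e : Fintype.card Ix - Fintype.card (Fin 4) = 3 := by simp
          rw [e]
          exact mul_le_mul_of_nonneg_left (sum_odd_le G hK ε (by rw [hε]; norm_num) hlo) (by positivity)
      _ ≤ ∑ q : Fin 4 → Ix, m^3 * (3 * ε * m^4) := by
          refine Finset.sum_le_sum_of_subset_of_nonneg (Finset.filter_subset _ _) fun _ _ _ => ?_
          rw [hε]; positivity
      _ = _ := by
          rw [Finset.sum_const, nsmul_eq_mul, Finset.card_univ]
          simp only [Fintype.card_pi, Finset.prod_const, Fintype.card_sum, Fintype.card_fin, Finset.card_univ]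
          norm_num
  have hEq : ∑ g, I (Eqr g) ≤ 7^2 * (m^5 * m) := by
    calc ∑ g, I (Eqr g) ≤ ∑ g : Ix → V, ∑ q ∈ (univ : Finset (Fin 2 → Ix)).filter Function.Injective,
          I (g (q 0) = g (q 1)) :=
          Finset.sum_le_sum fun g _ => I_exists_le _ _
      _ = ∑ q ∈ (univ : Finset (Fin 2 → Ix)).filter Function.Injective, ∑ g : Ix → V,
          I (g (q 0) = g (q 1)) := Finset.sum_comm
      _ ≤ ∑ q ∈ (univ : Finset (Fin 2 → Ix)).filter Function.Injective, m^5 * m := by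
          refine Finset.sum_le_sum fun q hq => ?_
          have hq' : Function.Injective q := (Finset.mem_filter.mp hq).2
          have := sum_comp_inj (V := V) q hq' (fun h => I (h 0 = h 1))
          refine (le_of_eq this).trans ?_
          rw [sum_fin2]
          have e : Fintype.card Ix - Fintype.card (Fin 2) = 5 := by simp
          rw [e]
          refine mul_le_mul_of_nonneg_left (le_of_eq ?_) (by positivity)
          simp [I, hmdef]
      _ ≤ ∑ q : Fin 2 → Ix, m^5 * m := by
          refine Finset.sum_le_sum_of_subset_of_nonneg (Finset.filter_subset _ _) fun _ _ _ => ?_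
          positivity
      _ = _ := by
          rw [Finset.sum_const, nsmul_eq_mul, Finset.card_univ]
          simp only [Fintype.card_pi, Finset.prod_const, Fintype.card_sum, Fintype.card_fin, Finset.card_univ]
          norm_num
  -- good edges
  let Ed : (Fin 2 → V) → (Fin 3 → V) → Prop := fun a r => ∀ i, G.E (a 0) (a 1) (r i)
  have hEd : m^5 / 40 ≤ ∑ a, ∑ r, I (Ed a r) := by
    have e1 : ∀ a : Fin 2 → V, ∑ r, I (Ed a r) = (∑ z, I (G.E (a 0) (a 1) z))^3 := by
      intro a
      have : ∀ r : Fin 3 → V, I (Ed a r) = ∏ i, I (G.E (a 0) (a 1) (r i)) := by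
        intro r
        simp only [Fin.prod_univ_three, ← I_and]
        refine I_congr ?_
        simp only [Ed, Fin.forall_fin_succ]
        simp
        tauto
      simp only [this]
      rw [← Fin.prod_const, Finset.prod_univ_sum]
      simp
    simp only [e1]
    rw [sum_fin2]
    simp only [Matrix.cons_val_zero, Matrix.cons_val_one]
    have h2 : ∀ x y, (1/3 - ε)^3 * m^3 * I (x ≠ y) ≤ (∑ z, I (G.E x y z))^3 := by
      intro x y
      by_cases h : x ≠ y
      · rw [I_true h, mul_one, ← mul_pow]
        exact pow_le_pow_left₀ (mul_nonneg (by rw [hε]; norm_num) hmp.le) (hlo x y h) 3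
      · rw [I_false h, mul_zero]
        exact pow_nonneg (Finset.sum_nonneg fun _ _ => I_nonneg _) 3
    refine le_trans ?_ (Finset.sum_le_sum fun x _ => Finset.sum_le_sum fun y _ => h2 x y)
    simp only [← Finset.mul_sum]
    have h3 : ∑ x : V, ∑ y, I (x ≠ y) = m * m - m := by
      simp only [ne_eq, I_not, Finset.sum_sub_distrib, sum_one_card]
      simp [I, hmdef]
    rw [h3]
    have h4 : m * m - m ≥ 99/100 * m^2 := by nlinarith
    have h5 : (1/3 - ε)^3 ≥ 36/1000 := by rw [hε]; norm_num
    have : (36/1000) * m^3 * (99/100 * m^2) ≤ (1/3 - ε)^3 * m^3 * (m * m - m) := by gcongr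
    nlinarith [pow_pos hmp 5]
  -- pick a good quintuple
  have hpick : ∃ a r, Ed a r ∧ ∑ k : Fin 2 → V, I (Bad (Sum.elim (Sum.elim a r) k) ∨
      Eqr (Sum.elim (Sum.elim a r) k)) ≤ (1/2000) * m^2 := by
    by_contra hcon
    push Not at hcon
    have h1 : ∑ a, ∑ r, I (Ed a r) * (1/2000 * m^2) ≤ ∑ g, I (Bad g ∨ Eqr g) := by
      have e : ∑ g, I (Bad g ∨ Eqr g) = ∑ a : Fin 2 → V, ∑ r : Fin 3 → V, ∑ k : Fin 2 → V,
          I (Bad (Sum.elim (Sum.elim a r) k) ∨ Eqr (Sum.elim (Sum.elim a r) k)) := by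
        rw [← (Equiv.sumArrowEquivProdArrow (Fin 2 ⊕ Fin 3) (Fin 2) V).symm.sum_comp,
          Fintype.sum_prod_type]
        rw [← (Equiv.sumArrowEquivProdArrow (Fin 2) (Fin 3) V).symm.sum_comp,
          Fintype.sum_prod_type]
        rfl
      rw [e]
      refine Finset.sum_le_sum fun a _ => Finset.sum_le_sum fun r _ => ?_
      by_cases h : Ed a r
      · rw [I_true h, one_mul]; exact (hcon a r h).le
      · rw [I_false h, zero_mul]; exact Finset.sum_nonneg fun _ _ => I_nonneg _
    simp only [← Finset.sum_mul] at h1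
    have h2 : ∑ g, I (Bad g ∨ Eqr g) ≤ ∑ g, I (Bad g) + ∑ g, I (Eqr g) := by
      rw [← Finset.sum_add_distrib]
      exact Finset.sum_le_sum fun g _ => I_or_le _ _
    have h3 : m^5/40 * (1/2000 * m^2) ≤ 7^4 * (m^3 * (3 * ε * m^4)) + 7^2 * (m^5 * m) := by
      refine le_trans (mul_le_mul_of_nonneg_right hEd (by positivity)) (h1.trans (h2.trans ?_))
      linarith
    have h4 : 10^10 * m^6 ≤ m^7 := by nlinarith [pow_pos hmp 6]
    have h5 : 0 < m^7 := by positivity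
    have h6 : m^5/40 * (1/2000 * m^2) = m^7/80000 := by ring
    have h7 : 7^4 * (m^3 * (3 * ε * m^4)) = 7203/10^10 * m^7 := by rw [hε]; ring
    have h8 : 7^2 * (m^5 * m) = 49 * m^6 := by ring
    rw [h6, h7, h8] at h3
    linarith
  obtain ⟨a, r, hE, hb⟩ := hpick
  rw [sum_fin2] at hb
  set y := a 0 with hy
  set z := a 1 with hz
  have E1 : G.E y z (r 0) := hE 0
  have E2 : G.E y z (r 1) := hE 1
  have E3 : G.E y z (r 2) := hE 2
  have hne : ∀ i j : Fin 3, i ≠ j → r i ≠ r j := by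
    intro i j hij hr
    have : ∀ t t', I (Bad (Sum.elim (Sum.elim a r) ![t, t']) ∨
      Eqr (Sum.elim (Sum.elim a r) ![t, t'])) = 1 := by
      intro t t'
      refine I_true (Or.inr ⟨![Sum.inl (Sum.inr i), Sum.inl (Sum.inr j)], ?_, ?_⟩)
      · simp only [Finset.mem_filter, Finset.mem_univ, true_and]
        intro u v huv
        fin_cases u <;> fin_cases v <;> simp_all
      · simpa using hr
    simp only [this, sum_one_card, Finset.sum_const, nsmul_eq_mul, Finset.card_univ, ← hmdef] at hb
    nlinarith
  have n1 : ∀ i, y ≠ r i := fun i => G.ne13 (hE i)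
  have n2 : ∀ i, z ≠ r i := fun i => G.ne23 (hE i)
  have Y0 : ∀ i j, ¬ G.E y (r i) (r j) := fun i j h =>
    hK y z (r i) (r j) (Or.inl ⟨hE i, hE j, h⟩)
  have Z0 : ∀ i j, ¬ G.E z (r i) (r j) := fun i j h =>
    hK y z (r i) (r j) (Or.inr (Or.inl ⟨hE i, hE j, h⟩))
  have hWB : ∀ (o : Fin 2) t t', G.W1 (a o) (r 0) (r 1) (r 2) t ∨ G.W2 (a o) (r 1) (r 2) t t' →
      Bad (Sum.elim (Sum.elim a r) ![t, t']) := by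
    intro o t t' h
    have mk : ∀ i j k l : Ix, ([i, j, k, l].Nodup) →
        G.odd (Sum.elim (Sum.elim a r) ![t, t'] i) (Sum.elim (Sum.elim a r) ![t, t'] j)
          (Sum.elim (Sum.elim a r) ![t, t'] k) (Sum.elim (Sum.elim a r) ![t, t'] l) →
        Bad (Sum.elim (Sum.elim a r) ![t, t']) := by
      intro i j k l hnd ho
      refine ⟨![i, j, k, l], ?_, ho⟩
      simp only [Finset.mem_filter, Finset.mem_univ, true_and]
      have := List.nodup_iff_injective_get.mp hnd
      intro u v huv
      apply this
      fin_cases u <;> fin_cases v <;> simpa using huv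
    rcases h with (h | h | h | h | h | h | h | h | h) | (h | h)
    · exact mk (.inl (.inl o)) (.inl (.inr 0)) (.inr 0) (.inl (.inr 1)) (by simp) h
    · exact mk (.inl (.inl o)) (.inl (.inr 1)) (.inr 0) (.inl (.inr 0)) (by simp) h
    · exact mk (.inl (.inl o)) (.inl (.inr 0)) (.inr 0) (.inl (.inr 2)) (by simp) h
    · exact mk (.inl (.inl o)) (.inl (.inr 2)) (.inr 0) (.inl (.inr 0)) (by simp) h
    · exact mk (.inl (.inl o)) (.inl (.inr 1)) (.inr 0) (.inl (.inr 2)) (by simp) h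
    · exact mk (.inl (.inl o)) (.inl (.inr 2)) (.inr 0) (.inl (.inr 1)) (by simp) h
    · exact mk (.inl (.inr 0)) (.inl (.inr 1)) (.inr 0) (.inl (.inl o)) (by simp) h
    · exact mk (.inl (.inr 0)) (.inl (.inr 2)) (.inr 0) (.inl (.inl o)) (by simp) h
    · exact mk (.inl (.inr 1)) (.inl (.inr 2)) (.inr 0) (.inl (.inl o)) (by simp) h
    · exact mk (.inl (.inl o)) (.inl (.inr 1)) (.inr 1) (.inr 0) (by simp) h
    · exact mk (.inl (.inl o)) (.inl (.inr 2)) (.inr 0) (.inr 1) (by simp) h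
  have hsum : ∀ o : Fin 2, ∑ t, ∑ t', I (G.W1 (a o) (r 0) (r 1) (r 2) t ∨
      G.W2 (a o) (r 1) (r 2) t t') ≤ 1/2000 * m^2 := fun o =>
    le_trans (Finset.sum_le_sum fun t _ => Finset.sum_le_sum fun t' _ =>
      I_mono fun h => Or.inl (hWB o t t' h)) hb
  have cy := (turan_core G hK ε (1/2000) (by rw [hε]; norm_num) (by rw [hε]; norm_num) rfl hmp hlo hhi
    y (r 0) (r 1) (r 2) (Y0 _ _) (Y0 _ _) (Y0 _ _) (n1 _) (n1 _) (n1 _)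
    (hne _ _ (by decide)) (hne _ _ (by decide)) (hne _ _ (by decide)) (hsum 0)).1
  have cz := (turan_core G hK ε (1/2000) (by rw [hε]; norm_num) (by rw [hε]; norm_num) rfl hmp hlo hhi
    z (r 0) (r 1) (r 2) (Z0 _ _) (Z0 _ _) (Z0 _ _) (n2 _) (n2 _) (n2 _)
    (hne _ _ (by decide)) (hne _ _ (by decide)) (hne _ _ (by decide)) (hsum 1)).2
  have cR := hlo y z (G.ne E1)
  have hdis : ∑ t, I (G.E y (r 0) t ∧ G.E y (r 1) t ∧ G.E y (r 2) t) +
      ∑ t, I (G.E z (r 0) t ∨ G.E z (r 1) t ∨ G.E z (r 2) t) + ∑ t, I (G.E y z t) ≤ m := by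
    rw [hmdef, ← sum_one_card, ← Finset.sum_add_distrib, ← Finset.sum_add_distrib]
    refine Finset.sum_le_sum fun t _ => ?_
    by_cases q1 : G.E y (r 0) t ∧ G.E y (r 1) t ∧ G.E y (r 2) t
    · have q2 : ¬ G.E y z t := fun h => hK y z (r 0) t (Or.inl ⟨E1, h, q1.1⟩)
      have q3 : ¬ (G.E z (r 0) t ∨ G.E z (r 1) t ∨ G.E z (r 2) t) := by
        rintro (h | h | h)
        · exact hK y z (r 0) t (Or.inr (Or.inr (Or.inl ⟨E1, q1.1, h⟩)))
        · exact hK y z (r 1) t (Or.inr (Or.inr (Or.inl ⟨E2, q1.2.1, h⟩)))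
        · exact hK y z (r 2) t (Or.inr (Or.inr (Or.inl ⟨E3, q1.2.2, h⟩)))
      rw [I_true q1, I_false q2, I_false q3]; norm_num
    · rw [I_false q1]
      by_cases q2 : G.E y z t
      · have q3 : ¬ (G.E z (r 0) t ∨ G.E z (r 1) t ∨ G.E z (r 2) t) := by
          rintro (h | h | h)
          · exact hK y z (r 0) t (Or.inr (Or.inl ⟨E1, q2, h⟩))
          · exact hK y z (r 1) t (Or.inr (Or.inl ⟨E2, q2, h⟩))
          · exact hK y z (r 2) t (Or.inr (Or.inl ⟨E3, q2, h⟩))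
        rw [I_true q2, I_false q3]; norm_num
      · rw [I_false q2]
        linarith [I_le_one (G.E z (r 0) t ∨ G.E z (r 1) t ∨ G.E z (r 2) t)]
  have : ε * m ≤ m / 1000 := by rw [hε]; nlinarith
  linarith

end Turan2
end KF

open Finset

namespace KF
open Classical

lemma abel_aux : ∀ (n : ℕ) (a w : Fin (n+1) → ℝ), Monotone a →
    (∀ k : Fin (n+1), 0 ≤ ∑ i, I (k ≤ i) * w i) → a 0 * ∑ i, w i ≤ ∑ i, w i * a i := by
  intro n
  induction n with
  | zero => intro a w _ _; simp; linarith [mul_comm (w 0) (a 0)]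
  | succ n ih =>
    intro a w ha hw
    rw [Fin.sum_univ_succ, Fin.sum_univ_succ (f := fun i => w i * a i)]
    have h1 := ih (fun i => a i.succ) (fun i => w i.succ)
      (fun i j hij => ha (Fin.succ_le_succ_iff.mpr hij)) (fun k => by
        have := hw k.succ
        rw [Fin.sum_univ_succ] at this
        have e : I (k.succ ≤ 0) = 0 := I_false (by simp)
        rw [e, zero_mul, zero_add] at this
        refine this.trans (le_of_eq (Finset.sum_congr rfl fun i _ => ?_))
        congr 1
        exact I_congr Fin.succ_le_succ_iff)
    have h2 := hw (Fin.succ 0)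
    rw [Fin.sum_univ_succ] at h2
    have e : I (Fin.succ (0 : Fin (n+1)) ≤ 0) = 0 := I_false (by simp)
    rw [e, zero_mul, zero_add] at h2
    have e2 : ∀ i : Fin (n+1), I ((0 : Fin (n+1)).succ ≤ i.succ) = 1 := fun i =>
      I_true (Fin.succ_le_succ_iff.mpr (Fin.zero_le _))
    simp only [e2, one_mul] at h2
    have h3 : a 0 ≤ a (Fin.succ 0) := ha (Fin.zero_le _)
    have h4 : a 0 * ∑ i : Fin (n+1), w i.succ ≤ a (Fin.succ 0) * ∑ i : Fin (n+1), w i.succ :=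
      mul_le_mul_of_nonneg_right h3 h2
    rw [mul_add]
    linarith

lemma sum_ge_card (n : ℕ) (k : Fin n) : ∑ i : Fin n, I (k ≤ i) = (n : ℝ) - k := by
  rw [sum_I]
  trans ((Finset.Ici k).card : ℝ)
  · congr 2; ext; simp
  · rw [Fin.card_Ici, Nat.cast_sub k.2.le]

/-- domination lemma -/
lemma mix {n : ℕ} (hn : 0 < n) (a : Fin n → ℝ) (ha : Monotone a) (p : Fin 3 → Fin 4 → Fin n)
    (l : Fin 3 → ℝ) (hl : ∀ j, 0 ≤ l j) (hl1 : ∑ j, l j = 1)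
    (hd : ∀ k : Fin n, (∑ j, l j * ∑ i, I (k ≤ p j i)) * n ≤ 4 * ((n:ℝ) - k)) :
    ∃ j, ∑ i, a (p j i) ≤ 4 / n * ∑ i, a i := by
  obtain ⟨n, rfl⟩ : ∃ m, n = m + 1 := ⟨n - 1, by omega⟩
  have hn' : (0:ℝ) < ((n+1 : ℕ) : ℝ) := by positivity
  set N : ℝ := ((n+1 : ℕ) : ℝ) with hN
  let w : Fin (n+1) → ℝ := fun v => 4 / N - ∑ j, l j * ∑ i, I (p j i = v)
  have key : ∀ f : Fin (n+1) → ℝ, ∑ v, w v * f v =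
      4 / N * ∑ v, f v - ∑ j, l j * ∑ i, f (p j i) := by
    intro f
    simp only [w, sub_mul, Finset.sum_sub_distrib, ← Finset.mul_sum]
    congr 1
    simp only [Finset.sum_mul]
    rw [Finset.sum_comm]
    refine Finset.sum_congr rfl fun j _ => ?_
    simp only [mul_assoc, ← Finset.mul_sum]
    congr 1
    simp only [Finset.sum_mul]
    rw [Finset.sum_comm]
    refine Finset.sum_congr rfl fun i _ => ?_
    simp [I]
  have h1 := abel_aux n a w ha (fun k => by
    have := key (fun v => I (k ≤ v))
    simp only [mul_comm (I _)]
    rw [this, sum_ge_card]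
    have h := hd k
    rw [sub_nonneg, div_mul_eq_mul_div, le_div_iff₀ hn']
    exact h)
  have h2 : ∑ v, w v = 0 := by
    have := key (fun _ => 1)
    simp only [mul_one] at this
    rw [this]
    simp only [Finset.sum_const, Finset.card_univ, Fintype.card_fin, nsmul_eq_mul, mul_one,
      ← Finset.sum_mul, hl1, ← hN]
    field_simp
    norm_num
  rw [h2, mul_zero, key a] at h1
  by_contra hcon
  push Not at hcon
  have h3 : ∑ j, l j * (4 / N * ∑ i, a i) < ∑ j, l j * ∑ i, a (p j i) := by
    apply Finset.sum_lt_sum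
    · intro j _; exact mul_le_mul_of_nonneg_left (hcon j).le (hl j)
    · obtain ⟨j, -, hj⟩ : ∃ j ∈ univ, 0 < l j := by
        by_contra hc
        push Not at hc
        have := Finset.sum_nonpos hc
        linarith
      exact ⟨j, mem_univ _, mul_lt_mul_of_pos_left (hcon j) hj⟩
  rw [← Finset.sum_mul, hl1, one_mul] at h3
  linarith

def G3.on {V : Type} (G : G3 V) (S : Finset V) : G3 ↥S where
  E x y z := G.E x y z
  s1 h := G.s1 h
  s2 h := G.s2 h
  ne h := fun e => G.ne h (by rw [e])

lemma G3.on_sum {V : Type} (G : G3 V) (S : Finset V) (x y : ↥S) :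
    ∑ z : ↥S, I ((G.on S).E x y z) = ∑ z ∈ S, I (G.E x y z) :=
  Finset.sum_coe_sort S (fun z => I (G.E x y z))

lemma G3.on_K {V : Type} (G : G3 V) (S : Finset V) (x y z t : ↥S) :
    (G.on S).K x y z t ↔ G.K x y z t := Iff.rfl

lemma sum_univ_le_add_compl {V : Type} [Fintype V] (S : Finset V) (p : V → Prop) :
    ∑ z, I (p z) ≤ ∑ z ∈ S, I (p z) + ((Fintype.card V : ℝ) - S.card) := by
  rw [← Finset.sum_add_sum_compl S]
  have : ∑ z ∈ Sᶜ, I (p z) ≤ ∑ z ∈ Sᶜ, (1:ℝ) := Finset.sum_le_sum fun _ _ => I_le_one _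
  have h2 : ∑ z ∈ Sᶜ, (1:ℝ) = (Fintype.card V : ℝ) - S.card := by
    rw [Finset.sum_const, nsmul_eq_mul, mul_one, Finset.card_compl, Nat.cast_sub (Finset.card_le_univ S)]
  linarith

lemma lowpos {V : Type} [Fintype V] {n : ℕ} (e : Fin n ≃ V) (p : V → Prop) (s : ℝ) (hs : 0 < s)
    (h : s ≤ ∑ v, I (p v)) : ∃ v, p v ∧ ((e.symm v : ℕ) : ℝ) ≤ n - s := by
  by_contra hcon
  push Not at hcon
  -- all elements of p have position > n - s
  have h1 : ∑ v, I (p v) = ∑ i : Fin n, I (p (e i)) := (Equiv.sum_comp e _).symm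
  obtain ⟨v, -, hv⟩ := exists_of_sum_I_pos univ p (lt_of_lt_of_le hs h)
  have hv' := hcon v hv
  -- minimal position
  let T := univ.filter fun i : Fin n => p (e i)
  have hT : T.Nonempty := ⟨e.symm v, by simp [T, hv]⟩
  let k := T.min' hT
  have hk : k ∈ T := Finset.min'_mem _ _
  have hk1 : p (e k) := (Finset.mem_filter.mp hk).2
  have hk2 := hcon (e k) hk1
  rw [Equiv.symm_apply_apply] at hk2
  have h2 : ∑ i : Fin n, I (p (e i)) ≤ ∑ i : Fin n, I (k ≤ i) :=
    Finset.sum_le_sum fun i _ => I_mono fun hi => Finset.min'_le _ _ (by simp [T, hi])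
  rw [sum_ge_card] at h2
  linarith

end KF

open Finset

namespace KF
open Classical

lemma exists_sorted {V : Type} [Fintype V] (a : V → ℝ) {n : ℕ} (hn : n = Fintype.card V) :
    ∃ e : Fin n ≃ V, Monotone (a ∘ e) := by
  subst hn
  let f : Fin (Fintype.card V) → ℝ := a ∘ (Fintype.equivFin V).symm
  refine ⟨(Tuple.sort f).trans (Fintype.equivFin V).symm, ?_⟩
  have := Tuple.monotone_sort f
  exact this

set_option maxHeartbeats 2000000 in
lemma fs_min : ∃ ε : ℝ, 0 < ε ∧ ε ≤ 1/100000 ∧ ∃ m0 : ℕ, ∀ (V : Type) [Fintype V] (G : G3 V),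
    m0 ≤ Fintype.card V → G.CD (1/2 - ε) → ∀ a : V → ℝ, ∃ x y z t, G.K x y z t ∧
      a x + a y + a z + a t ≤ 4 / (Fintype.card V : ℝ) * ∑ v, a v := by
  obtain ⟨εT, hT0, hT1, mT, hT⟩ := turan
  refine ⟨εT/100, by positivity, by linarith, 2 * mT + 2 + Nat.ceil (100000/εT), ?_⟩
  intro V _ G hm hG a
  set ε := εT/100 with hε
  have hε0 : 0 < ε := by positivity
  obtain ⟨n, hn⟩ : ∃ n, n = Fintype.card V := ⟨_, rfl⟩
  obtain ⟨e, he⟩ := exists_sorted a hn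
  rw [← hn] at hm ⊢
  have hnR : (2 * mT + 2 + 100000/εT : ℝ) ≤ n := by
    have h1 : ((2 * mT + 2 + Nat.ceil (100000/εT) : ℕ) : ℝ) ≤ n := by exact_mod_cast hm
    push_cast at h1
    linarith [Nat.le_ceil (100000/εT)]
  set N : ℝ := (n : ℝ) with hN
  have hmT0 : (0:ℝ) ≤ mT := Nat.cast_nonneg _
  have hE : 1000 ≤ ε * N := by
    have : 100000/εT ≤ N := by linarith
    rw [div_le_iff₀ hT0] at this
    rw [hε]; linarith
  set E := ε * N with hEdef
  have hNpos : 0 < N := by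
    have : 0 < 100000/εT := by positivity
    linarith
  have hEN : 100000 * E ≤ N := by rw [hEdef, hε]; nlinarith
  have hn1 : 3 < n := by
    have : (3:ℝ) < n := by linarith
    exact_mod_cast this
  have hCD : ∀ x y, x ≠ y → N/2 - E ≤ ∑ z, I (G.E x y z) := by
    intro x y h
    have := hG x y h
    rw [← hn, ← hN] at this
    linarith
  have hKc : ∀ x y z, G.E x y z → N/4 - 3/2*E ≤ ∑ t, I (G.K x y z t) := by
    intro x y z h
    have := G.ext_quarter hG h
    rw [← hn, ← hN] at this
    linarith
  let pos : V → ℝ := fun v => ((e.symm v : ℕ) : ℝ)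
  have hlow : ∀ (p : V → Prop) (s : ℝ), 0 < s → s ≤ ∑ v, I (p v) → ∃ v, p v ∧ pos v ≤ N - s :=
    fun p s h1 h2 => lowpos e p s h1 h2
  -- tile 1
  let v0 : Fin n := ⟨0, by omega⟩
  let v1 : Fin n := ⟨1, by omega⟩
  let v2 : Fin n := ⟨2, by omega⟩
  have n01 : e v0 ≠ e v1 := fun h => by simpa [v0, v1] using e.injective h
  obtain ⟨z1, hz1, pz1⟩ := hlow _ _ (by linarith) (hCD _ _ n01)
  obtain ⟨t1, ht1, pt1⟩ := hlow _ _ (by linarith) (hKc _ _ _ hz1)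
  -- tile 2
  let k1 := Nat.floor (N/2 - 25*E)
  have hk1a : (k1:ℝ) ≤ N/2 - 25*E := Nat.floor_le (by linarith)
  have hk1b : N/2 - 25*E - 1 < k1 := by linarith [Nat.lt_floor_add_one (N/2 - 25*E)]
  have hk1n : k1 < n := by
    have : (k1:ℝ) < n := by linarith
    exact_mod_cast this
  have hk13 : 3 < k1 := by
    have : (3:ℝ) < k1 := by linarith
    exact_mod_cast this
  have tile2 : ∃ x y z t, G.K x y z t ∧ pos x ≤ N/2 - 25*E ∧ pos y ≤ N/2 - 25*E ∧ pos z ≤ N/2 - 25*E ∧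
      pos t ≤ 3*N/4 + 3/2*E := by
    by_cases h : ∃ x y z, G.E x y z ∧ pos x ≤ N/2 - 25*E ∧ pos y ≤ N/2 - 25*E ∧ pos z ≤ N/2 - 25*E
    · obtain ⟨x, y, z, h, h1, h2, h3⟩ := h
      obtain ⟨t, ht, pt⟩ := hlow _ _ (by linarith) (hKc _ _ _ h)
      exact ⟨x, y, z, t, ht, h1, h2, h3, by linarith⟩
    · push Not at h
      have n02 : e v0 ≠ e v2 := fun h => by simpa [v0, v2] using e.injective h
      have n12 : e v1 ≠ e v2 := fun h => by simpa [v1, v2] using e.injective h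
      have q : ∀ i : Fin n, (i:ℕ) ≤ 2 → pos (e i) ≤ N/2 - 25*E := by
        intro i hi
        have : pos (e i) ≤ 2 := by
          simp only [pos, Equiv.symm_apply_apply]; exact_mod_cast hi
        linarith
      have q0 := q v0 (by simp [v0])
      have q1 := q v1 (by simp [v1])
      have q2 := q v2 (by simp [v2])
      let K1 : Fin n := ⟨k1, hk1n⟩
      have hcount : ∑ t, I (K1 ≤ e.symm t) = N - k1 := by
        rw [← sum_ge_card n K1]
        exact Equiv.sum_comp e.symm (fun i => I (K1 ≤ i))
      have hfar : ∀ x y t, G.E x y t → pos x ≤ N/2 - 25*E → pos y ≤ N/2 - 25*E → K1 ≤ e.symm t := by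
        intro x y t hE hx hy
        by_contra hlt
        push Not at hlt
        have h1 := h x y t hE hx hy
        have h2 : (e.symm t : ℕ) < k1 := hlt
        have : pos t < k1 := by simp only [pos]; exact_mod_cast h2
        linarith
      have hsum : ∑ t, I (G.E (e v0) (e v1) t) + ∑ t, I (G.E (e v0) (e v2) t)
          + ∑ t, I (G.E (e v1) (e v2) t) ≤ 2 * (N - k1) +
          ∑ t, I (G.E (e v0) (e v1) t ∧ G.E (e v0) (e v2) t ∧ G.E (e v1) (e v2) t) := by
        rw [← hcount, Finset.mul_sum, ← Finset.sum_add_distrib, ← Finset.sum_add_distrib,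
          ← Finset.sum_add_distrib]
        refine Finset.sum_le_sum fun t _ => ?_
        by_cases hk : K1 ≤ e.symm t
        · rw [I_true hk]
          by_cases p1 : G.E (e v0) (e v1) t <;> by_cases p2 : G.E (e v0) (e v2) t <;>
            by_cases p3 : G.E (e v1) (e v2) t <;> simp [I, p1, p2, p3] <;> norm_num
        · rw [I_false (fun h => hk (hfar _ _ _ h q0 q1)), I_false (fun h => hk (hfar _ _ _ h q0 q2)),
            I_false (fun h => hk (hfar _ _ _ h q1 q2))]
          linarith [I_nonneg (K1 ≤ e.symm t), I_nonneg (G.E (e v0) (e v1) t ∧ G.E (e v0) (e v2) t ∧ G.E (e v1) (e v2) t)]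
      have c1 := hCD _ _ n01
      have c2 := hCD _ _ n02
      have c3 := hCD _ _ n12
      obtain ⟨t, ht, pt⟩ := hlow (fun t => G.E (e v0) (e v1) t ∧ G.E (e v0) (e v2) t ∧ G.E (e v1) (e v2) t)
        (N/2 - 53*E - 2) (by linarith) (by linarith)
      exact ⟨e v0, e v1, e v2, t, Or.inr (Or.inr (Or.inr ht)), q0, q1, q2, by linarith⟩
  obtain ⟨x2, y2, z2, t2, hK2, px2, py2, pz2, pt2⟩ := tile2
  -- tile 3
  let k2 := Nat.ceil (3*N/4 - 50*E)
  have hk2a : 3*N/4 - 50*E ≤ k2 := Nat.le_ceil _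
  have hk2b : (k2:ℝ) < 3*N/4 - 50*E + 1 := Nat.ceil_lt_add_one (by linarith)
  have hk2n : k2 < n := by
    have : (k2:ℝ) < n := by linarith
    exact_mod_cast this
  let S : Finset V := (Finset.Iio (⟨k2, hk2n⟩ : Fin n)).map e.toEmbedding
  have hScard : S.card = k2 := by simp [S]
  have hSmem : ∀ v ∈ S, pos v < k2 := by
    intro v hv
    simp only [S, Finset.mem_map, Finset.mem_Iio] at hv
    obtain ⟨i, hi, rfl⟩ := hv
    have h2 : (i : ℕ) < k2 := hi
    have e3 : pos (e i) = (i:ℝ) := by simp [pos]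
    simp only [Equiv.coe_toEmbedding]
    rw [e3]; exact_mod_cast h2
  obtain ⟨x3, y3, z3, t3, hK3⟩ := hT ↥S (G.on S) (by
      rw [Fintype.card_coe, hScard]
      have : (mT:ℝ) ≤ k2 := by
        have : 0 < 100000/εT := by positivity
        linarith
      exact_mod_cast this) (by
      intro x y hxy
      rw [G.on_sum, Fintype.card_coe, hScard]
      have h1 := hCD x y (fun h => hxy (Subtype.ext h))
      have h2 := sum_univ_le_add_compl S (fun z => G.E x y z)
      rw [hScard, ← hn] at h2
      have h3 : εT * k2 ≥ εT * (3*N/4 - 50*E) := mul_le_mul_of_nonneg_left hk2a hT0.le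
      have h4 : εT * N = 100 * E := by rw [hEdef, hε]; ring
      have h5 : εT * E ≤ E / 1000 := by nlinarith
      linarith)
  rw [G.on_K] at hK3
  -- mixture
  let v : Fin 3 → Fin 4 → V := ![![e v0, e v1, z1, t1], ![x2, y2, z2, t2], ![x3, y3, z3, t3]]
  let l : Fin 3 → ℝ := ![1 - 40*ε, 30*ε, 10*ε]
  have hε1 : ε ≤ 1/100000 := by rw [hε]; linarith
  have hmix := mix (n := n) (by omega) (a ∘ e) he (fun j i => e.symm (v j i)) l (by
      intro j; fin_cases j <;> simp [l] <;> linarith) (by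
      simp [l, Fin.sum_univ_three]; ring) (by
      intro k
      have hI : ∀ (u : V) (b : ℝ), pos u ≤ b → b < k → I (k ≤ e.symm u) = 0 := by
        intro u b h1 h2
        refine I_false fun h => ?_
        have : (k:ℝ) ≤ pos u := by simp only [pos]; exact_mod_cast h
        linarith
      have hkn : (k:ℝ) ≤ N := by rw [hN]; exact_mod_cast k.2.le
      have p0 : pos (e v0) = 0 := by simp [pos, v0]
      have p1 : pos (e v1) = 1 := by simp [pos, v1]
      have o := fun u => I_le_one (k ≤ e.symm u)
      have p30 := (hSmem _ x3.2).le
      have p31 := (hSmem _ y3.2).le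
      have p32 := (hSmem _ z3.2).le
      have p33 := (hSmem _ t3.2).le
      simp only [Fin.sum_univ_three, Fin.sum_univ_four, v, l]
      simp only [Matrix.cons_val_zero, Matrix.cons_val_one, Matrix.cons_val]
      -- reduce to bounds
      have red : ∀ (b1 b2 b3 : ℝ), I (k ≤ e.symm (e v0)) + I (k ≤ e.symm (e v1)) + I (k ≤ e.symm z1) + I (k ≤ e.symm t1) ≤ b1 →
          I (k ≤ e.symm x2) + I (k ≤ e.symm y2) + I (k ≤ e.symm z2) + I (k ≤ e.symm t2) ≤ b2 →
          I (k ≤ e.symm (x3:V)) + I (k ≤ e.symm (y3:V)) + I (k ≤ e.symm (z3:V)) + I (k ≤ e.symm (t3:V)) ≤ b3 →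
          (N - 40*E) * b1 + 30*E*b2 + 10*E*b3 ≤ 4*(N - k) →
          ((1 - 40*ε) * (I (k ≤ e.symm (e v0)) + I (k ≤ e.symm (e v1)) + I (k ≤ e.symm z1) + I (k ≤ e.symm t1)) +
          30*ε*(I (k ≤ e.symm x2) + I (k ≤ e.symm y2) + I (k ≤ e.symm z2) + I (k ≤ e.symm t2)) +
          10*ε*(I (k ≤ e.symm (x3:V)) + I (k ≤ e.symm (y3:V)) + I (k ≤ e.symm (z3:V)) + I (k ≤ e.symm (t3:V)))) * N ≤ 4*(N - k) := by
        intro b1 b2 b3 h1 h2 h3 h4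
        refine le_trans ?_ h4
        have g1 := mul_le_mul_of_nonneg_left h1 (show (0:ℝ) ≤ N - 40*E by linarith)
        have g2 := mul_le_mul_of_nonneg_left h2 (show (0:ℝ) ≤ 30*E by linarith)
        have g3 := mul_le_mul_of_nonneg_left h3 (show (0:ℝ) ≤ 10*E by linarith)
        refine le_trans (le_of_eq ?_) (add_le_add (add_le_add g1 g2) g3)
        rw [hEdef]; ring
      have ox := o x2
      have oy := o y2
      have oz := o z2
      have ot := o t2
      have ox3 := o x3
      have oy3 := o y3
      have oz3 := o z3
      have ot3 := o t3
      have oa := o (e v0)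
      have ob := o (e v1)
      have oc := o z1
      have od := o t1
      by_cases c0 : (k:ℕ) = 0
      · have : (k:ℝ) = 0 := by rw [c0]; simp
        refine red 4 4 4 (by linarith) (by linarith) (by linarith) (by linarith)
      have c0' : (1:ℝ) ≤ k := by
        have : 1 ≤ (k:ℕ) := by omega
        exact_mod_cast this
      have i0 := hI (e v0) 0 p0.le (by linarith)
      by_cases c1 : (k:ℕ) = 1
      · have : (k:ℝ) = 1 := by rw [c1]; simp
        refine red 3 4 4 (by linarith) (by linarith) (by linarith) (by linarith)
      have c1' : (2:ℝ) ≤ k := by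
        have : 2 ≤ (k:ℕ) := by omega
        exact_mod_cast this
      have i1 := hI (e v1) 1 p1.le (by linarith)
      by_cases c2 : (k:ℝ) ≤ N/2 - 25*E
      · refine red 2 4 4 (by linarith) (by linarith) (by linarith) (by linarith)
      push Not at c2
      have i2 := hI x2 _ px2 c2
      have i3 := hI y2 _ py2 c2
      have i4 := hI z2 _ pz2 c2
      by_cases c3 : (k:ℝ) ≤ N/2 + E
      · refine red 2 1 4 (by linarith) (by linarith) (by linarith) (by linarith)
      push Not at c3
      have i5 := hI z1 _ pz1 (by linarith)
      by_cases c4 : (k:ℝ) ≤ k2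
      · refine red 1 1 4 (by linarith) (by linarith) (by linarith) (by linarith)
      push Not at c4
      have i6 := hI x3 _ p30 c4
      have i7 := hI y3 _ p31 c4
      have i8 := hI z3 _ p32 c4
      have i9 := hI t3 _ p33 c4
      by_cases c5 : (k:ℝ) ≤ 3*N/4 + 3/2*E
      · refine red 1 1 0 (by linarith) (by linarith) (by linarith) (by linarith)
      push Not at c5
      have i10 := hI t1 _ pt1 (by linarith)
      have i11 := hI t2 _ pt2 (by linarith)
      refine red 0 0 0 (by linarith) (by linarith) (by linarith) (by linarith))
  have hs : ∑ i, (a ∘ e) i = ∑ v, a v := Equiv.sum_comp e a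
  rw [hs] at hmix
  obtain ⟨j, hj⟩ := hmix
  simp only [Function.comp, Equiv.apply_symm_apply, Fin.sum_univ_four] at hj
  have hK1 : G.K (e v0) (e v1) z1 t1 := ht1
  have hall : ∀ j, G.K (v j 0) (v j 1) (v j 2) (v j 3) := by
    intro j; fin_cases j
    · exact hK1
    · exact hK2
    · exact hK3
  exact ⟨_, _, _, _, hall j, hj⟩

end KF

open Finset

namespace KF
open Classical

lemma fs_dist : ∃ ε : ℝ, 0 < ε ∧ ε ≤ 1/100000 ∧ ∃ m0 : ℕ, ∀ (V : Type) [Fintype V] (G : G3 V),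
    m0 ≤ Fintype.card V → G.CD (1/2 - ε) →
    ∃ (ι : Type) (_ : Fintype ι) (w : ι → ℝ) (q : ι → Fin 4 → V), (∀ i, 0 ≤ w i) ∧ ∑ i, w i = 1 ∧
      (∀ i, G.K (q i 0) (q i 1) (q i 2) (q i 3)) ∧
      ∀ a : V → ℝ, ∑ i, w i * ∑ j, a (q i j) = 4 / (Fintype.card V : ℝ) * ∑ v, a v := by
  obtain ⟨ε, h0, h1, m0, hmain⟩ := fs_min
  refine ⟨ε, h0, h1, m0, ?_⟩
  intro V _ G hm hG
  have hmin := hmain V G hm hG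
  let T : Finset (Fin 4 → V) := univ.filter fun q => G.K (q 0) (q 1) (q 2) (q 3)
  let φ : (Fin 4 → V) → (V → ℝ) := fun q v => ∑ j, I (q j = v)
  let s : Finset (V → ℝ) := T.image φ
  let c : V → ℝ := fun _ => 4 / (Fintype.card V : ℝ)
  have hφ : ∀ (a : V → ℝ) q, ∑ v, φ q v * a v = ∑ j, a (q j) := by
    intro a q
    simp only [φ, Finset.sum_mul]
    rw [Finset.sum_comm]
    refine Finset.sum_congr rfl fun j _ => ?_
    simp [I]
  have hc : c ∈ convexHull ℝ (s : Set (V → ℝ)) := by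
    by_contra hcon
    have hcl : IsClosed (convexHull ℝ (s : Set (V → ℝ))) := s.finite_toSet.isClosed_convexHull (𝕜 := ℝ)
    obtain ⟨f, u, hu1, hu2⟩ := geometric_hahn_banach_point_closed (convex_convexHull ℝ _) hcl hcon
    have hf : ∀ g : V → ℝ, f g = ∑ v, g v * f (Pi.single v 1) := by
      intro g
      conv_lhs => rw [pi_eq_sum_univ' g]
      rw [map_sum]
      refine Finset.sum_congr rfl fun v _ => ?_
      rw [map_smul, smul_eq_mul]
    obtain ⟨x, y, z, t, hK, hle⟩ := hmin (fun v => f (Pi.single v 1))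
    let q : Fin 4 → V := ![x, y, z, t]
    have hq : q ∈ T := by simp [T, q, hK]
    have h3 := hu2 (φ q) (subset_convexHull ℝ _ (by
      exact Finset.mem_coe.mpr (Finset.mem_image_of_mem φ hq)))
    rw [hf, hφ (fun v => f (Pi.single v 1))] at h3
    rw [hf] at hu1
    simp only [c, ← Finset.mul_sum] at hu1
    simp only [Fin.sum_univ_four] at h3
    have e : (fun v => f (Pi.single v 1)) (q 0) + (fun v => f (Pi.single v 1)) (q 1)
      + (fun v => f (Pi.single v 1)) (q 2) + (fun v => f (Pi.single v 1)) (q 3) =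
      f (Pi.single x 1) + f (Pi.single y 1) + f (Pi.single z 1) + f (Pi.single t 1) := rfl
    simp only at e
    rw [e] at h3
    linarith
  rw [Finset.mem_convexHull'] at hc
  obtain ⟨w, hw0, hw1, hw2⟩ := hc
  have hex : ∀ y : s, ∃ q, q ∈ T ∧ φ q = y := fun y => by
    exact Finset.mem_image.mp y.2
  choose q hqT hq using hex
  refine ⟨↥s, inferInstance, fun i => w i, q, fun i => hw0 i i.2, ?_, ?_, ?_⟩
  · rw [← hw1]; exact Finset.sum_coe_sort s w
  · intro i; exact (Finset.mem_filter.mp (hqT i)).2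
  · intro a
    have h2 : ∀ v, ∑ y ∈ s, w y * y v = 4 / (Fintype.card V : ℝ) := by
      intro v
      have := congrFun hw2 v
      simpa [c] using this
    have h3 : ∑ i : s, w i * ∑ j, a (q i j) = ∑ i : s, w i * ∑ v, (i : V → ℝ) v * a v := by
      refine Finset.sum_congr rfl fun i _ => ?_
      rw [← hφ, hq]
    rw [h3, Finset.sum_coe_sort s (fun y => w y * ∑ v, y v * a v)]
    simp only [Finset.mul_sum]
    rw [Finset.sum_comm]
    refine Finset.sum_congr rfl fun v _ => ?_
    rw [← h2 v, Finset.sum_mul]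
    refine Finset.sum_congr rfl fun i _ => by ring

/-- version on a subset -/
lemma fs_on : ∃ ε : ℝ, 0 < ε ∧ ε ≤ 1/100000 ∧ ∃ m0 : ℕ, ∀ (V : Type) [Fintype V] (G : G3 V)
    (U : Finset V), m0 ≤ U.card →
    (∀ x y, x ≠ y → (1/2 - ε) * U.card ≤ ∑ z ∈ U, I (G.E x y z)) →
    ∃ (ι : Type) (_ : Fintype ι) (w : ι → ℝ) (q : ι → Fin 4 → V), (∀ i, 0 ≤ w i) ∧ ∑ i, w i = 1 ∧
      (∀ i, G.K (q i 0) (q i 1) (q i 2) (q i 3)) ∧ (∀ i j, q i j ∈ U) ∧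
      ∀ a : V → ℝ, ∑ i, w i * ∑ j, a (q i j) = 4 / (U.card : ℝ) * ∑ v ∈ U, a v := by
  obtain ⟨ε, h0, h1, m0, hmain⟩ := fs_dist
  refine ⟨ε, h0, h1, m0, ?_⟩
  intro V _ G U hm hG
  obtain ⟨ι, hι, w, q, a1, a2, a3, a4⟩ := hmain ↥U (G.on U) (by rwa [Fintype.card_coe]) (by
    intro x y hxy
    rw [G.on_sum, Fintype.card_coe]
    exact hG x y (fun h => hxy (Subtype.ext h)))
  refine ⟨ι, hι, w, fun i j => q i j, a1, a2, a3, fun i j => (q i j).2, fun a => ?_⟩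
  have := a4 (fun v => a v)
  rw [this, Fintype.card_coe, Finset.sum_coe_sort U a]

end KF

open Finset

namespace KF
open Classical

lemma at_pair {ι : Type} [Fintype ι] (w : ι → ℝ) (hw : ∀ i, 0 ≤ w i) (hw1 : ∑ i, w i = 1)
    (J : ι → ℝ) (hJ0 : ∀ i, 0 ≤ J i) (hJ4 : ∀ i, J i ≤ 4) (D u l : ℝ) (hu : 4 < u) (hl : 0 ≤ l)
    (hlu : 4 * l ≤ u - 4) (hD0 : 0 ≤ D) (hD1 : D ≤ u) (hJ : ∑ i, w i * J i = 4 / u * D) :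
    ∑ i, w i * Real.exp (-l * ((D - J i) / (u - 4))) ≤
      (1 + 16 * l^2 / (u-4)^2) * Real.exp (-l * (D / u)) := by
  have hu4 : 0 < u - 4 := by linarith
  have hu0 : 0 < u := by linarith
  let t : ι → ℝ := fun i => -l / (u-4) * (4 / u * D - J i)
  have hA0 : 0 ≤ 4 / u * D := by positivity
  have hA1 : 4 / u * D ≤ 4 := by
    rw [div_mul_eq_mul_div, div_le_iff₀ hu0]; linarith
  have key : ∀ i, Real.exp (-l * ((D - J i) / (u - 4))) ≤
      Real.exp (-l * (D / u)) * (1 + t i + 16 * l^2 / (u-4)^2) := by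
    intro i
    have e1 : -l * ((D - J i) / (u - 4)) = -l * (D / u) + t i := by
      simp only [t]; field_simp; ring
    rw [e1, Real.exp_add]
    refine mul_le_mul_of_nonneg_left ?_ (Real.exp_pos _).le
    have habs : |4 / u * D - J i| ≤ 4 := by
      rw [abs_le]; constructor <;> linarith [hJ0 i, hJ4 i]
    have ht : |t i| ≤ l / (u-4) * 4 := by
      simp only [t]
      rw [abs_mul, abs_div, abs_neg, abs_of_nonneg hl, abs_of_pos hu4]
      exact mul_le_mul_of_nonneg_left habs (by positivity)
    have ht1 : |t i| ≤ 1 := by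
      refine ht.trans ?_
      rw [div_mul_eq_mul_div, div_le_iff₀ hu4]; linarith
    have h2 := (abs_le.mp (Real.abs_exp_sub_one_sub_id_le ht1)).2
    have h3 : (t i)^2 ≤ 16 * l^2 / (u-4)^2 := by
      rw [← sq_abs]
      refine (pow_le_pow_left₀ (abs_nonneg _) ht 2).trans (le_of_eq ?_)
      field_simp; ring
    linarith
  have hsum : ∑ i, w i * t i = 0 := by
    have : ∀ i, w i * t i = -l / (u-4) * (4 / u * D * w i - w i * J i) := fun i => by
      simp only [t]; ring
    simp only [this]
    rw [← Finset.mul_sum, Finset.sum_sub_distrib, ← Finset.mul_sum, hw1, hJ]; ring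
  calc ∑ i, w i * Real.exp (-l * ((D - J i) / (u - 4)))
      ≤ ∑ i, w i * (Real.exp (-l * (D / u)) * (1 + t i + 16 * l^2 / (u-4)^2)) :=
        Finset.sum_le_sum fun i _ => mul_le_mul_of_nonneg_left (key i) (hw i)
    _ = Real.exp (-l * (D / u)) * ((1 + 16 * l^2 / (u-4)^2) * ∑ i, w i + ∑ i, w i * t i) := by
        rw [Finset.mul_sum, ← Finset.sum_add_distrib, Finset.mul_sum]
        refine Finset.sum_congr rfl fun i _ => by ring
    _ = _ := by rw [hsum, hw1]; ring

noncomputable def phi {V : Type} [Fintype V] (G : G3 V) (l : ℝ) (U : Finset V) : ℝ :=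
  ∑ x, ∑ y, I (x ≠ y) * Real.exp (-l * ((∑ z ∈ U, I (G.E x y z)) / U.card))

lemma exists_le_avg {ι : Type} [Fintype ι] (w : ι → ℝ) (hw : ∀ i, 0 ≤ w i) (hw1 : ∑ i, w i = 1)
    (f : ι → ℝ) (b : ℝ) (h : ∑ i, w i * f i ≤ b) : ∃ i, f i ≤ b := by
  by_contra hc
  push Not at hc
  obtain ⟨j, -, hj⟩ : ∃ j ∈ univ, 0 < w j := by
    by_contra hc'
    push Not at hc'
    have := Finset.sum_nonpos hc'
    linarith
  have : ∑ i, w i * b < ∑ i, w i * f i := by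
    apply Finset.sum_lt_sum
    · intro i _; exact mul_le_mul_of_nonneg_left (hc i).le (hw i)
    · exact ⟨j, mem_univ _, mul_lt_mul_of_pos_left (hc j) hj⟩
  rw [← Finset.sum_mul, hw1, one_mul] at this
  linarith

lemma at_step {V : Type} [Fintype V] (G : G3 V) (l : ℝ) (U : Finset V) (hl : 0 ≤ l)
    (hu : (4:ℝ) < U.card) (hlu : 4 * l ≤ (U.card:ℝ) - 4)
    {ι : Type} [Fintype ι] (w : ι → ℝ) (q : ι → Fin 4 → V) (hw : ∀ i, 0 ≤ w i) (hw1 : ∑ i, w i = 1)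
    (hK : ∀ i, G.K (q i 0) (q i 1) (q i 2) (q i 3)) (hU : ∀ i j, q i j ∈ U)
    (hm : ∀ a : V → ℝ, ∑ i, w i * ∑ j, a (q i j) = 4 / (U.card : ℝ) * ∑ v ∈ U, a v) :
    ∃ T : Finset V, T ⊆ U ∧ T.card = 4 ∧ Tl G T ∧
      phi G l (U \ T) ≤ (1 + 16 * l^2 / ((U.card:ℝ)-4)^2) * phi G l U := by
  let T : ι → Finset V := fun i => {q i 0, q i 1, q i 2, q i 3}
  have hTU : ∀ i, T i ⊆ U := by
    intro i v hv
    simp only [T, mem_insert, mem_singleton] at hv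
    rcases hv with rfl | rfl | rfl | rfl <;> exact hU _ _
  have hTc : ∀ i, (T i).card = 4 := fun i => card_K (hK i)
  have hTs : ∀ i (a : V → ℝ), ∑ v ∈ T i, a v = ∑ j, a (q i j) := by
    intro i a
    obtain ⟨h1, h2, h3, h4, h5, h6⟩ := G.K_ne (hK i)
    simp only [T, Fin.sum_univ_four]
    rw [Finset.sum_insert, Finset.sum_insert, Finset.sum_insert, Finset.sum_singleton]
    · ring
    all_goals simp [*]
  have hcard : ∀ i, ((U \ T i).card : ℝ) = U.card - 4 := by
    intro i
    rw [Finset.card_sdiff_of_subset (hTU i), Nat.cast_sub (Finset.card_le_card (hTU i)), hTc]; norm_num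
  have hav : ∑ i, w i * phi G l (U \ T i) ≤ (1 + 16 * l^2 / ((U.card:ℝ)-4)^2) * phi G l U := by
    simp only [phi, Finset.mul_sum]
    rw [Finset.sum_comm]
    refine Finset.sum_le_sum fun x _ => ?_
    rw [Finset.sum_comm]
    refine Finset.sum_le_sum fun y _ => ?_
    have h := at_pair w hw hw1 (fun i => ∑ j, I (G.E x y (q i j)))
      (fun i => Finset.sum_nonneg fun _ _ => I_nonneg _)
      (fun i => (Finset.sum_le_sum fun j _ => I_le_one _).trans (by simp))
      (∑ z ∈ U, I (G.E x y z)) U.card l hu hl hlu (Finset.sum_nonneg fun _ _ => I_nonneg _)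
      ((Finset.sum_le_sum fun j _ => I_le_one _).trans (by simp)) (hm fun z => I (G.E x y z))
    have h2 := mul_le_mul_of_nonneg_left h (I_nonneg (x ≠ y))
    rw [Finset.mul_sum] at h2
    refine le_trans (le_of_eq ?_) (h2.trans (le_of_eq (by ring)))
    refine Finset.sum_congr rfl fun i _ => ?_
    rw [hcard]
    have : ∑ z ∈ U \ T i, I (G.E x y z) = ∑ z ∈ U, I (G.E x y z) - ∑ j, I (G.E x y (q i j)) := by
      rw [← hTs i (fun v => I (G.E x y v)), ← Finset.sum_sdiff (hTU i)]; ring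
    rw [this]; ring
  obtain ⟨i, hi⟩ := exists_le_avg w hw hw1 _ _ hav
  exact ⟨T i, hTU i, hTc i, Tl.of_K (hK i), hi⟩

/-- almost tiling -/
lemma almost : ∃ ε : ℝ, 0 < ε ∧ ε ≤ 1/200000 ∧ ∀ η : ℝ, 0 < η → η ≤ 1 → ∃ m0 : ℕ,
    ∀ (V : Type) [Fintype V] (G : G3 V), m0 ≤ Fintype.card V → G.CD (1/2 - ε) →
      ∃ L : Finset V, (L.card : ℝ) ≤ η * Fintype.card V ∧ Tl G Lᶜ := by
  obtain ⟨ε, hε0, hε1, m0, hfs⟩ := fs_on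
  refine ⟨ε/2, by positivity, by linarith, fun η hη0 hη1 => ?_⟩
  let c := ε * η^2 / 64
  have hc0 : 0 < c := by positivity
  refine ⟨Nat.ceil ((m0 + 16) / η) + Nat.ceil (384/(c*ε)^3) + 1, ?_⟩
  intro V _ G hn hG
  obtain ⟨n, hnn⟩ : ∃ n, n = Fintype.card V := ⟨_, rfl⟩
  rw [← hnn] at hn ⊢
  have hnR : (m0 + 16) / η + 384/(c*ε)^3 + 1 ≤ n := by
    have : ((Nat.ceil ((m0 + 16) / η) + Nat.ceil (384/(c*ε)^3) + 1 : ℕ) : ℝ) ≤ n := by exact_mod_cast hn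
    push_cast at this
    linarith [Nat.le_ceil ((m0 + 16) / η), Nat.le_ceil (384/(c*ε)^3)]
  have hp1 : 0 < (m0 + 16) / η := by positivity
  have hp2 : 0 < 384/(c*ε)^3 := by positivity
  have hnpos : (0:ℝ) < n := by linarith
  have hηn : m0 + 16 ≤ η * n := by
    have : (m0 + 16) / η ≤ n := by linarith
    rw [div_le_iff₀ hη0] at this; linarith
  have hexp : (n:ℝ)^2 ≤ Real.exp (c * ε * n / 4) := by
    have h1 : (c * ε * n / 4)^3 / (Nat.factorial 3) ≤ Real.exp (c * ε * n / 4) :=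
      Real.pow_div_factorial_le_exp _ (by positivity) 3
    refine le_trans ?_ h1
    have h2 : 384/(c*ε)^3 ≤ n := by linarith
    rw [div_le_iff₀ (by positivity)] at h2
    have : (c * ε * n / 4)^3 / (Nat.factorial 3) = (n * (c*ε)^3) * n^2 / 384 := by
      simp [Nat.factorial]; ring
    rw [this]
    have := mul_le_mul_of_nonneg_right h2 (sq_nonneg (n:ℝ))
    linarith
  let l := c * n
  have hl0 : 0 ≤ l := by positivity
  have hcη : c ≤ η / 64 := by
    simp only [c]
    have : ε * η^2 ≤ 1 * η := by
      rw [sq, ← mul_assoc]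
      exact mul_le_mul_of_nonneg_right (by nlinarith) hη0.le
    linarith
  let B := (n:ℝ)^2 * Real.exp (- l * (1/2 - ε/2))
  have claim : ∀ k : ℕ, (∃ U : Finset V, (U.card : ℝ) ≤ η * n ∧ Tl G Uᶜ) ∨
      (∃ U : Finset V, U.card + 4 * k = n ∧ Tl G Uᶜ ∧ phi G l U ≤ B * Real.exp (c * ε * k)) := by
    intro k
    induction k with
    | zero =>
      right
      refine ⟨univ, by simp [hnn], by simpa using Tl.empty, ?_⟩
      simp only [phi]
      have : ∀ x y : V, I (x ≠ y) * Real.exp (-l * ((∑ z, I (G.E x y z)) / (univ : Finset V).card)) ≤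
          Real.exp (- l * (1/2 - ε/2)) := by
        intro x y
        by_cases hxy : x ≠ y
        · rw [I_true hxy, one_mul]
          apply Real.exp_le_exp.mpr
          have h1 := hG x y hxy
          rw [Finset.card_univ, ← hnn]
          rw [← hnn] at h1
          have h2 : (1/2 - ε/2) ≤ (∑ z, I (G.E x y z)) / n := by
            rw [le_div_iff₀ hnpos]; exact h1
          nlinarith
        · rw [I_false hxy, zero_mul]; positivity
      refine (Finset.sum_le_sum fun x _ => Finset.sum_le_sum fun y _ => this x y).trans ?_
      simp only [Finset.sum_const, Finset.card_univ, ← hnn, nsmul_eq_mul, B]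
      simp only [Nat.cast_zero, mul_zero, Real.exp_zero, mul_one]
      apply le_of_eq; ring
    | succ k ih =>
      rcases ih with h | ⟨U, hU1, hU2, hU3⟩
      · exact Or.inl h
      by_cases hs : (U.card : ℝ) ≤ η * n
      · exact Or.inl ⟨U, hs, hU2⟩
      push Not at hs
      right
      have hkn : (k:ℝ) ≤ n / 4 := by
        have : 4 * k ≤ n := by omega
        have : ((4 * k : ℕ) : ℝ) ≤ n := by exact_mod_cast this
        push_cast at this; linarith
      have hm0' : (0:ℝ) ≤ m0 := Nat.cast_nonneg _
      obtain ⟨ι, hι, w, q, a1, a2, a3, a4, a5⟩ := hfs V G U (by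
        have : (m0 : ℝ) ≤ U.card := by linarith
        exact_mod_cast this) (by
        intro x y hxy
        have hu0 : (0:ℝ) < U.card := by linarith
        by_contra hcon
        push Not at hcon
        rw [← div_lt_iff₀ hu0] at hcon
        have h1 : Real.exp (-l * ((∑ z ∈ U, I (G.E x y z)) / U.card)) ≤ phi G l U := by
          simp only [phi]
          have g0 : ∀ x y : V, 0 ≤ I (x ≠ y) * Real.exp (-l * ((∑ z ∈ U, I (G.E x y z)) / U.card)) :=
            fun x y => mul_nonneg (I_nonneg _) (Real.exp_pos _).le
          have g1 := Finset.single_le_sum (f := fun x => ∑ y, I (x ≠ y) * Real.exp (-l * ((∑ z ∈ U, I (G.E x y z)) / U.card)))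
            (fun x _ => Finset.sum_nonneg fun y _ => g0 x y) (mem_univ x)
          have g2 := Finset.single_le_sum (f := fun y => I (x ≠ y) * Real.exp (-l * ((∑ z ∈ U, I (G.E x y z)) / U.card)))
            (fun y _ => g0 x y) (mem_univ y)
          simp only [I_true hxy, one_mul] at g2
          exact g2.trans g1
        have h2 : B * Real.exp (c * ε * k) ≤ Real.exp (-l * (1/2 - ε)) := by
          have e1 : Real.exp (c * ε * k) ≤ Real.exp (c * ε * n / 4) := by
            apply Real.exp_le_exp.mpr
            have := mul_le_mul_of_nonneg_left hkn (show 0 ≤ c * ε by positivity)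
            linarith
          calc B * Real.exp (c * ε * k) ≤ (Real.exp (c * ε * n / 4) * Real.exp (- l * (1/2 - ε/2))) * Real.exp (c * ε * n / 4) := by
                apply mul_le_mul _ e1 (Real.exp_pos _).le (by positivity)
                exact mul_le_mul_of_nonneg_right hexp (Real.exp_pos _).le
            _ = Real.exp (-l * (1/2 - ε)) := by
                rw [← Real.exp_add, ← Real.exp_add]; congr 1; simp only [l]; ring
        have h3 := Real.exp_le_exp.mp (h1.trans (hU3.trans h2))
        have hlpos : 0 < l := by positivity
        have := mul_lt_mul_of_pos_left hcon hlpos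
        linarith)
      have hlu : 4 * l ≤ (U.card:ℝ) - 4 := by
        simp only [l]
        have := mul_le_mul_of_nonneg_right hcη hnpos.le
        linarith
      obtain ⟨T, t1, t2, t3, t4⟩ := at_step G l U hl0 (by linarith) hlu w q a1 a2 a3 a4 a5
      refine ⟨U \ T, ?_, ?_, ?_⟩
      · rw [Finset.card_sdiff_of_subset t1, t2]
        have := Finset.card_le_card t1
        omega
      · have : (U \ T)ᶜ = Uᶜ ∪ T := by
          ext v; simp only [mem_compl, mem_sdiff, mem_union]; tauto
        rw [this]
        exact hU2.union t3 (Finset.disjoint_left.mpr fun v h1 h2 => (mem_compl.mp h1) (t1 h2))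
      · refine t4.trans ?_
        have hx : 16 * l^2 / ((U.card:ℝ)-4)^2 ≤ c * ε := by
          have h4 : η * n / 2 ≤ (U.card:ℝ) - 4 := by linarith
          have h5 : (η * n / 2)^2 ≤ ((U.card:ℝ) - 4)^2 := pow_le_pow_left₀ (by positivity) h4 2
          rw [div_le_iff₀ (lt_of_lt_of_le (by positivity) h5)]
          refine le_trans (le_of_eq ?_) (mul_le_mul_of_nonneg_left h5 (show 0 ≤ c * ε by positivity))
          simp only [l, c]; ring
        have h6 : 1 + 16 * l^2 / ((U.card:ℝ)-4)^2 ≤ Real.exp (c * ε) := by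
          linarith [Real.add_one_le_exp (c * ε)]
        have hphi : 0 ≤ phi G l U := Finset.sum_nonneg fun x _ => Finset.sum_nonneg fun y _ =>
          mul_nonneg (I_nonneg _) (Real.exp_pos _).le
        refine (mul_le_mul h6 hU3 hphi (Real.exp_pos _).le).trans (le_of_eq ?_)
        push_cast
        rw [mul_add, mul_one, Real.exp_add]; ring
  rcases claim n with ⟨U, h1, h2⟩ | ⟨U, h1, h2, -⟩
  · exact ⟨U, h1, h2⟩
  · refine ⟨U, ?_, h2⟩
    have : U.card = 0 := by omega
    rw [this]; push_cast; positivity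

end KF

open Finset

namespace KF
open Classical

section counts
variable {V ι : Type} [Fintype V] [Fintype ι] [DecidableEq ι]

lemma hit_count (X : Finset V) :
    (∑ g : ι → V, I (∃ i, g i ∈ X)) * (Fintype.card V : ℝ) ≤
      Fintype.card ι * X.card * (Fintype.card V : ℝ)^(Fintype.card ι) := by
  have h1 : ∀ g : ι → V, I (∃ i, g i ∈ X) ≤ ∑ i, I (g i ∈ X) := fun g => by
    have := I_exists_le (univ : Finset ι) (fun i => g i ∈ X)
    simpa using this
  have h2 : ∀ i : ι, (∑ g : ι → V, I (g i ∈ X)) * (Fintype.card V : ℝ) =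
      X.card * (Fintype.card V : ℝ)^(Fintype.card ι) := by
    intro i
    have h := sum_comp_inj (V := V) (ι := ι) (κ := Unit) (fun _ => i) (fun _ _ _ => rfl)
      (fun h => I (h () ∈ X))
    have hpos : 0 < Fintype.card ι := Fintype.card_pos_iff.mpr ⟨i⟩
    rw [h]
    have h3 : ∑ h : Unit → V, I (h () ∈ X) = X.card := by
      rw [← (Equiv.funUnique Unit V).symm.sum_comp]
      simp only [Equiv.funUnique_symm_apply, uniqueElim_const]
      rw [sum_I]; simp
    rw [h3]
    have : (Fintype.card V : ℝ)^(Fintype.card ι) = (Fintype.card V : ℝ)^(Fintype.card ι - 1) * (Fintype.card V : ℝ) := by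
      rw [← pow_succ]; congr 1; omega
    rw [this, Fintype.card_unit]; ring
  calc _ ≤ (∑ g : ι → V, ∑ i, I (g i ∈ X)) * (Fintype.card V : ℝ) :=
        mul_le_mul_of_nonneg_right (Finset.sum_le_sum fun g _ => h1 g) (Nat.cast_nonneg _)
    _ = ∑ i : ι, (∑ g : ι → V, I (g i ∈ X)) * (Fintype.card V : ℝ) := by
        rw [Finset.sum_comm, Finset.sum_mul]
    _ = _ := by
        simp only [h2, Finset.sum_const, Finset.card_univ, nsmul_eq_mul]; ring

lemma notinj_count :
    (∑ g : ι → V, I (¬ Function.Injective g)) * (Fintype.card V : ℝ) ≤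
      (Fintype.card ι : ℝ)^2 * (Fintype.card V : ℝ)^(Fintype.card ι) := by
  have h1 : ∀ g : ι → V, I (¬ Function.Injective g) ≤ ∑ i, ∑ j, I (i ≠ j ∧ g i = g j) := fun g => by
    by_cases hg : Function.Injective g
    · rw [I_false (by simpa using hg)]
      exact Finset.sum_nonneg fun _ _ => Finset.sum_nonneg fun _ _ => I_nonneg _
    · have hg2 := hg
      simp only [Function.Injective] at hg2
      push Not at hg2
      obtain ⟨i, j, h, hij⟩ := hg2
      have e : I (¬ Function.Injective g) = I (i ≠ j ∧ g i = g j) := by rw [I_true hg, I_true ⟨hij, h⟩]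
      rw [e]
      refine le_trans ?_ (Finset.single_le_sum (f := fun i => ∑ j, I (i ≠ j ∧ g i = g j))
        (fun _ _ => Finset.sum_nonneg fun _ _ => I_nonneg _) (mem_univ i))
      exact Finset.single_le_sum (f := fun j => I (i ≠ j ∧ g i = g j)) (fun _ _ => I_nonneg _) (mem_univ j)
  have h2 : ∀ i j : ι, (∑ g : ι → V, I (i ≠ j ∧ g i = g j)) * (Fintype.card V : ℝ) ≤
      (Fintype.card V : ℝ)^(Fintype.card ι) := by
    intro i j
    by_cases hij : i = j
    · have : ∀ g : ι → V, I (i ≠ j ∧ g i = g j) = 0 := fun g => I_false (fun h => h.1 hij)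
      simp only [this, Finset.sum_const_zero, zero_mul]; positivity
    · have hinj : Function.Injective (![i, j] : Fin 2 → ι) := by
        intro a b hab
        fin_cases a <;> fin_cases b <;> simp_all
      have h := sum_comp_inj (V := V) (ι := ι) (κ := Fin 2) ![i, j] hinj (fun h => I (h 0 = h 1))
      have e : ∀ g : ι → V, I (i ≠ j ∧ g i = g j) = I (g i = g j) := fun g => I_congr (by simp [hij])
      have hcard : 2 ≤ Fintype.card ι := by
        have := Fintype.card_le_of_injective _ hinj
        simpa using this
      simp only [e]
      simp only [Matrix.cons_val_zero, Matrix.cons_val_one] at h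
      rw [h, sum_fin2]
      have h3 : ∑ x : V, ∑ y : V, I (![x, y] 0 = ![x, y] 1) = Fintype.card V := by
        simp [I]
      rw [h3, Fintype.card_fin]
      apply le_of_eq
      rw [mul_assoc, ← sq, ← pow_add]; congr 1; omega
  calc _ ≤ (∑ g : ι → V, ∑ i, ∑ j, I (i ≠ j ∧ g i = g j)) * (Fintype.card V : ℝ) :=
        mul_le_mul_of_nonneg_right (Finset.sum_le_sum fun g _ => h1 g) (Nat.cast_nonneg _)
    _ = ∑ i : ι, ∑ j : ι, (∑ g : ι → V, I (i ≠ j ∧ g i = g j)) * (Fintype.card V : ℝ) := by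
        rw [Finset.sum_comm, Finset.sum_mul]
        refine Finset.sum_congr rfl fun i _ => ?_
        rw [Finset.sum_comm, Finset.sum_mul]
    _ ≤ ∑ i : ι, ∑ j : ι, (Fintype.card V : ℝ)^(Fintype.card ι) :=
        Finset.sum_le_sum fun i _ => Finset.sum_le_sum fun j _ => h2 i j
    _ = _ := by
        simp only [Finset.sum_const, Finset.card_univ, nsmul_eq_mul]; ring

/-- combined: keep only injective maps avoiding `X`. -/
lemma good_count (X : Finset V) (p : (ι → V) → Prop) {β : ℝ} (hn : 0 < Fintype.card V)
    (hp : β * (Fintype.card V : ℝ)^(Fintype.card ι) ≤ ∑ g : ι → V, I (p g))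
    (hX : ((Fintype.card ι:ℝ)^2 + Fintype.card ι * X.card) ≤ β / 2 * Fintype.card V) :
    β / 2 * (Fintype.card V : ℝ)^(Fintype.card ι) ≤
      ∑ g : ι → V, I (p g ∧ Function.Injective g ∧ ∀ i, g i ∉ X) := by
  have hn' : (0:ℝ) < Fintype.card V := by exact_mod_cast hn
  have h1 : ∀ g : ι → V, I (p g) ≤ I (p g ∧ Function.Injective g ∧ ∀ i, g i ∉ X) +
      I (¬ Function.Injective g) + I (∃ i, g i ∈ X) := by
    intro g
    by_cases a : Function.Injective g
    · by_cases b : ∃ i, g i ∈ X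
      · rw [I_true b]; linarith [I_le_one (p g), I_nonneg (p g ∧ Function.Injective g ∧ ∀ i, g i ∉ X), I_nonneg (¬ Function.Injective g)]
      · have : I (p g) ≤ I (p g ∧ Function.Injective g ∧ ∀ i, g i ∉ X) :=
          I_mono fun hp => ⟨hp, a, by simpa using b⟩
        linarith [I_nonneg (¬ Function.Injective g), I_nonneg (∃ i, g i ∈ X)]
    · rw [I_true a]; linarith [I_le_one (p g), I_nonneg (p g ∧ Function.Injective g ∧ ∀ i, g i ∉ X), I_nonneg (∃ i, g i ∈ X)]
  have h2 := Finset.sum_le_sum fun (g : ι → V) (_ : g ∈ univ) => h1 g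
  rw [Finset.sum_add_distrib, Finset.sum_add_distrib] at h2
  have h3 := hit_count (ι := ι) X
  have h4 := notinj_count (ι := ι) (V := V)
  set S1 := ∑ g : ι → V, I (¬ Function.Injective g)
  set S2 := ∑ g : ι → V, I (∃ i, g i ∈ X)
  have h5 : (S1 + S2) * (Fintype.card V : ℝ) ≤ (β / 2 * (Fintype.card V : ℝ)^(Fintype.card ι)) * Fintype.card V := by
    have := mul_le_mul_of_nonneg_right hX (show 0 ≤ (Fintype.card V : ℝ)^(Fintype.card ι) by positivity)
    linarith
  have h6 := le_of_mul_le_mul_right h5 hn'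
  linarith

end counts

/-- image of a tuple -/
noncomputable def rg {V ι : Type} [Fintype ι] (g : ι → V) : Finset V := univ.image g

lemma mem_rg {V ι : Type} [Fintype ι] {g : ι → V} {v : V} : v ∈ rg g ↔ ∃ i, g i = v := by
  simp [rg]

lemma rg_card_le {V ι : Type} [Fintype ι] (g : ι → V) : (rg g).card ≤ Fintype.card ι := by
  have := Finset.card_image_le (s := univ) (f := g)
  simpa [rg] using this

/-- disjoint unions of at most `k` good 4-tuples -/
inductive Dc {V : Type} (gd : (Fin 4 → V) → Prop) : ℕ → Finset V → Prop
  | nil : Dc gd 0 ∅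
  | step {k : ℕ} {T : Finset V} {q : Fin 4 → V} (hT : Dc gd k T) (hq : gd q)
      (hd : Disjoint T (rg q)) : Dc gd (k+1) (T ∪ rg q)

section family
variable {V ι : Type} [Fintype V] [Fintype ι] [DecidableEq ι]

lemma family_step (hι : 0 < Fintype.card ι) (Q : Finset (Fin 4 → V)) (hQ : Q.Nonempty)
    (A : (Fin 4 → V) → (ι → V) → Prop)
    (β : ℝ) (hβ : 0 < β) (hn : 0 < Fintype.card V)
    (hA : ∀ q ∈ Q, β * (Fintype.card V : ℝ)^(Fintype.card ι) ≤ ∑ g : ι → V, I (A q g))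
    (X : Finset V) (hX : ((Fintype.card ι:ℝ)^2 + Fintype.card ι * X.card) ≤ β / 2 * Fintype.card V)
    (w : (Fin 4 → V) → ℝ) (hw : ∀ q, 0 < w q) :
    ∃ g : ι → V, (∃ q ∈ Q, A q g) ∧ (∀ i, g i ∉ X) ∧
      β / 2 * ∑ q ∈ Q, w q ≤ ∑ q ∈ Q, w q * I (A q g) := by
  have hn' : (0:ℝ) < Fintype.card V := by exact_mod_cast hn
  have hcount : ∀ q ∈ Q, β / 2 * (Fintype.card V : ℝ)^(Fintype.card ι) ≤
      ∑ g : ι → V, I (A q g ∧ ∀ i, g i ∉ X) := by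
    intro q hq
    refine (good_count X _ hn (hA q hq) hX).trans ?_
    exact Finset.sum_le_sum fun g _ => I_mono fun h => ⟨h.1, h.2.2⟩
  by_contra hcon
  push Not at hcon
  have hwpos : 0 < ∑ q ∈ Q, w q := Finset.sum_pos (fun q _ => hw q) hQ
  have h1 : ∀ g : ι → V, ∑ q ∈ Q, w q * I (A q g ∧ ∀ i, g i ∉ X) < β / 2 * ∑ q ∈ Q, w q := by
    intro g
    by_cases h : (∃ q ∈ Q, A q g) ∧ ∀ i, g i ∉ X
    · refine lt_of_le_of_lt ?_ (hcon g h.1 h.2)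
      exact Finset.sum_le_sum fun q _ => mul_le_mul_of_nonneg_left (I_mono fun h => h.1) (hw q).le
    · have : ∑ q ∈ Q, w q * I (A q g ∧ ∀ i, g i ∉ X) = 0 := by
        refine Finset.sum_eq_zero fun q hq => ?_
        rw [I_false (fun h' => h ⟨⟨q, hq, h'.1⟩, h'.2⟩), mul_zero]
      rw [this]; positivity
  have hne : (univ : Finset (ι → V)).Nonempty := by
    obtain ⟨v⟩ := Fintype.card_pos_iff.mp hn
    exact ⟨fun _ => v, mem_univ _⟩
  have h2 := Finset.sum_lt_sum_of_nonempty hne fun g _ => h1 g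
  rw [Finset.sum_comm] at h2
  simp only [← Finset.mul_sum, Finset.sum_const, Finset.card_univ, nsmul_eq_mul] at h2
  have h3 : ∑ q ∈ Q, w q * (β / 2 * (Fintype.card V : ℝ)^(Fintype.card ι)) ≤
      ∑ q ∈ Q, w q * ∑ g : ι → V, I (A q g ∧ ∀ i, g i ∉ X) :=
    Finset.sum_le_sum fun q hq => mul_le_mul_of_nonneg_left (hcount q hq) (hw q).le
  rw [← Finset.sum_mul] at h3
  rw [Fintype.card_fun] at h2
  push_cast at h2
  nlinarith

lemma family_iter (hι : 0 < Fintype.card ι) (Q : Finset (Fin 4 → V)) (hQ : Q.Nonempty)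
    (A : (Fin 4 → V) → (ι → V) → Prop)
    (β : ℝ) (hβ : 0 < β) (hβ1 : β ≤ 1) (hn : 0 < Fintype.card V)
    (hA : ∀ q ∈ Q, β * (Fintype.card V : ℝ)^(Fintype.card ι) ≤ ∑ g : ι → V, I (A q g))
    (F : Finset V) (m : ℕ)
    (hX : ((Fintype.card ι:ℝ)^2 + Fintype.card ι * (F.card + Fintype.card ι * m)) ≤ β / 2 * Fintype.card V) :
    ∀ k, k ≤ m → ∃ P : Finset (ι → V), P.card = k ∧ (∀ g ∈ P, ∃ q ∈ Q, A q g) ∧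
      (∀ g ∈ P, Disjoint (rg g) F) ∧ (∀ g ∈ P, ∀ h ∈ P, g ≠ h → Disjoint (rg g) (rg h)) ∧
      ∑ q ∈ Q, ((1:ℝ)/2)^(P.filter (A q)).card ≤ (1 - β/4)^k * Q.card := by
  intro k
  induction k with
  | zero => intro _; exact ⟨∅, by simp⟩
  | succ k ih =>
    intro hk
    obtain ⟨P, p1, p2, p3, p4, p5⟩ := ih (by omega)
    let X := F ∪ P.biUnion rg
    have hXc : (X.card : ℝ) ≤ F.card + Fintype.card ι * m := by
      have h1 : X.card ≤ F.card + (P.biUnion rg).card := Finset.card_union_le _ _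
      have h2 : (P.biUnion rg).card ≤ P.card * Fintype.card ι :=
        Finset.card_biUnion_le_card_mul _ _ _ fun g _ => rg_card_le g
      rw [p1] at h2
      have h3 : k * Fintype.card ι ≤ Fintype.card ι * m := by
        rw [mul_comm]; exact Nat.mul_le_mul_left _ (by omega)
      have : X.card ≤ F.card + Fintype.card ι * m := by omega
      exact_mod_cast this
    obtain ⟨g, hg1, hg2, hg3⟩ := family_step hι Q hQ A β hβ hn hA X (by
      refine le_trans ?_ hX
      have := mul_le_mul_of_nonneg_left hXc (Nat.cast_nonneg (Fintype.card ι) (α := ℝ))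
      linarith) (fun q => ((1:ℝ)/2)^(P.filter (A q)).card) (fun q => by positivity)
    have hgX : Disjoint (rg g) X := by
      rw [Finset.disjoint_left]; intro v hv
      obtain ⟨i, rfl⟩ := mem_rg.mp hv
      exact hg2 i
    have hgP : g ∉ P := by
      intro hmem
      obtain ⟨i⟩ := Fintype.card_pos_iff.mp hι
      exact hg2 i (by
        simp only [X, mem_union, mem_biUnion]
        exact Or.inr ⟨g, hmem, mem_rg.mpr ⟨i, rfl⟩⟩)
    have hdis : ∀ h ∈ P, Disjoint (rg g) (rg h) := fun h hh =>
      Disjoint.mono_right (fun v hv => by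
        simp only [X, mem_union, mem_biUnion]; exact Or.inr ⟨h, hh, hv⟩) hgX
    refine ⟨insert g P, by rw [Finset.card_insert_of_notMem hgP, p1], ?_, ?_, ?_, ?_⟩
    · intro h hh
      rcases Finset.mem_insert.mp hh with rfl | hh
      · exact hg1
      · exact p2 h hh
    · intro h hh
      rcases Finset.mem_insert.mp hh with rfl | hh
      · exact Disjoint.mono_right Finset.subset_union_left hgX
      · exact p3 h hh
    · intro h hh h' hh' hne
      rcases Finset.mem_insert.mp hh with e1 | e1
      · rcases Finset.mem_insert.mp hh' with e2 | e2
        · exact absurd (e1.trans e2.symm) hne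
        · rw [e1]; exact hdis h' e2
      · rcases Finset.mem_insert.mp hh' with e2 | e2
        · rw [e2]; exact (hdis h e1).symm
        · exact p4 h e1 h' e2 hne
    · have e : ∀ q, ((1:ℝ)/2)^((insert g P).filter (A q)).card =
          ((1:ℝ)/2)^(P.filter (A q)).card - 1/2 * (((1:ℝ)/2)^(P.filter (A q)).card * I (A q g)) := by
        intro q
        rw [Finset.filter_insert]
        by_cases h : A q g
        · rw [if_pos h, I_true h, Finset.card_insert_of_notMem (by simp [hgP]), pow_succ]; ring
        · rw [if_neg h, I_false h]; ring
      simp only [e]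
      rw [Finset.sum_sub_distrib, ← Finset.mul_sum]
      have h5 := mul_le_mul_of_nonneg_left p5 (show (0:ℝ) ≤ 1 - β/4 by linarith)
      rw [pow_succ]
      linarith

end family

end KF

open Finset

namespace KF
open Classical

lemma absorb_use {V ι : Type} [Fintype ι] (G : G3 V)
    (gd : (Fin 4 → V) → Prop) (A : (Fin 4 → V) → (ι → V) → Prop)
    (hA : ∀ q g, gd q → A q g → Tl G (rg g) ∧ Tl G (rg g ∪ rg q))
    (P : Finset (ι → V)) (hP1 : ∀ g ∈ P, Tl G (rg g))
    (hP2 : ∀ g ∈ P, ∀ h ∈ P, g ≠ h → Disjoint (rg g) (rg h)) (h : ℕ)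
    (hh : ∀ q, gd q → h ≤ (P.filter (A q)).card) {k : ℕ} {L : Finset V} (hL : Dc gd k L) (hk : k ≤ h)
    (hd : Disjoint L (P.biUnion rg)) : Tl G (P.biUnion rg ∪ L) := by
  have claim : ∃ P1, P1 ⊆ P ∧ P1.card = k ∧ Tl G (P1.biUnion rg ∪ L) := by
    induction hL with
    | nil => exact ⟨∅, by simp, by simp, by simpa using Tl.empty⟩
    | @step k T q hT hq hdT ih =>
      rw [Finset.disjoint_union_left] at hd
      obtain ⟨P1, a1, a2, a3⟩ := ih (by omega) hd.1
      have hlt : P1.card < (P.filter (A q)).card := by have := hh q hq; omega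
      obtain ⟨g, hg1, hg2⟩ := Finset.exists_mem_notMem_of_card_lt_card hlt
      rw [Finset.mem_filter] at hg1
      refine ⟨insert g P1, ?_, by rw [Finset.card_insert_of_notMem hg2, a2], ?_⟩
      · intro x hx
        rcases Finset.mem_insert.mp hx with rfl | hx
        · exact hg1.1
        · exact a1 hx
      · have e : (insert g P1).biUnion rg ∪ (T ∪ rg q) = (P1.biUnion rg ∪ T) ∪ (rg g ∪ rg q) := by
          rw [Finset.biUnion_insert]
          ext v; simp only [mem_union]; tauto
        rw [e]
        refine a3.union (hA q g hq hg1.2).2 ?_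
        have gsub : rg g ⊆ P.biUnion rg := fun v hv => mem_biUnion.mpr ⟨g, hg1.1, hv⟩
        have psub : P1.biUnion rg ⊆ P.biUnion rg := Finset.biUnion_subset_biUnion_of_subset_left _ a1
        rw [Finset.disjoint_union_left, Finset.disjoint_union_right, Finset.disjoint_union_right]
        refine ⟨⟨?_, ?_⟩, ⟨?_, hdT⟩⟩
        · rw [Finset.disjoint_biUnion_left]
          intro p hp
          exact hP2 p (a1 hp) g hg1.1 (fun e => hg2 (e ▸ hp))
        · exact (Disjoint.mono_right psub hd.2).symm
        · exact Disjoint.mono_right gsub hd.1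
  obtain ⟨P1, a1, a2, a3⟩ := claim
  have e : P.biUnion rg ∪ L = (P1.biUnion rg ∪ L) ∪ (P \ P1).biUnion rg := by
    have : P = P1 ∪ (P \ P1) := (Finset.union_sdiff_of_subset a1).symm
    conv_lhs => rw [this, Finset.union_biUnion]
    ext v; simp only [mem_union]; tauto
  rw [e]
  refine a3.union (Tl.biUnion _ _ (fun g hg => hP1 g (mem_sdiff.mp hg).1) (fun g hg g' hg' =>
    hP2 g (mem_sdiff.mp hg).1 g' (mem_sdiff.mp hg').1)) ?_
  rw [Finset.disjoint_union_left]
  constructor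
  · rw [Finset.disjoint_biUnion_left]
    intro p hp
    rw [Finset.disjoint_biUnion_right]
    intro p' hp'
    exact hP2 p (a1 hp) p' (mem_sdiff.mp hp').1 (fun e => (mem_sdiff.mp hp').2 (e ▸ hp))
  · exact Disjoint.mono_right (Finset.biUnion_subset_biUnion_of_subset_left _ sdiff_subset) hd

lemma absorb (ι : Type) [Fintype ι] [DecidableEq ι] (hι : 0 < Fintype.card ι) (β ρ : ℝ) (hβ : 0 < β)
    (hβ1 : β ≤ 1) (hρ : 0 < ρ) : ∃ c : ℝ, 0 < c ∧ ∃ N0 : ℕ, ∀ (V : Type) [Fintype V] (G : G3 V),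
    N0 ≤ Fintype.card V → ∀ (gd : (Fin 4 → V) → Prop) (A : (Fin 4 → V) → (ι → V) → Prop),
    (∀ q, gd q → β * (Fintype.card V : ℝ)^(Fintype.card ι) ≤ ∑ g : ι → V, I (A q g)) →
    (∀ q g, gd q → A q g → Tl G (rg g) ∧ Tl G (rg g ∪ rg q)) →
    ∀ F : Finset V, (F.card : ℝ) ≤ c * Fintype.card V →
    ∃ W : Finset V, Tl G W ∧ Disjoint W F ∧ (W.card : ℝ) ≤ ρ * Fintype.card V ∧
      ∀ k L, Dc gd k L → (k:ℝ) ≤ c * Fintype.card V → Disjoint L W → Tl G (W ∪ L) := by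
  set s : ℝ := (Fintype.card ι : ℝ) with hs
  have hs1 : 1 ≤ s := by rw [hs]; exact_mod_cast hι
  let γ := min (β/(8*s^2)) (ρ/s)
  have hγ0 : 0 < γ := lt_min (by positivity) (by positivity)
  have hγ1 : γ ≤ β/(8*s^2) := min_le_left _ _
  have hγ2 : γ ≤ ρ/s := min_le_right _ _
  let c := min (β/(8*s)) (β*γ/32)
  have hc0 : 0 < c := lt_min (by positivity) (by positivity)
  have hc1 : c ≤ β/(8*s) := min_le_left _ _
  have hc2 : c ≤ β*γ/32 := min_le_right _ _
  let T := β*γ/16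
  have hT : 0 < T := by positivity
  refine ⟨c, hc0, Nat.ceil (8*s^2/β) + Nat.ceil (2/γ) + Nat.ceil (120/T^5) + 1, ?_⟩
  intro V _ G hN gd A hcnt hA F hF
  set n : ℝ := (Fintype.card V : ℝ) with hn
  have hnR : 8*s^2/β + 2/γ + 120/T^5 + 1 ≤ n := by
    have : ((Nat.ceil (8*s^2/β) + Nat.ceil (2/γ) + Nat.ceil (120/T^5) + 1 : ℕ) : ℝ) ≤ n := by
      rw [hn]; exact_mod_cast hN
    push_cast at this
    linarith [Nat.le_ceil (8*s^2/β), Nat.le_ceil (2/γ), Nat.le_ceil (120/T^5)]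
  have q1 : 0 < 8*s^2/β := by positivity
  have q2 : 0 < 2/γ := by positivity
  have q3 : 0 < 120/T^5 := by positivity
  have hnpos : 0 < n := by linarith
  have b1 : s^2 ≤ β/8 * n := by
    have : 8*s^2/β ≤ n := by linarith
    rw [div_le_iff₀ hβ] at this; linarith
  have b2 : 2 ≤ γ * n := by
    have : 2/γ ≤ n := by linarith
    rw [div_le_iff₀ hγ0] at this; linarith
  have b3 : 120 ≤ T^5 * n := by
    have : 120/T^5 ≤ n := by linarith
    rw [div_le_iff₀ (by positivity)] at this; linarith
  let m := Nat.floor (γ * n)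
  have m1 : (m:ℝ) ≤ γ * n := Nat.floor_le (by positivity)
  have m2 : γ * n / 2 ≤ m := by
    have := Nat.lt_floor_add_one (γ * n)
    have h : γ * n < (m:ℝ) + 1 := this
    linarith
  by_cases hQ : (univ.filter gd).Nonempty
  swap
  · refine ⟨∅, Tl.empty, by simp, by simp; positivity, ?_⟩
    intro k L hL _ _
    have hnone : ∀ q, ¬ gd q := by
      intro q hq
      exact hQ ⟨q, by simp [hq]⟩
    cases hL with
    | nil => simpa using Tl.empty
    | step hT hq hd => exact absurd hq (hnone _)
  have hX : ((Fintype.card ι:ℝ)^2 + Fintype.card ι * (F.card + Fintype.card ι * m)) ≤ β / 2 * Fintype.card V := by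
    rw [← hs, ← hn]
    have u1 : s * F.card ≤ β/8 * n := by
      calc s * F.card ≤ s * (β/(8*s) * n) := by
            apply mul_le_mul_of_nonneg_left _ (by linarith)
            exact hF.trans (mul_le_mul_of_nonneg_right hc1 hnpos.le)
        _ = β/8 * n := by field_simp
    have u2 : s^2 * m ≤ β/8 * n := by
      calc s^2 * m ≤ s^2 * (β/(8*s^2) * n) := by
            apply mul_le_mul_of_nonneg_left _ (by positivity)
            exact m1.trans (mul_le_mul_of_nonneg_right hγ1 hnpos.le)
        _ = β/8 * n := by field_simp
    nlinarith
  obtain ⟨P, p1, p2, p3, p4, p5⟩ := family_iter hι (univ.filter gd) hQ A β hβ hβ1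
    (by have : (0:ℝ) < Fintype.card V := hnpos
        exact_mod_cast this) (fun q hq => hcnt q (mem_filter.mp hq).2) F m hX m le_rfl
  have hP1 : ∀ g ∈ P, Tl G (rg g) := by
    intro g hg
    obtain ⟨q, hq, hq2⟩ := p2 g hg
    exact (hA q g (mem_filter.mp hq).2 hq2).1
  have hcard : ∀ q, gd q → β * γ * n / 16 ≤ ((P.filter (A q)).card : ℝ) := by
    intro q hq
    set h := (P.filter (A q)).card with hh
    have e1 : ((1:ℝ)/2)^h ≤ (1 - β/4)^m * (univ.filter gd : Finset (Fin 4 → V)).card := by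
      refine le_trans ?_ p5
      exact Finset.single_le_sum (f := fun q => ((1:ℝ)/2)^(P.filter (A q)).card)
        (fun _ _ => by positivity) (by simp [hq])
    have e2 : ((univ.filter gd : Finset (Fin 4 → V)).card : ℝ) ≤ n^4 := by
      have : (univ.filter gd : Finset (Fin 4 → V)).card ≤ (Fintype.card V)^4 := by
        refine (Finset.card_le_univ _).trans ?_
        simp
      rw [hn]; exact_mod_cast this
    have e3 : (1 - β/4)^m ≤ Real.exp (-(β/4*m)) := by
      have : 1 - β/4 ≤ Real.exp (-(β/4)) := by linarith [Real.add_one_le_exp (-(β/4))]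
      refine (pow_le_pow_left₀ (by linarith) this m).trans (le_of_eq ?_)
      rw [← Real.exp_nat_mul]; congr 1; ring
    have e4 : n^4 ≤ Real.exp (β/8*m) := by
      have h1 : (T*n)^5 / (Nat.factorial 5) ≤ Real.exp (T*n) :=
        Real.pow_div_factorial_le_exp _ (by positivity) 5
      have h2 : n^4 ≤ (T*n)^5 / (Nat.factorial 5) := by
        have : (T*n)^5 / (Nat.factorial 5) = (T^5*n) * n^4 / 120 := by
          simp [Nat.factorial]; ring
        rw [this]
        have := mul_le_mul_of_nonneg_right b3 (show 0 ≤ n^4 by positivity)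
        linarith
      refine h2.trans (h1.trans (Real.exp_le_exp.mpr ?_))
      have := mul_le_mul_of_nonneg_left m2 (show 0 ≤ β/8 by positivity)
      refine le_trans (le_of_eq ?_) this
      simp only [T]; ring
    have e5 : Real.exp (-(h:ℝ)) ≤ ((1:ℝ)/2)^h := by
      have : Real.exp (-1) ≤ 1/2 := by
        rw [Real.exp_neg, one_div]
        exact inv_anti₀ (by norm_num) (by linarith [Real.exp_one_gt_d9])
      refine le_trans (le_of_eq ?_) (pow_le_pow_left₀ (Real.exp_pos _).le this h)
      rw [← Real.exp_nat_mul]; congr 1; ring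
    have e6 : Real.exp (-(h:ℝ)) ≤ Real.exp (-(β/4*m) + β/8*m) := by
      rw [Real.exp_add]
      refine e5.trans (e1.trans ?_)
      exact mul_le_mul e3 (e2.trans e4) (Nat.cast_nonneg _) (Real.exp_pos _).le
    have e7 := Real.exp_le_exp.mp e6
    have := mul_le_mul_of_nonneg_left m2 (show 0 ≤ β/8 by positivity)
    linarith
  refine ⟨P.biUnion rg, Tl.biUnion _ _ hP1 p4, ?_, ?_, ?_⟩
  · rw [Finset.disjoint_biUnion_left]; exact p3
  · have h2 : (P.biUnion rg).card ≤ P.card * Fintype.card ι :=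
      Finset.card_biUnion_le_card_mul _ _ _ fun g _ => rg_card_le g
    rw [p1] at h2
    have h3 : ((P.biUnion rg).card : ℝ) ≤ m * s := by rw [hs]; exact_mod_cast h2
    have h4 : m * s ≤ (ρ/s * n) * s :=
      mul_le_mul_of_nonneg_right (m1.trans (mul_le_mul_of_nonneg_right hγ2 hnpos.le)) (by linarith)
    have h5 : (ρ/s * n) * s = ρ * n := by field_simp
    linarith
  · intro k L hL hk hd
    refine absorb_use G gd A hA P hP1 p4 (Nat.ceil (β * γ * n / 16)) (fun q hq => Nat.ceil_le.mpr (hcard q hq)) hL ?_ hd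
    have : (k:ℝ) ≤ β * γ * n / 16 := by
      have := mul_le_mul_of_nonneg_right hc2 hnpos.le
      have h0 : 0 ≤ β * γ * n := by positivity
      linarith
    have h2 := this.trans (Nat.le_ceil _)
    exact_mod_cast h2

end KF

open Finset

namespace KF
open Classical

/-- connectors -/
def Conn {V ι : Type} [Fintype ι] (G : G3 V) (g : ι → V) (x y : V) : Prop :=
  Function.Injective g ∧ x ∉ rg g ∧ y ∉ rg g ∧ Tl G (insert x (rg g)) ∧ Tl G (insert y (rg g))

def RchT {V : Type} [Fintype V] (G : G3 V) (ι : Type) [Fintype ι] [DecidableEq ι] (β : ℝ) (x y : V) : Prop :=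
  β * (Fintype.card V : ℝ)^(Fintype.card ι) ≤ ∑ g : ι → V, I (Conn G g x y)

abbrev Rch {V : Type} [Fintype V] (G : G3 V) (m : ℕ) (β : ℝ) (x y : V) : Prop := RchT G (Fin m) β x y

lemma Conn.symm {V ι : Type} [Fintype ι] {G : G3 V} {g : ι → V} {x y : V} (h : Conn G g x y) :
    Conn G g y x := ⟨h.1, h.2.2.1, h.2.1, h.2.2.2.2, h.2.2.2.1⟩

lemma RchT.symm {V ι : Type} [Fintype V] [Fintype ι] [DecidableEq ι] {G : G3 V} {β : ℝ} {x y : V}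
    (h : RchT G ι β x y) : RchT G ι β y x :=
  h.trans (Finset.sum_le_sum fun _ _ => I_mono Conn.symm)

lemma RchT.mono {V ι : Type} [Fintype V] [Fintype ι] [DecidableEq ι] {G : G3 V} {β β' : ℝ} {x y : V}
    (h : RchT G ι β x y) (hb : β' ≤ β) : RchT G ι β' x y :=
  (mul_le_mul_of_nonneg_right hb (by positivity)).trans h

lemma rg_equiv {V ι κ : Type} [Fintype ι] [Fintype κ] (e : ι ≃ κ) (g : κ → V) : rg (g ∘ e) = rg g := by
  ext v; simp only [mem_rg, Function.comp]
  exact ⟨fun ⟨i, h⟩ => ⟨e i, h⟩, fun ⟨i, h⟩ => ⟨e.symm i, by simpa using h⟩⟩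

lemma RchT.equiv {V ι κ : Type} [Fintype V] [Fintype ι] [DecidableEq ι] [Fintype κ] [DecidableEq κ]
    {G : G3 V} {β : ℝ} {x y : V} (e : ι ≃ κ) (h : RchT G ι β x y) : RchT G κ β x y := by
  unfold RchT at h ⊢
  rw [← Fintype.card_congr e]
  refine h.trans (le_of_eq ?_)
  refine Fintype.sum_equiv (Equiv.arrowCongr e (Equiv.refl V)) _ _ fun g => I_congr ?_
  have e1 : (Equiv.arrowCongr e (Equiv.refl V)) g = g ∘ e.symm := rfl
  rw [e1]
  unfold Conn
  rw [rg_equiv]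
  have : Function.Injective (g ∘ e.symm) ↔ Function.Injective g := e.symm.injective_comp g
  rw [this]

lemma RchT.toFin {V ι : Type} [Fintype V] [Fintype ι] [DecidableEq ι]
    {G : G3 V} {β : ℝ} {x y : V} {m : ℕ} (h : RchT G ι β x y) (hm : Fintype.card ι = m) : Rch G m β x y := by
  subst hm
  exact RchT.equiv (Fintype.equivFin ι) h

lemma RchT.mk {V κ : Type} [Fintype V] [Fintype κ] [DecidableEq κ] {G : G3 V} {β : ℝ} {x y : V}
    (hn : 0 < Fintype.card V) (p : (κ → V) → Prop)
    (hp : β * (Fintype.card V : ℝ)^(Fintype.card κ) ≤ ∑ g : κ → V, I (p g))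
    (hb : ((Fintype.card κ:ℝ)^2 + Fintype.card κ * 2) ≤ β / 2 * Fintype.card V)
    (h : ∀ g : κ → V, Function.Injective g → x ∉ rg g → y ∉ rg g → p g →
      Tl G (insert x (rg g)) ∧ Tl G (insert y (rg g))) : RchT G κ (β/2) x y := by
  have h1 := good_count ({x, y} : Finset V) p hn hp (by
    refine le_trans ?_ hb
    have : (({x, y} : Finset V).card : ℝ) ≤ 2 := by exact_mod_cast Finset.card_le_two
    have := mul_le_mul_of_nonneg_left this (Nat.cast_nonneg (Fintype.card κ) (α := ℝ))
    linarith)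
  refine h1.trans (Finset.sum_le_sum fun g _ => I_mono fun hg => ?_)
  have hx : x ∉ rg g := fun hx => by
    obtain ⟨i, hi⟩ := mem_rg.mp hx
    exact hg.2.2 i (by simp [hi])
  have hy : y ∉ rg g := fun hx => by
    obtain ⟨i, hi⟩ := mem_rg.mp hx
    exact hg.2.2 i (by simp [hi])
  exact ⟨hg.2.1, hx, hy, h g hg.2.1 hx hy hg.1⟩

lemma option_sum {V ι κ : Type} [Fintype V] [Fintype ι] [DecidableEq ι] [Fintype κ] [DecidableEq κ]
    (f : V → (ι → V) → (κ → V) → ℝ) :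
    ∑ g : Option (ι ⊕ κ) → V, f (g none) (fun i => g (some (Sum.inl i))) (fun j => g (some (Sum.inr j))) =
      ∑ z, ∑ a : ι → V, ∑ b : κ → V, f z a b := by
  let e : (Option (ι ⊕ κ) → V) ≃ V × ((ι → V) × (κ → V)) :=
    (Equiv.piOptionEquivProd (β := fun _ => V)).trans
      (Equiv.prodCongr (Equiv.refl _) (Equiv.sumArrowEquivProdArrow ι κ V))
  have : ∑ z, ∑ a : ι → V, ∑ b : κ → V, f z a b = ∑ q : V × ((ι → V) × (κ → V)), f q.1 q.2.1 q.2.2 := by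
    rw [Fintype.sum_prod_type]
    refine Finset.sum_congr rfl fun z _ => ?_
    rw [Fintype.sum_prod_type]
  rw [this]
  exact Fintype.sum_equiv e _ _ fun g => rfl

/-- composition of connectors -/
lemma RchT.comp {V ι κ : Type} [Fintype V] [Fintype ι] [DecidableEq ι] [Fintype κ] [DecidableEq κ]
    {G : G3 V} {β β' c : ℝ} {x y : V} (hn : 0 < Fintype.card V) (hβ : 0 ≤ β) (hβ' : 0 ≤ β')
    (hz : c * Fintype.card V ≤ ∑ z, I (RchT G ι β x z ∧ RchT G κ β' z y))
    (hb : (((Fintype.card ι + Fintype.card κ + 1 : ℕ):ℝ)^2 + ((Fintype.card ι + Fintype.card κ + 1 : ℕ):ℝ) * 2)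
      ≤ c * β * β' / 2 * Fintype.card V) :
    RchT G (Option (ι ⊕ κ)) (c * β * β' / 2) x y := by
  have hcard : Fintype.card (Option (ι ⊕ κ)) = Fintype.card ι + Fintype.card κ + 1 := by simp
  refine RchT.mk hn (fun g => Conn G (fun i => g (some (Sum.inl i))) x (g none) ∧
    Conn G (fun i => g (some (Sum.inr i))) (g none) y) ?_ (by rw [hcard]; exact hb) ?_
  · have h1 := option_sum (V := V) (ι := ι) (κ := κ) (fun z a b => I (Conn G a x z ∧ Conn G b z y))
    rw [h1, hcard]
    have h2 : ∀ z, β * (Fintype.card V : ℝ)^(Fintype.card ι) * (β' * (Fintype.card V : ℝ)^(Fintype.card κ)) *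
        I (RchT G ι β x z ∧ RchT G κ β' z y) ≤ ∑ a : ι → V, ∑ b : κ → V, I (Conn G a x z ∧ Conn G b z y) := by
      intro z
      by_cases h : RchT G ι β x z ∧ RchT G κ β' z y
      · rw [I_true h, mul_one]
        simp only [I_and, ← Finset.mul_sum]
        rw [← Finset.sum_mul]
        exact mul_le_mul h.1 h.2 (by positivity) (Finset.sum_nonneg fun _ _ => I_nonneg _)
      · rw [I_false h, mul_zero]
        exact Finset.sum_nonneg fun _ _ => Finset.sum_nonneg fun _ _ => I_nonneg _
    refine le_trans ?_ (Finset.sum_le_sum fun z _ => h2 z)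
    rw [← Finset.mul_sum]
    have h3 := mul_le_mul_of_nonneg_left hz (show 0 ≤ β * (Fintype.card V : ℝ)^(Fintype.card ι) *
      (β' * (Fintype.card V : ℝ)^(Fintype.card κ)) by positivity)
    refine le_trans (le_of_eq ?_) h3
    rw [pow_succ, pow_add]; ring
  · intro g hg hx hy hp
    obtain ⟨⟨a1, a2, a3, a4, a5⟩, b1, b2, b3, b4, b5⟩ := hp
    set ga : ι → V := fun i => g (some (Sum.inl i)) with hga
    set gb : κ → V := fun i => g (some (Sum.inr i)) with hgb
    have erg : rg g = insert (g none) (rg ga ∪ rg gb) := by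
      ext v
      simp only [mem_rg, mem_insert, mem_union, hga, hgb]
      constructor
      · rintro ⟨i, rfl⟩
        rcases i with _ | (i | i)
        · left; rfl
        · right; left; exact ⟨i, rfl⟩
        · right; right; exact ⟨i, rfl⟩
      · rintro (rfl | ⟨i, rfl⟩ | ⟨i, rfl⟩)
        · exact ⟨_, rfl⟩
        · exact ⟨_, rfl⟩
        · exact ⟨_, rfl⟩
    have hdab : Disjoint (rg ga) (rg gb) := by
      rw [Finset.disjoint_left]; intro v h1 h2
      obtain ⟨i, hi⟩ := mem_rg.mp h1
      obtain ⟨j, hj⟩ := mem_rg.mp h2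
      have := hg (hi.trans hj.symm)
      simp at this
    rw [erg] at hx hy
    simp only [mem_insert, mem_union, not_or] at hx hy
    constructor
    · have e : insert x (rg g) = insert x (rg ga) ∪ insert (g none) (rg gb) := by
        rw [erg]; ext v; simp only [mem_insert, mem_union]; tauto
      rw [e]
      refine a4.union b4 ?_
      rw [Finset.disjoint_insert_left, Finset.disjoint_insert_right, mem_insert, not_or]
      exact ⟨⟨hx.1, hx.2.2⟩, a3, hdab⟩
    · have e : insert y (rg g) = insert (g none) (rg ga) ∪ insert y (rg gb) := by
        rw [erg]; ext v; simp only [mem_insert, mem_union]; tauto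
      rw [e]
      refine a5.union b5 ?_
      rw [Finset.disjoint_insert_left, Finset.disjoint_insert_right, mem_insert, not_or]
      exact ⟨⟨fun h => hy.1 h.symm, b2⟩, hy.2.1, hdab⟩

/-- direct connectors -/
lemma Rch.direct {V : Type} [Fintype V] {G : G3 V} {β : ℝ} {x y : V}
    (h : β * (Fintype.card V : ℝ)^3 ≤ ∑ a, ∑ b, ∑ c, I (G.K x a b c ∧ G.K y a b c)) : Rch G 3 β x y := by
  unfold Rch RchT
  rw [Fintype.card_fin, sum_fin3]
  refine h.trans (Finset.sum_le_sum fun a _ => Finset.sum_le_sum fun b _ => Finset.sum_le_sum fun c _ =>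
    I_mono fun ⟨h1, h2⟩ => ?_)
  have er : rg ![a, b, c] = {a, b, c} := by
    ext v; simp only [mem_rg, mem_insert, mem_singleton, Fin.exists_fin_succ]
    simp [eq_comm]
  have t1 := Tl.of_K h1
  have t2 := Tl.of_K h2
  obtain ⟨p1, p2, p3, p4, p5, p6⟩ := G.K_ne h1
  obtain ⟨q1, q2, q3, q4, q5, q6⟩ := G.K_ne h2
  refine ⟨?_, ?_, ?_, ?_, ?_⟩
  · intro i j hij
    fin_cases i <;> fin_cases j <;> simp_all
  · rw [er]; simp [*]
  · rw [er]; simp [*]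
  · rw [er]; exact t1
  · rw [er]; exact t2

end KF

open Finset

namespace KF
open Classical

lemma I_forall {r : ℕ} (p : Fin r → Prop) : I (∀ i, p i) = ∏ i, I (p i) := by
  by_cases h : ∀ i, p i
  · rw [I_true h]; symm; exact Finset.prod_eq_one fun i _ => I_true (h i)
  · rw [I_false h]; symm
    push Not at h
    obtain ⟨i, hi⟩ := h
    exact Finset.prod_eq_zero (mem_univ i) (I_false hi)

lemma conn_prod {V : Type} [Fintype V] (G : G3 V) {r m : ℕ} {β : ℝ} (hβ : 0 ≤ β) (x y : Fin r → V)
    (h : ∀ i, Rch G m β (x i) (y i)) : β^r * (Fintype.card V : ℝ)^(r*m) ≤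
      ∑ c : Fin r → Fin m → V, I (∀ i, Conn G (c i) (x i) (y i)) := by
  have h1 : ∑ c : Fin r → Fin m → V, I (∀ i, Conn G (c i) (x i) (y i)) =
      ∏ i, ∑ g : Fin m → V, I (Conn G g (x i) (y i)) := by
    rw [Finset.prod_univ_sum]
    simp only [I_forall, Fintype.piFinset_univ]
  rw [h1]
  have h2 : ∏ _i : Fin r, (β * (Fintype.card V : ℝ)^m) ≤ ∏ i, ∑ g : Fin m → V, I (Conn G g (x i) (y i)) := by
    refine Finset.prod_le_prod (fun i _ => by positivity) fun i _ => ?_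
    have := h i
    unfold Rch RchT at this
    rwa [Fintype.card_fin] at this
  refine le_trans (le_of_eq ?_) h2
  rw [Finset.prod_const, Finset.card_univ, Fintype.card_fin, mul_pow, ← pow_mul, mul_comm r m]

lemma block_sum {V ι : Type} [Fintype V] [Fintype ι] [DecidableEq ι] {r m : ℕ}
    (f : (ι → V) → (Fin r → Fin m → V) → ℝ) :
    ∑ g : ι ⊕ (Fin r × Fin m) → V, f (fun i => g (Sum.inl i)) (fun i j => g (Sum.inr (i, j))) =
      ∑ a : ι → V, ∑ c : Fin r → Fin m → V, f a c := by
  let e : (ι ⊕ (Fin r × Fin m) → V) ≃ (ι → V) × (Fin r → Fin m → V) :=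
    (Equiv.sumArrowEquivProdArrow ι (Fin r × Fin m) V).trans
      (Equiv.prodCongr (Equiv.refl _) (Equiv.curry (Fin r) (Fin m) V))
  rw [← Fintype.sum_prod_type']
  exact Fintype.sum_equiv e _ _ fun g => rfl

lemma block_Tl {V : Type} {G : G3 V} {r m : ℕ} (y : Fin r → V) (c : Fin r → Fin m → V)
    (hy : Function.Injective y) (hyc : ∀ i j k, y i ≠ c j k)
    (hc : ∀ i k j l, c i k = c j l → i = j) (h : ∀ i, Tl G (insert (y i) (rg (c i)))) :
    Tl G (rg y ∪ univ.biUnion fun i => rg (c i)) := by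
  have e : rg y ∪ univ.biUnion (fun i => rg (c i)) = univ.biUnion fun i => insert (y i) (rg (c i)) := by
    ext v
    simp only [mem_union, mem_biUnion, mem_univ, true_and, mem_insert, mem_rg]
    constructor
    · rintro (⟨i, rfl⟩ | ⟨i, h⟩)
      · exact ⟨i, Or.inl rfl⟩
      · exact ⟨i, Or.inr h⟩
    · rintro ⟨i, rfl | h⟩
      · exact Or.inl ⟨i, rfl⟩
      · exact Or.inr ⟨i, h⟩
  rw [e]
  refine Tl.biUnion _ _ (fun i _ => h i) fun i _ j _ hij => ?_
  rw [Finset.disjoint_insert_left, Finset.disjoint_insert_right, mem_insert, not_or, mem_rg, mem_rg]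
  refine ⟨⟨fun e => hij (hy e), ?_⟩, ?_, ?_⟩
  · rintro ⟨k, hk⟩; exact hyc i j k hk.symm
  · rintro ⟨k, hk⟩; exact hyc j i k hk.symm
  · rw [Finset.disjoint_left]; intro v h1 h2
    obtain ⟨k, rfl⟩ := mem_rg.mp h1
    obtain ⟨l, hl⟩ := mem_rg.mp h2
    exact hij (hc _ _ _ _ hl).symm

lemma rg_fin4 {V : Type} (p : Fin 4 → V) : rg p = {p 0, p 1, p 2, p 3} := by
  ext v; simp only [mem_rg, mem_insert, mem_singleton, Fin.exists_fin_succ]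
  simp [eq_comm]

lemma rg_fin3 {V : Type} (p : Fin 3 → V) : rg p = {p 0, p 1, p 2} := by
  ext v; simp only [mem_rg, mem_insert, mem_singleton, Fin.exists_fin_succ]
  simp [eq_comm]

def absRel {V : Type} (G : G3 V) (m : ℕ) (q : Fin 4 → V) (g : Fin 4 ⊕ (Fin 4 × Fin m) → V) : Prop :=
  (G.K (g (Sum.inl 0)) (g (Sum.inl 1)) (g (Sum.inl 2)) (g (Sum.inl 3)) ∧
    ∀ i, Conn G (fun j => g (Sum.inr (i, j))) (q i) (g (Sum.inl i))) ∧
  Function.Injective g ∧ ∀ i, g i ∉ rg q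

lemma absRel_Tl {V : Type} {G : G3 V} {m : ℕ} {q : Fin 4 → V} {g : Fin 4 ⊕ (Fin 4 × Fin m) → V}
    (hq : Function.Injective q) (h : absRel G m q g) : Tl G (rg g) ∧ Tl G (rg g ∪ rg q) := by
  obtain ⟨⟨hK, hC⟩, hg, hgq⟩ := h
  set p : Fin 4 → V := fun i => g (Sum.inl i) with hp
  set c : Fin 4 → Fin m → V := fun i j => g (Sum.inr (i, j)) with hc
  have hpi : Function.Injective p := fun i j hij => Sum.inl_injective (hg hij)
  have hpc : ∀ i j k, p i ≠ c j k := fun i j k h => by have := hg h; simp at this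
  have hcc : ∀ i k j l, c i k = c j l → i = j := fun i k j l h => by
    have := hg h; simp at this; exact this.1
  have hqc : ∀ i j k, q i ≠ c j k := fun i j k h => hgq (Sum.inr (j, k)) (mem_rg.mpr ⟨i, h⟩)
  have erg : rg g = rg p ∪ univ.biUnion fun i => rg (c i) := by
    ext v
    simp only [mem_rg, mem_union, mem_biUnion, mem_univ, true_and, hp, hc]
    constructor
    · rintro ⟨i | ⟨i, j⟩, rfl⟩
      · exact Or.inl ⟨i, rfl⟩
      · exact Or.inr ⟨i, j, rfl⟩
    · rintro (⟨i, rfl⟩ | ⟨i, j, rfl⟩)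
      · exact ⟨_, rfl⟩
      · exact ⟨_, rfl⟩
  constructor
  · rw [erg]; exact block_Tl p c hpi hpc hcc fun i => (hC i).2.2.2.2
  · have h1 := block_Tl q c hq hqc hcc fun i => (hC i).2.2.2.1
    have h2 : Tl G (rg p) := by rw [rg_fin4]; exact Tl.of_K hK
    have e : rg g ∪ rg q = rg p ∪ (rg q ∪ univ.biUnion fun i => rg (c i)) := by
      rw [erg]; ext v; simp only [mem_union]; tauto
    rw [e]
    refine h2.union h1 ?_
    rw [Finset.disjoint_left]; intro v hv hv2
    obtain ⟨i, rfl⟩ := mem_rg.mp hv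
    rcases mem_union.mp hv2 with h | h
    · exact hgq _ h
    · simp only [mem_biUnion, mem_univ, true_and, mem_rg] at h
      obtain ⟨j, k, hk⟩ := h
      exact hpc i j k hk.symm

/-- absorbers from reachability -/
lemma absorbR (m : ℕ) (β ρ : ℝ) (hβ : 0 < β) (hβ1 : β ≤ 1) (hρ : 0 < ρ) :
    ∃ c : ℝ, 0 < c ∧ ∃ N0 : ℕ, ∀ (V : Type) [Fintype V] (G : G3 V),
    N0 ≤ Fintype.card V → ∀ (gd : (Fin 4 → V) → Prop),
    (∀ q, gd q → Function.Injective q ∧ β * (Fintype.card V : ℝ)^4 ≤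
      ∑ p : Fin 4 → V, I (G.K (p 0) (p 1) (p 2) (p 3) ∧ ∀ i, Rch G m β (q i) (p i))) →
    ∀ F : Finset V, (F.card : ℝ) ≤ c * Fintype.card V →
    ∃ W : Finset V, Tl G W ∧ Disjoint W F ∧ (W.card : ℝ) ≤ ρ * Fintype.card V ∧
      ∀ k L, Dc gd k L → (k:ℝ) ≤ c * Fintype.card V → Disjoint L W → Tl G (W ∪ L) := by
  have hb5 : β^5 ≤ 1 := pow_le_one₀ hβ.le hβ1
  obtain ⟨c, hc, N0, h⟩ := absorb (Fin 4 ⊕ (Fin 4 × Fin m)) (by simp) (β^5/2) ρ (by positivity)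
    (by linarith) hρ
  have hcard : Fintype.card (Fin 4 ⊕ (Fin 4 × Fin m)) = 4 + 4 * m := by simp
  refine ⟨c, hc, N0 + 1 + Nat.ceil (2 * ((4+4*m:ℕ)^2 + (4+4*m:ℕ)*4 : ℝ) / β^5), ?_⟩
  intro V _ G hN gd hgd F hF
  have hn : 0 < Fintype.card V := by omega
  have hbig : (((4+4*m:ℕ):ℝ)^2 + (4+4*m:ℕ)*4 : ℝ) ≤ β^5/2 * Fintype.card V := by
    have h1 : Nat.ceil (2 * (((4+4*m:ℕ):ℝ)^2 + (4+4*m:ℕ)*4 : ℝ) / β^5) ≤ Fintype.card V := by omega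
    have h2 := (Nat.le_ceil _).trans (Nat.cast_le (α := ℝ).mpr h1)
    rw [div_le_iff₀ (by positivity)] at h2
    linarith
  refine h V G (by omega) gd (absRel G m) ?_ (fun q g hq hA => absRel_Tl (hgd q hq).1 hA) F hF
  intro q hq
  obtain ⟨-, hq2⟩ := hgd q hq
  refine good_count (rg q) (fun g => G.K (g (Sum.inl 0)) (g (Sum.inl 1)) (g (Sum.inl 2)) (g (Sum.inl 3)) ∧
    ∀ i, Conn G (fun j => g (Sum.inr (i, j))) (q i) (g (Sum.inl i))) hn ?_ ?_
  · rw [block_sum (fun p c => I (G.K (p 0) (p 1) (p 2) (p 3) ∧ ∀ i, Conn G (c i) (q i) (p i))), hcard]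
    have h1 : ∀ p : Fin 4 → V, β^4 * (Fintype.card V : ℝ)^(4*m) *
        I (G.K (p 0) (p 1) (p 2) (p 3) ∧ ∀ i, Rch G m β (q i) (p i)) ≤
        ∑ c : Fin 4 → Fin m → V, I (G.K (p 0) (p 1) (p 2) (p 3) ∧ ∀ i, Conn G (c i) (q i) (p i)) := by
      intro p
      by_cases hp : G.K (p 0) (p 1) (p 2) (p 3) ∧ ∀ i, Rch G m β (q i) (p i)
      · rw [I_true hp, mul_one]
        refine (conn_prod G hβ.le q p hp.2).trans (Finset.sum_le_sum fun c _ => I_mono fun h => ⟨hp.1, h⟩)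
      · rw [I_false hp, mul_zero]; exact Finset.sum_nonneg fun _ _ => I_nonneg _
    refine le_trans ?_ (Finset.sum_le_sum fun p _ => h1 p)
    rw [← Finset.mul_sum]
    refine le_trans (le_of_eq ?_) (mul_le_mul_of_nonneg_left hq2 (by positivity))
    rw [pow_add]; ring
  · rw [hcard]
    refine le_trans ?_ hbig
    have : ((rg q).card : ℝ) ≤ 4 := by
      have := rg_card_le q
      rw [Fintype.card_fin] at this
      exact_mod_cast this
    have := mul_le_mul_of_nonneg_left this (Nat.cast_nonneg (4+4*m) (α := ℝ))
    linarith

/-- padding -/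
lemma Rch.pad {V : Type} [Fintype V] {G : G3 V} {m : ℕ} {β τ : ℝ} {x y : V} (hn : 0 < Fintype.card V)
    (hβ : 0 ≤ β) (h : Rch G m β x y)
    (hT : τ * (Fintype.card V : ℝ)^4 ≤ ∑ p : Fin 4 → V, I (G.K (p 0) (p 1) (p 2) (p 3)))
    (hb : (((4+m:ℕ):ℝ)^2 + (4+m:ℕ)*2 : ℝ) ≤ τ*β/2 * Fintype.card V) : Rch G (4+m) (τ*β/2) x y := by
  have hcard : Fintype.card (Fin 4 ⊕ Fin m) = 4 + m := by simp
  refine RchT.toFin (ι := Fin 4 ⊕ Fin m) ?_ hcard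
  refine RchT.mk hn (fun g => G.K (g (Sum.inl 0)) (g (Sum.inl 1)) (g (Sum.inl 2)) (g (Sum.inl 3)) ∧
    Conn G (fun i => g (Sum.inr i)) x y) ?_ (by rw [hcard]; exact hb) ?_
  · rw [hcard]
    have e : ∑ g : Fin 4 ⊕ Fin m → V, I (G.K (g (Sum.inl 0)) (g (Sum.inl 1)) (g (Sum.inl 2)) (g (Sum.inl 3)) ∧
        Conn G (fun i => g (Sum.inr i)) x y) = (∑ p : Fin 4 → V, I (G.K (p 0) (p 1) (p 2) (p 3))) *
        ∑ c : Fin m → V, I (Conn G c x y) := by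
      rw [Finset.sum_mul_sum, ← Fintype.sum_prod_type']
      refine Fintype.sum_equiv (Equiv.sumArrowEquivProdArrow _ _ V) _ _ fun g => ?_
      rw [I_and]; rfl
    rw [e]
    unfold Rch RchT at h
    rw [Fintype.card_fin] at h
    refine le_trans (le_of_eq ?_) (mul_le_mul hT h (by positivity) (Finset.sum_nonneg fun _ _ => I_nonneg _))
    rw [pow_add]; ring
  · intro g hg hx hy hp
    obtain ⟨hK, a1, a2, a3, a4, a5⟩ := hp
    set p : Fin 4 → V := fun i => g (Sum.inl i) with hp
    set c : Fin m → V := fun i => g (Sum.inr i) with hc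
    have h2 : Tl G (rg p) := by rw [rg_fin4]; exact Tl.of_K hK
    have erg : rg g = rg p ∪ rg c := by
      ext v
      simp only [mem_rg, mem_union, hp, hc]
      constructor
      · rintro ⟨i | i, rfl⟩
        · exact Or.inl ⟨i, rfl⟩
        · exact Or.inr ⟨i, rfl⟩
      · rintro (⟨i, rfl⟩ | ⟨i, rfl⟩)
        · exact ⟨_, rfl⟩
        · exact ⟨_, rfl⟩
    have hd : Disjoint (rg p) (rg c) := by
      rw [Finset.disjoint_left]; intro v h1 h2
      obtain ⟨i, hi⟩ := mem_rg.mp h1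
      obtain ⟨j, hj⟩ := mem_rg.mp h2
      have := hg (hi.trans hj.symm)
      simp at this
    rw [erg] at hx hy ⊢
    simp only [mem_union, not_or] at hx hy
    have e : ∀ v, insert v (rg p ∪ rg c) = rg p ∪ insert v (rg c) := fun v => by
      ext u; simp only [mem_insert, mem_union]; tauto
    constructor
    · rw [e]; exact h2.union a4 (by rw [Finset.disjoint_insert_right]; exact ⟨hx.1, hd⟩)
    · rw [e]; exact h2.union a5 (by rw [Finset.disjoint_insert_right]; exact ⟨hy.1, hd⟩)

lemma merge_Tl {V : Type} [Fintype V] {G : G3 V} {m : ℕ} (c : Fin 3 → Fin m → V)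
    (hcc : ∀ i k j l, c i k = c j l → i = j)
    (v : V) (s s' : Fin 3 → V) (hK : G.K v (s 0) (s 1) (s 2)) (h1 : Function.Injective s')
    (h2 : ∀ i j k, s' i ≠ c j k) (h2' : ∀ i j k, s i ≠ c j k) (h3 : ∀ i j, s i ≠ s' j)
    (h4 : ∀ i, Tl G (insert (s' i) (rg (c i))))
    (h5 : v ∉ rg s') (h6 : v ∉ (univ.biUnion fun i => rg (c i))) :
    Tl G (insert v (rg s ∪ rg s' ∪ univ.biUnion fun i => rg (c i))) := by
  have e : insert v (rg s ∪ rg s' ∪ univ.biUnion fun i => rg (c i)) =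
      insert v (rg s) ∪ (rg s' ∪ univ.biUnion fun i => rg (c i)) := by
    ext u; simp only [mem_insert, mem_union]; tauto
  rw [e]
  have t1 : Tl G (insert v (rg s)) := by rw [rg_fin3]; exact Tl.of_K hK
  refine t1.union (block_Tl s' c h1 h2 hcc h4) ?_
  rw [Finset.disjoint_insert_left, mem_union, not_or]
  refine ⟨⟨h5, h6⟩, ?_⟩
  rw [Finset.disjoint_left]; intro u hu hu2
  obtain ⟨i, rfl⟩ := mem_rg.mp hu
  rcases mem_union.mp hu2 with h | h
  · obtain ⟨j, hj⟩ := mem_rg.mp h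
    exact h3 i j hj.symm
  · simp only [mem_biUnion, mem_univ, true_and, mem_rg] at h
    obtain ⟨j, k, hk⟩ := h
    exact h2' i j k hk.symm

set_option maxHeartbeats 1000000 in
/-- merging gadget -/
lemma Rch.merge {V : Type} [Fintype V] {G : G3 V} {m : ℕ} {β τ : ℝ} {a b : V} (hn : 0 < Fintype.card V)
    (hβ : 0 ≤ β)
    (hT : τ * (Fintype.card V : ℝ)^6 ≤ ∑ s : Fin 3 → V, ∑ s' : Fin 3 → V,
      I ((G.K a (s 0) (s 1) (s 2) ∧ G.K b (s' 0) (s' 1) (s' 2)) ∧ ∀ i, Rch G m β (s i) (s' i)))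
    (hb : (((6+3*m:ℕ):ℝ)^2 + (6+3*m:ℕ)*2 : ℝ) ≤ τ*β^3/2 * Fintype.card V) :
    Rch G (6+3*m) (τ*β^3/2) a b := by
  have hcard : Fintype.card ((Fin 3 ⊕ Fin 3) ⊕ (Fin 3 × Fin m)) = 6 + 3 * m := by simp
  refine RchT.toFin (ι := (Fin 3 ⊕ Fin 3) ⊕ (Fin 3 × Fin m)) ?_ hcard
  refine RchT.mk hn (fun g => (G.K a (g (Sum.inl (Sum.inl 0))) (g (Sum.inl (Sum.inl 1))) (g (Sum.inl (Sum.inl 2))) ∧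
    G.K b (g (Sum.inl (Sum.inr 0))) (g (Sum.inl (Sum.inr 1))) (g (Sum.inl (Sum.inr 2)))) ∧
    ∀ i, Conn G (fun j => g (Sum.inr (i, j))) (g (Sum.inl (Sum.inl i))) (g (Sum.inl (Sum.inr i)))) ?_
    (by rw [hcard]; exact hb) ?_
  · rw [block_sum (fun p c => I ((G.K a (p (Sum.inl 0)) (p (Sum.inl 1)) (p (Sum.inl 2)) ∧
      G.K b (p (Sum.inr 0)) (p (Sum.inr 1)) (p (Sum.inr 2))) ∧
      ∀ i, Conn G (c i) (p (Sum.inl i)) (p (Sum.inr i)))), hcard]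
    have e : ∑ p : Fin 3 ⊕ Fin 3 → V, ∑ c : Fin 3 → Fin m → V, I ((G.K a (p (Sum.inl 0)) (p (Sum.inl 1)) (p (Sum.inl 2)) ∧
      G.K b (p (Sum.inr 0)) (p (Sum.inr 1)) (p (Sum.inr 2))) ∧
      ∀ i, Conn G (c i) (p (Sum.inl i)) (p (Sum.inr i))) = ∑ s : Fin 3 → V, ∑ s' : Fin 3 → V, ∑ c : Fin 3 → Fin m → V,
      I ((G.K a (s 0) (s 1) (s 2) ∧ G.K b (s' 0) (s' 1) (s' 2)) ∧ ∀ i, Conn G (c i) (s i) (s' i)) := by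
      rw [← Fintype.sum_prod_type' (f := fun (s s' : Fin 3 → V) => ∑ c : Fin 3 → Fin m → V,
        I ((G.K a (s 0) (s 1) (s 2) ∧ G.K b (s' 0) (s' 1) (s' 2)) ∧ ∀ i, Conn G (c i) (s i) (s' i)))]
      exact Fintype.sum_equiv (Equiv.sumArrowEquivProdArrow _ _ V) _ _ fun g => rfl
    rw [e]
    have h1 : ∀ s s' : Fin 3 → V, β^3 * (Fintype.card V : ℝ)^(3*m) *
        I ((G.K a (s 0) (s 1) (s 2) ∧ G.K b (s' 0) (s' 1) (s' 2)) ∧ ∀ i, Rch G m β (s i) (s' i)) ≤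
        ∑ c : Fin 3 → Fin m → V,
        I ((G.K a (s 0) (s 1) (s 2) ∧ G.K b (s' 0) (s' 1) (s' 2)) ∧ ∀ i, Conn G (c i) (s i) (s' i)) := by
      intro s s'
      by_cases hp : (G.K a (s 0) (s 1) (s 2) ∧ G.K b (s' 0) (s' 1) (s' 2)) ∧ ∀ i, Rch G m β (s i) (s' i)
      · rw [I_true hp, mul_one]
        refine (conn_prod G hβ s s' hp.2).trans (Finset.sum_le_sum fun c _ => I_mono fun h => ⟨hp.1, h⟩)
      · rw [I_false hp, mul_zero]; exact Finset.sum_nonneg fun _ _ => I_nonneg _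
    refine le_trans ?_ (Finset.sum_le_sum fun s _ => Finset.sum_le_sum fun s' _ => h1 s s')
    simp only [← Finset.mul_sum]
    refine le_trans (le_of_eq ?_) (mul_le_mul_of_nonneg_left hT (by positivity))
    rw [pow_add]; ring
  · intro g hg hx hy hp
    obtain ⟨⟨hK1, hK2⟩, hC⟩ := hp
    set p : Fin 3 → V := fun i => g (Sum.inl (Sum.inl i)) with hp
    set p' : Fin 3 → V := fun i => g (Sum.inl (Sum.inr i)) with hp'
    set c : Fin 3 → Fin m → V := fun i j => g (Sum.inr (i, j)) with hc
    have hpi : Function.Injective p := fun i j hij => Sum.inl_injective (Sum.inl_injective (hg hij))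
    have hpi' : Function.Injective p' := fun i j hij => Sum.inr_injective (Sum.inl_injective (hg hij))
    have hpc : ∀ i j k, p i ≠ c j k := fun i j k h => by have := hg h; simp at this
    have hpc' : ∀ i j k, p' i ≠ c j k := fun i j k h => by have := hg h; simp at this
    have hpp : ∀ i j, p i ≠ p' j := fun i j h => by have := hg h; simp at this
    have hcc : ∀ i k j l, c i k = c j l → i = j := fun i k j l h => by
      have := hg h; simp at this; exact this.1
    have erg : rg g = rg p ∪ rg p' ∪ univ.biUnion fun i => rg (c i) := by
      ext v
      simp only [mem_rg, mem_union, mem_biUnion, mem_univ, true_and, hp, hc, hp']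
      constructor
      · rintro ⟨(i | i) | ⟨i, j⟩, rfl⟩
        · exact Or.inl (Or.inl ⟨i, rfl⟩)
        · exact Or.inl (Or.inr ⟨i, rfl⟩)
        · exact Or.inr ⟨i, j, rfl⟩
      · rintro ((⟨i, rfl⟩ | ⟨i, rfl⟩) | ⟨i, j, rfl⟩)
        · exact ⟨_, rfl⟩
        · exact ⟨_, rfl⟩
        · exact ⟨_, rfl⟩
    rw [erg] at hx hy
    rw [mem_union, mem_union, not_or, not_or] at hx hy
    constructor
    · rw [erg]
      exact merge_Tl c hcc a p p' hK1 hpi' hpc' hpc hpp (fun i => (hC i).2.2.2.2) hx.1.2 hx.2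
    · rw [erg, Finset.union_comm (rg p) (rg p')]
      exact merge_Tl c hcc b p' p hK2 hpi hpc hpc' (fun i j => (hpp j i).symm) (fun i => (hC i).2.2.2.1) hy.1.1 hy.2

end KF

open Finset

namespace KF
open Classical

noncomputable def G3.w {V : Type} [Fintype V] (G : G3 V) (x y : V) : ℝ :=
  ∑ a, ∑ b, ∑ c, I (G.K x a b c ∧ G.K y a b c)

section
variable {V : Type} [Fintype V] (G : G3 V)

lemma G3.w_nonneg (x y : V) : 0 ≤ G.w x y :=
  Finset.sum_nonneg fun _ _ => Finset.sum_nonneg fun _ _ => Finset.sum_nonneg fun _ _ => I_nonneg _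

lemma G3.w_comm (x y : V) : G.w x y = G.w y x := by
  unfold G3.w
  simp only [and_comm]

lemma sum_le_card {α : Type*} (s : Finset α) (f : α → ℝ) (c : ℝ) (h : ∀ x ∈ s, f x ≤ c) :
    ∑ x ∈ s, f x ≤ s.card * c := by
  have := Finset.sum_le_card_nsmul s f c h
  rwa [nsmul_eq_mul] at this

lemma sum_le_n (f : V → ℝ) (c : ℝ) (h : ∀ x, f x ≤ c) :
    ∑ x, f x ≤ Fintype.card V * c := by
  have := sum_le_card univ f c (fun x _ => h x)
  rwa [Finset.card_univ] at this

lemma G3.w_le (x y : V) : G.w x y ≤ (Fintype.card V : ℝ)^3 := by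
  unfold G3.w
  have h := sum_le_n (V := V) (fun a => ∑ b, ∑ c, I (G.K x a b c ∧ G.K y a b c))
    ((Fintype.card V : ℝ) * (Fintype.card V * 1)) (fun a => sum_le_n _ _ fun b => sum_le_n _ _ fun c => I_le_one _)
  refine h.trans (le_of_eq (by ring))

/-- few vertices have small similarity neighbourhood -/
lemma low_bound {ε κ : ℝ} (hκ : 0 ≤ κ) (hε0 : 0 ≤ ε) (hε : ε ≤ 1/400)
    (hn : (400:ℝ) ≤ Fintype.card V) (hG : G.CD (1/2 - ε)) (A O : Finset V) (hOA : O ⊆ A)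
    (hO : ∀ x ∈ O, ∑ y ∈ A, I (1/162 * (Fintype.card V : ℝ)^3 ≤ G.w x y) ≤ κ * Fintype.card V) :
    (O.card : ℝ) ≤ 162 * κ * Fintype.card V := by
  set n : ℝ := (Fintype.card V : ℝ) with hnn
  have hn0 : 0 < n := by linarith
  set o : ℝ := (O.card : ℝ) with ho
  have ho0 : 0 ≤ o := by positivity
  -- lower bound
  have low : o^2 * n^3 / 81 ≤ ∑ x ∈ O, ∑ y ∈ O, G.w x y := by
    have e : ∑ x ∈ O, ∑ y ∈ O, G.w x y =
        ∑ a, ∑ b, ∑ c, (∑ x ∈ O, I (G.K x a b c)) * (∑ y ∈ O, I (G.K y a b c)) := by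
      simp only [Finset.sum_mul_sum, ← I_and, G3.w]
      have sw : ∀ (f : V → V → ℝ), ∑ y ∈ O, ∑ a, f y a = ∑ a, ∑ y ∈ O, f y a := fun f => Finset.sum_comm
      simp only [sw]
    have h1 : ∀ a b c, 2 * (o/9) * (∑ x ∈ O, I (G.K x a b c)) - (o/9)^2 ≤
        (∑ x ∈ O, I (G.K x a b c)) * (∑ y ∈ O, I (G.K y a b c)) := by
      intro a b c
      nlinarith [sq_nonneg ((∑ x ∈ O, I (G.K x a b c)) - o/9)]
    have h2 : ∑ a, ∑ b, ∑ c, (2 * (o/9) * (∑ x ∈ O, I (G.K x a b c)) - (o/9)^2) ≤ ∑ x ∈ O, ∑ y ∈ O, G.w x y := by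
      rw [e]
      exact Finset.sum_le_sum fun a _ => Finset.sum_le_sum fun b _ => Finset.sum_le_sum fun c _ => h1 a b c
    refine le_trans ?_ h2
    simp only [Finset.sum_sub_distrib, ← Finset.mul_sum, Finset.sum_const, Finset.card_univ, nsmul_eq_mul]
    have h3 : o * (n^3/9) ≤ ∑ a, ∑ b, ∑ c, ∑ x ∈ O, I (G.K x a b c) := by
      have sw : ∀ (f : V → V → ℝ), ∑ a, ∑ y ∈ O, f y a = ∑ y ∈ O, ∑ a, f y a := fun f => Finset.sum_comm
      simp only [sw]
      have := Finset.card_nsmul_le_sum O (fun x => ∑ a, ∑ b, ∑ c, I (G.K x a b c)) (n^3/9)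
        (fun x _ => G.tiles_at hε0 hε hn hG x)
      rwa [nsmul_eq_mul] at this
    rw [← hnn]
    nlinarith [mul_le_mul_of_nonneg_left h3 (by positivity : 0 ≤ 2 * (o/9))]
  have up : ∑ x ∈ O, ∑ y ∈ O, G.w x y ≤ o * (n^3 * (κ * n) + o * (1/162 * n^3)) := by
    refine sum_le_card O _ _ fun x hx => ?_
    have h1 : ∀ y ∈ O, G.w x y ≤ n^3 * I (1/162 * n^3 ≤ G.w x y) + 1/162 * n^3 := by
      intro y _
      by_cases h : 1/162 * n^3 ≤ G.w x y
      · rw [I_true h]; have := G.w_le x y; rw [← hnn] at this; nlinarith [pow_pos hn0 3]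
      · rw [I_false h]; push Not at h; linarith
    refine (Finset.sum_le_sum h1).trans ?_
    rw [Finset.sum_add_distrib, ← Finset.mul_sum, Finset.sum_const, nsmul_eq_mul]
    have h2 : ∑ y ∈ O, I (1/162 * n^3 ≤ G.w x y) ≤ κ * n :=
      (Finset.sum_le_sum_of_subset_of_nonneg hOA fun _ _ _ => I_nonneg _).trans (hO x hx)
    have := mul_le_mul_of_nonneg_left h2 (by positivity : 0 ≤ n^3)
    linarith
  have h3 := low.trans up
  rcases ho0.eq_or_lt with h | h
  · rw [← h]
    positivity
  · have h4 : o * n^3 * (o / 162) ≤ o * n^3 * (κ * n) := by nlinarith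
    have := le_of_mul_le_mul_left h4 (by positivity)
    linarith

lemma cut_expand {ε : ℝ} (hε0 : 0 ≤ ε) (hn : (0:ℝ) < Fintype.card V) (Z Y : Finset V)
    (h : ε * (Fintype.card V : ℝ)^5 ≤ ∑ y ∈ Y, ∑ z ∈ Z, G.w z y) :
    ε / 2 * Fintype.card V ≤ ∑ y ∈ Y, I (ε/4 * (Fintype.card V : ℝ) ≤
      ∑ z ∈ Z, I (ε/4 * (Fintype.card V : ℝ)^3 ≤ G.w z y)) := by
  set n : ℝ := (Fintype.card V : ℝ) with hnn
  have cZ : (Z.card : ℝ) ≤ n := by rw [hnn]; exact_mod_cast Finset.card_le_univ Z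
  have cY : (Y.card : ℝ) ≤ n := by rw [hnn]; exact_mod_cast Finset.card_le_univ Y
  have h1 : ∀ y ∈ Y, ∑ z ∈ Z, G.w z y ≤
      n^4 * I (ε/4 * n ≤ ∑ z ∈ Z, I (ε/4 * n^3 ≤ G.w z y)) + ε/2 * n^4 := by
    intro y _
    have h2 : ∑ z ∈ Z, G.w z y ≤ n^3 * ∑ z ∈ Z, I (ε/4 * n^3 ≤ G.w z y) + n * (ε/4 * n^3) := by
      have h3 : ∀ z ∈ Z, G.w z y ≤ n^3 * I (ε/4 * n^3 ≤ G.w z y) + ε/4 * n^3 := by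
        intro z _
        by_cases h : ε/4 * n^3 ≤ G.w z y
        · rw [I_true h]; have := G.w_le z y; rw [← hnn] at this
          have : 0 ≤ ε/4 * n^3 := by positivity
          linarith
        · rw [I_false h]; push Not at h; linarith
      refine (Finset.sum_le_sum h3).trans ?_
      rw [Finset.sum_add_distrib, ← Finset.mul_sum, Finset.sum_const, nsmul_eq_mul]
      have := mul_le_mul_of_nonneg_right cZ (by positivity : 0 ≤ ε/4 * n^3)
      linarith
    refine h2.trans ?_
    by_cases h : ε/4 * n ≤ ∑ z ∈ Z, I (ε/4 * n^3 ≤ G.w z y)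
    · rw [I_true h]
      have h4 : ∑ z ∈ Z, I (ε/4 * n^3 ≤ G.w z y) ≤ n :=
        (sum_le_card Z _ 1 fun _ _ => I_le_one _).trans (by linarith)
      have := mul_le_mul_of_nonneg_left h4 (by positivity : 0 ≤ n^3)
      have : 0 ≤ ε * n^4 := by positivity
      nlinarith
    · rw [I_false h]; push Not at h
      have := mul_le_mul_of_nonneg_left h.le (by positivity : 0 ≤ n^3)
      nlinarith
  have h5 := h.trans (Finset.sum_le_sum h1)
  rw [Finset.sum_add_distrib, ← Finset.mul_sum, Finset.sum_const, nsmul_eq_mul] at h5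
  have := mul_le_mul_of_nonneg_right cY (by positivity : 0 ≤ ε/2 * n^4)
  have h6 : n^4 * (ε / 2 * n) ≤ n^4 * ∑ y ∈ Y, I (ε/4 * n ≤ ∑ z ∈ Z, I (ε/4 * n^3 ≤ G.w z y)) := by
    nlinarith
  exact le_of_mul_le_mul_left h6 (by positivity)

lemma sum_I_sub (A Z : Finset V) (p : V → Prop) (hZ : Z ⊆ A) (h : ∀ z ∈ Z, p z) :
    ((Z.card : ℕ) : ℝ) ≤ ∑ y ∈ A, I (p y) := by
  rw [sum_I]
  exact_mod_cast Finset.card_le_card fun z hz => Finset.mem_filter.mpr ⟨hZ hz, h z hz⟩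

lemma tiles_total {ε : ℝ} (hε0 : 0 ≤ ε) (hε : ε ≤ 1/400)
    (hn : (400:ℝ) ≤ Fintype.card V) (hG : G.CD (1/2 - ε)) :
    1/9 * (Fintype.card V : ℝ)^4 ≤ ∑ p : Fin 4 → V, I (G.K (p 0) (p 1) (p 2) (p 3)) := by
  rw [sum_fin4]
  have := Finset.card_nsmul_le_sum (univ : Finset V) (fun x => ∑ a, ∑ b, ∑ c, I (G.K x a b c)) ((Fintype.card V : ℝ)^3/9)
        (fun x _ => G.tiles_at hε0 hε hn hG x)
  rw [nsmul_eq_mul, Finset.card_univ] at this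
  refine le_trans (le_of_eq (by ring)) this

/-- no sparse cut inside `A` -/
def NoCut (A : Finset V) (κ ε : ℝ) : Prop :=
  ∀ Z ⊆ A, κ * Fintype.card V ≤ (Z.card : ℝ) → κ * Fintype.card V ≤ ((A \ Z).card : ℝ) →
    ε * (Fintype.card V : ℝ)^5 ≤ ∑ y ∈ A \ Z, ∑ z ∈ Z, G.w z y

noncomputable def bt (ε : ℝ) (t : ℕ) : ℝ := 1/162 * (ε^2/32)^t

lemma grow_step {ε ε0 : ℝ} (hε0 : 0 ≤ ε0) (hε0' : ε0 ≤ 1/400) (hn : (400:ℝ) ≤ Fintype.card V)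
    (hG : G.CD (1/2 - ε0)) (hε : 0 < ε) (hε1 : ε ≤ 1) (A : Finset V) (x : V) (t : ℕ)
    (hb : ((4*t+7:ℕ):ℝ)^2 + ((4*t+7:ℕ):ℝ)*2 ≤ bt ε (t+1) * Fintype.card V) :
    (∀ y, Rch G (4*t+3) (bt ε t) x y → Rch G (4*(t+1)+3) (bt ε (t+1)) x y) ∧
    (∀ y, ε/4 * Fintype.card V ≤ ∑ z, I (Rch G (4*t+3) (bt ε t) x z ∧ ε/4 * (Fintype.card V : ℝ)^3 ≤ G.w z y) →
      Rch G (4*(t+1)+3) (bt ε (t+1)) x y) := by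
  have hc : 0 < Fintype.card V := by
    have : (0:ℝ) < Fintype.card V := by linarith
    exact_mod_cast this
  have hbt : 0 < bt ε t := by unfold bt; positivity
  have hs : bt ε (t+1) = bt ε t * (ε^2/32) := by unfold bt; ring
  constructor
  · intro y h
    have hle : bt ε (t+1) ≤ 1/9 * bt ε t / 2 := by
      have h2 : ε^2 ≤ 1 := by nlinarith
      rw [hs]; nlinarith [mul_le_mul_of_nonneg_left h2 hbt.le]
    have := Rch.pad hc hbt.le h (tiles_total G hε0 hε0' hn hG) (by
      have e : 4 + (4*t+3) = 4*t+7 := by ring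
      rw [e]
      exact hb.trans (mul_le_mul_of_nonneg_right hle (by positivity)))
    have e : 4 + (4*t+3) = 4*(t+1)+3 := by ring
    rw [e] at this
    exact this.mono hle
  · intro y h
    have e1 : ε/4 * bt ε t * (ε/4) / 2 = bt ε (t+1) := by rw [hs]; ring
    have := RchT.comp (ι := Fin (4*t+3)) (κ := Fin 3) (G := G) (x := x) (y := y) (c := ε/4) (β' := ε/4) hc hbt.le
      (by positivity) (h.trans (Finset.sum_le_sum fun z _ => I_mono fun ⟨a, b⟩ => ⟨a, Rch.direct b⟩)) (by
        simp only [Fintype.card_fin]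
        rw [e1]
        exact hb)
    rw [e1] at this
    exact this.toFin (by simp; ring)

lemma grow (κ ε : ℝ) (hκ : 0 < κ) (hε : 0 < ε) (hε1 : ε ≤ 1) : ∃ m : ℕ, ∃ β : ℝ, 0 < β ∧ ∃ N0 : ℕ,
    ∀ (V : Type) [Fintype V] (G : G3 V), N0 ≤ Fintype.card V → G.CD (1/2 - 1/400) →
    ∀ A : Finset V, 3 * κ * Fintype.card V ≤ (A.card : ℝ) → NoCut G A κ ε →
    ∃ O ⊆ A, (O.card : ℝ) ≤ 162 * κ * Fintype.card V ∧ ∀ x ∈ A \ O, ∀ y ∈ A \ O, Rch G (4*m+3) β x y := by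
  obtain ⟨T, hT⟩ := exists_nat_gt (2/ε)
  have hbp : ∀ t, 0 < bt ε t := fun t => by unfold bt; positivity
  have hanti : ∀ t s, t ≤ s → bt ε s ≤ bt ε t := by
    intro t s h
    unfold bt
    have := pow_le_pow_of_le_one (by positivity : 0 ≤ ε^2/32) (by nlinarith) h
    linarith
  set β := κ * bt ε T * bt ε T / 2 with hβ
  have hβ0 : 0 < β := by have := hbp T; positivity
  obtain ⟨N1, hN1⟩ := exists_nat_gt ((((8*T+10:ℕ):ℝ)^2 + ((8*T+10:ℕ):ℝ)*2) / β)
  obtain ⟨N2, hN2⟩ := exists_nat_gt ((((8*T+10:ℕ):ℝ)^2 + ((8*T+10:ℕ):ℝ)*2) / bt ε T)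
  refine ⟨2*T+1, β, hβ0, N1 + N2 + 400, ?_⟩
  intro V _ G hN hG A hA hcut
  have hn400 : (400:ℝ) ≤ Fintype.card V := by
    have : 400 ≤ Fintype.card V := by omega
    exact_mod_cast this
  have hc : 0 < Fintype.card V := by omega
  have hb1 : (((8*T+10:ℕ):ℝ)^2 + ((8*T+10:ℕ):ℝ)*2) ≤ β * Fintype.card V := by
    rw [div_lt_iff₀ hβ0] at hN1
    have : (N1:ℝ) ≤ Fintype.card V := by exact_mod_cast (by omega : N1 ≤ Fintype.card V)
    nlinarith
  have hb2 : (((8*T+10:ℕ):ℝ)^2 + ((8*T+10:ℕ):ℝ)*2) ≤ bt ε T * Fintype.card V := by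
    rw [div_lt_iff₀ (hbp T)] at hN2
    have : (N2:ℝ) ≤ Fintype.card V := by exact_mod_cast (by omega : N2 ≤ Fintype.card V)
    nlinarith [hbp T]
  obtain ⟨n, hnn⟩ : ∃ n : ℝ, n = Fintype.card V := ⟨_, rfl⟩
  refine ⟨A.filter fun x => ∑ y ∈ A, I (1/162 * (Fintype.card V : ℝ)^3 ≤ G.w x y) ≤ κ * Fintype.card V,
    Finset.filter_subset _ _, low_bound G hκ.le (by norm_num) le_rfl hn400 hG A _ (Finset.filter_subset _ _)
      (fun x hx => (Finset.mem_filter.mp hx).2), ?_⟩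
  -- growth
  have key : ∀ x ∈ A, κ * Fintype.card V < ∑ y ∈ A, I (1/162 * (Fintype.card V : ℝ)^3 ≤ G.w x y) →
      ((A \ A.filter fun y => Rch G (4*T+3) (bt ε T) x y).card : ℝ) < κ * Fintype.card V := by
    intro x hxA hx
    have step : ∀ t, t ≤ T →
        ((A \ A.filter fun y => Rch G (4*t+3) (bt ε t) x y).card : ℝ) < κ * Fintype.card V ∨
        κ * Fintype.card V + t * (ε/2 * Fintype.card V) ≤ ((A.filter fun y => Rch G (4*t+3) (bt ε t) x y).card : ℝ) := by
      intro t
      induction t with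
      | zero =>
        intro _
        right
        simp only [Nat.cast_zero, zero_mul, add_zero]
        rw [← sum_I]
        refine hx.le.trans (Finset.sum_le_sum fun y _ => I_mono fun h => ?_)
        have : bt ε 0 = 1/162 := by unfold bt; norm_num
        rw [this]
        exact Rch.direct h
      | succ t ih =>
        intro ht
        have hst := grow_step G (by norm_num) le_rfl hn400 hG hε hε1 A x t (by
          refine le_trans ?_ (hb2.trans (mul_le_mul_of_nonneg_right (hanti (t+1) T ht) (by positivity)))
          have : ((4*t+7:ℕ):ℝ) ≤ ((8*T+10:ℕ):ℝ) := by exact_mod_cast (by omega)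
          gcongr)
        set Z := A.filter fun y => Rch G (4*t+3) (bt ε t) x y with hZ
        set Z' := A.filter fun y => Rch G (4*(t+1)+3) (bt ε (t+1)) x y with hZ'
        have hsub : Z ⊆ Z' := by
          intro y hy
          rw [hZ, Finset.mem_filter] at hy
          rw [hZ', Finset.mem_filter]
          exact ⟨hy.1, hst.1 y hy.2⟩
        rcases ih (by omega) with h | h
        · left
          refine lt_of_le_of_lt ?_ h
          exact_mod_cast Finset.card_le_card (Finset.sdiff_subset_sdiff le_rfl hsub)
        · by_cases hAZ : ((A \ Z).card : ℝ) < κ * Fintype.card V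
          · left
            refine lt_of_le_of_lt ?_ hAZ
            exact_mod_cast Finset.card_le_card (Finset.sdiff_subset_sdiff le_rfl hsub)
          · right
            push Not at hAZ
            have hc1 := cut_expand G hε.le (by linarith) Z (A \ Z) (hcut Z (Finset.filter_subset _ _)
              (le_trans (by have : (0:ℝ) ≤ t * (ε/2 * Fintype.card V) := by positivity
                            linarith) h) hAZ)
            rw [sum_I] at hc1
            set Y := (A \ Z).filter fun y => (ε/4 * (Fintype.card V : ℝ) ≤
              ∑ z ∈ Z, I (ε/4 * (Fintype.card V : ℝ)^3 ≤ G.w z y)) with hY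
            have hYs : Y ⊆ Z' := by
              intro y hy
              rw [hY, Finset.mem_filter, Finset.mem_sdiff] at hy
              rw [hZ', Finset.mem_filter]
              refine ⟨hy.1.1, hst.2 y (hy.2.trans ?_)⟩
              rw [hZ, Finset.sum_filter]
              refine (Finset.sum_le_sum_of_subset_of_nonneg (Finset.subset_univ A) ?_).trans
                (Finset.sum_le_sum fun z _ => ?_)
              · intro z _ _; split_ifs
                · exact I_nonneg _
                · exact le_rfl
              · split_ifs with h1
                · exact I_mono fun h2 => ⟨h1, h2⟩
                · exact I_nonneg _
            have hdis : Disjoint Z Y := by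
              rw [Finset.disjoint_right]; intro y hy
              rw [hY, Finset.mem_filter, Finset.mem_sdiff] at hy
              exact hy.1.2
            have hcard : ((Z.card + Y.card : ℕ):ℝ) ≤ (Z'.card : ℝ) := by
              rw [← Finset.card_union_of_disjoint hdis]
              exact_mod_cast Finset.card_le_card (Finset.union_subset hsub hYs)
            push_cast at hcard ⊢
            linarith
    rcases step T le_rfl with h | h
    · exact h
    · exfalso
      have h1 : ((A.filter fun y => Rch G (4*T+3) (bt ε T) x y).card : ℝ) ≤ Fintype.card V := by
        exact_mod_cast Finset.card_le_univ _
      rw [div_lt_iff₀ hε] at hT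
      have h2 : (0:ℝ) < Fintype.card V := by linarith
      nlinarith [mul_pos hκ h2, mul_pos (by linarith : (0:ℝ) < T * ε - 2) h2]
  intro x hx y hy
  simp only [Finset.mem_sdiff, Finset.mem_filter, not_and, not_le] at hx hy
  have kx := key x hx.1 (hx.2 hx.1)
  have ky := key y hy.1 (hy.2 hy.1)
  have := RchT.comp (ι := Fin (4*T+3)) (κ := Fin (4*T+3)) (G := G) (x := x) (y := y) (c := κ) hc (hbp T).le
      (hbp T).le (by
        set Zx := A.filter fun y => Rch G (4*T+3) (bt ε T) x y with hZx
        set Zy := A.filter fun z => Rch G (4*T+3) (bt ε T) y z with hZy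
        have h1 : A ⊆ (A \ Zx) ∪ ((A \ Zy) ∪ univ.filter fun z => Rch G (4*T+3) (bt ε T) x z ∧ Rch G (4*T+3) (bt ε T) z y) := by
          intro z hz
          by_cases c1 : Rch G (4*T+3) (bt ε T) x z <;> by_cases c2 : Rch G (4*T+3) (bt ε T) y z
          · have c3 := c2.symm
            simp [hZx, hZy, hz, c1, c2, c3]
          all_goals simp [hZx, hZy, hz, c1, c2]
        have h2 : (A.card : ℝ) ≤ (A \ Zx).card + ((A \ Zy).card + (univ.filter fun z => Rch G (4*T+3) (bt ε T) x z ∧ Rch G (4*T+3) (bt ε T) z y).card : ℝ) := by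
          exact_mod_cast (Finset.card_le_card h1).trans ((Finset.card_union_le _ _).trans
            (Nat.add_le_add_left (Finset.card_union_le _ _) _))
        have h3 := sum_I_sub univ (univ.filter fun z => Rch G (4*T+3) (bt ε T) x z ∧ Rch G (4*T+3) (bt ε T) z y)
          (fun z => Rch G (4*T+3) (bt ε T) x z ∧ Rch G (4*T+3) (bt ε T) z y) (Finset.subset_univ _)
          (fun z hz => (Finset.mem_filter.mp hz).2)
        linarith) (by
        simp only [Fintype.card_fin]
        rw [← hβ]
        refine le_trans ?_ hb1
        have : ((4*T+3+(4*T+3)+1:ℕ):ℝ) ≤ ((8*T+10:ℕ):ℝ) := by exact_mod_cast (by omega)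
        gcongr)
  exact this.toFin (by simp; ring)

end

end KF

open Finset

namespace KF
open Classical

section
variable {V : Type} [Fintype V] (G : G3 V)

/-- extension count into a predicate -/
noncomputable def G3.kc (P : V → Prop) (x y z : V) : ℝ := ∑ t, I (G.K x y z t ∧ P t)

lemma G3.kc_nonneg (P : V → Prop) (x y z : V) : 0 ≤ G.kc P x y z :=
  Finset.sum_nonneg fun _ _ => I_nonneg _

lemma sum_split (P : V → Prop) (q : V → Prop) :
    ∑ t, I (q t) = ∑ t, I (q t ∧ P t) + ∑ t, I (q t ∧ ¬ P t) := by
  rw [← Finset.sum_add_distrib]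
  refine Finset.sum_congr rfl fun t _ => ?_
  by_cases h : P t <;> simp [I, h]

lemma d_split (P : V → Prop) (x y : V) :
    ∑ t, I (G.E x y t) = G.d P x y + G.d (fun t => ¬ P t) x y := sum_split P _

lemma card_split (P : V → Prop) :
    (Fintype.card V : ℝ) = ∑ t, I (P t) + ∑ t, I (¬ P t) := by
  rw [← sum_one_card, ← Finset.sum_add_distrib]
  refine Finset.sum_congr rfl fun t _ => ?_
  by_cases h : P t <;> simp [I, h]

lemma kc_prod (A : V → Prop) :
    ∑ x, ∑ y, ∑ z, G.kc A x y z * G.kc (fun t => ¬ A t) x y z = ∑ a, ∑ b, I (A a ∧ ¬ A b) * G.w a b := by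
  have h1 : ∀ x y z, G.kc A x y z * G.kc (fun t => ¬ A t) x y z =
      ∑ a, ∑ b, I (A a ∧ ¬ A b) * I (G.K a x y z ∧ G.K b x y z) := by
    intro x y z
    unfold G3.kc
    rw [Finset.sum_mul_sum]
    refine Finset.sum_congr rfl fun a _ => Finset.sum_congr rfl fun b _ => ?_
    rw [← I_and, ← I_and, G.Krot' x y z a, G.Krot' x y z b]
    exact I_congr (by tauto)
  simp only [h1]
  have h2 : ∀ f : V → V → V → V → V → ℝ, ∑ x, ∑ y, ∑ z, ∑ a, ∑ b, f a b x y z = ∑ a, ∑ b, ∑ x, ∑ y, ∑ z, f a b x y z := by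
    intro f
    have sw : ∀ (g : V → V → V → ℝ), ∑ z, ∑ a, ∑ b, g a b z = ∑ a, ∑ b, ∑ z, g a b z := by
      intro g
      rw [Finset.sum_comm]
      exact Finset.sum_congr rfl fun a _ => Finset.sum_comm
    calc _ = ∑ x, ∑ y, ∑ a, ∑ b, ∑ z, f a b x y z :=
          Finset.sum_congr rfl fun x _ => Finset.sum_congr rfl fun y _ => sw _
      _ = ∑ x, ∑ a, ∑ b, ∑ y, ∑ z, f a b x y z :=
          Finset.sum_congr rfl fun x _ => sw fun a b y => ∑ z, f a b x y z
      _ = _ := sw fun a b x => ∑ y, ∑ z, f a b x y z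
  rw [h2]
  simp only [← Finset.mul_sum]
  rfl

/-- an inconsistent tile position -/
def Bd (A : V → Prop) (τ : ℝ) (x y z t : V) : Prop :=
  (G.K x y z t ∧ A t) ∧ τ < G.kc (fun t => ¬ A t) x y z ∨ (G.K x y z t ∧ ¬ A t) ∧ τ < G.kc A x y z

def Bd4 (A : V → Prop) (τ : ℝ) (x y z t : V) : Prop :=
  Bd G A τ x y z t ∨ Bd G A τ y z t x ∨ Bd G A τ z t x y ∨ Bd G A τ t x y z

lemma sum4_rot (f : V → V → V → V → ℝ) :
    ∑ x, ∑ y, ∑ z, ∑ t, f y z t x = ∑ x, ∑ y, ∑ z, ∑ t, f x y z t := by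
  rw [Finset.sum_comm]
  refine Finset.sum_congr rfl fun a _ => ?_
  rw [Finset.sum_comm]
  refine Finset.sum_congr rfl fun b _ => ?_
  rw [Finset.sum_comm]

lemma Bd4_count (A : V → Prop) {τ : ℝ} (hτ : 0 < τ) :
    ∑ x, ∑ y, ∑ z, ∑ t, I (Bd4 G A τ x y z t) ≤ 8 / τ * ∑ a, ∑ b, I (A a ∧ ¬ A b) * G.w a b := by
  have h1 : ∑ x, ∑ y, ∑ z, ∑ t, I (Bd G A τ x y z t) ≤ 2 / τ * ∑ a, ∑ b, I (A a ∧ ¬ A b) * G.w a b := by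
    rw [← kc_prod]
    simp only [Finset.mul_sum]
    refine Finset.sum_le_sum fun x _ => Finset.sum_le_sum fun y _ => Finset.sum_le_sum fun z _ => ?_
    have hA := G.kc_nonneg A x y z
    have hB := G.kc_nonneg (fun t => ¬ A t) x y z
    have h2 : ∑ t, I (Bd G A τ x y z t) ≤ G.kc A x y z * I (τ < G.kc (fun t => ¬ A t) x y z) +
        G.kc (fun t => ¬ A t) x y z * I (τ < G.kc A x y z) := by
      conv_rhs => unfold G3.kc
      rw [Finset.sum_mul, Finset.sum_mul, ← Finset.sum_add_distrib]
      refine Finset.sum_le_sum fun t _ => (I_or_le _ _).trans (le_of_eq ?_)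
      rw [I_and, I_and (G.K x y z t ∧ ¬ A t)]
      rfl
    refine h2.trans ?_
    have h3 : ∀ a b : ℝ, 0 ≤ a → 0 ≤ b → a * I (τ < b) ≤ 1 / τ * (a * b) := by
      intro a b ha hb
      by_cases h : τ < b
      · rw [I_true h, mul_one]
        rw [one_div, ← div_eq_inv_mul, le_div_iff₀ hτ]
        exact mul_le_mul_of_nonneg_left h.le ha
      · rw [I_false h]; simp; positivity
    have := h3 _ _ hA hB
    have := h3 _ _ hB hA
    refine (add_le_add (h3 _ _ hA hB) (h3 _ _ hB hA)).trans (le_of_eq (by ring))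
  have h2 : ∀ x y z t, I (Bd4 G A τ x y z t) ≤ I (Bd G A τ x y z t) + (I (Bd G A τ y z t x) +
      (I (Bd G A τ z t x y) + I (Bd G A τ t x y z))) := by
    intro x y z t
    refine (I_or_le _ _).trans (add_le_add le_rfl ((I_or_le _ _).trans (add_le_add le_rfl (I_or_le _ _))))
  refine (Finset.sum_le_sum fun x _ => Finset.sum_le_sum fun y _ => Finset.sum_le_sum fun z _ =>
    Finset.sum_le_sum fun t _ => h2 x y z t).trans ?_
  simp only [Finset.sum_add_distrib]
  have r1 := sum4_rot (fun x y z t => I (Bd G A τ x y z t))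
  have r2 := sum4_rot (fun x y z t => I (Bd G A τ y z t x))
  have r3 := sum4_rot (fun x y z t => I (Bd G A τ z t x y))
  rw [r3, r2, r1]
  refine le_trans (le_of_eq ?_) ((mul_le_mul_of_nonneg_left h1 (by norm_num : (0:ℝ) ≤ 4)).trans (le_of_eq ?_))
  · ring
  · ring

lemma Bd_tile {A : V → Prop} {τ : ℝ} {x y z t : V} (hK : G.K x y z t) (hb : ¬ Bd4 G A τ x y z t) :
    (A t → G.kc (fun t => ¬ A t) x y z ≤ τ) ∧ (¬ A t → G.kc A x y z ≤ τ) ∧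
    (A x → G.kc (fun t => ¬ A t) y z t ≤ τ) ∧ (¬ A x → G.kc A y z t ≤ τ) ∧
    (A y → G.kc (fun t => ¬ A t) z t x ≤ τ) ∧ (¬ A y → G.kc A z t x ≤ τ) ∧
    (A z → G.kc (fun t => ¬ A t) t x y ≤ τ) ∧ (¬ A z → G.kc A t x y ≤ τ) := by
  have k1 := (G.Krot _ _ _ _).mp hK
  have k2 := (G.Krot _ _ _ _).mp k1
  have k3 := (G.Krot _ _ _ _).mp k2
  unfold Bd4 Bd at hb
  simp only [not_or, not_and, not_lt] at hb
  obtain ⟨⟨a1, a2⟩, ⟨b1, b2⟩, ⟨c1, c2⟩, d1, d2⟩ := hb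
  exact ⟨fun h => a1 ⟨hK, h⟩, fun h => a2 ⟨hK, h⟩, fun h => b1 ⟨k1, h⟩, fun h => b2 ⟨k1, h⟩,
    fun h => c1 ⟨k2, h⟩, fun h => c2 ⟨k2, h⟩, fun h => d1 ⟨k3, h⟩, fun h => d2 ⟨k3, h⟩⟩

lemma kc_perm1 (P : V → Prop) (x y z : V) : G.kc P x y z = G.kc P y x z := by
  unfold G3.kc; simp only [G.K12 x y]
lemma kc_perm2 (P : V → Prop) (x y z : V) : G.kc P x y z = G.kc P x z y := by
  unfold G3.kc; simp only [G.K23 x y]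

/-- an edge with few extensions in `A` has large degrees into the complement -/
lemma LB_deg (hG : G.CD (1/2 - 1/400)) {A : V → Prop} {τ : ℝ} {x y z : V} (h : G.E x y z)
    (hk : G.kc A x y z ≤ τ) :
    (1/2 - 3/400) * Fintype.card V + ∑ t, I (¬ A t) - 2 * τ ≤
      G.d (fun t => ¬ A t) x y + G.d (fun t => ¬ A t) x z + G.d (fun t => ¬ A t) y z := by
  have h0 := G.ext_count h A
  have h1 := hG x y (G.ne h)
  have h2 := hG x z (G.ne13 h)
  have h3 := hG y z (G.ne23 h)
  rw [d_split G A] at h1 h2 h3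
  have h4 := card_split A
  unfold G3.kc at hk
  linarith

lemma LA_deg {A : V → Prop} {τ : ℝ} {x y z : V} (h : G.E x y z)
    (hk : G.kc (fun t => ¬ A t) x y z ≤ τ) :
    G.d (fun t => ¬ A t) x y + G.d (fun t => ¬ A t) x z + G.d (fun t => ¬ A t) y z ≤
      ∑ t, I (¬ A t) + 2 * τ := by
  have h0 := G.ext_count h (fun t => ¬ A t)
  unfold G3.kc at hk
  linarith

lemma d_le (P : V → Prop) (x y : V) : G.d P x y ≤ ∑ t, I (P t) :=
  Finset.sum_le_sum fun _ _ => I_mono fun h => h.2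

end

end KF

open Finset

namespace KF
open Classical

section
variable {V : Type} [Fintype V] (G : G3 V)

/-- no consistent full K4 with both classes, if B is small -/
lemma J_end (hG : G.CD (1/2 - 1/400)) (hn : (400:ℝ) ≤ Fintype.card V) {A : V → Prop}
    (hB : ∑ t, I (¬ A t) < 0.34 * Fintype.card V) {b w t s : V}
    (hbB : ¬ A b) (hwA : A w) (hsB : ¬ A s) (e1 : G.E b w t) (e2 : G.E b w s) (e3 : G.E b t s) (e4 : G.E w t s)
    (hb : ¬ Bd4 G A ((Fintype.card V : ℝ)/200) b w t s) : False := by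
  have hK : G.K b w t s := Or.inl ⟨e1, e2, e3⟩
  obtain ⟨-, f1, -, f2, f3, -, f4, f5⟩ := Bd_tile G hK hb
  have g1 := LB_deg G hG e1 (f1 hsB)
  have g2 := LB_deg G hG e4 (f2 hbB)
  have g3 := LA_deg G ((G.rot _ _ _).mp e3) (f3 hwA)
  rw [G.d_comm _ t b, G.d_comm _ s b] at g3
  have h1 := d_le G (fun t => ¬ A t) w t
  have h2 := d_le G (fun t => ¬ A t) b w
  have h3 := d_le G (fun t => ¬ A t) w s
  have h4 := G.d_nonneg (fun t => ¬ A t) b s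
  have e5 : G.E s b w := G.s1 (G.s2 e2)
  by_cases ht : A t
  · have g4 := LA_deg G e5 (f4 ht)
    rw [G.d_comm _ s b, G.d_comm _ s w] at g4
    linarith
  · have g4 := LB_deg G hG e5 (f5 ht)
    rw [G.d_comm _ s b, G.d_comm _ s w] at g4
    linarith

/-- edges leaving `B` labelled `B` -/
def LL (A : V → Prop) (τ : ℝ) (b w t : V) : Prop := (G.E b w t ∧ G.kc A b w t ≤ τ) ∧ ¬ A b ∧ A w

lemma J_full (hG : G.CD (1/2 - 1/400)) (hn : (400:ℝ) ≤ Fintype.card V) {A : V → Prop}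
    (hB : ∑ t, I (¬ A t) < 0.34 * Fintype.card V) {b w t : V}
    (h : LL G A ((Fintype.card V : ℝ)/200) b w t) :
    0.14 * Fintype.card V ≤ ∑ s, I ((G.E b w s ∧ G.E b t s ∧ G.E w t s) ∧ ¬ A s) := by
  have g1 := LB_deg G hG h.1.1 h.1.2
  have g2 := G.ext_count3 (x := b) (y := w) (z := t) (fun t => ¬ A t)
  linarith

lemma J_pt (hG : G.CD (1/2 - 1/400)) (hn : (400:ℝ) ≤ Fintype.card V) {A : V → Prop} {τ : ℝ}
    (hτ : τ = (Fintype.card V : ℝ)/200) (b b' w : V) :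
    I ((¬ A b ∧ ¬ A b') ∧ G.E b b' w ∧ A w) ≤ I (LL G A τ b w b') +
      1/τ^2 * (G.kc A b b' w * G.kc (fun t => ¬ A t) b b' w) +
      1/(0.24 * Fintype.card V) * ∑ t, (I (LL G A τ b w t) + I (LL G A τ b' w t) + I (Bd4 G A τ b b' w t)) := by
  set n : ℝ := (Fintype.card V : ℝ) with hnn
  have hn0 : 0 < n := by linarith
  have hτ0 : 0 < τ := by rw [hτ]; positivity
  have kA := G.kc_nonneg A b b' w
  have kB := G.kc_nonneg (fun t => ¬ A t) b b' w
  have t1 := I_nonneg (LL G A τ b w b')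
  have t2 : 0 ≤ 1/τ^2 * (G.kc A b b' w * G.kc (fun t => ¬ A t) b b' w) := by positivity
  have t3 : 0 ≤ ∑ t, (I (LL G A τ b w t) + I (LL G A τ b' w t) + I (Bd4 G A τ b b' w t)) :=
    Finset.sum_nonneg fun t _ => by
      have := I_nonneg (LL G A τ b w t); have := I_nonneg (LL G A τ b' w t)
      have := I_nonneg (Bd4 G A τ b b' w t); linarith
  have t3' : 0 ≤ 1/(0.24 * n) * ∑ t, (I (LL G A τ b w t) + I (LL G A τ b' w t) + I (Bd4 G A τ b b' w t)) :=
    mul_nonneg (by positivity) t3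
  by_cases hp : (¬ A b ∧ ¬ A b') ∧ G.E b b' w ∧ A w
  swap
  · rw [I_false hp]; linarith
  rw [I_true hp]
  obtain ⟨⟨hb, hb'⟩, he, hw⟩ := hp
  by_cases c1 : G.kc A b b' w ≤ τ
  · have : LL G A τ b w b' := ⟨⟨G.s2 he, by rw [kc_perm2]; exact c1⟩, hb, hw⟩
    rw [I_true this]; linarith
  push Not at c1
  by_cases c2 : G.kc (fun t => ¬ A t) b b' w ≤ τ
  · have q := G.ext_quarter hG he
    rw [sum_split A] at q
    have q1 : 0.24 * n ≤ G.kc A b b' w := by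
      unfold G3.kc at c2 ⊢
      rw [← hnn] at q
      rw [hτ] at c2
      linarith
    have q2 : G.kc A b b' w ≤ ∑ t, (I (LL G A τ b w t) + I (LL G A τ b' w t) + I (Bd4 G A τ b b' w t)) := by
      unfold G3.kc
      refine Finset.sum_le_sum fun t _ => ?_
      have u1 := I_nonneg (LL G A τ b w t); have u2 := I_nonneg (LL G A τ b' w t)
      have u3 := I_nonneg (Bd4 G A τ b b' w t)
      by_cases hk : G.K b b' w t ∧ A t
      swap
      · rw [I_false hk]; linarith
      rw [I_true hk]
      by_cases hbd : Bd4 G A τ b b' w t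
      · rw [I_true hbd]; linarith
      obtain ⟨-, -, -, f1, -, f2, -, -⟩ := Bd_tile G hk.1 hbd
      have f1 := f1 hb
      have f2 := f2 hb'
      by_cases hE : G.E b w t
      · have : LL G A τ b w t := ⟨⟨hE, by rw [kc_perm1, kc_perm2]; exact f2⟩, hb, hw⟩
        rw [I_true this]; linarith
      · have hE' : G.E b' w t := by
          rcases hk.1 with h | h | h | h
          · exact absurd h.2.2 hE
          · exact h.2.2
          · exact h.2.2
          · exact h.2.2
        have : LL G A τ b' w t := ⟨⟨hE', f1⟩, hb', hw⟩
        rw [I_true this]; linarith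
    have q3 := q1.trans q2
    have : 1 ≤ 1/(0.24 * n) * ∑ t, (I (LL G A τ b w t) + I (LL G A τ b' w t) + I (Bd4 G A τ b b' w t)) := by
      rw [one_div, ← div_eq_inv_mul, le_div_iff₀ (by positivity)]
      linarith
    linarith
  · push Not at c2
    have : 1 ≤ 1/τ^2 * (G.kc A b b' w * G.kc (fun t => ¬ A t) b b' w) := by
      rw [one_div, ← div_eq_inv_mul, le_div_iff₀ (by positivity)]
      nlinarith
    linarith

lemma I_ne_sum (P : V → Prop) (b : V) : ∑ t, I (P t) - 1 ≤ ∑ t, I (P t ∧ b ≠ t) := by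
  have : ∀ t, I (P t) ≤ I (P t ∧ b ≠ t) + I (b = t) := by
    intro t
    by_cases h : b = t <;> by_cases h' : P t <;> simp [I, h, h']
  have h2 := Finset.sum_le_sum fun t (_ : t ∈ univ) => this t
  rw [Finset.sum_add_distrib] at h2
  have : ∑ t, I (b = t) = 1 := by simp [I]
  linarith

lemma J_count (hG : G.CD (1/2 - 1/400)) (hn : (400:ℝ) ≤ Fintype.card V) {A : V → Prop} {κ : ℝ}
    (hκ : 0 < κ) (hκn : 2 ≤ κ * Fintype.card V)
    (hB : ∑ t, I (¬ A t) < 0.34 * Fintype.card V) (hB' : κ * Fintype.card V ≤ ∑ t, I (¬ A t)) :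
    0.07 * κ^2 * (Fintype.card V : ℝ)^3 ≤ ∑ b, ∑ b', ∑ w, I ((¬ A b ∧ ¬ A b') ∧ G.E b b' w ∧ A w) := by
  set n : ℝ := (Fintype.card V : ℝ) with hnn
  have hn0 : 0 < n := by linarith
  set β := ∑ t, I (¬ A t) with hβ
  have h1 : ∀ b b', 0.15 * n * I (¬ A b ∧ ¬ A b' ∧ b ≠ b') ≤ ∑ w, I ((¬ A b ∧ ¬ A b') ∧ G.E b b' w ∧ A w) := by
    intro b b'
    by_cases h : ¬ A b ∧ ¬ A b' ∧ b ≠ b'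
    · rw [I_true h]
      have q1 := hG b b' h.2.2
      rw [d_split G A] at q1
      have q2 := d_le G (fun t => ¬ A t) b b'
      have q3 : G.d A b b' ≤ ∑ w, I ((¬ A b ∧ ¬ A b') ∧ G.E b b' w ∧ A w) :=
        Finset.sum_le_sum fun w _ => I_mono fun h' => ⟨⟨h.1, h.2.1⟩, h'⟩
      linarith
    · rw [I_false h, mul_zero]; exact Finset.sum_nonneg fun _ _ => I_nonneg _
  refine le_trans ?_ (Finset.sum_le_sum fun b _ => Finset.sum_le_sum fun b' _ => h1 b b')
  simp only [← Finset.mul_sum]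
  have h2 : (β - 1) * β ≤ ∑ b, ∑ b', I (¬ A b ∧ ¬ A b' ∧ b ≠ b') := by
    rw [hβ, Finset.mul_sum]
    refine Finset.sum_le_sum fun b _ => ?_
    have := I_ne_sum (fun t => ¬ A t) b
    refine (mul_le_mul_of_nonneg_right this (I_nonneg (¬ A b))).trans (le_of_eq ?_)
    rw [mul_comm, Finset.mul_sum]
    refine Finset.sum_congr rfl fun b' _ => ?_
    rw [← I_and]
  have h3 : κ * n * (κ * n) / 2 ≤ (β - 1) * β := by nlinarith
  have := mul_le_mul_of_nonneg_left (h3.trans h2) (by positivity : 0 ≤ 0.15 * n)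
  nlinarith [pow_pos hn0 3, pow_pos hκ 2, mul_pos (pow_pos hn0 3) (pow_pos hκ 2)]

lemma J_L (hG : G.CD (1/2 - 1/400)) (hn : (400:ℝ) ≤ Fintype.card V) {A : V → Prop} {κ : ℝ}
    (hκ : 0 < κ) (hκn : 2 ≤ κ * Fintype.card V)
    (hB : ∑ t, I (¬ A t) < 0.34 * Fintype.card V) (hB' : κ * Fintype.card V ≤ ∑ t, I (¬ A t))
    (hcut : ∑ a, ∑ b, I (A a ∧ ¬ A b) * G.w a b ≤ κ^2/10^7 * (Fintype.card V : ℝ)^5) :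
    0.0035 * κ^2 * (Fintype.card V : ℝ)^3 ≤ ∑ b, ∑ w, ∑ t, I (LL G A ((Fintype.card V : ℝ)/200) b w t) := by
  set n : ℝ := (Fintype.card V : ℝ) with hnn
  have hn0 : 0 < n := by linarith
  obtain ⟨τ, hτ⟩ : ∃ τ : ℝ, τ = n/200 := ⟨_, rfl⟩
  have hτ0 : 0 < τ := by rw [hτ]; positivity
  rw [← hτ]
  have c1 := J_count G hG hn hκ hκn hB hB'
  have c2 := c1.trans (Finset.sum_le_sum fun b _ => Finset.sum_le_sum fun b' _ => Finset.sum_le_sum fun w _ =>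
    J_pt G hG hn hτ b b' w)
  have c3 := Bd4_count G A hτ0
  simp only [Finset.sum_add_distrib, ← Finset.mul_sum] at c2
  rw [kc_prod G A, ← hnn] at c2
  set S := ∑ b, ∑ w, ∑ t, I (LL G A τ b w t) with hS
  set D := ∑ a, ∑ b, I (A a ∧ ¬ A b) * G.w a b with hD
  have e1 : ∑ x, ∑ y, ∑ z, I (LL G A τ x z y) = S := Finset.sum_congr rfl fun x _ => Finset.sum_comm
  have e2 : ∑ x : V, ∑ y : V, ∑ z, ∑ t, I (LL G A τ x z t) = n * S := by
    simp only [Finset.sum_const, Finset.card_univ, nsmul_eq_mul, ← Finset.mul_sum]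
    rw [← hnn]
  have e3 : ∑ x : V, ∑ y : V, ∑ z, ∑ t, I (LL G A τ y z t) = n * S := by
    rw [Finset.sum_const, Finset.card_univ, nsmul_eq_mul]
  rw [e1, e2, e3] at c2
  have c4 : 8/τ * D ≤ 8/τ * (κ^2/10^7 * n^5) := mul_le_mul_of_nonneg_left hcut (by positivity)
  have c5 : 1/τ^2 * D ≤ 1/τ^2 * (κ^2/10^7 * n^5) := mul_le_mul_of_nonneg_left hcut (by positivity)
  have c6 : 8/τ * (κ^2/10^7 * n^5) = 1600/10^7 * κ^2 * n^4 := by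
    rw [hτ]; field_simp; norm_num
  have c7 : 1/τ^2 * (κ^2/10^7 * n^5) = 40000/10^7 * κ^2 * n^3 := by
    rw [hτ]; field_simp; norm_num
  have c8 : 1/(0.24*n) * (n * S + n * S + ∑ x, ∑ y, ∑ z, ∑ t, I (Bd4 G A τ x y z t)) ≤
      1/(0.24*n) * (n * S + n * S + 1600/10^7 * κ^2 * n^4) :=
    mul_le_mul_of_nonneg_left (by linarith) (by positivity)
  have c9 : 1/(0.24*n) * (n * S + n * S + 1600/10^7 * κ^2 * n^4) = 
      2/0.24 * S + 1600/10^7/0.24 * (κ^2 * n^3) := by field_simp; ring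
  have S0 : 0 ≤ S := Finset.sum_nonneg fun _ _ => Finset.sum_nonneg fun _ _ => Finset.sum_nonneg fun _ _ => I_nonneg _
  have c10 : 0 < κ^2 * n^3 := by positivity
  rw [c9] at c8
  have c12 := c2.trans (add_le_add (add_le_add le_rfl (c5.trans c7.le)) c8)
  norm_num at c12 ⊢
  nlinarith

/-- sparse cuts are balanced -/
lemma lemJ (hG : G.CD (1/2 - 1/400)) (hn : (400:ℝ) ≤ Fintype.card V) {A : V → Prop} {κ : ℝ}
    (hκ : 0 < κ) (hκn : 2 ≤ κ * Fintype.card V) (hB' : κ * Fintype.card V ≤ ∑ t, I (¬ A t))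
    (hcut : ∑ a, ∑ b, I (A a ∧ ¬ A b) * G.w a b ≤ κ^2/10^7 * (Fintype.card V : ℝ)^5) :
    0.34 * Fintype.card V ≤ ∑ t, I (¬ A t) := by
  by_contra hB
  push Not at hB
  have c1 := J_L G hG hn hκ hκn hB hB' hcut
  set n : ℝ := (Fintype.card V : ℝ) with hnn
  have hn0 : 0 < n := by linarith
  have c3 := Bd4_count G A (by positivity : 0 < n/200)
  have c2 : ∀ b w t, 0.14 * n * I (LL G A (n/200) b w t) ≤ ∑ s, I (Bd4 G A (n/200) b w t s) := by
    intro b w t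
    by_cases h : LL G A (n/200) b w t
    · rw [I_true h, mul_one]
      refine (J_full G hG hn hB h).trans (Finset.sum_le_sum fun s _ => I_mono fun hs => ?_)
      by_contra hbd
      exact J_end G hG hn hB h.2.1 h.2.2 hs.2 h.1.1 hs.1.1 hs.1.2.1 hs.1.2.2 hbd
    · rw [I_false h, mul_zero]; exact Finset.sum_nonneg fun _ _ => I_nonneg _
  have c4 := (Finset.sum_le_sum fun b (_ : b ∈ univ) => Finset.sum_le_sum fun w (_ : w ∈ univ) =>
    Finset.sum_le_sum fun t (_ : t ∈ univ) => c2 b w t).trans c3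
  simp only [← Finset.mul_sum] at c4
  have c5 := mul_le_mul_of_nonneg_left hcut (by positivity : 0 ≤ 8/(n/200))
  have c6 : 8/(n/200) * (κ^2/10^7 * n^5) = 1600/10^7 * κ^2 * n^4 := by
    field_simp; norm_num
  have c7 := mul_le_mul_of_nonneg_left c1 (by positivity : 0 ≤ 0.14 * n)
  have c10 : 0 < κ^2 * n^4 := by positivity
  have c11 := c7.trans (c4.trans (c5.trans (le_of_eq c6)))
  norm_num at c11
  nlinarith

end

end KF

open Finset

namespace KF
open Classical

section
variable {V : Type} [Fintype V] (G : G3 V)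

noncomputable def G3.ws (X Y : Finset V) : ℝ := ∑ y ∈ Y, ∑ x ∈ X, G.w x y

lemma ws_nonneg (X Y : Finset V) : 0 ≤ G.ws X Y :=
  Finset.sum_nonneg fun _ _ => Finset.sum_nonneg fun _ _ => G.w_nonneg _ _

lemma ws_comm (X Y : Finset V) : G.ws X Y = G.ws Y X := by
  unfold G3.ws
  rw [Finset.sum_comm]
  exact Finset.sum_congr rfl fun x _ => Finset.sum_congr rfl fun y _ => G.w_comm _ _

lemma ws_union (X Y Z : Finset V) (h : Disjoint Y Z) : G.ws X (Y ∪ Z) = G.ws X Y + G.ws X Z := by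
  unfold G3.ws
  rw [Finset.sum_union h]

lemma ws_mono (X X' Y : Finset V) (h : X ⊆ X') : G.ws X Y ≤ G.ws X' Y :=
  Finset.sum_le_sum fun _ _ => Finset.sum_le_sum_of_subset_of_nonneg h fun _ _ _ => G.w_nonneg _ _

lemma sum_I_mem (X : Finset V) : ∑ t, I (t ∈ X) = (X.card : ℝ) := by
  rw [sum_I]; congr 1; simp

lemma J_fin (hG : G.CD (1/2 - 1/400)) (hn : (400:ℝ) ≤ Fintype.card V) {κ : ℝ}
    (hκ : 0 < κ) (hκn : 2 ≤ κ * Fintype.card V) (B : Finset V) (hB : κ * Fintype.card V ≤ (B.card : ℝ))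
    (hcut : G.ws B Bᶜ ≤ κ^2/10^7 * (Fintype.card V : ℝ)^5) :
    0.34 * Fintype.card V ≤ (B.card : ℝ) := by
  have e : ∑ t, I (¬ t ∈ Bᶜ) = (B.card : ℝ) := by
    rw [← sum_I_mem]; exact Finset.sum_congr rfl fun t _ => I_congr (by simp)
  have := lemJ G hG hn (A := fun t => t ∈ Bᶜ) hκ hκn (by rw [e]; exact hB) (by
    refine le_trans (le_of_eq ?_) hcut
    unfold G3.ws
    rw [← Finset.sum_filter_add_sum_filter_not univ (fun a => a ∈ Bᶜ)]
    have h2 : ∑ x ∈ univ.filter (fun a => ¬ a ∈ Bᶜ), ∑ b, I (x ∈ Bᶜ ∧ ¬ b ∈ Bᶜ) * G.w x b = 0 := by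
      refine Finset.sum_eq_zero fun x hx => Finset.sum_eq_zero fun b _ => ?_
      rw [I_false (fun h => (Finset.mem_filter.mp hx).2 h.1), zero_mul]
    rw [h2, add_zero]
    refine Finset.sum_congr (by ext; simp) fun a ha => ?_
    have ha' : a ∉ B := by simpa using ha
    rw [← Finset.sum_subset (Finset.subset_univ B)]
    · refine Finset.sum_congr rfl fun b hb => ?_
      rw [I_true (by simp [ha', hb]), one_mul, G.w_comm]
    · intro b _ hb
      rw [I_false (by simp [hb]), zero_mul])
  rwa [e] at this

lemma noCut_side (hG : G.CD (1/2 - 1/400)) (hn : (400:ℝ) ≤ Fintype.card V) {κ : ℝ}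
    (hκ : 0 < κ) (hκn : 2 ≤ κ * Fintype.card V) (A : Finset V)
    (hA : 0.34 * Fintype.card V ≤ (Aᶜ.card : ℝ))
    (hcut : G.ws A Aᶜ ≤ κ^2/(2*10^7) * (Fintype.card V : ℝ)^5) : NoCut G A κ (κ^2/(2*10^7)) := by
  intro Z hZ h1 h2
  by_contra hc
  push Not at hc
  change G.ws Z (A \ Z) < _ at hc
  have hn0 : (0:ℝ) < Fintype.card V := by linarith
  have e1 : Zᶜ = (A \ Z) ∪ Aᶜ := by
    ext v; simp only [mem_compl, mem_union, mem_sdiff]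
    have := @hZ v; tauto
  have e2 : (A \ Z)ᶜ = Z ∪ Aᶜ := by
    ext v; simp only [mem_compl, mem_union, mem_sdiff]
    have := @hZ v; tauto
  have d1 : Disjoint (A \ Z) Aᶜ := by
    rw [Finset.disjoint_left]; intro v hv; simp at hv ⊢; exact hv.1
  have d2 : Disjoint Z Aᶜ := by
    rw [Finset.disjoint_left]; intro v hv; simp; exact hZ hv
  have j1 := J_fin G hG hn hκ hκn Z h1 (by
    rw [e1, ws_union _ _ _ _ d1]
    have := (ws_mono G Z A Aᶜ hZ).trans hcut
    linarith)
  have j2 := J_fin G hG hn hκ hκn (A \ Z) h2 (by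
    rw [e2, ws_union _ _ _ _ d2, ws_comm G (A \ Z) Z]
    have := (ws_mono G (A \ Z) A Aᶜ Finset.sdiff_subset).trans hcut
    linarith)
  have h3 : ((Z.card + (A \ Z).card + Aᶜ.card : ℕ):ℝ) = Fintype.card V := by
    have a1 := Finset.card_sdiff_add_card_eq_card hZ
    have a2 := Finset.card_add_card_compl A
    exact_mod_cast (by omega)
  push_cast at h3
  linarith

end

lemma struct (κ : ℝ) (hκ : 0 < κ) (hκ1 : κ ≤ 1/10) : ∃ m : ℕ, ∃ β : ℝ, 0 < β ∧ ∃ N0 : ℕ,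
    ∀ (V : Type) [Fintype V] (G : G3 V), N0 ≤ Fintype.card V → G.CD (1/2 - 1/400) →
    (∃ O : Finset V, (O.card : ℝ) ≤ 324 * κ * Fintype.card V ∧ ∀ x, x ∉ O → ∀ y, y ∉ O → Rch G (4*m+3) β x y) ∨
    (∃ A O : Finset V, 0.34 * Fintype.card V ≤ (A.card : ℝ) ∧ 0.34 * Fintype.card V ≤ (Aᶜ.card : ℝ) ∧
      (O.card : ℝ) ≤ 324 * κ * Fintype.card V ∧
      ∀ x, x ∉ O → ∀ y, y ∉ O → (x ∈ A ↔ y ∈ A) → Rch G (4*m+3) β x y) := by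
  obtain ⟨m, β, hβ, N0, h⟩ := grow κ (κ^2/(2*10^7)) hκ (by positivity) (by
    rw [div_le_one (by positivity)]; nlinarith)
  obtain ⟨N1, hN1⟩ := exists_nat_gt (2/κ)
  refine ⟨m, β, hβ, N0 + N1 + 400, ?_⟩
  intro V _ G hN hG
  have hn : (400:ℝ) ≤ Fintype.card V := by exact_mod_cast (by omega : 400 ≤ Fintype.card V)
  have hκn : 2 ≤ κ * Fintype.card V := by
    rw [div_lt_iff₀ hκ] at hN1
    have : (N1:ℝ) ≤ Fintype.card V := by exact_mod_cast (by omega : N1 ≤ Fintype.card V)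
    nlinarith
  by_cases hc : NoCut G univ κ (κ^2/(2*10^7))
  · left
    obtain ⟨O, -, hO, hr⟩ := h V G (by omega) hG univ (by rw [Finset.card_univ]; nlinarith) hc
    refine ⟨O, by nlinarith, fun x hx y hy => hr x (by simp [hx]) y (by simp [hy])⟩
  · right
    unfold NoCut at hc
    push Not at hc
    obtain ⟨A, -, h1, h2, h3⟩ := hc
    rw [← Finset.compl_eq_univ_sdiff] at h2 h3
    change G.ws A Aᶜ < _ at h3
    have h3' : G.ws Aᶜ Aᶜᶜ < κ^2/(2*10^7) * (Fintype.card V : ℝ)^5 := by rw [compl_compl, ws_comm]; exact h3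
    have hp : 0 ≤ κ^2/(2*10^7) * (Fintype.card V : ℝ)^5 := by positivity
    have j1 := J_fin G hG hn hκ hκn A h1 (by linarith)
    have j2 := J_fin G hG hn hκ hκn Aᶜ h2 (by linarith)
    obtain ⟨O1, -, hO1, hr1⟩ := h V G (by omega) hG A (by nlinarith) (noCut_side G hG hn hκ hκn A j2 h3.le)
    obtain ⟨O2, -, hO2, hr2⟩ := h V G (by omega) hG Aᶜ (by nlinarith) (noCut_side G hG hn hκ hκn Aᶜ
      (by rw [compl_compl]; exact j1) h3'.le)
    refine ⟨A, O1 ∪ O2, j1, j2, ?_, ?_⟩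
    · have : ((O1 ∪ O2).card : ℝ) ≤ O1.card + O2.card := by exact_mod_cast Finset.card_union_le _ _
      linarith
    · intro x hx y hy hxy
      simp only [mem_union, not_or] at hx hy
      by_cases hA : x ∈ A
      · exact hr1 x (by simp [hA, hx]) y (by simp [hxy.mp hA, hy])
      · have hyA : y ∉ A := fun h => hA (hxy.mpr h)
        exact hr2 x (by simp [hA, hx]) y (by simp [hyA, hy])

end KF

open Finset

namespace KF
open Classical

lemma pad_iter (m k : ℕ) (β : ℝ) (hβ : 0 < β) : ∃ β' : ℝ, 0 < β' ∧ ∃ N0 : ℕ,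
    ∀ (V : Type) [Fintype V] (G : G3 V), N0 ≤ Fintype.card V → G.CD (1/2 - 1/400) →
    ∀ x y, Rch G m β x y → Rch G (4*k+m) β' x y := by
  induction k with
  | zero => exact ⟨β, hβ, 0, fun V _ G _ _ x y h => by simpa using h⟩
  | succ k ih =>
    obtain ⟨β', hβ', N0, h⟩ := ih
    obtain ⟨N1, hN1⟩ := exists_nat_gt ((((4+(4*k+m):ℕ):ℝ)^2 + ((4+(4*k+m):ℕ):ℝ)*2) / (1/9*β'/2))
    refine ⟨1/9*β'/2, by positivity, N0 + N1 + 400, ?_⟩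
    intro V _ G hN hG x y hr
    have hn : (400:ℝ) ≤ Fintype.card V := by exact_mod_cast (by omega : 400 ≤ Fintype.card V)
    have h1 := h V G (by omega) hG x y hr
    have h2 := Rch.pad (by omega) hβ'.le h1 (tiles_total G (by norm_num) le_rfl hn hG) (by
      rw [div_lt_iff₀ (by positivity)] at hN1
      have : (N1:ℝ) ≤ Fintype.card V := by exact_mod_cast (by omega : N1 ≤ Fintype.card V)
      have := mul_le_mul_of_nonneg_right this (by positivity : 0 ≤ 1/9*β'/2)
      linarith)
    have e : 4 + (4*k+m) = 4*(k+1)+m := by ring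
    rwa [e] at h2

section
variable {V : Type} [Fintype V] (G : G3 V)

lemma sum_O3 (O : Finset V) : ∑ x : V, ∑ _y : V, ∑ _z : V, ∑ _t : V, I (x ∈ O) = O.card * (Fintype.card V : ℝ)^3 := by
  simp only [Finset.sum_const, Finset.card_univ, nsmul_eq_mul, ← Finset.mul_sum, sum_I_mem]
  ring

/-- remove an exceptional set from a count of quadruples -/
lemma restrictO (O : Finset V) (p : V → V → V → V → Prop) :
    ∑ x, ∑ y, ∑ z, ∑ t, I (p x y z t) ≤ ∑ x, ∑ y, ∑ z, ∑ t, I (p x y z t ∧ x ∉ O ∧ y ∉ O ∧ z ∉ O ∧ t ∉ O) +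
      4 * O.card * (Fintype.card V : ℝ)^3 := by
  have h1 : ∀ x y z t, I (p x y z t) ≤ I (p x y z t ∧ x ∉ O ∧ y ∉ O ∧ z ∉ O ∧ t ∉ O) +
      (I (x ∈ O) + I (y ∈ O) + I (z ∈ O) + I (t ∈ O)) := by
    intro x y z t
    by_cases h : x ∉ O ∧ y ∉ O ∧ z ∉ O ∧ t ∉ O
    · have : 0 ≤ (I (x ∈ O) + I (y ∈ O) + I (z ∈ O) + I (t ∈ O)) := by
        have := I_nonneg (x ∈ O); have := I_nonneg (y ∈ O); have := I_nonneg (z ∈ O); have := I_nonneg (t ∈ O)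
        linarith
      have h3 : I (p x y z t) ≤ I (p x y z t ∧ x ∉ O ∧ y ∉ O ∧ z ∉ O ∧ t ∉ O) := I_mono fun hp => ⟨hp, h⟩
      linarith
    · have h2 : x ∈ O ∨ y ∈ O ∨ z ∈ O ∨ t ∈ O := by tauto
      have := I_nonneg (x ∈ O); have := I_nonneg (y ∈ O); have := I_nonneg (z ∈ O); have := I_nonneg (t ∈ O)
      have := I_nonneg (p x y z t ∧ x ∉ O ∧ y ∉ O ∧ z ∉ O ∧ t ∉ O)
      have := I_le_one (p x y z t)
      rcases h2 with h | h | h | h <;> · have := I_true h; linarith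
  refine (Finset.sum_le_sum fun x _ => Finset.sum_le_sum fun y _ => Finset.sum_le_sum fun z _ =>
    Finset.sum_le_sum fun t _ => h1 x y z t).trans ?_
  simp only [Finset.sum_add_distrib]
  have r1 := sum_O3 (V := V) O
  have r2 := sum4_rot (fun x (_ _ t : V) => I (x ∈ O))
  have r3 := sum4_rot (fun (_ y _ _ : V) => I (y ∈ O))
  have r4 := sum4_rot (fun (_ _ z _ : V) => I (z ∈ O))
  rw [r4, r3, r2, r1]
  linarith

lemma many_of_sum (f : V → ℝ) {μ : ℝ} (hμ : 0 ≤ μ) (hn : (0:ℝ) < Fintype.card V)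
    (hf : ∀ a, f a ≤ (Fintype.card V : ℝ)^3)
    (h : 3/4 * μ * (Fintype.card V : ℝ)^4 ≤ ∑ a, f a) :
    μ/2 * Fintype.card V ≤ ∑ a, I (μ/4 * (Fintype.card V : ℝ)^3 ≤ f a) := by
  set n : ℝ := (Fintype.card V : ℝ) with hnn
  have h1 : ∀ a, f a ≤ n^3 * I (μ/4 * n^3 ≤ f a) + μ/4 * n^3 := by
    intro a
    by_cases h : μ/4 * n^3 ≤ f a
    · rw [I_true h]; have := hf a; have : 0 ≤ μ/4 * n^3 := by positivity
      linarith
    · rw [I_false h]; push Not at h; linarith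
  have h2 := h.trans (Finset.sum_le_sum fun a _ => h1 a)
  rw [Finset.sum_add_distrib, ← Finset.mul_sum, Finset.sum_const, Finset.card_univ, nsmul_eq_mul, ← hnn] at h2
  have h3 : n^3 * (μ/2 * n) ≤ n^3 * ∑ a, I (μ/4 * n^3 ≤ f a) := by nlinarith
  exact le_of_mul_le_mul_left h3 (by positivity)

/-- typical tiles through `a` with rest of pattern `σ` -/
noncomputable def ft (O : Finset V) (σ : Fin 3 → V → Prop) (P : V → Prop) (a : V) : ℝ :=
  ∑ s : Fin 3 → V, I ((G.K a (s 0) (s 1) (s 2) ∧ ∀ i, σ i (s i) ∧ s i ∉ O) ∧ P a ∧ a ∉ O)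

lemma ft_le (O : Finset V) (σ : Fin 3 → V → Prop) (P : V → Prop) (a : V) :
    ft G O σ P a ≤ (Fintype.card V : ℝ)^3 := by
  unfold ft
  have := sum_le_card (univ : Finset (Fin 3 → V)) (fun s => I ((G.K a (s 0) (s 1) (s 2) ∧ ∀ i, σ i (s i) ∧ s i ∉ O) ∧ P a ∧ a ∉ O)) 1
    fun _ _ => I_le_one _
  refine this.trans (le_of_eq ?_)
  rw [Finset.card_univ, Fintype.card_fun, Fintype.card_fin]; push_cast; ring

lemma ft_sum (O : Finset V) (σ : Fin 3 → V → Prop) (P : V → Prop) {μ : ℝ}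
    (hO : (O.card : ℝ) ≤ μ/16 * Fintype.card V)
    (h : μ * (Fintype.card V : ℝ)^4 ≤ ∑ x, ∑ y, ∑ z, ∑ t, I (G.K x y z t ∧ P x ∧ σ 0 y ∧ σ 1 z ∧ σ 2 t)) :
    3/4 * μ * (Fintype.card V : ℝ)^4 ≤ ∑ a, ft G O σ P a := by
  have h1 := h.trans (restrictO O _)
  have h2 := mul_le_mul_of_nonneg_right hO (by positivity : 0 ≤ (Fintype.card V : ℝ)^3)
  have h3 : ∑ x, ∑ y, ∑ z, ∑ t, I ((G.K x y z t ∧ P x ∧ σ 0 y ∧ σ 1 z ∧ σ 2 t) ∧ x ∉ O ∧ y ∉ O ∧ z ∉ O ∧ t ∉ O)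
      ≤ ∑ a, ft G O σ P a := by
    unfold ft
    simp only [sum_fin3]
    refine Finset.sum_le_sum fun x _ => Finset.sum_le_sum fun y _ => Finset.sum_le_sum fun z _ =>
      Finset.sum_le_sum fun t _ => I_mono fun ⟨⟨a1, a2, a3, a4, a5⟩, b1, b2, b3, b4⟩ => ?_
    refine ⟨⟨a1, fun i => ?_⟩, a2, b1⟩
    fin_cases i
    · exact ⟨a3, b2⟩
    · exact ⟨a4, b3⟩
    · exact ⟨a5, b4⟩
  nlinarith

end

/-- two adjacent tile types merge the two classes -/
lemma merge_classes (M : ℕ) (β μ : ℝ) (hβ : 0 < β) (hμ : 0 < μ) :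
    ∃ M' : ℕ, ∃ β' : ℝ, 0 < β' ∧ ∃ N0 : ℕ,
    ∀ (V : Type) [Fintype V] (G : G3 V), N0 ≤ Fintype.card V → G.CD (1/2 - 1/400) →
    ∀ (A O : Finset V) (σ : Fin 3 → V → Prop), (O.card : ℝ) ≤ μ/16 * Fintype.card V →
    (∀ x, x ∉ O → ∀ y, y ∉ O → (x ∈ A ↔ y ∈ A) → Rch G (4*M+3) β x y) →
    (∀ i, σ i = (fun v => v ∈ A) ∨ σ i = fun v => v ∉ A) →
    μ * (Fintype.card V : ℝ)^4 ≤ ∑ x, ∑ y, ∑ z, ∑ t, I (G.K x y z t ∧ x ∈ A ∧ σ 0 y ∧ σ 1 z ∧ σ 2 t) →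
    μ * (Fintype.card V : ℝ)^4 ≤ ∑ x, ∑ y, ∑ z, ∑ t, I (G.K x y z t ∧ x ∉ A ∧ σ 0 y ∧ σ 1 z ∧ σ 2 t) →
    ∀ x, x ∉ O → ∀ y, y ∉ O → Rch G (4*M'+3) β' x y := by
  obtain ⟨β0, hβ0, N0, hpad⟩ := pad_iter (4*M+3) (4*M+5) β hβ
  set τ := μ/4*(μ/4) with hτ
  set β1 := τ*β^3/2 with hβ1
  set β2 := μ/2 * β1 * β / 2 with hβ2
  set β3 := μ/2 * β * β2 / 2 with hβ3
  have p1 : 0 < β1 := by positivity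
  have p2 : 0 < β2 := by positivity
  have p3 : 0 < β3 := by positivity
  set R : ℕ := 20*M+23 with hR
  obtain ⟨N1, hN1⟩ := exists_nat_gt (((R:ℝ)^2 + (R:ℝ)*2) / β1)
  obtain ⟨N2, hN2⟩ := exists_nat_gt (((R:ℝ)^2 + (R:ℝ)*2) / β2)
  obtain ⟨N3, hN3⟩ := exists_nat_gt (((R:ℝ)^2 + (R:ℝ)*2) / β3)
  refine ⟨5*M+5, min β0 β3, by positivity, N0 + N1 + N2 + N3 + 400, ?_⟩
  intro V _ G hN hG A O σ hO hcl hσ hT1 hT2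
  have hc : 0 < Fintype.card V := by omega
  have hn : (0:ℝ) < Fintype.card V := by exact_mod_cast hc
  have big : ∀ (b : ℝ) (N : ℕ), 0 < b → N ≤ Fintype.card V → ((R:ℝ)^2 + (R:ℝ)*2) / b < N →
      ∀ r : ℕ, r ≤ R → ((r:ℝ)^2 + (r:ℝ)*2) ≤ b * Fintype.card V := by
    intro b N hb hN hlt r hr
    rw [div_lt_iff₀ hb] at hlt
    have h1 : (N:ℝ) ≤ Fintype.card V := by exact_mod_cast hN
    have h2 := mul_le_mul_of_nonneg_right h1 hb.le
    have h3 : (r:ℝ) ≤ R := by exact_mod_cast hr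
    have h4 : (r:ℝ)^2 ≤ (R:ℝ)^2 := by gcongr
    linarith
  have big1 := big β1 N1 p1 (by omega) hN1
  have big2 := big β2 N2 p2 (by omega) hN2
  have big3 := big β3 N3 p3 (by omega) hN3
  have F1 := many_of_sum (ft G O σ fun v => v ∈ A) hμ.le hn (ft_le G O σ _) (ft_sum G O σ _ hO hT1)
  have F2 := many_of_sum (ft G O σ fun v => v ∉ A) hμ.le hn (ft_le G O σ _) (ft_sum G O σ _ hO hT2)
  have pos : ∀ (P : V → Prop) a, μ/4 * (Fintype.card V : ℝ)^3 ≤ ft G O σ P a → P a ∧ a ∉ O := by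
    intro P a h
    have : 0 < ft G O σ P a := lt_of_lt_of_le (by positivity) h
    obtain ⟨s, -, hs⟩ := exists_of_sum_I_pos _ _ this
    exact hs.2
  have pair : ∀ a b, μ/4 * (Fintype.card V : ℝ)^3 ≤ ft G O σ (fun v => v ∈ A) a →
      μ/4 * (Fintype.card V : ℝ)^3 ≤ ft G O σ (fun v => v ∉ A) b → Rch G (6+3*(4*M+3)) β1 a b := by
    intro a b ha hb
    refine Rch.merge hc hβ.le ?_ (by
      refine big1 (6+3*(4*M+3)) (by omega))
    have h1 := mul_le_mul ha hb (by positivity) (le_trans (by positivity) ha)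
    refine le_trans (le_of_eq (by rw [hτ]; ring)) (h1.trans ?_)
    unfold ft
    rw [Finset.sum_mul_sum]
    refine Finset.sum_le_sum fun s _ => Finset.sum_le_sum fun s' _ => ?_
    rw [← I_and]
    refine I_mono fun ⟨⟨⟨k1, q1⟩, _⟩, ⟨k2, q2⟩, _⟩ => ⟨⟨k1, k2⟩, fun i => ?_⟩
    refine hcl _ (q1 i).2 _ (q2 i).2 ?_
    have a1 := (q1 i).1
    have a2 := (q2 i).1
    rcases hσ i with h | h
    · rw [h] at a1 a2; exact iff_of_true a1 a2
    · rw [h] at a1 a2; exact iff_of_false a1 a2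
  have cross : ∀ x, x ∉ O → x ∈ A → ∀ y, y ∉ O → y ∉ A → Rch G (4*(5*M+5)+3) β3 x y := by
    intro x hxO hxA y hyO hyA
    have s1 : ∀ a, μ/4 * (Fintype.card V : ℝ)^3 ≤ ft G O σ (fun v => v ∈ A) a → Rch G (16*M+19) β2 a y := by
      intro a ha
      refine (RchT.comp (ι := Fin (6+3*(4*M+3))) (κ := Fin (4*M+3)) (c := μ/2) hc p1.le hβ.le
        (F2.trans (Finset.sum_le_sum fun b _ => I_mono fun hb => ⟨pair a b ha hb, ?_⟩)) ?_).toFin ?_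
      · obtain ⟨b1, b2⟩ := pos _ b hb
        exact hcl b b2 y hyO (iff_of_false b1 hyA)
      · simp only [Fintype.card_fin]
        exact big2 _ (by omega)
      · simp; ring
    refine (RchT.comp (ι := Fin (4*M+3)) (κ := Fin (16*M+19)) (c := μ/2) hc hβ.le p2.le
        (F1.trans (Finset.sum_le_sum fun a _ => I_mono fun ha => ⟨?_, s1 a ha⟩)) ?_).toFin ?_
    · obtain ⟨b1, b2⟩ := pos _ a ha
      exact hcl x hxO a b2 (iff_of_true hxA b1)
    · simp only [Fintype.card_fin]
      exact big3 _ (by omega)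
    · simp; ring
  intro x hx y hy
  by_cases hxy : x ∈ A ↔ y ∈ A
  · have h1 := hpad V G (by omega) hG x y (hcl x hx y hy hxy)
    have e : 4*(4*M+5)+(4*M+3) = 4*(5*M+5)+3 := by ring
    rw [e] at h1
    exact h1.mono (min_le_left _ _)
  · by_cases hxA : x ∈ A
    · exact (cross x hx hxA y hy (by tauto)).mono (min_le_right _ _)
    · exact (cross y hy (by tauto) x hx hxA).symm.mono (min_le_right _ _)

end KF

open Finset

namespace KF
open Classical

section
variable {V : Type} [Fintype V] (G : G3 V)

/-- averaging -/
noncomputable def av (f : V → ℝ) : ℝ := (∑ x, f x) / (Fintype.card V : ℝ)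

lemma av_add (f g : V → ℝ) : av (fun x => f x + g x) = av f + av g := by
  unfold av; rw [Finset.sum_add_distrib, add_div]
lemma av_sub (f g : V → ℝ) : av (fun x => f x - g x) = av f - av g := by
  unfold av; rw [Finset.sum_sub_distrib, sub_div]
lemma av_cmul (c : ℝ) (f : V → ℝ) : av (fun x => c * f x) = c * av f := by
  unfold av; rw [← Finset.mul_sum, mul_div_assoc]
lemma av_mulc (c : ℝ) (f : V → ℝ) : av (fun x => f x * c) = av f * c := by
  unfold av; rw [← Finset.sum_mul, div_mul_eq_mul_div]
lemma av_mono {f g : V → ℝ} (h : ∀ x, f x ≤ g x) : av f ≤ av g := by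
  unfold av; exact div_le_div_of_nonneg_right (Finset.sum_le_sum fun x _ => h x) (by positivity)
lemma av_congr {f g : V → ℝ} (h : ∀ x, f x = g x) : av f = av g := by
  unfold av; rw [Finset.sum_congr rfl fun x _ => h x]
lemma av_const (hn : (0:ℝ) < Fintype.card V) (c : ℝ) : av (fun _ : V => c) = c := by
  unfold av; rw [Finset.sum_const, Finset.card_univ, nsmul_eq_mul]; field_simp
lemma av_nonneg {f : V → ℝ} (h : ∀ x, 0 ≤ f x) : 0 ≤ av f := by
  unfold av; exact div_nonneg (Finset.sum_nonneg fun x _ => h x) (by positivity)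
lemma av_comm (f : V → V → ℝ) : av (fun x => av fun y => f x y) = av (fun y => av fun x => f x y) := by
  unfold av
  rw [← Finset.sum_div, ← Finset.sum_div, Finset.sum_comm]
lemma av_eq_diag (x : V) : av (fun y => I (x = y)) = 1 / (Fintype.card V : ℝ) := by
  unfold av; simp [I]

lemma av2_le (hn : (0:ℝ) < Fintype.card V) {f : V → V → ℝ} {c : ℝ} (h : ∀ x y, f x y ≤ c) :
    av (fun x => av fun y => f x y) ≤ c :=
  (av_mono fun x => (av_mono fun y => h x y).trans (le_of_eq (av_const hn c))).trans (le_of_eq (av_const hn c))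

lemma av2_eq (f : V → V → ℝ) : av (fun x => av fun y => f x y) = (∑ x, ∑ y, f x y) / (Fintype.card V : ℝ)^2 := by
  unfold av; rw [← Finset.sum_div, div_div, ← pow_two]
lemma av3_eq (f : V → V → V → ℝ) : av (fun x => av fun y => av fun z => f x y z) =
    (∑ x, ∑ y, ∑ z, f x y z) / (Fintype.card V : ℝ)^3 := by
  rw [av2_eq]; unfold av
  simp only [← Finset.sum_div, div_div]; congr 1; ring
lemma av4_eq (f : V → V → V → V → ℝ) : av (fun x => av fun y => av fun z => av fun t => f x y z t) =
    (∑ x, ∑ y, ∑ z, ∑ t, f x y z t) / (Fintype.card V : ℝ)^4 := by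
  rw [av3_eq]; unfold av
  simp only [← Finset.sum_div, div_div]; congr 1; ring

/-- normalised codegree -/
noncomputable def G3.u (P : V → Prop) (x y : V) : ℝ := av fun z => I (G.E x y z) * I (P z)

lemma u_eq (P : V → Prop) (x y : V) : G.u P x y = G.d P x y / Fintype.card V := by
  unfold G3.u av G3.d; simp only [I_and]

lemma u_nonneg (P : V → Prop) (x y : V) : 0 ≤ G.u P x y :=
  av_nonneg fun _ => mul_nonneg (I_nonneg _) (I_nonneg _)

lemma u_le (P : V → Prop) (x y : V) : G.u P x y ≤ av fun z => I (P z) :=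
  av_mono fun _ => mul_le_of_le_one_left (I_nonneg _) (I_le_one _)

lemma av_I_le (hn : (0:ℝ) < Fintype.card V) (P : V → Prop) : av (fun z => I (P z)) ≤ 1 :=
  (av_mono fun _ => I_le_one _).trans (le_of_eq (av_const hn 1))

lemma u_comm (P : V → Prop) (x y : V) : G.u P x y = G.u P y x := by
  rw [u_eq, u_eq, G.d_comm]

/-- edge densities -/
noncomputable def G3.N (P Q R : V → Prop) : ℝ := av fun x => av fun y => I (P x) * I (Q y) * G.u R x y
noncomputable def G3.D (P Q R S : V → Prop) : ℝ :=
  av fun x => av fun y => I (P x) * I (Q y) * (G.u R x y * G.u S x y)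

lemma N_swap23 (P Q R : V → Prop) : G.N P Q R = G.N P R Q := by
  unfold G3.N G3.u
  refine av_congr fun x => ?_
  simp only [← av_cmul]
  rw [av_comm]
  refine av_congr fun y => av_congr fun z => ?_
  rw [I_congr (G.c2 x z y)]; ring

lemma N_swap12 (P Q R : V → Prop) : G.N P Q R = G.N Q P R := by
  unfold G3.N
  rw [av_comm]
  refine av_congr fun y => av_congr fun x => ?_
  rw [u_comm]; ring

lemma D_swap12 (P Q R S : V → Prop) : G.D P Q R S = G.D Q P R S := by
  unfold G3.D
  rw [av_comm]
  refine av_congr fun y => av_congr fun x => ?_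
  rw [u_comm, u_comm G S]; ring

lemma D_swap34 (P Q R S : V → Prop) : G.D P Q R S = G.D P Q S R := by
  unfold G3.D
  refine av_congr fun y => av_congr fun x => ?_
  ring

lemma D_as (P Q R S : V → Prop) : G.D P Q R S =
    av fun x => av fun y => av fun z => (I (P x) * I (Q y) * I (R z) * I (G.E x y z)) * G.u S x y := by
  unfold G3.D
  refine av_congr fun x => av_congr fun y => ?_
  rw [av_mulc]
  have : av (fun z => I (P x) * I (Q y) * I (R z) * I (G.E x y z)) = I (P x) * I (Q y) * G.u R x y := by
    unfold G3.u
    rw [← av_cmul]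
    exact av_congr fun z => by ring
  rw [this]; ring

/-- the moment inequality -/
lemma moment (P Q R S : V → Prop) {μ : ℝ} (hn : (0:ℝ) < Fintype.card V)
    (hT : ∑ x, ∑ y, ∑ z, ∑ t, I (G.K x y z t ∧ P x ∧ Q y ∧ R z ∧ S t) ≤ μ * (Fintype.card V : ℝ)^4) :
    G.D P Q R S + G.D P R Q S + G.D Q R P S ≤ (av fun z => I (S z)) * G.N P Q R + 2 * μ := by
  set n : ℝ := (Fintype.card V : ℝ) with hnn
  have e2 : G.D P R Q S = av fun x => av fun y => av fun z => (I (P x) * I (Q y) * I (R z) * I (G.E x y z)) * G.u S x z := by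
    rw [D_as]
    refine av_congr fun x => ?_
    rw [av_comm]
    exact av_congr fun y => av_congr fun z => by rw [I_congr (G.c2 x z y)]; ring
  have e3 : G.D Q R P S = av fun x => av fun y => av fun z => (I (P x) * I (Q y) * I (R z) * I (G.E x y z)) * G.u S y z := by
    rw [D_as]
    have : ∀ f : V → V → V → ℝ, (av fun y => av fun z => av fun x => f x y z) = av fun x => av fun y => av fun z => f x y z := by
      intro f
      rw [av_comm (fun x y => av fun z => f x y z)]
      exact av_congr fun y => av_comm _
    refine Eq.trans ?_ (this fun x y z => (I (P x) * I (Q y) * I (R z) * I (G.E x y z)) * G.u S y z)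
    exact av_congr fun y => av_congr fun z => av_congr fun x => by rw [I_congr (G.rot x y z)]; ring
  have e4 : G.N P Q R = av fun x => av fun y => av fun z => (I (P x) * I (Q y) * I (R z) * I (G.E x y z)) := by
    unfold G3.N G3.u
    simp only [← av_cmul]
    exact av_congr fun x => av_congr fun y => av_congr fun z => by ring
  have hT' : (av fun x => av fun y => av fun z => av fun t => I (G.K x y z t ∧ P x ∧ Q y ∧ R z ∧ S t)) ≤ μ := by
    rw [av4_eq, div_le_iff₀ (by positivity)]; exact hT
  have pt : ∀ x y z, (I (P x) * I (Q y) * I (R z) * I (G.E x y z)) * G.u S x y +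
      (I (P x) * I (Q y) * I (R z) * I (G.E x y z)) * G.u S x z +
      (I (P x) * I (Q y) * I (R z) * I (G.E x y z)) * G.u S y z ≤
      (av fun z => I (S z)) * (I (P x) * I (Q y) * I (R z) * I (G.E x y z)) +
      2 * av fun t => I (G.K x y z t ∧ P x ∧ Q y ∧ R z ∧ S t) := by
    intro x y z
    have hnn2 : 0 ≤ av fun t => I (G.K x y z t ∧ P x ∧ Q y ∧ R z ∧ S t) := av_nonneg fun _ => I_nonneg _
    by_cases hP : P x
    swap
    · rw [I_false hP]; linarith
    by_cases hQ : Q y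
    swap
    · rw [I_false hQ]; linarith
    by_cases hR : R z
    swap
    · rw [I_false hR]; linarith
    by_cases hE : G.E x y z
    swap
    · rw [I_false hE]; linarith
    have h := G.ext_count hE S
    rw [I_true hP, I_true hQ, I_true hR, I_true hE, u_eq, u_eq, u_eq]
    have e5 : (av fun t => I (G.K x y z t ∧ P x ∧ Q y ∧ R z ∧ S t)) = (∑ t, I (G.K x y z t ∧ S t)) / n := by
      unfold av
      rw [Finset.sum_congr rfl fun t _ => I_congr (show (G.K x y z t ∧ P x ∧ Q y ∧ R z ∧ S t) ↔ (G.K x y z t ∧ S t) by tauto)]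
    have e6 : (av fun z => I (S z)) = (∑ t, I (S t)) / n := rfl
    rw [e5, e6, ← hnn]
    have h' := div_le_div_of_nonneg_right h hn.le
    rw [add_div, add_div, add_div, mul_div_assoc] at h'
    linarith
  rw [D_as G P Q, e2, e3, e4]
  have := av_mono fun x => av_mono fun y => av_mono fun z => pt x y z
  simp only [av_add, av_cmul] at this
  linarith

end

end KF

open Finset

namespace KF
open Classical

section
variable {V : Type} [Fintype V] (G : G3 V)

/-- weighted double average -/
noncomputable def m2 (P Q : V → Prop) (f : V → V → ℝ) : ℝ := av fun x => av fun y => I (P x) * I (Q y) * f x y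

lemma m2_add (P Q : V → Prop) (f g : V → V → ℝ) : m2 P Q (fun x y => f x y + g x y) = m2 P Q f + m2 P Q g := by
  unfold m2; simp only [← av_add, mul_add]
lemma m2_cmul (P Q : V → Prop) (c : ℝ) (f : V → V → ℝ) : m2 P Q (fun x y => c * f x y) = c * m2 P Q f := by
  unfold m2; simp only [← av_cmul]
  exact av_congr fun x => av_congr fun y => by ring
lemma m2_const (P Q : V → Prop) (c : ℝ) : m2 P Q (fun _ _ => c) = c * ((av fun x => I (P x)) * av fun x => I (Q x)) := by
  unfold m2
  simp only [av_mulc, av_cmul]; ring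
lemma m2_mono {P Q : V → Prop} {f g : V → V → ℝ} (h : ∀ x y, P x → Q y → f x y ≤ g x y) : m2 P Q f ≤ m2 P Q g := by
  refine av_mono fun x => av_mono fun y => ?_
  by_cases hP : P x
  swap
  · rw [I_false hP]; simp
  by_cases hQ : Q y
  swap
  · rw [I_false hQ]; simp
  exact mul_le_mul_of_nonneg_left (h x y hP hQ) (mul_nonneg (I_nonneg _) (I_nonneg _))
lemma m2_nonneg {P Q : V → Prop} {f : V → V → ℝ} (h : ∀ x y, P x → Q y → 0 ≤ f x y) : 0 ≤ m2 P Q f := by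
  have := m2_mono (f := fun _ _ => 0) h
  rw [m2_const] at this; linarith
lemma m2_diag (hn : (0:ℝ) < Fintype.card V) (P Q : V → Prop) : m2 P Q (fun x y => I (x = y)) ≤ 1 / Fintype.card V := by
  unfold m2
  rw [← av_const hn (1 / (Fintype.card V : ℝ))]
  refine av_mono fun x => ?_
  rw [← av_eq_diag x]
  refine av_mono fun y => ?_
  have := mul_le_one₀ (I_le_one (P x)) (I_nonneg (Q y)) (I_le_one (Q y))
  nlinarith [I_nonneg (x = y)]
lemma m2_sum_le (hn : (0:ℝ) < Fintype.card V) (P Q : V → Prop) {f : V → V → ℝ} {c : ℝ} (hc : 0 ≤ c) (h : ∀ x y, P x → Q y → f x y ≤ c) :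
    m2 P Q f ≤ c := by
  refine (m2_mono h).trans ?_
  rw [m2_const]
  have := mul_le_one₀ (av_I_le hn P) (av_nonneg fun x => I_nonneg (Q x)) (av_I_le hn Q)
  nlinarith

lemma N_m2 (P Q R : V → Prop) : G.N P Q R = m2 P Q (G.u R) := rfl
lemma D_m2 (P Q R S : V → Prop) : G.D P Q R S = m2 P Q (fun x y => G.u R x y * G.u S x y) := rfl

/-- tangent line lower bound -/
lemma D_tan (P Q R : V → Prop) (s : ℝ) :
    2 * s * G.N P Q R - s^2 * ((av fun x => I (P x)) * av fun x => I (Q x)) ≤ G.D P Q R R := by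
  have h : m2 P Q (fun x y => 2 * s * G.u R x y + (-s^2)) ≤ m2 P Q (fun x y => G.u R x y * G.u R x y) :=
    m2_mono fun x y _ _ => by nlinarith [sq_nonneg (G.u R x y - s)]
  rw [m2_add, m2_cmul, m2_const] at h
  rw [N_m2, D_m2]; linarith

lemma D_prod (P Q R S : V → Prop) :
    (av fun x => I (R x)) * G.N P Q S + (av fun x => I (S x)) * G.N P Q R -
      ((av fun x => I (R x)) * av fun x => I (S x)) * ((av fun x => I (P x)) * av fun x => I (Q x)) ≤ G.D P Q R S := by
  have h : m2 P Q (fun x y => (av fun x => I (R x)) * G.u S x y + ((av fun x => I (S x)) * G.u R x y +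
      (-((av fun x => I (R x)) * av fun x => I (S x))))) ≤ m2 P Q (fun x y => G.u R x y * G.u S x y) :=
    m2_mono fun x y _ _ => by nlinarith [mul_nonneg (sub_nonneg.2 (u_le G R x y)) (sub_nonneg.2 (u_le G S x y))]
  rw [m2_add, m2_add, m2_cmul, m2_cmul, m2_const] at h
  rw [N_m2, N_m2, D_m2]; linarith

/-- pointwise codegree in normalised form -/
def CDn (A B : V → Prop) (ε : ℝ) : Prop := ∀ x y, 1/2 - ε ≤ G.u A x y + G.u B x y + I (x = y)

lemma cd_N {A B : V → Prop} {ε : ℝ} (hn : (0:ℝ) < Fintype.card V) (h : CDn G A B ε) (P Q : V → Prop) :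
    (1/2 - ε) * ((av fun x => I (P x)) * av fun x => I (Q x)) - 1 / Fintype.card V ≤ G.N P Q A + G.N P Q B := by
  have h1 : m2 P Q (fun _ _ => 1/2 - ε) ≤ m2 P Q (fun x y => G.u A x y + G.u B x y + I (x = y)) :=
    m2_mono fun x y _ _ => h x y
  rw [m2_add, m2_add, m2_const] at h1
  have := m2_diag hn P Q
  rw [N_m2, N_m2]; linarith

/-- tile density -/
noncomputable def G3.tc (P Q R S : V → Prop) : ℝ := ∑ x, ∑ y, ∑ z, ∑ t, I (G.K x y z t ∧ P x ∧ Q y ∧ R z ∧ S t)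

lemma IV_arith {a b X Y Z T d1 d2 d3 d4 d5 δ : ℝ} (hs : a + b = 1) (ha : 0.34 ≤ a) (hb : 0.34 ≤ b) (hd : δ ≤ 1/10^7)
    (m1 : d1 + d2 + d2 ≤ b * Y + 2 * (1/10^7)) (m2' : d2 + d2 + d3 ≤ a * T + 2 * (1/10^7))
    (m3 : d4 + d4 + d4 ≤ a * X + 2 * (1/10^7)) (m4 : d5 + d5 + d5 ≤ b * Z + 2 * (1/10^7))
    (c1 : (1/2 - 1/10^7) * (a * a) - δ ≤ X + Y) (c3 : (1/2 - 1/10^7) * (b * b) - δ ≤ T + Z)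
    (t1 : 2 * (2/3 * b) * Y - (2/3 * b)^2 * (a * a) ≤ d1) (t2 : 2 * (2/3 * a) * T - (2/3 * a)^2 * (b * b) ≤ d3)
    (t3 : 2 * (1/3 * a) * X - (1/3 * a)^2 * (a * a) ≤ d4) (t4 : 2 * (1/3 * b) * Z - (1/3 * b)^2 * (b * b) ≤ d5)
    (t5 : a * T + b * Y - a * b * (a * b) ≤ d2) : False := by
  have hb' : b = 1 - a := by linarith
  have u1 : 13/3 * (a * T + b * Y) ≤ 44/9 * (a*b)^2 + 4/10^7 := by linarith
  have u2 : X ≤ a^3/3 + 6/10^7 := by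
    have : a * X ≤ a * (a^3/3 + 6/10^7) := by linarith
    exact le_of_mul_le_mul_left this (by linarith)
  have u3 : Z ≤ b^3/3 + 6/10^7 := by
    have : b * Z ≤ b * (b^3/3 + 6/10^7) := by linarith
    exact le_of_mul_le_mul_left this (by linarith)
  have v1 : a^2/2 - a^3/3 - 8/10^7 ≤ Y := by linarith [mul_le_one₀ (show a ≤ 1 by linarith) (show 0 ≤ a by linarith) (show a ≤ 1 by linarith)]
  have v2 : b^2/2 - b^3/3 - 8/10^7 ≤ T := by linarith [mul_le_one₀ (show b ≤ 1 by linarith) (show 0 ≤ b by linarith) (show b ≤ 1 by linarith)]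
  have w1 : a * (b^2/2 - b^3/3 - 8/10^7) ≤ a * T := mul_le_mul_of_nonneg_left v2 (by linarith)
  have w2 : b * (a^2/2 - a^3/3 - 8/10^7) ≤ b * Y := mul_le_mul_of_nonneg_left v1 (by linarith)
  have w3 : a * (b^2/2 - b^3/3) + b * (a^2/2 - a^3/3) = (a*b) * (1/6 + 2/3 * (a*b)) := by rw [hb']; ring
  have w4 : a * b ≤ 1/4 := by rw [hb']; linarith [sq_nonneg (a - 1/2)]
  have w5 : 0.2 ≤ a * b := by linarith [mul_nonneg (sub_nonneg.2 ha) (sub_nonneg.2 hb)]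
  have w6 : (a*b) * (1/6 + 2/3 * (a*b)) - 8/10^7 ≤ a * T + b * Y := by linarith
  generalize a * b = π at *
  clear * - u1 w4 w5 w6
  nlinarith

lemma caseIV (A B : V → Prop) (hn : (10:ℝ)^7 ≤ Fintype.card V)
    (hs : (av fun x => I (A x)) + (av fun x => I (B x)) = 1)
    (ha : 0.34 ≤ av fun x => I (A x)) (hb : 0.34 ≤ av fun x => I (B x))
    (hcd : CDn G A B (1/10^7))
    (h4 : G.tc A A A A ≤ 1/10^7 * (Fintype.card V : ℝ)^4)
    (h2 : G.tc A A B B ≤ 1/10^7 * (Fintype.card V : ℝ)^4)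
    (h2' : G.tc A B B A ≤ 1/10^7 * (Fintype.card V : ℝ)^4)
    (h0 : G.tc B B B B ≤ 1/10^7 * (Fintype.card V : ℝ)^4) : False := by
  have hn0 : (0:ℝ) < Fintype.card V := by linarith
  have hd : 1 / (Fintype.card V : ℝ) ≤ 1/10^7 := one_div_le_one_div_of_le (by norm_num) hn
  have m1 := moment G A A B B hn0 h2
  have m2' := moment G A B B A hn0 h2'
  have m3 := moment G A A A A hn0 h4
  have m4 := moment G B B B B hn0 h0
  have c1 := cd_N G hn0 hcd A A
  have c3 := cd_N G hn0 hcd B B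
  have t1 := D_tan G A A B (2/3 * av fun x => I (B x))
  have t2 := D_tan G B B A (2/3 * av fun x => I (A x))
  have t3 := D_tan G A A A (1/3 * av fun x => I (A x))
  have t4 := D_tan G B B B (1/3 * av fun x => I (B x))
  have t5 := D_prod G A B A B
  have s1 : G.N A B A = G.N A A B := N_swap23 G A B A
  have s2 : G.N B B A = G.N A B B := by rw [N_swap23, N_swap12]
  have s3 : G.D A B B A = G.D A B A B := D_swap34 G A B B A
  rw [s1] at t5
  rw [s2] at c3 t2
  rw [s3] at m2'
  generalize G.N A A B = Y at *
  generalize G.N A B B = T at *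
  generalize G.N A A A = X at *
  generalize G.N B B B = Z at *
  generalize G.D A A B B = d1 at *
  generalize G.D A B A B = d2 at *
  generalize G.D B B A A = d3 at *
  generalize G.D A A A A = d4 at *
  generalize G.D B B B B = d5 at *
  generalize (av fun x => I (A x)) = a at *
  generalize (av fun x => I (B x)) = b at *
  exact IV_arith hs ha hb hd m1 m2' m3 m4 c1 c3 t1 t2 t3 t4 t5

lemma III_arith {a b η X Y T d1 d2 d3 d4 S δ : ℝ} (ha' : a = 1/2 + η) (hb' : b = 1/2 - η) (hb : 0.34 ≤ b) (η0 : 0 ≤ η)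
    (hd : δ ≤ 1/10^7) (m1 : d1 + d2 + d2 ≤ a * Y + 2 * (1/10^7)) (m2' : d3 + d3 + d4 ≤ b * T + 2 * (1/10^7))
    (c1 : (1/2 - 1/10^7) * (a * a) - δ ≤ X + Y) (c2 : (1/2 - 1/10^7) * (a * b) - δ ≤ Y + T)
    (q1 : 1/2 * Y + (1/2 * T + -(1/4) * (a * b)) + S ≤ 2 * d2 + 2 * d3 - 1/2 * (Y + T))
    (q2 : - (2/10^7) ≤ d1 - η * Y) (q3 : 0 ≤ d4) (q4 : 0 ≤ S) (nY : 0 ≤ Y) (nT : 0 ≤ T)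
    (k1 : Y + -1 * T ≤ 500 * S + 1/2000 * (a * b)) (k2 : T + -1 * Y ≤ 500 * S + 1/2000 * (a * b)) :
    η ≤ 180/10^7 ∧ d1 ≤ 25/10^7 ∧ 0.04 ≤ Y ∧ 0.06 ≤ X := by
  have ηT : 0 ≤ η * T := mul_nonneg η0 nT
  have hab2 : 0.17 ≤ a * b := by nlinarith
  have hab' : a * b ≤ 1/4 := by rw [ha', hb']; linarith [sq_nonneg η]
  have haa : 1/4 ≤ a * a := by rw [ha']; linarith [sq_nonneg η]
  have haa1 : a * a ≤ 1 := mul_le_one₀ (by linarith) (by linarith) (by linarith)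
  have r0 : -(2/10^7) ≤ 2 * d2 + 2 * d3 - 1/2 * (Y + T) := by linarith
  have main : (2 * d2 + 2 * d3 - 1/2 * (Y + T)) + η * T + (d1 - η * Y) + d4 ≤ 4/10^7 := by
    rw [ha'] at m1; rw [hb'] at m2'
    linarith
  have r1 : η * T ≤ 8/10^7 := by linarith
  have r2 : d1 ≤ η * Y + 6/10^7 := by linarith
  have r4 : S ≤ 8/10^7 := by linarith
  have r5 : Y + T ≤ a * b / 2 + 14/10^7 := by linarith
  have r6 : Y - T ≤ 1/1000 := by linarith
  have r7 : T - Y ≤ 1/1000 := by linarith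
  have Ylb : 0.04 ≤ Y := by linarith
  have Tlb : 0.04 ≤ T := by linarith
  have ηub : η ≤ 200/10^7 := by linarith [mul_le_mul_of_nonneg_left Tlb η0]
  have Yub : Y ≤ 0.064 := by linarith
  refine ⟨?_, ?_, Ylb, by linarith⟩
  · have : 0.045 ≤ T := by linarith [show 0.22 ≤ a * b by rw [ha', hb']; nlinarith]
    linarith [mul_le_mul_of_nonneg_left this η0]
  · linarith [mul_le_mul_of_nonneg_left Yub η0]

set_option maxHeartbeats 1000000 in
lemma caseIII (A B : V → Prop) (hAB : ∀ x, B x ↔ ¬ A x) (hn : (10:ℝ)^7 ≤ Fintype.card V)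
    (hs : (av fun x => I (A x)) + (av fun x => I (B x)) = 1)
    (ha : 1/2 ≤ av fun x => I (A x)) (hb : 0.34 ≤ av fun x => I (B x))
    (hcd : CDn G A B (1/10^7))
    (h3 : G.tc A A B A ≤ 1/10^7 * (Fintype.card V : ℝ)^4)
    (h1 : G.tc A B B B ≤ 1/10^7 * (Fintype.card V : ℝ)^4) : False := by
  have hn0 : (0:ℝ) < Fintype.card V := by linarith
  have hd : 1 / (Fintype.card V : ℝ) ≤ 1/10^7 := one_div_le_one_div_of_le (by norm_num) hn
  have m1 := moment G A A B A hn0 h3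
  have m2' := moment G A B B B hn0 h1
  have c1 := cd_N G hn0 hcd A A
  have c2 := cd_N G hn0 hcd A B
  have s1 : G.N A B A = G.N A A B := N_swap23 G A B A
  rw [s1] at c2
  have uA : ∀ x y, G.u A x y ≤ av fun x => I (A x) := u_le G A
  have uB : ∀ x y, G.u B x y ≤ av fun x => I (B x) := u_le G B
  obtain ⟨a, hae⟩ : ∃ a, a = av fun x => I (A x) := ⟨_, rfl⟩
  obtain ⟨b, hbe⟩ : ∃ b, b = av fun x => I (B x) := ⟨_, rfl⟩
  obtain ⟨η, hη⟩ : ∃ η, η = a - 1/2 := ⟨_, rfl⟩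
  simp only [← hae, ← hbe] at hs ha hb m1 m2' c1 c2 uA uB
  have hb' : b = 1/2 - η := by linarith
  have ha' : a = 1/2 + η := by linarith
  have nA := u_nonneg G A
  have nB := u_nonneg G B
  have hne : ∀ x y, A x → B y → I (x = y) = 0 := fun x y h1 h2 => I_false (by rintro rfl; exact (hAB x).1 h2 h1)
  have hcd2 : ∀ x y, A x → B y → 1/2 - 1/10^7 ≤ G.u A x y + G.u B x y := by
    intro x y h1 h2
    have := hcd x y
    rw [hne x y h1 h2] at this; linarith
  have dAA : 0 ≤ m2 A A (fun x y => I (x = y)) := m2_nonneg fun x y _ _ => I_nonneg _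
  have dAA' := m2_diag hn0 A A
  -- key quadratics
  have q1 : m2 A B (fun x y => 1/2 * G.u A x y + (1/2 * G.u B x y + -(1/4))) + m2 A B (fun x y => (G.u A x y - G.u B x y)^2) ≤
      2 * G.D A B A A + 2 * G.D A B B B - 1/2 * (G.N A B A + G.N A B B) := by
    have : m2 A B (fun x y => (1/2 * G.u A x y + (1/2 * G.u B x y + -(1/4))) + ((G.u A x y - G.u B x y)^2)) ≤
       m2 A B (fun x y => 2 * (G.u A x y * G.u A x y) + (2 * (G.u B x y * G.u B x y) + ((-(1/2)) * G.u A x y + (-(1/2)) * G.u B x y))) :=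
      m2_mono fun x y _ _ => by linarith [sq_nonneg (G.u A x y + G.u B x y - 1/2)]
    rw [m2_add, m2_add A B (fun x y => 2 * (G.u A x y * G.u A x y)), m2_add A B (fun x y => 2 * (G.u B x y * G.u B x y)),
      m2_add A B (fun x y => (-(1/2)) * G.u A x y), m2_cmul, m2_cmul, m2_cmul, m2_cmul] at this
    rw [D_m2, D_m2, N_m2, N_m2]; linarith
  rw [m2_add, m2_add, m2_cmul, m2_cmul, m2_const, ← N_m2, ← N_m2, ← hae, ← hbe, s1] at q1
  have q2 : - (2/10^7) ≤ G.D A A B A - η * G.N A A B := by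
    have : m2 A A (fun x y => -(1/10^7) + (-1) * I (x = y)) ≤ m2 A A (fun x y => G.u B x y * G.u A x y + (-η) * G.u B x y) :=
      m2_mono fun x y _ _ => by
        have e1 := hcd x y
        have e2 := uB x y
        have e3 := nB x y
        have e4 : G.u B x y ≤ 1 := by linarith
        have e5 := I_nonneg (x = y)
        have e6 : 0 ≤ (G.u A x y - η + 1/10^7 + I (x = y)) * G.u B x y := mul_nonneg (by linarith) e3
        have e7 : 0 ≤ (1 - G.u B x y) * (1/10^7 + I (x = y)) := mul_nonneg (by linarith) (by linarith)
        linarith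
    rw [m2_add, m2_add, m2_cmul, m2_cmul, m2_const, ← hae] at this
    rw [D_m2, N_m2]
    have : a * a ≤ 1 := mul_le_one₀ (by linarith) (by linarith) (by linarith)
    linarith
  have q3 : 0 ≤ G.D B B A B := m2_nonneg fun x y _ _ => mul_nonneg (nA x y) (nB x y)
  have q4 : 0 ≤ m2 A B (fun x y => (G.u A x y - G.u B x y)^2) := m2_nonneg fun x y _ _ => sq_nonneg _
  have nY : 0 ≤ G.N A A B := m2_nonneg fun x y _ _ => nB x y
  have nT : 0 ≤ G.N A B B := m2_nonneg fun x y _ _ => nB x y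
  have η0 : 0 ≤ η := by linarith
  have k1 : m2 A B (fun x y => G.u A x y + (-1) * G.u B x y) ≤ m2 A B (fun x y => 500 * (G.u A x y - G.u B x y)^2 + 1/2000) :=
    m2_mono fun x y _ _ => by linarith [sq_nonneg (1000 * (G.u A x y - G.u B x y) - 1)]
  have k2 : m2 A B (fun x y => G.u B x y + (-1) * G.u A x y) ≤ m2 A B (fun x y => 500 * (G.u A x y - G.u B x y)^2 + 1/2000) :=
    m2_mono fun x y _ _ => by linarith [sq_nonneg (1000 * (G.u A x y - G.u B x y) + 1)]
  rw [m2_add, m2_add, m2_cmul, m2_cmul, m2_const, ← N_m2, ← N_m2, s1, ← hae, ← hbe] at k1 k2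
  obtain ⟨ηub, Dub, Ylb, Xlb⟩ := III_arith ha' hb' hb η0 hd m1 m2' c1 c2 q1 q2 q3 q4 nY nT k1 k2
  -- P2
  set P : V → ℝ := fun x => av fun y => I (A y) * G.u A x y with hP
  set Q : V → ℝ := fun x => av fun y => I (A y) * G.u B x y with hQ
  have P0 : ∀ x, 0 ≤ P x := fun x => av_nonneg fun y => mul_nonneg (I_nonneg _) (nA x y)
  have Q0 : ∀ x, 0 ≤ Q x := fun x => av_nonneg fun y => mul_nonneg (I_nonneg _) (nB x y)
  have b1 : b ≤ 1 := by linarith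
  have a1 : a ≤ 1 := by linarith
  have P1 : ∀ x, P x ≤ 1 := fun x => by
    rw [← av_const hn0 1]
    exact av_mono fun y => mul_le_one₀ (I_le_one _) (nA x y) ((uA x y).trans a1)
  have Q1 : ∀ x, Q x ≤ 1 := fun x => by
    rw [← av_const hn0 1]
    exact av_mono fun y => mul_le_one₀ (I_le_one _) (nB x y) ((uB x y).trans b1)
  have XP : G.N A A A = av fun x => I (A x) * P x := by
    unfold G3.N; simp only [hP, ← av_cmul, mul_assoc]
  have YQ : G.N A A B = av fun x => I (A x) * Q x := by
    unfold G3.N; simp only [hQ, ← av_cmul, mul_assoc]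
  -- upper bound of P2
  have P2a : (av fun x => I (A x) * (P x * Q x)) ≤ G.D A A B A + m2 A A (fun x y => G.u A x y * (a - G.u A x y)) := by
    have e1 : (av fun x => I (A x) * (P x * Q x)) =
        av fun x => av fun y => av fun z => I (A x) * (I (A y) * I (A z)) * (G.u A x y * G.u B x z) := by
      refine av_congr fun x => ?_
      rw [hP, hQ]
      simp only
      rw [← av_mulc, ← av_cmul]
      refine av_congr fun y => ?_
      rw [← av_cmul, ← av_cmul]
      exact av_congr fun z => by ring
    have e2 : ∀ x y z, I (A x) * (I (A y) * I (A z)) * (G.u A x y * G.u B x z) ≤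
        I (A x) * I (A z) * G.u B x z * (I (G.E x z y) * I (A y)) +
        I (A x) * I (A y) * G.u A x y * (I (A z) - I (G.E x y z) * I (A z)) := by
      intro x y z
      have f1 := (uA x y).trans a1
      have f2 := (uB x z).trans b1
      have f3 := nA x y
      have f4 := nB x z
      have w0 : 0 ≤ I (A x) * (I (A y) * I (A z)) := mul_nonneg (I_nonneg _) (mul_nonneg (I_nonneg _) (I_nonneg _))
      rw [I_congr (G.c2 x z y)]
      by_cases hE : G.E x y z
      · rw [I_true hE]
        linarith [mul_nonneg w0 (mul_nonneg f4 (sub_nonneg.2 f1))]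
      · rw [I_false hE]
        linarith [mul_nonneg w0 (mul_nonneg f3 (sub_nonneg.2 f2))]
    rw [e1]
    refine (av_mono fun x => av_mono fun y => av_mono fun z => e2 x y z).trans ?_
    simp only [av_add]
    refine add_le_add (le_of_eq ?_) (le_of_eq ?_)
    · rw [D_m2]; unfold m2
      refine av_congr fun x => ?_
      rw [av_comm]
      refine av_congr fun z => ?_
      rw [av_cmul]
      show _ * G.u A x z = _
      ring
    · unfold m2
      refine av_congr fun x => av_congr fun y => ?_
      rw [av_cmul, av_sub, ← hae]
      show _ * (a - G.u A x y) = _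
      ring
  have P2b : m2 A A (fun x y => G.u A x y * (a - G.u A x y)) ≤ G.D A A B A + (η + 2/10^7) := by
    have : m2 A A (fun x y => G.u A x y * (a - G.u A x y)) ≤ m2 A A (fun x y => G.u B x y * G.u A x y + (I (x = y) + (η + 1/10^7))) :=
      m2_mono fun x y _ _ => by
        have e1 := hcd x y
        have e2 := nA x y
        have e3 := (uA x y).trans a1
        have e5 := I_nonneg (x = y)
        have : G.u A x y * (a - G.u A x y) ≤ G.u A x y * (G.u B x y + (I (x = y) + (η + 1/10^7))) :=
          mul_le_mul_of_nonneg_left (by linarith) e2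
        linarith [mul_nonneg (sub_nonneg.2 e3) (show 0 ≤ I (x = y) + (η + 1/10^7) by linarith)]
    rw [m2_add, m2_add, m2_const, ← hae] at this
    rw [D_m2]
    have : a * a ≤ 1 := mul_le_one₀ (by linarith) (by linarith) (by linarith)
    have : (η + 1/10^7) * (a * a) ≤ η + 1/10^7 := mul_le_of_le_one_right (by linarith) this
    linarith
  -- lower bound
  have low : (1/2 - 1/10^7) * (G.N A A A * G.N A A B) ≤ 2 * (av fun x => I (A x) * (P x * Q x)) + 1/10^7 := by
    have e1 : G.N A A A * G.N A A B = m2 A A (fun x y => P x * Q y) := by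
      rw [XP, YQ, ← av_mulc]
      unfold m2
      refine av_congr fun x => ?_
      rw [← av_cmul]
      exact av_congr fun y => by ring
    have e2 : m2 A A (fun x y => (1/2 - 1/10^7) * (P x * Q y)) ≤ m2 A A (fun x y => P x * G.u B x y + (Q y * G.u A x y + I (x = y))) := by
      refine m2_mono fun x y _ _ => ?_
      have g1 := hcd x y
      have g2 : 0 ≤ P x * Q y := mul_nonneg (P0 x) (Q0 y)
      have g3 : P x * Q y ≤ 1 := mul_le_one₀ (P1 x) (Q0 y) (Q1 y)
      have g4 : P x * Q y ≤ P x := mul_le_of_le_one_right (P0 x) (Q1 y)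
      have g5 : P x * Q y ≤ Q y := mul_le_of_le_one_left (Q0 y) (P1 x)
      have g6 := mul_le_mul_of_nonneg_right g1 g2
      have g7 := mul_le_mul_of_nonneg_right g4 (nB x y)
      have g8 := mul_le_mul_of_nonneg_right g5 (nA x y)
      have g9 := mul_le_mul_of_nonneg_left g3 (I_nonneg (x = y))
      linarith
    rw [m2_cmul, m2_add, m2_add, ← e1] at e2
    have e3 : m2 A A (fun x y => P x * G.u B x y) = av fun x => I (A x) * (P x * Q x) := by
      unfold m2
      refine av_congr fun x => ?_
      rw [hQ]; simp only
      rw [← av_cmul, ← av_cmul]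
      exact av_congr fun y => by ring
    have e4 : m2 A A (fun x y => Q y * G.u A x y) = av fun x => I (A x) * (P x * Q x) := by
      unfold m2
      rw [av_comm]
      refine av_congr fun x => ?_
      rw [hP]; simp only
      rw [← av_mulc, ← av_cmul]
      exact av_congr fun y => by rw [u_comm]; ring
    linarith
  have : 0.06 * 0.04 ≤ G.N A A A * G.N A A B := mul_le_mul Xlb Ylb (by norm_num) (by linarith)
  linarith

end

end KF

open Finset

namespace KF
open Classical

section
variable {V : Type} [Fintype V] (G : G3 V)

lemma tc_12 (P Q R S : V → Prop) : G.tc P Q R S = G.tc Q P R S := by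
  unfold G3.tc
  rw [Finset.sum_comm]
  refine Finset.sum_congr rfl fun y _ => Finset.sum_congr rfl fun x _ => Finset.sum_congr rfl fun z _ =>
    Finset.sum_congr rfl fun t _ => I_congr ?_
  rw [G.K12 x y z t]; tauto

lemma tc_23 (P Q R S : V → Prop) : G.tc P Q R S = G.tc P R Q S := by
  unfold G3.tc
  refine Finset.sum_congr rfl fun x _ => ?_
  rw [Finset.sum_comm]
  refine Finset.sum_congr rfl fun y _ => Finset.sum_congr rfl fun z _ =>
    Finset.sum_congr rfl fun t _ => I_congr ?_
  rw [G.K23 x z y t]; tauto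

lemma tc_34 (P Q R S : V → Prop) : G.tc P Q R S = G.tc P Q S R := by
  unfold G3.tc
  refine Finset.sum_congr rfl fun x _ => Finset.sum_congr rfl fun y _ => ?_
  rw [Finset.sum_comm]
  refine Finset.sum_congr rfl fun z _ =>
    Finset.sum_congr rfl fun t _ => I_congr ?_
  rw [G.K34 x y t z]; tauto

/-- few wrong edges -/
lemma few_edges {A B : V → Prop} (hAB : ∀ x, B x ↔ ¬ A x) (hG : G.CD (1/2 - 1/400)) {μ : ℝ}
    (hn : (0:ℝ) < Fintype.card V)
    (h1 : G.tc A A B A ≤ μ * (Fintype.card V : ℝ)^4) (h2 : G.tc A A B B ≤ μ * (Fintype.card V : ℝ)^4) :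
    ∑ x, ∑ y, ∑ z, I (G.E x y z ∧ A x ∧ A y ∧ B z) ≤ 10 * μ * (Fintype.card V : ℝ)^3 := by
  set n : ℝ := (Fintype.card V : ℝ) with hnn
  have pt : ∀ x y z, n / 5 * I (G.E x y z ∧ A x ∧ A y ∧ B z) ≤
      ∑ t, I (G.K x y z t ∧ A x ∧ A y ∧ B z ∧ A t) + ∑ t, I (G.K x y z t ∧ A x ∧ A y ∧ B z ∧ B t) := by
    intro x y z
    by_cases h : G.E x y z ∧ A x ∧ A y ∧ B z
    · rw [I_true h, mul_one, ← Finset.sum_add_distrib]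
      have := G.ext_quarter hG h.1
      refine le_trans ?_ (this.trans (Finset.sum_le_sum fun t _ => ?_))
      · rw [← hnn]; linarith
      · by_cases hA : A t
        · refine le_trans (le_of_eq (I_congr ?_)) (le_add_of_nonneg_right (I_nonneg _))
          exact ⟨fun k => ⟨k, h.2.1, h.2.2.1, h.2.2.2, hA⟩, fun k => k.1⟩
        · refine le_trans (le_of_eq (I_congr ?_)) (le_add_of_nonneg_left (I_nonneg _))
          exact ⟨fun k => ⟨k, h.2.1, h.2.2.1, h.2.2.2, (hAB t).2 hA⟩, fun k => k.1⟩
    · rw [I_false h, mul_zero]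
      exact add_nonneg (Finset.sum_nonneg fun _ _ => I_nonneg _) (Finset.sum_nonneg fun _ _ => I_nonneg _)
  have h3 := Finset.sum_le_sum fun x (_ : x ∈ (univ : Finset V)) => Finset.sum_le_sum fun y (_ : y ∈ (univ : Finset V)) =>
    Finset.sum_le_sum fun z (_ : z ∈ (univ : Finset V)) => pt x y z
  simp only [Finset.sum_add_distrib, ← Finset.mul_sum] at h3
  have h4 : n / 5 * ∑ x, ∑ y, ∑ z, I (G.E x y z ∧ A x ∧ A y ∧ B z) ≤ n / 5 * (10 * μ * n^3) := by
    refine h3.trans ?_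
    unfold G3.tc at h1 h2
    linarith
  exact le_of_mul_le_mul_left h4 (by positivity)

lemma sum_I_nmem (A : Finset V) : ∑ t, I (t ∉ A) = (Aᶜ.card : ℝ) := by
  rw [← sum_I_mem]
  exact Finset.sum_congr rfl fun t _ => I_congr (by simp)

lemma CDn_of (hG : G.CD (1/2 - 1/10^7)) (hn : (0:ℝ) < Fintype.card V) {A B : V → Prop} (hAB : ∀ x, B x ↔ ¬ A x) : CDn G A B (1/10^7) := by
  intro x y
  by_cases h : x = y
  · rw [I_true h]; linarith [u_nonneg G A x y, u_nonneg G B x y]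
  · rw [I_false h, add_zero]
    have := hG x y h
    rw [u_eq, u_eq, ← add_div, le_div_iff₀ hn]
    refine this.trans (le_of_eq ?_)
    unfold G3.d
    rw [← Finset.sum_add_distrib]
    refine Finset.sum_congr rfl fun z _ => ?_
    by_cases hE : G.E x y z <;> by_cases hA : A z <;> simp [I, hE, hA, hAB z]

end

lemma CD_mono {V : Type} [Fintype V] {G : G3 V} {a b : ℝ} (h : G.CD a) (hab : b ≤ a) : G.CD b := fun x y hxy =>
  (mul_le_mul_of_nonneg_right hab (by positivity)).trans (h x y hxy)

/-- the main dichotomy -/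
lemma dichotomy (μe ν : ℝ) (hμe : 0 < μe) (hν : 0 < ν) : ∃ M : ℕ, ∃ β : ℝ, 0 < β ∧ ∃ N0 : ℕ,
    ∀ (V : Type) [Fintype V] (G : G3 V), N0 ≤ Fintype.card V → G.CD (1/2 - 1/10^7) →
    (∃ O : Finset V, (O.card : ℝ) ≤ ν * Fintype.card V ∧ ∀ x, x ∉ O → ∀ y, y ∉ O → Rch G M β x y) ∨
    (∃ A : Finset V, 0.34 * Fintype.card V ≤ (A.card : ℝ) ∧ 0.34 * Fintype.card V ≤ (Aᶜ.card : ℝ) ∧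
      ∑ x, ∑ y, ∑ z, I (G.E x y z ∧ x ∈ A ∧ y ∈ A ∧ z ∉ A) ≤ μe * (Fintype.card V : ℝ)^3) := by
  obtain ⟨μ, hμ0, hμ1, hμ2⟩ : ∃ μ : ℝ, 0 < μ ∧ μ ≤ μe/10 ∧ μ ≤ 1/10^7 :=
    ⟨min (μe/10) (1/10^7), by positivity, min_le_left _ _, min_le_right _ _⟩
  obtain ⟨κ, hκ0, hκ1, hκ2, hκ3⟩ : ∃ κ : ℝ, 0 < κ ∧ κ ≤ 1/10 ∧ 324*κ ≤ μ/16 ∧ 324*κ ≤ ν := by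
    refine ⟨min (1/10) (min (μ/16/324) (ν/324)), by positivity, min_le_left _ _, ?_, ?_⟩
    · linarith [(min_le_right (1/10) (min (μ/16/324) (ν/324))).trans (min_le_left _ _)]
    · linarith [(min_le_right (1/10) (min (μ/16/324) (ν/324))).trans (min_le_right _ _)]
  obtain ⟨m, β, hβ, N0, hst⟩ := struct κ hκ0 hκ1
  obtain ⟨M, β', hβ', N1, hmg⟩ := merge_classes m β μ hβ hμ0
  obtain ⟨β1, hβ1, N2, hp1⟩ := pad_iter (4*m+3) M β hβ
  obtain ⟨β2, hβ2, N3, hp2⟩ := pad_iter (4*M+3) m β' hβ'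
  refine ⟨4*M+(4*m+3), min β1 β2, lt_min hβ1 hβ2, N0+N1+N2+N3+10^7, ?_⟩
  intro V _ G hN hG
  have hG' : G.CD (1/2 - 1/400) := CD_mono hG (by norm_num)
  have hn : (10:ℝ)^7 ≤ Fintype.card V := by exact_mod_cast (by omega : 10^7 ≤ Fintype.card V)
  have hn0 : (0:ℝ) < Fintype.card V := by linarith
  rcases hst V G (by omega) hG' with ⟨O, hO, hr⟩ | ⟨A, O, hA, hB, hO, hr⟩
  · left
    refine ⟨O, hO.trans (mul_le_mul_of_nonneg_right hκ3 hn0.le), fun x hx y hy => ?_⟩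
    exact (hp1 V G (by omega) hG' x y (hr x hx y hy)).mono (min_le_left _ _)
  set n : ℝ := (Fintype.card V : ℝ) with hnn
  have hO2 : (O.card : ℝ) ≤ ν * n := hO.trans (mul_le_mul_of_nonneg_right hκ3 hn0.le)
  have hO3 : (O.card : ℝ) ≤ μ/16 * n := hO.trans (mul_le_mul_of_nonneg_right hκ2 hn0.le)
  by_contra hcon
  push Not at hcon
  obtain ⟨hc1, hc2⟩ := hcon
  set a : V → Prop := fun v => v ∈ A with ha
  set b : V → Prop := fun v => v ∉ A with hb
  have key : ∀ S0 S1 S2 : V → Prop, (S0 = a ∨ S0 = b) → (S1 = a ∨ S1 = b) → (S2 = a ∨ S2 = b) →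
      μ * n^4 ≤ G.tc a S0 S1 S2 → G.tc b S0 S1 S2 < μ * n^4 := by
    intro S0 S1 S2 h0 h1 h2 hta
    by_contra htb
    push Not at htb
    have := hmg V G (by omega) hG' A O ![S0, S1, S2] hO3 hr (by
      intro i; fin_cases i
      · exact h0
      · exact h1
      · exact h2) hta htb
    obtain ⟨x, hx, y, hy, hxy⟩ := hc1 O hO2
    refine hxy ?_
    have h3 := hp2 V G (by omega) hG' x y (this x hx y hy)
    have e : 4*m+(4*M+3) = 4*M+(4*m+3) := by ring
    rw [e] at h3
    exact h3.mono (min_le_right _ _)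
  have hμn : μ * n^4 ≤ 1/10^7 * n^4 := mul_le_mul_of_nonneg_right hμ2 (by positivity)
  have k4 := key a a a (Or.inl rfl) (Or.inl rfl) (Or.inl rfl)
  have k3 := key a a b (Or.inl rfl) (Or.inl rfl) (Or.inr rfl)
  have k2 := key a b b (Or.inl rfl) (Or.inr rfl) (Or.inr rfl)
  have k1 := key b b b (Or.inr rfl) (Or.inr rfl) (Or.inr rfl)
  have hav : ∀ P : V → Prop, (av fun x => I (P x)) = (∑ x, I (P x)) / n := fun _ => rfl
  have ea : (av fun x => I (a x)) = A.card / n := by rw [hav, ha, sum_I_mem]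
  have eb : (av fun x => I (b x)) = Aᶜ.card / n := by rw [hav, hb, sum_I_nmem]
  have hs : (av fun x => I (a x)) + (av fun x => I (b x)) = 1 := by
    rw [ea, eb, ← add_div, div_eq_one_iff_eq (by linarith)]
    rw [hnn]; exact_mod_cast Finset.card_add_card_compl A
  have ha34 : 0.34 ≤ av fun x => I (a x) := by rw [ea, le_div_iff₀ hn0]; exact hA
  have hb34 : 0.34 ≤ av fun x => I (b x) := by rw [eb, le_div_iff₀ hn0]; exact hB
  have hba : ∀ x, b x ↔ ¬ a x := fun x => Iff.rfl
  have hab : ∀ x, a x ↔ ¬ b x := fun x => by simp [ha, hb]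
  have cdab := CDn_of G hG hn0 hba
  have cdba := CDn_of G hG hn0 hab
  -- permutations
  have p3a : G.tc a a b a = G.tc b a a a := by rw [tc_23, tc_12]
  have p3b : G.tc a a a b = G.tc b a a a := by rw [tc_34, tc_23, tc_12]
  have p2a : G.tc b a a b = G.tc a a b b := by rw [tc_12, tc_23]
  have p2b : G.tc a b b a = G.tc a a b b := by rw [tc_34, tc_23, tc_34, tc_23, tc_34, tc_23]
  have p2c : G.tc b b a a = G.tc a a b b := by rw [tc_23, tc_12, tc_34, tc_23]
  have p1a : G.tc b a b b = G.tc a b b b := by rw [tc_12]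
  have p1b : G.tc b b a b = G.tc a b b b := by rw [tc_23, tc_12]
  rw [p3b, p2a] at k3
  rw [p1a] at k2
  have extr : ∀ (A' : Finset V), 0.34 * n ≤ (A'.card : ℝ) → 0.34 * n ≤ (A'ᶜ.card : ℝ) →
      G.tc (fun v => v ∈ A') (fun v => v ∈ A') (fun v => v ∉ A') (fun v => v ∈ A') ≤ μ * n^4 →
      G.tc (fun v => v ∈ A') (fun v => v ∈ A') (fun v => v ∉ A') (fun v => v ∉ A') ≤ μ * n^4 → False := by
    intro A' h1 h2 h3 h4
    have h5 := few_edges G (A := fun v => v ∈ A') (B := fun v => v ∉ A') (fun _ => Iff.rfl) hG' hn0 h3 h4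
    have h6 := hc2 A' h1 h2
    have : 10 * μ * n^3 ≤ μe * n^3 := mul_le_mul_of_nonneg_right (by linarith) (by positivity)
    linarith
  by_cases c2 : μ * n^4 ≤ G.tc a a b b
  · have t3 : G.tc b a a a < μ * n^4 := by
      by_contra hh; push Not at hh; exact absurd (k3 hh) (not_lt.2 c2)
    have t1 := k2 c2
    rcases le_total (1/2) (av fun x => I (a x)) with hh | hh
    · exact caseIII G a b hba hn hs hh hb34 cdab (by rw [p3a]; linarith) (by linarith)
    · exact caseIII G b a hab hn (by linarith) (by linarith) ha34 cdba (by rw [p1b]; linarith) (by linarith)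
  push Not at c2
  by_cases c3 : μ * n^4 ≤ G.tc b a a a
  swap
  · push Not at c3
    exact extr A hA hB (by change G.tc a a b a ≤ _; rw [p3a]; linarith) c2.le
  by_cases c1 : μ * n^4 ≤ G.tc a b b b
  swap
  · push Not at c1
    refine extr Aᶜ hB (by rw [compl_compl]; exact hA) ?_ ?_
    · have : G.tc (fun v => v ∈ Aᶜ) (fun v => v ∈ Aᶜ) (fun v => v ∉ Aᶜ) (fun v => v ∈ Aᶜ) = G.tc b b a b := by
        congr 1 <;> (ext v; simp [ha, hb])
      rw [this, p1b]; linarith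
    · have : G.tc (fun v => v ∈ Aᶜ) (fun v => v ∈ Aᶜ) (fun v => v ∉ Aᶜ) (fun v => v ∉ Aᶜ) = G.tc b b a a := by
        congr 1 <;> (ext v; simp [ha, hb])
      rw [this, p2c]; linarith
  have t4 : G.tc a a a a < μ * n^4 := by
    by_contra hh; push Not at hh; exact absurd (k4 hh) (not_lt.2 c3)
  have t0 := k1 c1
  exact caseIV G a b hn hs ha34 hb34 cdab (by linarith) (by linarith) (by rw [p2b]; linarith) (by linarith)

end KF

open Finset

namespace KF
open Classical

section
variable {V : Type} [Fintype V] (G : G3 V)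

lemma Tl_on {S : Finset V} {T : Finset ↥S} (h : Tl (G.on S) T) : Tl G (T.map (Function.Embedding.subtype _)) := by
  induction h with
  | empty => simpa using Tl.empty
  | @cons T x y z t hT hK hd ih =>
    have e := Tl.union ih (Tl.of_K (G := G) (x := x.1) (y := y.1) (z := z.1) (t := t.1) hK) (by
      rw [Finset.disjoint_left]
      intro v hv hv2
      obtain ⟨w, hw, rfl⟩ := Finset.mem_map.1 hv
      refine Finset.disjoint_left.1 hd hw ?_
      simp only [Finset.mem_insert, Finset.mem_singleton, Function.Embedding.subtype_apply] at hv2 ⊢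
      rcases hv2 with h | h | h | h
      · exact Or.inl (Subtype.ext h)
      · exact Or.inr (Or.inl (Subtype.ext h))
      · exact Or.inr (Or.inr (Or.inl (Subtype.ext h)))
      · exact Or.inr (Or.inr (Or.inr (Subtype.ext h))))
    convert e using 1
    ext v
    simp only [Finset.mem_map, Finset.mem_union, Finset.mem_insert, Finset.mem_singleton, Function.Embedding.subtype_apply]
    constructor
    · rintro ⟨w, hw | rfl | rfl | rfl | rfl, rfl⟩
      · exact Or.inl ⟨w, hw, rfl⟩
      all_goals simp
    · rintro (⟨w, hw, rfl⟩ | rfl | rfl | rfl | rfl)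
      · exact ⟨w, Or.inl hw, rfl⟩
      · exact ⟨x, by simp, rfl⟩
      · exact ⟨y, by simp, rfl⟩
      · exact ⟨z, by simp, rfl⟩
      · exact ⟨t, by simp, rfl⟩

lemma sum_card_mul (U : Finset V) (c : ℝ) : ∑ t, I (t ∈ U) * c = U.card * c := by
  rw [← Finset.sum_mul, sum_I_mem]

/-- a general avoiding lemma for triples -/
lemma avoid3 (f : V → V → V → Prop) (U : Finset V)
    (h : 3 * (U.card : ℝ) * (Fintype.card V : ℝ)^2 < ∑ y, ∑ z, ∑ t, I (f y z t)) :
    ∃ y z t, f y z t ∧ y ∉ U ∧ z ∉ U ∧ t ∉ U := by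
  by_contra hcon
  push Not at hcon
  set n : ℝ := (Fintype.card V : ℝ) with hn
  have pt : ∀ y z t, I (f y z t) ≤ I (y ∈ U) + I (z ∈ U) + I (t ∈ U) := by
    intro y z t
    by_cases hf : f y z t
    swap
    · rw [I_false hf]; linarith [I_nonneg (y ∈ U), I_nonneg (z ∈ U), I_nonneg (t ∈ U)]
    have h0 := I_le_one (f y z t)
    by_cases h1 : y ∈ U
    · rw [I_true h1]; linarith [I_nonneg (z ∈ U), I_nonneg (t ∈ U)]
    by_cases h2 : z ∈ U
    · rw [I_true h2]; linarith [I_nonneg (y ∈ U), I_nonneg (t ∈ U)]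
    rw [I_true (hcon y z t hf h1 h2)]; linarith [I_nonneg (y ∈ U), I_nonneg (z ∈ U)]
  have h2 := h.trans_le (Finset.sum_le_sum fun y _ => Finset.sum_le_sum fun z _ => Finset.sum_le_sum fun t _ => pt y z t)
  simp only [Finset.sum_add_distrib, Finset.sum_const, Finset.card_univ, nsmul_eq_mul, ← Finset.mul_sum, sum_I_mem, ← hn] at h2
  linarith

/-- greedy covering of a small set -/
lemma cover {ε : ℝ} (hε0 : 0 ≤ ε) (hε : ε ≤ 1/400) (hn : (400:ℝ) ≤ Fintype.card V) (hG : G.CD (1/2 - ε)) (F : Finset V) (O : Finset V) :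
    4 * (O.card : ℝ) + F.card + 1 ≤ Fintype.card V / 30 →
    ∃ T : Finset V, O \ F ⊆ T ∧ Disjoint T F ∧ Tl G T ∧ T.card ≤ 4 * O.card := by
  induction O using Finset.induction_on with
  | empty => intro _; exact ⟨∅, by simp, by simp, Tl.empty, by simp⟩
  | insert v O hv ih =>
    intro hc
    rw [Finset.card_insert_of_notMem hv] at hc
    push_cast at hc
    obtain ⟨T, h1, h2, h3, h4⟩ := ih (by linarith)
    by_cases hvF : v ∈ T ∪ F
    · refine ⟨T, ?_, h2, h3, by rw [Finset.card_insert_of_notMem hv]; omega⟩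
      intro w hw
      rw [Finset.mem_sdiff, Finset.mem_insert] at hw
      rcases hw.1 with rfl | hw1
      · exact (Finset.mem_union.1 hvF).resolve_right hw.2
      · exact h1 (Finset.mem_sdiff.2 ⟨hw1, hw.2⟩)
    · obtain ⟨y, z, t, hK, hy, hz, ht⟩ := avoid3 (fun y z t => G.K v y z t) (T ∪ F) (by
        refine lt_of_lt_of_le ?_ (G.tiles_at hε0 hε hn hG v)
        have e1 : ((T ∪ F).card : ℝ) ≤ T.card + F.card := by exact_mod_cast Finset.card_union_le T F
        have e2 : (T.card : ℝ) ≤ 4 * O.card := by exact_mod_cast h4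
        have e3 : ((T ∪ F).card : ℝ) ≤ Fintype.card V / 30 := by linarith
        have e4 : 0 < (Fintype.card V : ℝ)^3 := by positivity
        calc 3 * ((T ∪ F).card : ℝ) * (Fintype.card V : ℝ)^2 ≤ 3 * (Fintype.card V / 30 : ℝ) * (Fintype.card V : ℝ)^2 := by gcongr
          _ < (Fintype.card V : ℝ)^3 / 9 := by nlinarith)
      simp only [Finset.mem_union, not_or] at hvF hy hz ht
      refine ⟨T ∪ {v, y, z, t}, ?_, ?_, Tl.union h3 (Tl.of_K hK) ?_, ?_⟩
      · intro w hw
        rw [Finset.mem_sdiff, Finset.mem_insert] at hw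
        rcases hw.1 with rfl | hw1
        · simp
        · exact Finset.mem_union_left _ (h1 (Finset.mem_sdiff.2 ⟨hw1, hw.2⟩))
      · rw [Finset.disjoint_union_left]
        refine ⟨h2, ?_⟩
        simp [hvF.2, hy.2, hz.2, ht.2]
      · simp [hvF.1, hy.1, hz.1, ht.1]
      · rw [Finset.card_insert_of_notMem hv]
        have := Finset.card_union_le T {v, y, z, t}
        rw [card_K hK] at this
        omega

end

/-- final assembly -/
lemma assemble : ∃ ε : ℝ, 0 < ε ∧ ε ≤ 1/10^7 ∧ ∀ (m : ℕ) (β : ℝ), 0 < β → β ≤ 1 → ∃ c : ℝ, 0 < c ∧ c ≤ ε ∧ ∃ N0 : ℕ,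
    ∀ (V : Type) [Fintype V] (G : G3 V), N0 ≤ Fintype.card V → G.CD (1/2 - ε) → ∀ (gd : (Fin 4 → V) → Prop),
    (∀ q, gd q → Function.Injective q ∧ β * (Fintype.card V : ℝ)^4 ≤
      ∑ p : Fin 4 → V, I (G.K (p 0) (p 1) (p 2) (p 3) ∧ ∀ i, Rch G m β (q i) (p i))) →
    ∀ O F : Finset V, (O.card : ℝ) ≤ ε * Fintype.card V → (F.card : ℝ) ≤ c * Fintype.card V →
    (∀ L0 : Finset V, Disjoint L0 (O ∪ F) → (L0.card : ℝ) ≤ c / 100 * Fintype.card V → 4 ∣ L0.card + F.card →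
      ∃ Y, Y ⊆ F ∧ Tl G Y ∧ ∃ k : ℕ, (k:ℝ) ≤ c * Fintype.card V ∧ Dc gd k (L0 ∪ (F \ Y))) →
    4 ∣ Fintype.card V → Tl G univ := by
  obtain ⟨ε, hε0, hε1, hal⟩ := almost
  refine ⟨ε/100, by positivity, by linarith, fun m β hβ hβ1 => ?_⟩
  obtain ⟨c0, hc0, N0, hab⟩ := absorbR m β (ε/100) hβ hβ1 (by positivity)
  obtain ⟨c, hc, hcc, hcε⟩ : ∃ c : ℝ, 0 < c ∧ c ≤ c0 ∧ c ≤ ε/100 :=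
    ⟨min c0 (ε/100), by positivity, min_le_left _ _, min_le_right _ _⟩
  obtain ⟨m0, hal⟩ := hal (c/100) (by positivity) (by linarith)
  refine ⟨c, hc, hcε, N0 + 2 * m0 + 400, ?_⟩
  intro V _ G hN hG gd hgd O F hO hF hL h4
  have hn : (400:ℝ) ≤ Fintype.card V := by exact_mod_cast (by omega : 400 ≤ Fintype.card V)
  have hcn : c * (Fintype.card V : ℝ) ≤ c0 * Fintype.card V := mul_le_mul_of_nonneg_right hcc (by positivity)
  have hcn2 : c * (Fintype.card V : ℝ) ≤ ε/100 * Fintype.card V := mul_le_mul_of_nonneg_right hcε (by positivity)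
  obtain ⟨W, hW1, hW2, hW3, hW4⟩ := hab V G (by omega) gd hgd F (hF.trans hcn)
  have hWF : ((W ∪ F).card : ℝ) ≤ W.card + F.card := by exact_mod_cast Finset.card_union_le W F
  have hsm : ε / 100 * (Fintype.card V : ℝ) ≤ 1/10^7 * Fintype.card V := mul_le_mul_of_nonneg_right (by linarith) (by positivity)
  obtain ⟨T, hT1, hT2, hT3, hT4⟩ := cover G (by positivity) (by linarith : ε/100 ≤ 1/400) hn hG (W ∪ F) O (by
    linarith)
  have hT4' : (T.card : ℝ) ≤ 4 * O.card := by exact_mod_cast hT4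
  set S : Finset V := (W ∪ F ∪ T)ᶜ with hS
  have hSc : ((W ∪ F ∪ T).card : ℝ) ≤ 6 * (ε / 100 * Fintype.card V) := by
    have : ((W ∪ F ∪ T).card : ℝ) ≤ (W ∪ F).card + T.card := by exact_mod_cast Finset.card_union_le (W ∪ F) T
    linarith
  have hSc2 : (S.card : ℝ) = Fintype.card V - (W ∪ F ∪ T).card := by
    rw [hS, Finset.card_compl, Nat.cast_sub (Finset.card_le_univ _)]
  have hSn : (S.card : ℝ) ≤ Fintype.card V := by exact_mod_cast Finset.card_le_univ S
  obtain ⟨L', hL1, hL2⟩ := hal ↥S (G.on S) (by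
      rw [Fintype.card_coe]
      have : (m0 : ℝ) ≤ S.card := by
        have e : ((2 * m0 : ℕ) : ℝ) ≤ Fintype.card V := by exact_mod_cast (by omega : 2 * m0 ≤ Fintype.card V)
        push_cast at e
        linarith
      exact_mod_cast this) (by
      intro x y hxy
      rw [G.on_sum, Fintype.card_coe]
      have h1 := hG x y (fun h => hxy (Subtype.ext h))
      have h2 := sum_univ_le_add_compl S (fun z => G.E x y z)
      have h3 : (1/2 - ε) * (S.card : ℝ) ≤ (1/2 - ε) * Fintype.card V := mul_le_mul_of_nonneg_left hSn (by linarith)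
      have h4 : 0 ≤ ε * (Fintype.card V : ℝ) := by positivity
      linarith)
  rw [Fintype.card_coe] at hL1
  set L0 : Finset V := L'.map (Function.Embedding.subtype _) with hL0
  have hL0c : L0.card = L'.card := Finset.card_map _
  have hL0S : L0 ⊆ S := fun v hv => by
    obtain ⟨w, -, rfl⟩ := Finset.mem_map.1 hv
    exact w.2
  have hrest : Tl G (S \ L0) := by
    have := Tl_on G hL2
    convert this using 1
    ext v
    simp only [hL0, Finset.mem_sdiff, Finset.mem_map, Finset.mem_compl, Function.Embedding.subtype_apply]
    constructor
    · rintro ⟨h1, h2⟩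
      exact ⟨⟨v, h1⟩, fun h => h2 ⟨_, h, rfl⟩, rfl⟩
    · rintro ⟨w, hw, rfl⟩
      refine ⟨w.2, ?_⟩
      rintro ⟨u, hu, he⟩
      exact hw (by rwa [← Subtype.ext he])
  have mS : ∀ v, v ∈ S ↔ v ∉ W ∧ v ∉ F ∧ v ∉ T := by intro v; simp [hS, and_assoc]
  have dWF : ∀ v, v ∈ W → v ∉ F := fun v h1 h2 => Finset.disjoint_left.1 hW2 h1 h2
  have dT : ∀ v, v ∈ T → v ∉ W ∧ v ∉ F := fun v h1 => by
    have := Finset.disjoint_left.1 hT2 h1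
    simpa using this
  have hOc : ∀ v, v ∈ O → v ∈ W ∨ v ∈ F ∨ v ∈ T := by
    intro v hv
    by_contra hh
    push Not at hh
    exact hh.2.2 (hT1 (by simp [hv, hh.1, hh.2.1]))
  obtain ⟨Y, hYF, hY, k, hk, hD⟩ := hL L0 (by
      rw [Finset.disjoint_left]
      intro v hv hv2
      have h1 := (mS v).1 (hL0S hv)
      rcases Finset.mem_union.1 hv2 with h | h
      · rcases hOc v h with h | h | h
        · exact h1.1 h
        · exact h1.2.1 h
        · exact h1.2.2 h
      · exact h1.2.1 h) (by
      rw [hL0c]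
      refine hL1.trans (mul_le_mul_of_nonneg_left hSn (by positivity))) (by
      have e1 := hW1.card
      have e2 := hT3.card
      have e3 := hrest.card
      rw [Finset.card_sdiff_of_subset hL0S] at e3
      have e4 : S.card + (W ∪ F ∪ T).card = Fintype.card V := by
        rw [hS]; have := Finset.card_add_card_compl (W ∪ F ∪ T); omega
      rw [Finset.card_union_of_disjoint hT2.symm, Finset.card_union_of_disjoint hW2] at e4
      have e5 := Finset.card_le_card hL0S
      omega)
  have hfin := hW4 k _ hD (hk.trans hcn) (by
    rw [Finset.disjoint_left]
    intro v hv hv2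
    rcases Finset.mem_union.1 hv with h | h
    · exact ((mS v).1 (hL0S h)).1 hv2
    · exact dWF v hv2 (Finset.mem_sdiff.1 h).1)
  have f1 := Tl.union hfin hY (by
    rw [Finset.disjoint_left]
    intro v hv hv2
    rcases Finset.mem_union.1 hv with h | h
    · exact dWF v h (hYF hv2)
    · rcases Finset.mem_union.1 h with h | h
      · exact ((mS v).1 (hL0S h)).2.1 (hYF hv2)
      · exact (Finset.mem_sdiff.1 h).2 hv2)
  have f2 := Tl.union f1 hT3 (by
    rw [Finset.disjoint_left]
    intro v hv hv2
    have := dT v hv2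
    rcases Finset.mem_union.1 hv with h | h
    · rcases Finset.mem_union.1 h with h | h
      · exact this.1 h
      · rcases Finset.mem_union.1 h with h | h
        · exact ((mS v).1 (hL0S h)).2.2 hv2
        · exact this.2 (Finset.mem_sdiff.1 h).1
    · exact this.2 (hYF h))
  have f3 := Tl.union f2 hrest (by
    rw [Finset.disjoint_left]
    intro v hv hv2
    rw [Finset.mem_sdiff, mS] at hv2
    simp only [Finset.mem_union, Finset.mem_sdiff] at hv
    rcases hv with ((h | h | h) | h) | h
    · exact hv2.1.1 h
    · exact hv2.2 h
    · exact hv2.1.2.1 h.1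
    · exact hv2.1.2.1 (hYF h)
    · exact hv2.1.2.2 h)
  convert f3
  refine (Finset.eq_univ_of_forall fun v => ?_).symm
  simp only [Finset.mem_union, Finset.mem_sdiff, mS]
  tauto

end KF

open Finset

namespace KF
open Classical

lemma rg_mem {V : Type} (q : Fin 4 → V) (i : Fin 4) : q i ∈ rg q := mem_rg.2 ⟨i, rfl⟩

/-- splitting a set into arbitrary 4-tuples -/
lemma Dc_all {V : Type} (gd : (Fin 4 → V) → Prop) (P : Finset V)
    (h : ∀ q : Fin 4 → V, Function.Injective q → (∀ i, q i ∈ P) → gd q) (k : ℕ) :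
    ∀ L : Finset V, L ⊆ P → L.card = 4 * k → Dc gd k L := by
  induction k with
  | zero =>
    intro L _ hc
    have : L = ∅ := Finset.card_eq_zero.1 (by omega)
    rw [this]; exact Dc.nil
  | succ k ih =>
    intro L hL hc
    obtain ⟨Q, hQ, hQc⟩ := Finset.exists_subset_card_eq (show 4 ≤ L.card by omega)
    let e := Q.equivFin.symm
    let q : Fin 4 → V := fun i => (e (Fin.cast hQc.symm i)).1
    have hqi : Function.Injective q := by
      intro i j hij
      have := e.injective (Subtype.ext hij)
      simpa using this
    have hrg : rg q = Q := by
      ext v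
      rw [mem_rg]
      constructor
      · rintro ⟨i, rfl⟩; exact (e _).2
      · intro hv
        refine ⟨Fin.cast hQc (e.symm ⟨v, hv⟩), ?_⟩
        simp [q]
    have h1 := ih (L \ Q) ((Finset.sdiff_subset).trans hL) (by rw [Finset.card_sdiff_of_subset hQ]; omega)
    have h2 := Dc.step h1 (h q hqi fun i => hL (hQ (by rw [← hrg]; exact rg_mem q i))) (by
      rw [hrg]; exact Finset.sdiff_disjoint)
    rw [hrg, Finset.sdiff_union_of_subset hQ] at h2
    exact h2

/-- non-extremal case -/
lemma case1 : ∃ ε : ℝ, 0 < ε ∧ ε ≤ 1/10^7 ∧ ∀ (m : ℕ) (β : ℝ), 0 < β → ∃ N0 : ℕ,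
    ∀ (V : Type) [Fintype V] (G : G3 V), N0 ≤ Fintype.card V → G.CD (1/2 - ε) →
    ∀ O : Finset V, (O.card : ℝ) ≤ ε * Fintype.card V → (∀ x, x ∉ O → ∀ y, y ∉ O → Rch G m β x y) →
    4 ∣ Fintype.card V → Tl G univ := by
  obtain ⟨ε, hε0, hε1, has⟩ := assemble
  refine ⟨ε, hε0, hε1, fun m β hβ => ?_⟩
  obtain ⟨c, hc, hcε, N0, h⟩ := has m (min β (1/10)) (by positivity) ((min_le_right _ _).trans (by norm_num))
  refine ⟨N0 + 400, ?_⟩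
  intro V _ G hN hG O hO hr h4
  have hn : (400:ℝ) ≤ Fintype.card V := by exact_mod_cast (by omega : 400 ≤ Fintype.card V)
  refine h V G (by omega) hG (fun q => Function.Injective q ∧ ∀ i, q i ∈ Oᶜ) ?_ O ∅ hO (by simp; positivity) ?_ h4
  · rintro q ⟨hq1, hq2⟩
    refine ⟨hq1, ?_⟩
    have h1 := tiles_total G hε0.le (by linarith) hn hG
    have h2 := hit_count (ι := Fin 4) O
    rw [Fintype.card_fin] at h2
    set n : ℝ := (Fintype.card V : ℝ) with hnn
    have hn0 : 0 < n := by linarith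
    have h3 : (∑ g : Fin 4 → V, I (∃ i, g i ∈ O)) ≤ 1/100 * n^4 := by
      refine le_of_mul_le_mul_right ?_ hn0
      refine h2.trans ?_
      push_cast
      have : 4 * (O.card : ℝ) * n^4 ≤ 4 * (1/10^7 * n) * n^4 := by
        have : (O.card : ℝ) ≤ 1/10^7 * n := hO.trans (mul_le_mul_of_nonneg_right hε1 hn0.le)
        gcongr
      have : 0 < n^5 := by positivity
      nlinarith
    have pt : ∀ p : Fin 4 → V, I (G.K (p 0) (p 1) (p 2) (p 3)) ≤
        I (G.K (p 0) (p 1) (p 2) (p 3) ∧ ∀ i, Rch G m (min β (1/10)) (q i) (p i)) + I (∃ i, p i ∈ O) := by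
      intro p
      by_cases hp : ∃ i, p i ∈ O
      · rw [I_true hp]; linarith [I_le_one (G.K (p 0) (p 1) (p 2) (p 3)), I_nonneg (G.K (p 0) (p 1) (p 2) (p 3) ∧ ∀ i, Rch G m (min β (1/10)) (q i) (p i))]
      · rw [I_false hp, add_zero]
        push Not at hp
        exact I_mono fun hK => ⟨hK, fun i => (hr _ (by simpa using hq2 i) _ (hp i)).mono (min_le_left _ _)⟩
    have h5 := Finset.sum_le_sum fun p (_ : p ∈ (univ : Finset (Fin 4 → V))) => pt p
    rw [Finset.sum_add_distrib] at h5
    have h6 : min β (1/10) * n^4 ≤ 1/10 * n^4 := mul_le_mul_of_nonneg_right (min_le_right _ _) (by positivity)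
    have : 0 < n^4 := by positivity
    linarith
  · intro L0 hL0 hc0 h40
    refine ⟨∅, by simp, Tl.empty, L0.card / 4, ?_, ?_⟩
    · have : ((L0.card / 4 : ℕ) : ℝ) ≤ L0.card := by exact_mod_cast Nat.div_le_self _ _
      have h7 : c / 100 * (Fintype.card V : ℝ) ≤ c * Fintype.card V := mul_le_mul_of_nonneg_right (by linarith) (by positivity)
      linarith
    · rw [Finset.sdiff_self, Finset.union_empty]
      rw [Finset.card_empty, add_zero] at h40
      refine Dc_all _ Oᶜ (fun q h1 h2 => ⟨h1, h2⟩) _ L0 ?_ (by omega)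
      intro v hv
      rw [Finset.union_empty] at hL0
      exact Finset.mem_compl.2 (Finset.disjoint_left.1 hL0 hv)

end KF

open Finset

namespace KF
open Classical

/-- the extremal structure -/
structure Ext {V : Type} [Fintype V] (G : G3 V) (A B O : Finset V) (ε : ℝ) : Prop where
  dAB : ∀ v, v ∈ A → v ∉ B
  dAO : ∀ v, v ∈ A → v ∉ O
  dBO : ∀ v, v ∈ B → v ∉ O
  un : ∀ v, v ∈ A ∨ v ∈ B ∨ v ∈ O
  cA : 0.499 * Fintype.card V ≤ (A.card : ℝ)
  cA' : (A.card : ℝ) ≤ 0.501 * Fintype.card V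
  cB : 0.499 * Fintype.card V ≤ (B.card : ℝ)
  cB' : (B.card : ℝ) ≤ 0.501 * Fintype.card V
  cO : (O.card : ℝ) ≤ ε * Fintype.card V
  cO' : (O.card : ℝ) ≤ 1/1000 * Fintype.card V
  a1 : ∀ v ∈ A, ∑ y, ∑ z, I (y ∈ A ∧ z ∈ A ∧ ¬ G.E v y z) ≤ 1/1000 * (Fintype.card V : ℝ)^2
  a2 : ∀ v ∈ A, ∑ y, ∑ z, I (y ∈ A ∧ z ∈ B ∧ G.E v y z) ≤ 1/1000 * (Fintype.card V : ℝ)^2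
  b1 : ∀ v ∈ B, ∑ y, ∑ z, I (y ∈ A ∧ z ∈ B ∧ ¬ G.E v y z) ≤ 1/1000 * (Fintype.card V : ℝ)^2
  b2 : ∀ v ∈ B, ∑ y, ∑ z, I (y ∈ A ∧ z ∈ A ∧ G.E v y z) ≤ 1/1000 * (Fintype.card V : ℝ)^2
  o1 : ∀ v ∈ O, 1/20000 * (Fintype.card V : ℝ)^2 ≤ ∑ y, ∑ z, I (y ∈ A ∧ z ∈ A ∧ G.E v y z)
  o2 : ∀ v ∈ O, 1/20000 * (Fintype.card V : ℝ)^2 ≤ ∑ y, ∑ z, I (y ∈ A ∧ z ∈ B ∧ G.E v y z)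
  ta : ∑ x, ∑ y, ∑ z, I (x ∈ A ∧ y ∈ A ∧ z ∈ A ∧ ¬ G.E x y z) ≤ 1/10^11 * (Fintype.card V : ℝ)^3
  tb : ∑ x, ∑ y, ∑ z, I (x ∈ A ∧ y ∈ B ∧ z ∈ B ∧ ¬ G.E x y z) ≤ 1/10^11 * (Fintype.card V : ℝ)^3

section
variable {V : Type} [Fintype V] (G : G3 V)

lemma CDn_of' {μ : ℝ} (hμ : 0 ≤ μ) (hG : G.CD (1/2 - μ)) (hn : (0:ℝ) < Fintype.card V) {A B : V → Prop} (hAB : ∀ x, B x ↔ ¬ A x) : CDn G A B μ := by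
  intro x y
  by_cases h : x = y
  · rw [I_true h]; linarith [u_nonneg G A x y, u_nonneg G B x y]
  · rw [I_false h, add_zero]
    have := hG x y h
    rw [u_eq, u_eq, ← add_div, le_div_iff₀ hn]
    refine this.trans (le_of_eq ?_)
    unfold G3.d
    rw [← Finset.sum_add_distrib]
    refine Finset.sum_congr rfl fun z _ => ?_
    by_cases hE : G.E x y z <;> by_cases hA : A z <;> simp [I, hE, hA, hAB z]

lemma m2_tr (hn : (0:ℝ) < Fintype.card V) {P Q P' Q' S : V → Prop} {f : V → V → ℝ} (h0 : ∀ x y, 0 ≤ f x y) (h1 : ∀ x y, f x y ≤ 1)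
    (hP : ∀ x, P x → P' x ∨ S x) (hQ : ∀ x, Q x → Q' x ∨ S x) :
    m2 P Q f ≤ m2 P' Q' f + 2 * av fun x => I (S x) := by
  have key : m2 P Q f ≤ av fun x => av fun y => (I (P' x) * I (Q' y) * f x y + (I (S x) + I (S y))) := by
    refine av_mono fun x => av_mono fun y => ?_
    have a := h0 x y
    have b := h1 x y
    have c := I_nonneg (S x)
    have d := I_nonneg (S y)
    have e : 0 ≤ I (P' x) * I (Q' y) * f x y := mul_nonneg (mul_nonneg (I_nonneg _) (I_nonneg _)) a
    by_cases hp : P x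
    swap
    · rw [I_false hp]; linarith
    by_cases hq : Q y
    swap
    · rw [I_false hq]; linarith
    rw [I_true hp, I_true hq]
    rcases hP x hp with h | h
    · rcases hQ y hq with h' | h'
      · rw [I_true h, I_true h']; linarith
      · rw [I_true h']; linarith
    · rw [I_true h]; linarith
  refine key.trans (le_of_eq ?_)
  simp only [av_add]
  rw [av_const hn]
  have : av (fun x : V => av fun _ : V => I (S x)) = av fun x => I (S x) := av_congr fun x => av_const hn _
  rw [this]; unfold m2; ring

lemma m2_sum (P Q : V → Prop) (R : V → V → Prop) (hn : (0:ℝ) < Fintype.card V) :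
    ∑ y, ∑ z, I (P y ∧ Q z ∧ R y z) = m2 P Q (fun y z => I (R y z)) * (Fintype.card V : ℝ)^2 := by
  unfold m2
  rw [av2_eq, div_mul_cancel₀ _ (by positivity)]
  refine Finset.sum_congr rfl fun y _ => Finset.sum_congr rfl fun z _ => ?_
  rw [I_and, I_and]; ring

lemma m3_sum (T P Q : V → Prop) (R : V → V → V → Prop) (hn : (0:ℝ) < Fintype.card V) :
    ∑ x, ∑ y, ∑ z, I (T x ∧ P y ∧ Q z ∧ R x y z) = (av fun x => I (T x) * m2 P Q (fun y z => I (R x y z))) * (Fintype.card V : ℝ)^3 := by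
  unfold av
  rw [div_mul_eq_mul_div, eq_div_iff (by positivity), Finset.sum_mul, Finset.sum_mul]
  refine Finset.sum_congr rfl fun x _ => ?_
  have := m2_sum P Q (R x) hn
  simp only [I_and] at this ⊢
  simp only [← Finset.mul_sum]
  simp only [← Finset.mul_sum] at this
  rw [this]; ring

lemma N_link (P Q R : V → Prop) : G.N P Q R = av fun x => I (P x) * m2 Q R (fun y z => I (G.E x y z)) := by
  unfold G3.N m2 G3.u
  simp only [← av_cmul]
  refine av_congr fun x => av_congr fun y => av_congr fun z => ?_
  ring

lemma m2_compl (P Q : V → Prop) (R : V → V → Prop) :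
    m2 P Q (fun y z => I (¬ R y z)) = (av fun x => I (P x)) * (av fun x => I (Q x)) - m2 P Q (fun y z => I (R y z)) := by
  have := m2_add P Q (fun y z => I (¬ R y z)) (fun y z => I (R y z))
  have h2 : m2 P Q (fun y z => I (¬ R y z) + I (R y z)) = m2 P Q (fun _ _ => 1) := by
    congr 1; ext y z; rw [I_not]; ring
  rw [h2, m2_const] at this
  linarith

lemma link_cd {A B : V → Prop} {μ : ℝ} (hn : (0:ℝ) < Fintype.card V) (h : CDn G A B μ) (v : V) :
    (1/2 - μ) * (av fun x => I (A x)) - 1 / Fintype.card V ≤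
      m2 A A (fun y z => I (G.E v y z)) + m2 A B (fun y z => I (G.E v y z)) := by
  have e : ∀ Q : V → Prop, m2 A Q (fun y z => I (G.E v y z)) = av fun y => I (A y) * G.u Q v y := by
    intro Q
    unfold m2 G3.u
    simp only [← av_cmul]
    refine av_congr fun y => av_congr fun z => ?_
    ring
  rw [e, e, ← av_add, ← av_eq_diag v, ← av_cmul, ← av_sub]
  refine av_mono fun y => ?_
  have := h v y
  by_cases hA : A y
  · rw [I_true hA]; linarith
  · rw [I_false hA]; linarith [I_nonneg (v = y)]

lemma av3_tr (hn : (0:ℝ) < Fintype.card V) {T T' S : V → Prop} {f g : V → ℝ} {σ : ℝ} (h0 : ∀ x, 0 ≤ g x)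
    (h1 : ∀ x, f x ≤ 1) (hfg : ∀ x, f x ≤ g x + 2 * σ) (hσ : 0 ≤ σ) (hT : ∀ x, T x → T' x ∨ S x) (hS : av (fun x => I (S x)) = σ) :
    av (fun x => I (T x) * f x) ≤ av (fun x => I (T' x) * g x) + 3 * σ := by
  have : av (fun x => I (T x) * f x) ≤ av fun x => I (T' x) * g x + (I (S x) + 2 * σ) := by
    refine av_mono fun x => ?_
    have a := h0 x
    have b := h1 x
    have c := I_nonneg (S x)
    have d := hfg x
    have e : 0 ≤ I (T' x) * g x := mul_nonneg (I_nonneg _) a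
    by_cases hp : T x
    · rw [I_true hp]
      rcases hT x hp with h | h
      · rw [I_true h]; linarith
      · rw [I_true h]; linarith
    · rw [I_false hp]; linarith
  refine this.trans (le_of_eq ?_)
  rw [av_add, av_add, av_const hn, hS]; ring

lemma ext_arith1 {α β μ X w : ℝ} (hs : α + β = 1) (ha : 0.34 ≤ α) (hb : 0.34 ≤ β) (hμ : 0 < μ) (hμ1 : μ ≤ 1/10^16)
    (hw : w ≤ μ) (h : (1/2 - μ) * (α * β) - μ ≤ w + X) (hX : X ≤ α * β * β) : 1/2 - 20 * μ ≤ β := by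
  by_contra hh
  push Not at hh
  have h1 : α * β * (1/2 - μ - β) ≤ 2 * μ := by nlinarith
  have h2 : 0.11 ≤ α * β := by nlinarith
  nlinarith

lemma ext_arith2 {α μ X w : ℝ} (ha : 0.34 ≤ α) (hμ : 0 < μ) (hμ1 : μ ≤ 1/10^16)
    (hw : w ≤ μ) (h : (1/2 - μ) * (α * α) - μ ≤ X + w) (hX : X ≤ α * α * α) : 1/2 - 20 * μ ≤ α := by
  by_contra hh
  push Not at hh
  have h1 : α * α * (1/2 - μ - α) ≤ 2 * μ := by nlinarith
  have h2 : 0.11 ≤ α * α := by nlinarith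
  nlinarith

lemma ext_arith3 {α β μ X w : ℝ} (ha : 0 ≤ α) (ha1 : α ≤ 1) (hb0 : 0 ≤ β) (hb1 : β ≤ 1) (hμ : 0 < μ)
    (hw : w ≤ μ) (h : (1/2 - μ) * (α * β) - μ ≤ w + X) (hb : β ≤ 1/2 + 20 * μ) : α * β * β - X ≤ 25 * μ := by
  have h1 : α * β * β ≤ α * β * (1/2 + 20 * μ) := mul_le_mul_of_nonneg_left hb (by positivity)
  have h2 : α * β ≤ 1 := mul_le_one₀ ha1 hb0 hb1
  have h3 : α * β * (21 * μ) ≤ 1 * (21*μ) := mul_le_mul_of_nonneg_right h2 (by positivity)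
  nlinarith

lemma ext_arith4 {α β μ X w : ℝ} (ha : 0 ≤ α) (ha1 : α ≤ 1) (hμ : 0 < μ) (τ : ℝ)
    (hw : w ≤ τ) (h : (1/2 - μ) * α - μ ≤ X + w) (hb : β ≤ 1/2 + 20 * μ) : α * β - X ≤ 22 * μ + τ := by
  have h1 : α * β ≤ α * (1/2 + 20 * μ) := mul_le_mul_of_nonneg_left hb (by positivity)
  have h3 : α * (21 * μ) ≤ 1 * (21*μ) := mul_le_mul_of_nonneg_right ha1 (by positivity)
  nlinarith

end
end KF

open Finset

namespace KF
open Classical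

lemma av_card {V : Type} [Fintype V] (hn : (0:ℝ) < Fintype.card V) (A : Finset V) :
    (A.card : ℝ) = (av fun x => I (x ∈ A)) * Fintype.card V := by
  unfold av; rw [sum_I_mem, div_mul_cancel₀ _ hn.ne']

lemma av_S_le {V : Type} [Fintype V] {a : V → Prop} {f : V → ℝ} {τ μ : ℝ} (hτ : 0 < τ) (h0 : ∀ x, 0 ≤ f x)
    (h : av (fun x => I (a x) * f x) ≤ μ) : av (fun x => I (a x ∧ τ < f x)) ≤ μ / τ := by
  rw [le_div_iff₀ hτ, ← av_mulc]
  refine (av_mono fun x => ?_).trans h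
  have := mul_nonneg (I_nonneg (a x)) (h0 x)
  by_cases h1 : a x
  · by_cases h2 : τ < f x
    · rw [I_true ⟨h1, h2⟩, I_true h1]; linarith
    · rw [I_false (fun h => h2 h.2)]; linarith
  · rw [I_false (fun h => h1 h.1)]; linarith

lemma ext_of (ε : ℝ) (hε : 0 < ε) : ∃ μ : ℝ, 0 < μ ∧ ∀ (V : Type) [Fintype V] (G : G3 V), 1/μ ≤ (Fintype.card V : ℝ) →
    G.CD (1/2 - μ) → ∀ A0 : Finset V, 0.34 * Fintype.card V ≤ (A0.card : ℝ) → 0.34 * Fintype.card V ≤ (A0ᶜ.card : ℝ) →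
      ∑ x, ∑ y, ∑ z, I (G.E x y z ∧ x ∈ A0 ∧ y ∈ A0 ∧ z ∉ A0) ≤ μ * (Fintype.card V : ℝ)^3 →
    ∃ A B O : Finset V, Ext G A B O ε := by
  obtain ⟨μ, hμ, hμ1, hμ2⟩ : ∃ μ : ℝ, 0 < μ ∧ μ ≤ 1/10^16 ∧ μ ≤ ε/10^5 :=
    ⟨min (1/10^16) (ε/10^5), by positivity, min_le_left _ _, min_le_right _ _⟩
  refine ⟨μ, hμ, ?_⟩
  intro V _ G hN hG A0 hA0 hB0 hw0
  have hn : (0:ℝ) < Fintype.card V := lt_of_lt_of_le (by positivity) hN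
  have hn1 : 1 / (Fintype.card V : ℝ) ≤ μ := by
    rw [div_le_iff₀ hn]; rw [div_le_iff₀ hμ] at hN; linarith
  have hcd : CDn G (fun x => x ∈ A0) (fun x => x ∉ A0) μ := CDn_of' G hμ.le hG hn (fun _ => Iff.rfl)
  set a : V → Prop := fun x => x ∈ A0 with ha
  set b : V → Prop := fun x => x ∉ A0 with hb
  set α := av fun x => I (a x) with hα
  set β := av fun x => I (b x) with hβ
  have hs : α + β = 1 := by
    rw [hα, hβ, ← av_add, ← av_const hn 1]
    refine av_congr fun x => ?_
    change I (a x) + I (¬ a x) = 1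
    rw [I_not]; ring
  have hα34 : 0.34 ≤ α := by
    rw [av_card hn] at hA0; exact le_of_mul_le_mul_right hA0 hn
  have hβ34 : 0.34 ≤ β := by
    rw [← sum_I_nmem] at hB0
    change 0.34 ≤ (∑ t, I (t ∉ A0)) / _
    rw [le_div_iff₀ hn]; exact hB0
  have hw : G.N a a b ≤ μ := by
    rw [N_link]
    have := m3_sum a a b G.E hn
    have h2 : ∑ x, ∑ y, ∑ z, I (a x ∧ a y ∧ b z ∧ G.E x y z) ≤ μ * (Fintype.card V : ℝ)^3 := by
      refine le_trans (le_of_eq ?_) hw0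
      refine Finset.sum_congr rfl fun x _ => Finset.sum_congr rfl fun y _ => Finset.sum_congr rfl fun z _ => I_congr ?_
      simp only [ha, hb]; tauto
    rw [this] at h2
    exact le_of_mul_le_mul_right h2 (by positivity)
  have hXle : ∀ P Q R : V → Prop, G.N P Q R ≤ (av fun x => I (P x)) * (av fun x => I (Q x)) * (av fun x => I (R x)) := by
    intro P Q R
    rw [N_m2]
    refine (m2_mono fun x y _ _ => u_le G R x y).trans (le_of_eq ?_)
    rw [m2_const]; ring
  have c1 := cd_N G hn hcd a a
  have c2 := cd_N G hn hcd a b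
  have hw' : G.N a b a ≤ μ := by rw [N_swap23]; exact hw
  have hw'' : G.N b a a ≤ μ := by rw [N_swap12]; exact hw'
  have hαl : 1/2 - 20*μ ≤ α := ext_arith2 hα34 hμ hμ1 hw (by linarith) (hXle a a a)
  have hβl : 1/2 - 20*μ ≤ β := ext_arith1 hs hα34 hβ34 hμ hμ1 hw' (by linarith) (hXle a b b)
  have hαu : α ≤ 1/2 + 20*μ := by linarith
  have hβu : β ≤ 1/2 + 20*μ := by linarith
  have hX3 : α * α * α - G.N a a a ≤ 25*μ := ext_arith3 (by linarith) (by linarith) (by linarith) (by linarith) hμ hw (by linarith) hαu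
  have hX4 : α * β * β - G.N a b b ≤ 25*μ := ext_arith3 (by linarith) (by linarith) (by linarith) (by linarith) hμ hw' (by linarith) hβu
  set τ : ℝ := 1/10^4 with hτ
  set LA : V → ℝ := fun v => m2 a a (fun y z => I (G.E v y z)) with hLA
  set LB : V → ℝ := fun v => m2 a b (fun y z => I (G.E v y z)) with hLB
  have hL : ∀ v, (1/2 - μ) * α - μ ≤ LA v + LB v := fun v => by
    have := link_cd G hn hcd v
    linarith
  have hL2 : ∀ v, LB v ≤ τ → τ < LA v := fun v h => by
    have := hL v
    have h2 : 0.49 * 0.34 ≤ (1/2 - μ) * α := mul_le_mul (by linarith) hα34 (by norm_num) (by linarith)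
    rw [hτ] at *
    linarith
  have hLA0 : ∀ v, 0 ≤ LA v := fun v => m2_nonneg fun _ _ _ _ => I_nonneg _
  have hLB0 : ∀ v, 0 ≤ LB v := fun v => m2_nonneg fun _ _ _ _ => I_nonneg _
  set S : V → Prop := fun v => (a v ∧ τ < LB v) ∨ (b v ∧ τ < LA v) with hS
  set σ := av fun x => I (S x) with hσ
  have hσ0 : 0 ≤ σ := av_nonneg fun _ => I_nonneg _
  have hσ1 : σ ≤ 2*10^4*μ := by
    have h1 : av (fun x => I (a x ∧ τ < LB x)) ≤ μ / τ := av_S_le (by positivity) hLB0 (by rw [N_link] at hw; exact hw)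
    have h2 : av (fun x => I (b x ∧ τ < LA x)) ≤ μ / τ := av_S_le (by positivity) hLA0 (by rw [N_link] at hw''; exact hw'')
    have h3 : σ ≤ av (fun x => I (a x ∧ τ < LB x)) + av (fun x => I (b x ∧ τ < LA x)) := by
      rw [hσ, ← av_add]; exact av_mono fun x => I_or_le _ _
    have h4 : μ / τ = 10^4 * μ := by rw [hτ]; field_simp
    rw [h4] at h1 h2
    linarith
  set A : Finset V := univ.filter fun v => LB v ≤ τ with hA
  set B : Finset V := univ.filter fun v => τ < LB v ∧ LA v ≤ τ with hB
  set O : Finset V := univ.filter fun v => τ < LB v ∧ τ < LA v with hO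
  have mA : ∀ v, v ∈ A ↔ LB v ≤ τ := fun v => by simp [hA]
  have mB : ∀ v, v ∈ B ↔ τ < LB v ∧ LA v ≤ τ := fun v => by simp [hB]
  have mO : ∀ v, v ∈ O ↔ τ < LB v ∧ τ < LA v := fun v => by simp [hO]
  have aS : ∀ v, a v → v ∈ A ∨ S v := fun v h => by
    rw [mA]
    rcases le_or_gt (LB v) τ with h1 | h1
    · exact Or.inl h1
    · exact Or.inr (Or.inl ⟨h, h1⟩)
  have bS : ∀ v, b v → v ∈ B ∨ S v := fun v h => by
    rw [mB]
    rcases le_or_gt (LB v) τ with h1 | h1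
    · exact Or.inr (Or.inr ⟨h, hL2 v h1⟩)
    · rcases le_or_gt (LA v) τ with h2 | h2
      · exact Or.inl ⟨h1, h2⟩
      · exact Or.inr (Or.inr ⟨h, h2⟩)
  have AS : ∀ v, v ∈ A → a v ∨ S v := fun v h => by
    rw [mA] at h
    by_cases h1 : a v
    · exact Or.inl h1
    · exact Or.inr (Or.inr ⟨h1, hL2 v h⟩)
  have BS : ∀ v, v ∈ B → b v ∨ S v := fun v h => by
    rw [mB] at h
    by_cases h1 : a v
    · exact Or.inr (Or.inl ⟨h1, h.1⟩)
    · exact Or.inl h1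
  have OS : ∀ v, v ∈ O → S v := fun v h => by
    rw [mO] at h
    by_cases h1 : a v
    · exact Or.inl ⟨h1, h.1⟩
    · exact Or.inr ⟨h1, h.2⟩
  have avle : ∀ P Q : V → Prop, (∀ v, P v → Q v ∨ S v) → av (fun v => I (P v)) ≤ av (fun v => I (Q v)) + σ := by
    intro P Q h
    rw [hσ, ← av_add]
    exact av_mono fun v => (I_mono (h v)).trans (I_or_le _ _)
  have hA1 := avle _ _ aS
  have hA2 := avle _ _ AS
  have hB1 := avle _ _ bS
  have hB2 := avle _ _ BS
  have hO1 : av (fun v => I (v ∈ O)) ≤ σ := av_mono fun v => I_mono (OS v)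
  have hσ2 : σ ≤ 2/10^12 := by linarith
  have hEn : ∀ v : V, ∀ y z, (0:ℝ) ≤ I (G.E v y z) := fun _ _ _ => I_nonneg _
  have hEn1 : ∀ v : V, ∀ y z, I (G.E v y z) ≤ (1:ℝ) := fun _ _ _ => I_le_one _
  have hNn : ∀ v : V, ∀ y z, (0:ℝ) ≤ I (¬ G.E v y z) := fun _ _ _ => I_nonneg _
  have hNn1 : ∀ v : V, ∀ y z, I (¬ G.E v y z) ≤ (1:ℝ) := fun _ _ _ => I_le_one _
  have hcard : ∀ X : Finset V, ∀ c : ℝ, (av fun v => I (v ∈ X)) ≤ c → (X.card : ℝ) ≤ c * Fintype.card V := fun X c h => by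
    rw [av_card hn X]; exact mul_le_mul_of_nonneg_right h hn.le
  have hcard' : ∀ X : Finset V, ∀ c : ℝ, c ≤ (av fun v => I (v ∈ X)) → c * Fintype.card V ≤ (X.card : ℝ) := fun X c h => by
    rw [av_card hn X]; exact mul_le_mul_of_nonneg_right h hn.le
  refine ⟨A, B, O, ?_, ?_, ?_, ?_, hcard' _ _ (by linarith), hcard _ _ (by linarith), hcard' _ _ (by linarith), hcard _ _ (by linarith),
    hcard _ _ (by linarith), hcard _ _ (by linarith), ?_, ?_, ?_, ?_, ?_, ?_, ?_, ?_⟩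
  · intro v h1 h2; rw [mA] at h1; rw [mB] at h2; linarith [h2.1]
  · intro v h1 h2; rw [mA] at h1; rw [mO] at h2; linarith [h2.1]
  · intro v h1 h2; rw [mB] at h1; rw [mO] at h2; linarith [h2.2, h1.2]
  · intro v; rw [mA, mB, mO]
    rcases le_or_gt (LB v) τ with h1 | h1
    · exact Or.inl h1
    · rcases le_or_gt (LA v) τ with h2 | h2
      · exact Or.inr (Or.inl ⟨h1, h2⟩)
      · exact Or.inr (Or.inr ⟨h1, h2⟩)
  · intro v hv
    rw [m2_sum (fun y => y ∈ A) (fun y => y ∈ A) (fun y z => ¬ G.E v y z) hn]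
    refine mul_le_mul_of_nonneg_right ?_ (by positivity)
    have h1 := m2_tr hn (hNn v) (hNn1 v) AS AS
    rw [m2_compl a a] at h1
    have h2 : α * α - LA v ≤ 22 * μ + τ := ext_arith4 (by linarith) (by linarith) hμ τ ((mA v).1 hv) (hL v) hαu
    rw [hτ] at h2
    linarith
  · intro v hv
    rw [m2_sum (fun y => y ∈ A) (fun y => y ∈ B) (fun y z => G.E v y z) hn]
    refine mul_le_mul_of_nonneg_right ?_ (by positivity)
    have h1 := m2_tr hn (hEn v) (hEn1 v) AS BS
    have h2 : LB v ≤ τ := (mA v).1 hv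
    rw [hτ] at h2
    linarith
  · intro v hv
    rw [m2_sum (fun y => y ∈ A) (fun y => y ∈ B) (fun y z => ¬ G.E v y z) hn]
    refine mul_le_mul_of_nonneg_right ?_ (by positivity)
    have h1 := m2_tr hn (hNn v) (hNn1 v) AS BS
    rw [m2_compl a b] at h1
    have h2 : α * β - LB v ≤ 22 * μ + τ := ext_arith4 (by linarith) (by linarith) hμ τ ((mB v).1 hv).2 (by linarith [hL v]) hβu
    rw [hτ] at h2
    linarith
  · intro v hv
    rw [m2_sum (fun y => y ∈ A) (fun y => y ∈ A) (fun y z => G.E v y z) hn]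
    refine mul_le_mul_of_nonneg_right ?_ (by positivity)
    have h1 := m2_tr hn (hEn v) (hEn1 v) AS AS
    have h2 : LA v ≤ τ := ((mB v).1 hv).2
    rw [hτ] at h2
    linarith
  · intro v hv
    rw [m2_sum (fun y => y ∈ A) (fun y => y ∈ A) (fun y z => G.E v y z) hn]
    refine mul_le_mul_of_nonneg_right ?_ (by positivity)
    have h1 := m2_tr hn (hEn v) (hEn1 v) aS aS
    have h2 : τ < LA v := ((mO v).1 hv).2
    rw [hτ] at h2
    linarith
  · intro v hv
    rw [m2_sum (fun y => y ∈ A) (fun y => y ∈ B) (fun y z => G.E v y z) hn]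
    refine mul_le_mul_of_nonneg_right ?_ (by positivity)
    have h1 := m2_tr hn (hEn v) (hEn1 v) aS bS
    have h2 : τ < LB v := ((mO v).1 hv).1
    rw [hτ] at h2
    linarith
  · rw [m3_sum (fun y => y ∈ A) (fun y => y ∈ A) (fun y => y ∈ A) (fun x y z => ¬ G.E x y z) hn]
    refine mul_le_mul_of_nonneg_right ?_ (by positivity)
    have h1 := av3_tr hn (f := fun x => m2 (fun y => y ∈ A) (fun y => y ∈ A) (fun y z => I (¬ G.E x y z)))
      (g := fun x => m2 a a (fun y z => I (¬ G.E x y z))) (fun x => m2_nonneg fun _ _ _ _ => I_nonneg _)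
      (fun x => m2_sum_le hn _ _ (by norm_num) fun _ _ _ _ => I_le_one _) (fun x => m2_tr hn (hNn x) (hNn1 x) AS AS) hσ0 AS hσ.symm
    have h2 : av (fun x => I (a x) * m2 a a (fun y z => I (¬ G.E x y z))) = α * α * α - G.N a a a := by
      rw [N_link]
      simp only [m2_compl, mul_sub]
      rw [av_sub, av_mulc]; ring
    rw [h2] at h1
    linarith
  · rw [m3_sum (fun y => y ∈ A) (fun y => y ∈ B) (fun y => y ∈ B) (fun x y z => ¬ G.E x y z) hn]
    refine mul_le_mul_of_nonneg_right ?_ (by positivity)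
    have h1 := av3_tr hn (f := fun x => m2 (fun y => y ∈ B) (fun y => y ∈ B) (fun y z => I (¬ G.E x y z)))
      (g := fun x => m2 b b (fun y z => I (¬ G.E x y z))) (fun x => m2_nonneg fun _ _ _ _ => I_nonneg _)
      (fun x => m2_sum_le hn _ _ (by norm_num) fun _ _ _ _ => I_le_one _) (fun x => m2_tr hn (hNn x) (hNn1 x) BS BS) hσ0 AS hσ.symm
    have h2 : av (fun x => I (a x) * m2 b b (fun y z => I (¬ G.E x y z))) = α * β * β - G.N a b b := by
      rw [N_link]
      simp only [m2_compl, mul_sub]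
      rw [av_sub, av_mulc]; ring
    rw [h2] at h1
    linarith

end KF

open Finset

namespace KF
open Classical

lemma Ile1 {p q r : Prop} (h : p → q ∨ r) : I p ≤ I q + I r := (I_mono h).trans (I_or_le _ _)
lemma Ile2 {p q r s : Prop} (h : p → q ∨ r ∨ s) : I p ≤ I q + (I r + I s) :=
  (Ile1 h).trans (add_le_add le_rfl (I_or_le _ _))
lemma Ile3 {p q r s t : Prop} (h : p → q ∨ r ∨ s ∨ t) : I p ≤ I q + (I r + (I s + I t)) :=
  (Ile1 h).trans (add_le_add le_rfl (Ile2 id))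
lemma Ile4 {p q r s t u : Prop} (h : p → q ∨ r ∨ s ∨ t ∨ u) : I p ≤ I q + (I r + (I s + (I t + I u))) :=
  (Ile1 h).trans (add_le_add le_rfl (Ile3 id))
lemma Ile5 {p q r s t u v : Prop} (h : p → q ∨ r ∨ s ∨ t ∨ u ∨ v) : I p ≤ I q + (I r + (I s + (I t + (I u + I v)))) :=
  (Ile1 h).trans (add_le_add le_rfl (Ile4 id))
lemma Ile6 {p q r s t u v w : Prop} (h : p → q ∨ r ∨ s ∨ t ∨ u ∨ v ∨ w) : I p ≤ I q + (I r + (I s + (I t + (I u + (I v + I w))))) :=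
  (Ile1 h).trans (add_le_add le_rfl (Ile5 id))

section
variable {V : Type} [Fintype V]

lemma s3_ab (F : V → V → ℝ) : ∑ a, ∑ b, ∑ _c : V, F a b = (Fintype.card V : ℝ) * ∑ a, ∑ b, F a b := by
  simp only [Finset.sum_const, Finset.card_univ, nsmul_eq_mul, Finset.mul_sum]
lemma s3_ac (F : V → V → ℝ) : ∑ a, ∑ _b : V, ∑ c, F a c = (Fintype.card V : ℝ) * ∑ a, ∑ b, F a b := by
  simp only [Finset.sum_const, Finset.card_univ, nsmul_eq_mul, Finset.mul_sum]
lemma s3_bc (F : V → V → ℝ) : ∑ _a : V, ∑ b, ∑ c, F b c = (Fintype.card V : ℝ) * ∑ a, ∑ b, F a b := by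
  simp only [Finset.sum_const, Finset.card_univ, nsmul_eq_mul]

lemma s2_prod (P Q : Finset V) : ∑ a, ∑ b, I (a ∈ P ∧ b ∈ Q) = (P.card : ℝ) * Q.card := by
  simp only [I_and, ← Finset.mul_sum, ← Finset.sum_mul, sum_I_mem]
lemma s3_prod (P Q R : Finset V) : ∑ a, ∑ b, ∑ c, I (a ∈ P ∧ b ∈ Q ∧ c ∈ R) = (P.card : ℝ) * Q.card * R.card := by
  simp only [I_and, ← Finset.mul_sum, ← Finset.sum_mul, sum_I_mem]; ring
lemma s4_prod (P Q R S : Finset V) : ∑ a, ∑ b, ∑ c, ∑ d, I (a ∈ P ∧ b ∈ Q ∧ c ∈ R ∧ d ∈ S) = (P.card : ℝ) * Q.card * R.card * S.card := by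
  simp only [I_and, ← Finset.mul_sum, ← Finset.sum_mul, sum_I_mem]; ring

lemma s4_abc (F : V → V → V → ℝ) : ∑ a, ∑ b, ∑ c, ∑ _d : V, F a b c = (Fintype.card V : ℝ) * ∑ a, ∑ b, ∑ c, F a b c := by
  simp only [Finset.sum_const, Finset.card_univ, nsmul_eq_mul, Finset.mul_sum]
lemma s4_abd (F : V → V → V → ℝ) : ∑ a, ∑ b, ∑ _c : V, ∑ d, F a b d = (Fintype.card V : ℝ) * ∑ a, ∑ b, ∑ c, F a b c := by
  simp only [Finset.sum_const, Finset.card_univ, nsmul_eq_mul, Finset.mul_sum]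
lemma s4_acd (F : V → V → V → ℝ) : ∑ a, ∑ _b : V, ∑ c, ∑ d, F a c d = (Fintype.card V : ℝ) * ∑ a, ∑ b, ∑ c, F a b c := by
  simp only [Finset.sum_const, Finset.card_univ, nsmul_eq_mul, Finset.mul_sum]

variable {G : G3 V} {A B O : Finset V} {ε : ℝ}

lemma Ext.rA (h : Ext G A B O ε) {x y : V} (hx : x ∈ A) (hy : y ∈ A) : Rch G 3 (1/20) x y := by
  refine Rch.direct ?_
  have pt : ∀ a b c : V, I (a ∈ A ∧ b ∈ A ∧ c ∈ A) ≤ I (G.K x a b c ∧ G.K y a b c) +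
      (I (a ∈ A ∧ b ∈ A ∧ ¬ G.E x a b) + (I (a ∈ A ∧ c ∈ A ∧ ¬ G.E x a c) + (I (b ∈ A ∧ c ∈ A ∧ ¬ G.E x b c) +
      (I (a ∈ A ∧ b ∈ A ∧ ¬ G.E y a b) + (I (a ∈ A ∧ c ∈ A ∧ ¬ G.E y a c) + I (b ∈ A ∧ c ∈ A ∧ ¬ G.E y b c)))))) := by
    intro a b c
    apply Ile6
    unfold G3.K; tauto
  have hs := Finset.sum_le_sum fun a (_ : a ∈ (univ : Finset V)) => Finset.sum_le_sum fun b (_ : b ∈ (univ : Finset V)) =>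
    Finset.sum_le_sum fun c (_ : c ∈ (univ : Finset V)) => pt a b c
  simp only [Finset.sum_add_distrib] at hs
  rw [s3_prod, s3_ab, s3_ac, s3_bc, s3_ab, s3_ac, s3_bc] at hs
  have h1 := h.a1 x hx
  have h2 := h.a1 y hy
  have h3 := h.cA
  set n : ℝ := (Fintype.card V : ℝ) with hn
  have hn0 : 0 ≤ n := Nat.cast_nonneg _
  have h4 := mul_le_mul_of_nonneg_left h1 hn0
  have h5 := mul_le_mul_of_nonneg_left h2 hn0
  have h6 : (0.499 * n) * (0.499 * n) * (0.499 * n) ≤ (A.card : ℝ) * A.card * A.card := by gcongr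
  have h7 : 0 ≤ n^3 := by positivity
  linarith

lemma Ext.rB (h : Ext G A B O ε) {x y : V} (hx : x ∈ B) (hy : y ∈ B) : Rch G 3 (1/20) x y := by
  refine Rch.direct ?_
  have pt : ∀ a b c : V, I (a ∈ A ∧ b ∈ B ∧ c ∈ B) ≤ I (G.K x a b c ∧ G.K y a b c) +
      (I (a ∈ A ∧ b ∈ B ∧ ¬ G.E x a b) + (I (a ∈ A ∧ c ∈ B ∧ ¬ G.E x a c) + (I (a ∈ A ∧ b ∈ B ∧ c ∈ B ∧ ¬ G.E a b c) +
      (I (a ∈ A ∧ b ∈ B ∧ ¬ G.E y a b) + I (a ∈ A ∧ c ∈ B ∧ ¬ G.E y a c))))) := by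
    intro a b c
    apply Ile5
    unfold G3.K; tauto
  have hs := Finset.sum_le_sum fun a (_ : a ∈ (univ : Finset V)) => Finset.sum_le_sum fun b (_ : b ∈ (univ : Finset V)) =>
    Finset.sum_le_sum fun c (_ : c ∈ (univ : Finset V)) => pt a b c
  simp only [Finset.sum_add_distrib] at hs
  rw [s3_prod, s3_ab, s3_ac, s3_ab, s3_ac] at hs
  have h1 := h.b1 x hx
  have h2 := h.b1 y hy
  have h3 := h.cA
  have h3' := h.cB
  have h8 := h.tb
  set n : ℝ := (Fintype.card V : ℝ) with hn
  have hn0 : 0 ≤ n := Nat.cast_nonneg _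
  have h4 := mul_le_mul_of_nonneg_left h1 hn0
  have h5 := mul_le_mul_of_nonneg_left h2 hn0
  have h6 : (0.499 * n) * (0.499 * n) * (0.499 * n) ≤ (A.card : ℝ) * B.card * B.card := by gcongr
  have h7 : 0 ≤ n^3 := by positivity
  linarith

/-- good quadruples in the extremal case -/
def gdX (A B : Finset V) (q : Fin 4 → V) : Prop :=
  Function.Injective q ∧ ((∀ i, q i ∈ A) ∨ (q 0 ∈ A ∧ q 1 ∈ B ∧ q 2 ∈ B ∧ q 3 ∈ B))

lemma Ext.gd (h : Ext G A B O ε) (q : Fin 4 → V) (hq : gdX A B q) :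
    Function.Injective q ∧ 1/20 * (Fintype.card V : ℝ)^4 ≤
      ∑ p : Fin 4 → V, I (G.K (p 0) (p 1) (p 2) (p 3) ∧ ∀ i, Rch G 3 (1/20) (q i) (p i)) := by
  refine ⟨hq.1, ?_⟩
  obtain ⟨B', hB', hr, ht⟩ : ∃ B' : Finset V, 0.499 * Fintype.card V ≤ (B'.card : ℝ) ∧
      (∀ p : Fin 4 → V, p 0 ∈ A → p 1 ∈ B' → p 2 ∈ B' → p 3 ∈ B' → ∀ i, Rch G 3 (1/20) (q i) (p i)) ∧
      ∑ x, ∑ y, ∑ z, I (x ∈ A ∧ y ∈ B' ∧ z ∈ B' ∧ ¬ G.E x y z) ≤ 1/10^11 * (Fintype.card V : ℝ)^3 := by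
    rcases hq.2 with h1 | ⟨h0, h1, h2, h3⟩
    · refine ⟨A, h.cA, fun p p0 p1 p2 p3 i => ?_, h.ta⟩
      fin_cases i
      · exact h.rA (h1 _) p0
      · exact h.rA (h1 _) p1
      · exact h.rA (h1 _) p2
      · exact h.rA (h1 _) p3
    · refine ⟨B, h.cB, fun p p0 p1 p2 p3 i => ?_, h.tb⟩
      fin_cases i
      · exact h.rA h0 p0
      · exact h.rB h1 p1
      · exact h.rB h2 p2
      · exact h.rB h3 p3
  rw [sum_fin4]
  have pt : ∀ a b c d : V, I (a ∈ A ∧ b ∈ B' ∧ c ∈ B' ∧ d ∈ B') ≤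
      I (G.K (![a,b,c,d] 0) (![a,b,c,d] 1) (![a,b,c,d] 2) (![a,b,c,d] 3) ∧ ∀ i, Rch G 3 (1/20) (q i) (![a,b,c,d] i)) +
      (I (a ∈ A ∧ b ∈ B' ∧ c ∈ B' ∧ ¬ G.E a b c) + (I (a ∈ A ∧ b ∈ B' ∧ d ∈ B' ∧ ¬ G.E a b d) + 
        I (a ∈ A ∧ c ∈ B' ∧ d ∈ B' ∧ ¬ G.E a c d))) := by
    intro a b c d
    apply Ile3
    rintro ⟨ha, hb, hc, hd⟩
    by_cases e1 : G.E a b c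
    swap
    · tauto
    by_cases e2 : G.E a b d
    swap
    · tauto
    by_cases e3 : G.E a c d
    swap
    · tauto
    exact Or.inl ⟨Or.inl ⟨e1, e2, e3⟩, hr _ ha hb hc hd⟩
  have hs := Finset.sum_le_sum fun a (_ : a ∈ (univ : Finset V)) => Finset.sum_le_sum fun b (_ : b ∈ (univ : Finset V)) =>
    Finset.sum_le_sum fun c (_ : c ∈ (univ : Finset V)) => Finset.sum_le_sum fun d (_ : d ∈ (univ : Finset V)) => pt a b c d
  simp only [Finset.sum_add_distrib] at hs
  rw [s4_prod, s4_abc, s4_abd, s4_acd] at hs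
  have h3 := h.cA
  set n : ℝ := (Fintype.card V : ℝ) with hn
  have hn0 : 0 ≤ n := Nat.cast_nonneg _
  have h4 := mul_le_mul_of_nonneg_left ht hn0
  have h6 : (0.499 * n) * (0.499 * n) * (0.499 * n) * (0.499 * n) ≤ (A.card : ℝ) * B'.card * B'.card * B'.card := by gcongr
  have h7 : 0 ≤ n^4 := by positivity
  linarith

/-- decomposition of a leftover set into good quadruples -/
lemma Ext.dec (h : Ext G A B O ε) (j : ℕ) : ∀ (k : ℕ) (L : Finset V), L ⊆ A ∪ B → (L ∩ B).card = 3 * j → j ≤ (L ∩ A).card →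
    L.card = 4 * k → Dc (gdX A B) k L := by
  induction j with
  | zero =>
    intro k L hL hB _ hc
    refine Dc_all (gdX A B) A (fun q hq hA => ⟨hq, Or.inl hA⟩) k L ?_ hc
    intro v hv
    rcases Finset.mem_union.1 (hL hv) with h1 | h1
    · exact h1
    · have : L ∩ B = ∅ := Finset.card_eq_zero.1 (by omega)
      have h2 : v ∈ L ∩ B := Finset.mem_inter.2 ⟨hv, h1⟩
      rw [this] at h2; simp at h2
  | succ j ih =>
    intro k L hL hB hA hc
    obtain ⟨Q, hQ, hQc⟩ := Finset.exists_subset_card_eq (show 3 ≤ (L ∩ B).card by omega)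
    obtain ⟨b1, b2, b3, n12, n13, n23, rfl⟩ := Finset.card_eq_three.1 hQc
    obtain ⟨a, ha⟩ : (L ∩ A).Nonempty := Finset.card_pos.1 (by omega)
    rw [Finset.mem_inter] at ha
    have m1 := Finset.mem_inter.1 (hQ (show b1 ∈ _ by simp))
    have m2 := Finset.mem_inter.1 (hQ (show b2 ∈ _ by simp))
    have m3 := Finset.mem_inter.1 (hQ (show b3 ∈ _ by simp))
    have naB : a ∉ B := h.dAB a ha.2
    have na1 : a ≠ b1 := fun e => naB (e ▸ m1.2)
    have na2 : a ≠ b2 := fun e => naB (e ▸ m2.2)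
    have na3 : a ≠ b3 := fun e => naB (e ▸ m3.2)
    have hrg : rg ![a, b1, b2, b3] = {a, b1, b2, b3} := rg_fin4 _
    have hsub : ({a, b1, b2, b3} : Finset V) ⊆ L := by
      intro v hv
      simp only [Finset.mem_insert, Finset.mem_singleton] at hv
      rcases hv with rfl | rfl | rfl | rfl
      exacts [ha.1, m1.1, m2.1, m3.1]
    have hc4 : ({a, b1, b2, b3} : Finset V).card = 4 := by
      rw [Finset.card_insert_of_notMem (by simp [na1, na2, na3]), hQc]
    have hk : 4 ≤ L.card := hc4 ▸ Finset.card_le_card hsub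
    obtain ⟨k, rfl⟩ : ∃ k', k = k' + 1 := ⟨k - 1, by omega⟩
    have hinj : Function.Injective ![a, b1, b2, b3] := by
      intro i i' hi
      fin_cases i <;> fin_cases i' <;> simp_all
    have e1 : (L \ {a, b1, b2, b3}) ∩ B = (L ∩ B) \ {b1, b2, b3} := by
      ext v
      simp only [Finset.mem_inter, Finset.mem_sdiff, Finset.mem_insert, Finset.mem_singleton]
      constructor
      · rintro ⟨⟨h1, h2⟩, h3⟩; exact ⟨⟨h1, h3⟩, fun h4 => h2 (Or.inr h4)⟩
      · rintro ⟨⟨h1, h3⟩, h2⟩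
        refine ⟨⟨h1, ?_⟩, h3⟩
        rintro (rfl | h4)
        · exact naB h3
        · exact h2 h4
    have e2 : (L \ {a, b1, b2, b3}) ∩ A = (L ∩ A) \ {a} := by
      ext v
      simp only [Finset.mem_inter, Finset.mem_sdiff, Finset.mem_insert, Finset.mem_singleton]
      constructor
      · rintro ⟨⟨h1, h2⟩, h3⟩; exact ⟨⟨h1, h3⟩, fun h4 => h2 (Or.inl h4)⟩
      · rintro ⟨⟨h1, h3⟩, h2⟩
        refine ⟨⟨h1, ?_⟩, h3⟩
        rintro (h4 | rfl | rfl | rfl)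
        · exact h2 h4
        · exact h.dAB _ h3 m1.2
        · exact h.dAB _ h3 m2.2
        · exact h.dAB _ h3 m3.2
    have h1 := ih k (L \ {a, b1, b2, b3}) (Finset.sdiff_subset.trans hL)
      (by rw [e1, Finset.card_sdiff_of_subset hQ, hQc]; omega)
      (by rw [e2, Finset.card_sdiff_of_subset (by simpa using ha)]; simp; omega)
      (by rw [Finset.card_sdiff_of_subset hsub]; omega)
    have h2 := Dc.step (q := ![a, b1, b2, b3]) h1 ⟨hinj, Or.inr ⟨ha.2, m1.2, m2.2, m3.2⟩⟩ (by
      rw [hrg]; exact Finset.sdiff_disjoint)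
    rw [hrg, Finset.sdiff_union_of_subset hsub] at h2
    exact h2

end
end KF

open Finset

namespace KF
open Classical

section
variable {V : Type} [Fintype V] (G : G3 V) (A B : Finset V)

def Opt (X : Finset V) (r : ℕ) : Prop :=
  ∃ Y, Y ⊆ X ∧ Tl G Y ∧ X \ Y ⊆ A ∪ B ∧ ((X \ Y) ∩ B).card % 3 = r

def Gad (X : Finset V) : Prop := ∃ r s, r ≠ s ∧ Opt G A B X r ∧ Opt G A B X s

def VT (v : V) (T : Finset V) (r : ℕ) : Prop :=
  Tl G (insert v T) ∧ T ⊆ A ∪ B ∧ v ∉ T ∧ (T ∩ B).card = r ∧ T.card ≤ 3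

variable {G A B}

lemma Opt.of {Y R : Finset V} {r : ℕ} (hY : Tl G Y) (hd : Disjoint Y R) (hR : R ⊆ A ∪ B) (hr : (R ∩ B).card % 3 = r) :
    Opt G A B (Y ∪ R) r := by
  have : (Y ∪ R) \ Y = R := by
    rw [Finset.union_sdiff_left, Finset.sdiff_eq_self_of_disjoint hd.symm]
  exact ⟨Y, Finset.subset_union_left, hY, by rw [this]; exact hR, by rw [this]; exact hr⟩

lemma Opt.lt {X : Finset V} {r : ℕ} (h : Opt G A B X r) : r < 3 := by
  obtain ⟨Y, _, _, _, h⟩ := h; omega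

lemma Opt.union {X X' : Finset V} {r s t : ℕ} (h : Opt G A B X r) (h' : Opt G A B X' s) (hd : Disjoint X X')
    (ht : (r + s) % 3 = t) : Opt G A B (X ∪ X') t := by
  obtain ⟨Y, h1, h2, h3, h4⟩ := h
  obtain ⟨Y', h1', h2', h3', h4'⟩ := h'
  have e : (X ∪ X') \ (Y ∪ Y') = (X \ Y) ∪ (X' \ Y') := by
    ext v
    simp only [Finset.mem_sdiff, Finset.mem_union]
    constructor
    · tauto
    · rintro (⟨a, b⟩ | ⟨a, b⟩)
      · refine ⟨Or.inl a, ?_⟩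
        rintro (c | c)
        · exact b c
        · exact (Finset.disjoint_left.1 hd a) (h1' c)
      · refine ⟨Or.inr a, ?_⟩
        rintro (c | c)
        · exact (Finset.disjoint_left.1 hd (h1 c)) a
        · exact b c
  refine ⟨Y ∪ Y', Finset.union_subset_union h1 h1', h2.union h2' (hd.mono h1 h1'), ?_, ?_⟩
  · rw [e]; exact Finset.union_subset h3 h3'
  · rw [e, Finset.union_inter_distrib_right, Finset.card_union_of_disjoint]
    · omega
    · exact hd.mono (Finset.inter_subset_left.trans Finset.sdiff_subset) (Finset.inter_subset_left.trans Finset.sdiff_subset)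

lemma Gad.two {X X' : Finset V} (h : Gad G A B X) (h' : Gad G A B X') (hd : Disjoint X X') :
    ∀ r < 3, Opt G A B (X ∪ X') r := by
  obtain ⟨r, s, hrs, h1, h2⟩ := h
  obtain ⟨r', s', hrs', h1', h2'⟩ := h'
  intro t ht
  have := h1.lt
  have := h2.lt
  have := h1'.lt
  have := h2'.lt
  by_cases e1 : (r + r') % 3 = t
  · exact h1.union h1' hd e1
  by_cases e2 : (r + s') % 3 = t
  · exact h1.union h2' hd e2
  by_cases e3 : (s + r') % 3 = t
  · exact h2.union h1' hd e3
  by_cases e4 : (s + s') % 3 = t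
  · exact h2.union h2' hd e4
  omega

lemma VT.opt {v : V} {T R : Finset V} {r : ℕ} (h : VT G A B v T r) (hd : Disjoint T R) (hv : v ∉ R) (hR : R ⊆ A ∪ B) :
    Opt G A B (insert v (T ∪ R)) ((R ∩ B).card % 3) := by
  have := Opt.of (A := A) (B := B) h.1 (R := R) (by rw [Finset.disjoint_insert_left]; exact ⟨hv, hd⟩) hR rfl
  rwa [Finset.insert_union] at this

lemma VT.two {v : V} {T T' : Finset V} (h : VT G A B v T 0) (h' : VT G A B v T' 2) (hd : Disjoint T T') :
    Gad G A B (insert v (T ∪ T')) := by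
  have h1 := h.opt hd h'.2.2.1 h'.2.1
  have h2 := h'.opt hd.symm h.2.2.1 h.2.1
  rw [Finset.union_comm T' T] at h2
  rw [h'.2.2.2.1] at h1
  rw [h.2.2.2.1] at h2
  exact ⟨_, _, by norm_num, h1, h2⟩

lemma VT.three {v : V} {T T1 T2 : Finset V} (h : VT G A B v T 0) (h1 : VT G A B v T1 1) (h2 : VT G A B v T2 2)
    (d01 : Disjoint T T1) (d02 : Disjoint T T2) (d12 : Disjoint T1 T2) :
    ∀ r < 3, Opt G A B (insert v (T ∪ T1 ∪ T2)) r := by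
  have k0 := h.opt (R := T1 ∪ T2) (by rw [Finset.disjoint_union_right]; exact ⟨d01, d02⟩) (by simp [h1.2.2.1, h2.2.2.1])
    (Finset.union_subset h1.2.1 h2.2.1)
  have k1 := h1.opt (R := T ∪ T2) (by rw [Finset.disjoint_union_right]; exact ⟨d01.symm, d12⟩) (by simp [h.2.2.1, h2.2.2.1])
    (Finset.union_subset h.2.1 h2.2.1)
  have k2 := h2.opt (R := T ∪ T1) (by rw [Finset.disjoint_union_right]; exact ⟨d02.symm, d12.symm⟩) (by simp [h1.2.2.1, h.2.2.1])
    (Finset.union_subset h.2.1 h1.2.1)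
  have cd : ∀ P Q : Finset V, Disjoint P Q → ((P ∪ Q) ∩ B).card = (P ∩ B).card + (Q ∩ B).card := fun P Q hd => by
    rw [Finset.union_inter_distrib_right, Finset.card_union_of_disjoint]
    exact hd.mono Finset.inter_subset_left Finset.inter_subset_left
  rw [cd _ _ d12, h1.2.2.2.1, h2.2.2.2.1, ← Finset.union_assoc] at k0
  rw [cd _ _ d02, h.2.2.2.1, h2.2.2.2.1, ← Finset.union_assoc, Finset.union_comm T1 T] at k1
  rw [cd _ _ d01, h.2.2.2.1, h1.2.2.2.1, Finset.union_comm T2] at k2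
  intro r hr
  interval_cases r
  · exact k0
  · exact k2
  · exact k1

lemma gad_K {x y z t : V} (h : G.K x y z t) (hs : ({x, y, z, t} : Finset V) ⊆ A ∪ B)
    (hc : (({x, y, z, t} : Finset V) ∩ B).card % 3 ≠ 0) : Gad G A B {x, y, z, t} := by
  refine ⟨_, 0, hc, ⟨∅, Finset.empty_subset _, Tl.empty, by simpa using hs, by simp⟩, ⟨_, subset_rfl, Tl.of_K h, by simp, by simp⟩⟩

/-- two-dimensional avoidance -/
lemma avoid2 (f : V → V → Prop) (U : Finset V)
    (h : 2 * (U.card : ℝ) * (Fintype.card V : ℝ) < ∑ y, ∑ z, I (f y z)) :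
    ∃ y z, f y z ∧ y ∉ U ∧ z ∉ U := by
  by_contra hcon
  push Not at hcon
  have pt : ∀ y z, I (f y z) ≤ I (y ∈ U) + I (z ∈ U) := fun y z => by
    apply Ile1
    intro hf
    by_contra hh
    push Not at hh
    exact hh.2 (hcon y z hf hh.1)
  have hs := Finset.sum_le_sum fun a (_ : a ∈ (univ : Finset V)) => Finset.sum_le_sum fun b (_ : b ∈ (univ : Finset V)) => pt a b
  simp only [Finset.sum_add_distrib, Finset.sum_const, Finset.card_univ, nsmul_eq_mul, sum_I_mem, ← Finset.mul_sum] at hs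
  linarith

/-- cherries through a vertex -/
lemma path {v : V} {P : Finset V} (U : Finset V) (hU : U.card ≤ 20) (hn : (10:ℝ)^13 ≤ Fintype.card V)
    (h1 : 1/20000 * (Fintype.card V : ℝ)^2 ≤ ∑ y, ∑ z, I (y ∈ A ∧ z ∈ P ∧ G.E v y z))
    (h2 : ∑ x, ∑ y, ∑ z, I (x ∈ A ∧ y ∈ P ∧ z ∈ P ∧ ¬ G.E x y z) ≤ 1/10^11 * (Fintype.card V : ℝ)^3) :
    ∃ a p q, (a ∈ A ∧ p ∈ P ∧ q ∈ P ∧ G.E v a p ∧ G.E v a q ∧ G.E a p q) ∧ a ∉ U ∧ p ∉ U ∧ q ∉ U := by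
  apply avoid3 (fun a p q => a ∈ A ∧ p ∈ P ∧ q ∈ P ∧ G.E v a p ∧ G.E v a q ∧ G.E a p q)
  have pt : ∀ a p q : V, I (a ∈ A ∧ p ∈ P ∧ G.E v a p) * I (a ∈ A ∧ q ∈ P ∧ G.E v a q) ≤
      I (a ∈ A ∧ p ∈ P ∧ q ∈ P ∧ G.E v a p ∧ G.E v a q ∧ G.E a p q) + I (a ∈ A ∧ p ∈ P ∧ q ∈ P ∧ ¬ G.E a p q) := by
    intro a p q
    rw [← I_and]
    apply Ile1
    tauto
  have hs := Finset.sum_le_sum fun a (_ : a ∈ (univ : Finset V)) => Finset.sum_le_sum fun b (_ : b ∈ (univ : Finset V)) =>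
    Finset.sum_le_sum fun c (_ : c ∈ (univ : Finset V)) => pt a b c
  simp only [Finset.sum_add_distrib] at hs
  have e : ∑ a, ∑ p, ∑ q, I (a ∈ A ∧ p ∈ P ∧ G.E v a p) * I (a ∈ A ∧ q ∈ P ∧ G.E v a q) =
      ∑ a, (∑ p, I (a ∈ A ∧ p ∈ P ∧ G.E v a p))^2 := by
    refine Finset.sum_congr rfl fun a _ => ?_
    rw [pow_two, Finset.sum_mul_sum]
  rw [e] at hs
  have cs := sq_sum_le_card_mul_sum_sq (s := (univ : Finset V)) (f := fun a => ∑ p, I (a ∈ A ∧ p ∈ P ∧ G.E v a p))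
  rw [Finset.card_univ] at cs
  set n : ℝ := (Fintype.card V : ℝ) with hnn
  have hn0 : 0 < n := by linarith
  have h3 : (1/20000 * n^2)^2 ≤ n * ∑ a, (∑ p, I (a ∈ A ∧ p ∈ P ∧ G.E v a p))^2 := by
    refine le_trans ?_ cs
    gcongr
  have h4 : 1/20000^2 * n^3 ≤ ∑ a, (∑ p, I (a ∈ A ∧ p ∈ P ∧ G.E v a p))^2 := by
    refine le_of_mul_le_mul_left ?_ hn0
    refine le_trans (le_of_eq ?_) h3
    ring
  have h5 : (U.card : ℝ) ≤ 20 := by exact_mod_cast hU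
  have h6 : 3 * (U.card : ℝ) * n^2 ≤ 3 * 20 * n^2 := by gcongr
  have h7 : 10^13 * n^2 ≤ n * n^2 := by gcongr
  have h8 : 0 < n^2 := by positivity
  have h9 : n^3 = n * n^2 := by ring
  have h10 : 0 < n^3 := by positivity
  linarith

variable {O : Finset V} {ε : ℝ}

lemma Ext.vt0 (h : Ext G A B O ε) {v : V} (hv : v ∈ O) (U : Finset V) (hU : U.card ≤ 20) (hn : (10:ℝ)^13 ≤ Fintype.card V) :
    ∃ T, VT G A B v T 0 ∧ Disjoint T U := by
  obtain ⟨a, p, q, ⟨ha, hp, hq, e1, e2, e3⟩, ua, up, uq⟩ := path U hU hn (h.o1 v hv) h.ta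
  refine ⟨{a, p, q}, ⟨Tl.of_K (Or.inr (Or.inl ⟨e1, e2, e3⟩)), ?_, ?_, ?_, Finset.card_le_three⟩, ?_⟩
  · intro w hw
    simp only [Finset.mem_insert, Finset.mem_singleton] at hw
    rcases hw with rfl | rfl | rfl <;> simp [*]
  · have := h.dAO
    simp only [Finset.mem_insert, Finset.mem_singleton]
    rintro (rfl | rfl | rfl)
    exacts [h.dAO _ ha hv, h.dAO _ hp hv, h.dAO _ hq hv]
  · rw [Finset.card_eq_zero]
    ext w
    simp only [Finset.mem_inter, Finset.mem_insert, Finset.mem_singleton, Finset.notMem_empty, iff_false]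
    rintro ⟨rfl | rfl | rfl, hw⟩
    exacts [h.dAB _ ha hw, h.dAB _ hp hw, h.dAB _ hq hw]
  · simp [ua, up, uq]

lemma Ext.vt2 (h : Ext G A B O ε) {v : V} (hv : v ∈ O) (U : Finset V) (hU : U.card ≤ 20) (hn : (10:ℝ)^13 ≤ Fintype.card V) :
    ∃ T, VT G A B v T 2 ∧ Disjoint T U := by
  obtain ⟨a, p, q, ⟨ha, hp, hq, e1, e2, e3⟩, ua, up, uq⟩ := path U hU hn (h.o2 v hv) h.tb
  have hpq : p ≠ q := G.ne23 e3
  have haB := h.dAB _ ha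
  refine ⟨{a, p, q}, ⟨Tl.of_K (Or.inr (Or.inl ⟨e1, e2, e3⟩)), ?_, ?_, ?_, Finset.card_le_three⟩, ?_⟩
  · intro w hw
    simp only [Finset.mem_insert, Finset.mem_singleton] at hw
    rcases hw with rfl | rfl | rfl <;> simp [*]
  · simp only [Finset.mem_insert, Finset.mem_singleton]
    rintro (rfl | rfl | rfl)
    exacts [h.dAO _ ha hv, h.dBO _ hp hv, h.dBO _ hq hv]
  · rw [Finset.insert_inter_of_notMem haB, Finset.insert_inter_of_mem hp, Finset.singleton_inter_of_mem hq, Finset.card_pair hpq]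
  · simp [ua, up, uq]

lemma Ext.vgad (h : Ext G A B O ε) {v : V} (hv : v ∈ O) (U : Finset V) (hU : U.card ≤ 10) (hvU : v ∉ U) (hn : (10:ℝ)^13 ≤ Fintype.card V) :
    ∃ X, Gad G A B X ∧ Disjoint X U ∧ X.card ≤ 7 ∧ ∀ w ∈ X, w ∈ O → w = v := by
  obtain ⟨T, hT, dT⟩ := h.vt0 hv U (by omega) hn
  obtain ⟨T', hT', dT'⟩ := h.vt2 hv (U ∪ T) ((Finset.card_union_le _ _).trans (by linarith [hT.2.2.2.2])) hn
  rw [Finset.disjoint_union_right] at dT'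
  refine ⟨_, hT.two hT' dT'.2.symm, ?_, ?_, ?_⟩
  · simp [Finset.disjoint_insert_left, Finset.disjoint_union_left, hvU, dT, dT'.1]
  · have h1 := Finset.card_insert_le v (T ∪ T')
    have h2 := Finset.card_union_le T T'
    have := hT.2.2.2.2
    have := hT'.2.2.2.2
    omega
  · intro w hw hwO
    rw [Finset.mem_insert, Finset.mem_union] at hw
    have nO : w ∉ A ∪ B := fun hh => by
      rcases Finset.mem_union.1 hh with h1 | h1
      exacts [h.dAO _ h1 hwO, h.dBO _ h1 hwO]
    rcases hw with rfl | h1 | h1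
    · rfl
    · exact absurd (hT.2.1 h1) nO
    · exact absurd (hT'.2.1 h1) nO

end
end KF

open Finset

namespace KF
open Classical

section
variable {V : Type} [Fintype V] {G : G3 V} {A B O : Finset V} {ε : ℝ}

lemma Ext.dgad1 (h : Ext G A B O ε) {a b : V} (ha : a ∈ A) (hb : b ∈ B) (U : Finset V) (hU : U.card ≤ 10) (haU : a ∉ U) (hbU : b ∉ U)
    (hn : (10:ℝ)^13 ≤ Fintype.card V) (hd : 1/10 * (Fintype.card V : ℝ) ≤ ∑ z, I (z ∈ A ∧ G.E a b z)) :
    ∃ X, Gad G A B X ∧ Disjoint X U ∧ X.card ≤ 4 := by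
  obtain ⟨p, q, ⟨hp, hq, e1, e2, e3⟩, up, uq⟩ : ∃ p q, (p ∈ A ∧ q ∈ A ∧ G.E a b p ∧ G.E a b q ∧ G.E a p q) ∧ p ∉ U ∧ q ∉ U := by
    apply avoid2 (fun p q => p ∈ A ∧ q ∈ A ∧ G.E a b p ∧ G.E a b q ∧ G.E a p q)
    have pt : ∀ p q : V, I (p ∈ A ∧ G.E a b p) * I (q ∈ A ∧ G.E a b q) ≤
        I (p ∈ A ∧ q ∈ A ∧ G.E a b p ∧ G.E a b q ∧ G.E a p q) + I (p ∈ A ∧ q ∈ A ∧ ¬ G.E a p q) := by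
      intro p q
      rw [← I_and]
      apply Ile1
      tauto
    have hs := Finset.sum_le_sum fun a (_ : a ∈ (univ : Finset V)) => Finset.sum_le_sum fun b (_ : b ∈ (univ : Finset V)) => pt a b
    simp only [Finset.sum_add_distrib] at hs
    rw [← Finset.sum_mul_sum] at hs
    have h1 := h.a1 a ha
    set n : ℝ := (Fintype.card V : ℝ) with hnn
    have hn0 : 0 < n := by linarith
    have h5 : (U.card : ℝ) ≤ 10 := by exact_mod_cast hU
    have h6 : 2 * (U.card : ℝ) * n ≤ 2 * 10 * n := by gcongr
    have h7 : 10^13 * n ≤ n * n := by gcongr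
    have h8 : (1/10 * n) * (1/10 * n) ≤ (∑ z, I (z ∈ A ∧ G.E a b z)) * ∑ z, I (z ∈ A ∧ G.E a b z) := mul_self_le_mul_self (by positivity) hd
    have h9 : n^2 = n * n := by ring
    linarith
  have hA : ∀ w, w ∈ A → w ∉ B := h.dAB
  refine ⟨{a, b, p, q}, gad_K (Or.inl ⟨e1, e2, e3⟩) ?_ ?_, ?_, Finset.card_le_four⟩
  · intro w hw
    simp only [Finset.mem_insert, Finset.mem_singleton] at hw
    rcases hw with rfl | rfl | rfl | rfl <;> simp [*]
  · rw [Finset.insert_inter_of_notMem (hA a ha), Finset.insert_inter_of_mem hb, Finset.insert_inter_of_notMem (hA p hp),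
      Finset.singleton_inter_of_notMem (hA q hq)]
    simp
  · simp [haU, hbU, up, uq]

lemma Ext.dgad (h : Ext G A B O ε) {a a' b : V} (ha : a ∈ A) (ha' : a' ∈ A) (hb : b ∈ B) (e : G.E a a' b) (U : Finset V) (hU : U.card ≤ 10)
    (haU : a ∉ U) (haU' : a' ∉ U) (hbU : b ∉ U)
    (hn : (10:ℝ)^13 ≤ Fintype.card V) (hG : G.CD (1/2 - 1/10^7)) :
    ∃ X, Gad G A B X ∧ Disjoint X U ∧ X.card ≤ 4 := by
  by_cases hd : 1/10 * (Fintype.card V : ℝ) ≤ ∑ z, I (z ∈ A ∧ G.E a b z)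
  · exact h.dgad1 ha hb U hU haU hbU hn hd
  by_cases hd' : 1/10 * (Fintype.card V : ℝ) ≤ ∑ z, I (z ∈ A ∧ G.E a' b z)
  · exact h.dgad1 ha' hb U hU haU' hbU hn hd'
  push Not at hd hd'
  have hab : a ≠ b := G.ne13 e
  have hab' : a' ≠ b := G.ne23 e
  have pt : ∀ x : V, ∀ z, I (G.E x b z) ≤ I (z ∈ B ∧ G.E x b z) + (I (z ∈ A ∧ G.E x b z) + I (z ∈ O)) := fun x z => by
    apply Ile2
    have := h.un z
    tauto
  have k1 := (hG a b hab).trans (Finset.sum_le_sum fun z _ => pt a z)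
  have k2 := (hG a' b hab').trans (Finset.sum_le_sum fun z _ => pt a' z)
  simp only [Finset.sum_add_distrib, sum_I_mem] at k1 k2
  have pt2 : ∀ z, I (z ∈ B ∧ G.E a b z) + I (z ∈ B ∧ G.E a' b z) ≤ I ((z ∈ B ∧ G.E a b z ∧ G.E a' b z) ∧ z ∉ U) + (I (z ∈ U) + I (z ∈ B)) := fun z => by
    by_cases h1 : z ∈ B
    swap
    · rw [I_false (fun h => h1 h.1), I_false (fun h => h1 h.1)]
      linarith [I_nonneg ((z ∈ B ∧ G.E a b z ∧ G.E a' b z) ∧ z ∉ U), I_nonneg (z ∈ U), I_nonneg (z ∈ B)]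
    rw [I_true h1]
    by_cases h2 : G.E a b z
    swap
    · rw [I_false (fun h => h2 h.2)]
      linarith [I_nonneg ((z ∈ B ∧ G.E a b z ∧ G.E a' b z) ∧ z ∉ U), I_nonneg (z ∈ U), I_le_one (z ∈ B ∧ G.E a' b z)]
    by_cases h3 : G.E a' b z
    swap
    · rw [I_false (show ¬ (z ∈ B ∧ G.E a' b z) from fun h => h3 h.2)]
      linarith [I_nonneg ((z ∈ B ∧ G.E a b z ∧ G.E a' b z) ∧ z ∉ U), I_nonneg (z ∈ U), I_le_one (z ∈ B ∧ G.E a b z)]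
    by_cases h4 : z ∈ U
    · rw [I_true h4]
      linarith [I_nonneg ((z ∈ B ∧ G.E a b z ∧ G.E a' b z) ∧ z ∉ U), I_le_one (z ∈ B ∧ G.E a b z), I_le_one (z ∈ B ∧ G.E a' b z)]
    · rw [I_true (show (z ∈ B ∧ G.E a b z ∧ G.E a' b z) ∧ z ∉ U from ⟨⟨h1, h2, h3⟩, h4⟩)]
      linarith [I_nonneg (z ∈ U), I_le_one (z ∈ B ∧ G.E a b z), I_le_one (z ∈ B ∧ G.E a' b z)]
  have k3 := Finset.sum_le_sum fun z (_ : z ∈ (univ : Finset V)) => pt2 z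
  simp only [Finset.sum_add_distrib, sum_I_mem] at k3
  have h5 : (U.card : ℝ) ≤ 10 := by exact_mod_cast hU
  have h6 := h.cB'
  have h7 := h.cO'
  obtain ⟨z, _, ⟨hz, e1, e2⟩, hzU⟩ := exists_of_sum_I_pos univ (fun z => (z ∈ B ∧ G.E a b z ∧ G.E a' b z) ∧ z ∉ U) (by linarith)
  have hA : ∀ w, w ∈ A → w ∉ B := h.dAB
  refine ⟨{a, a', b, z}, gad_K (Or.inr (Or.inr (Or.inl ⟨e, e1, e2⟩))) ?_ ?_, ?_, Finset.card_le_four⟩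
  · intro w hw
    simp only [Finset.mem_insert, Finset.mem_singleton] at hw
    rcases hw with rfl | rfl | rfl | rfl <;> simp [*]
  · rw [Finset.insert_inter_of_notMem (hA a ha), Finset.insert_inter_of_notMem (hA a' ha'), Finset.insert_inter_of_mem hb, 
      Finset.singleton_inter_of_mem hz, Finset.card_pair (G.ne23 e1)]
    norm_num
  · simp [haU, hbU, haU', hzU]

/-- few bad pairs -/
lemma badpair (P Q U : Finset V) (W : V → V → V → Prop) (hU : U.card ≤ 10) (hn : (10:ℝ)^13 ≤ Fintype.card V)
    (hW : ∀ f ∈ U, ∑ y, ∑ z, I (y ∈ P ∧ z ∈ Q ∧ W f y z) ≤ 1/1000 * (Fintype.card V : ℝ)^2) :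
    ∑ y, ∑ z, I (y ∈ P ∧ z ∈ Q ∧ (y = z ∨ y ∈ U ∨ z ∈ U ∨ ∃ f ∈ U, W f y z)) ≤ 2/100 * (Fintype.card V : ℝ)^2 := by
  have pt : ∀ y z, I (y ∈ P ∧ z ∈ Q ∧ (y = z ∨ y ∈ U ∨ z ∈ U ∨ ∃ f ∈ U, W f y z)) ≤
      (I (y = z) + (I (y ∈ U) + I (z ∈ U))) + ∑ f ∈ U, I (y ∈ P ∧ z ∈ Q ∧ W f y z) := by
    intro y z
    have h0 : 0 ≤ ∑ f ∈ U, I (y ∈ P ∧ z ∈ Q ∧ W f y z) := Finset.sum_nonneg fun _ _ => I_nonneg _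
    have h1 := I_nonneg (y = z)
    have h2 := I_nonneg (y ∈ U)
    have h3 := I_nonneg (z ∈ U)
    by_cases hh : (y ∈ P ∧ z ∈ Q ∧ (y = z ∨ y ∈ U ∨ z ∈ U ∨ ∃ f ∈ U, W f y z))
    swap
    · rw [I_false hh]; linarith
    rw [I_true hh]
    obtain ⟨hP, hQ, h | h | h | ⟨f, hf, h⟩⟩ := hh
    · rw [I_true h]; linarith
    · rw [I_true h]; linarith
    · rw [I_true h]; linarith
    · have := Finset.single_le_sum (f := fun f => I (y ∈ P ∧ z ∈ Q ∧ W f y z)) (fun _ _ => I_nonneg _) hf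
      rw [I_true ⟨hP, hQ, h⟩] at this
      linarith
  have hs := Finset.sum_le_sum fun a (_ : a ∈ (univ : Finset V)) => Finset.sum_le_sum fun b (_ : b ∈ (univ : Finset V)) => pt a b
  simp only [Finset.sum_add_distrib, Finset.sum_const, Finset.card_univ, nsmul_eq_mul, sum_I_mem, ← Finset.mul_sum] at hs
  have e1 : ∑ y : V, ∑ z : V, I (y = z) = (Fintype.card V : ℝ) := by simp [I]
  have e2 : ∑ y : V, ∑ z : V, ∑ f ∈ U, I (y ∈ P ∧ z ∈ Q ∧ W f y z) ≤ U.card * (1/1000 * (Fintype.card V : ℝ)^2) := by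
    have : ∑ y : V, ∑ z : V, ∑ f ∈ U, I (y ∈ P ∧ z ∈ Q ∧ W f y z) = ∑ f ∈ U, ∑ y, ∑ z, I (y ∈ P ∧ z ∈ Q ∧ W f y z) := by
      rw [Finset.sum_comm]
      rw [Finset.sum_congr rfl fun y _ => Finset.sum_comm]
      rw [Finset.sum_comm]
      refine Finset.sum_congr rfl fun f _ => Finset.sum_comm
    rw [this]
    refine (Finset.sum_le_sum hW).trans ?_
    simp
  rw [e1] at hs
  set n : ℝ := (Fintype.card V : ℝ) with hnn
  have hn0 : 0 < n := by linarith
  have h5 : (U.card : ℝ) ≤ 10 := by exact_mod_cast hU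
  have h6 : (U.card : ℝ) * n ≤ 10 * n := by gcongr
  have h7 : 10^13 * n ≤ n * n := by gcongr
  have h8 : (U.card : ℝ) * (1/1000 * n^2) ≤ 10 * (1/1000 * n^2) := by gcongr
  have h9 : n^2 = n * n := by ring
  linarith

end
end KF

open Finset

namespace KF
open Classical

section
variable {V : Type} [Fintype V] {G : G3 V} {A B O : Finset V} {ε : ℝ}

lemma Ext.card_eq (h : Ext G A B O ε) : A.card + B.card + O.card = Fintype.card V := by
  have d1 : Disjoint A B := Finset.disjoint_left.2 fun v hv => h.dAB v hv
  have d2 : Disjoint (A ∪ B) O := by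
    rw [Finset.disjoint_union_left]
    exact ⟨Finset.disjoint_left.2 fun v hv => h.dAO v hv, Finset.disjoint_left.2 fun v hv => h.dBO v hv⟩
  rw [← Finset.card_union_of_disjoint d1, ← Finset.card_union_of_disjoint d2, ← Finset.card_univ]
  congr 1
  ext v
  have := h.un v
  simp only [Finset.mem_union, Finset.mem_univ, iff_true]; tauto

lemma Ext.adj (h : Ext G A B O ε) (hn : (10:ℝ)^13 ≤ Fintype.card V) (hG : G.CD (1/2 - 1/10^7))
    (hc : ∀ x y, x ≠ y → Fintype.card V ≤ 2 * (univ.filter fun z => G.E x y z).card + 2) :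
    ∃ X : Finset V, X.card ≤ 20 ∧ ∀ r < 3, Opt G A B X r := by
  by_cases RW : ∀ U : Finset V, U.card ≤ 10 → ∃ a a' b, a ∈ A ∧ a' ∈ A ∧ b ∈ B ∧ G.E a a' b ∧ a ∉ U ∧ a' ∉ U ∧ b ∉ U
  · obtain ⟨a, a', b, ha, ha', hb, he, u1, u2, u3⟩ := RW ∅ (by simp)
    obtain ⟨X, hX, _, hXc⟩ := h.dgad ha ha' hb he ∅ (by simp) u1 u2 u3 hn hG
    obtain ⟨a, a', b, ha, ha', hb, he, u1, u2, u3⟩ := RW X (by omega)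
    obtain ⟨X', hX', hd, hXc'⟩ := h.dgad ha ha' hb he X (by omega) u1 u2 u3 hn hG
    exact ⟨X ∪ X', (Finset.card_union_le _ _).trans (by omega), hX.two hX' hd.symm⟩
  push Not at RW
  obtain ⟨U, hU, hR⟩ := RW
  have n0 : (0:ℝ) ≤ 1/1000 * (Fintype.card V : ℝ)^2 := by positivity
  have SA := badpair A A U (fun f y z => f ∈ B ∧ G.E f y z) hU hn (fun f _ => by
    by_cases hf : f ∈ B
    · refine le_trans (le_of_eq ?_) (h.b2 f hf)
      refine Finset.sum_congr rfl fun y _ => Finset.sum_congr rfl fun z _ => I_congr ?_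
      tauto
    · refine le_trans (le_of_eq ?_) n0
      exact Finset.sum_eq_zero fun y _ => Finset.sum_eq_zero fun z _ => I_false (by tauto))
  have SB := badpair A B U (fun f y z => f ∈ A ∧ G.E f y z) hU hn (fun f _ => by
    by_cases hf : f ∈ A
    · refine le_trans (le_of_eq ?_) (h.a2 f hf)
      refine Finset.sum_congr rfl fun y _ => Finset.sum_congr rfl fun z _ => I_congr ?_
      tauto
    · refine le_trans (le_of_eq ?_) n0
      exact Finset.sum_eq_zero fun y _ => Finset.sum_eq_zero fun z _ => I_false (by tauto))
  set bA : V → V → Prop := fun y z => y = z ∨ y ∈ U ∨ z ∈ U ∨ ∃ f ∈ U, f ∈ B ∧ G.E f y z with hbA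
  set bB : V → V → Prop := fun y z => y = z ∨ y ∈ U ∨ z ∈ U ∨ ∃ f ∈ U, f ∈ A ∧ G.E f y z with hbB
  change ∑ y, ∑ z, I (y ∈ A ∧ z ∈ A ∧ bA y z) ≤ _ at SA
  change ∑ y, ∑ z, I (y ∈ A ∧ z ∈ B ∧ bB y z) ≤ _ at SB
  -- neighbourhoods of good pairs
  have nA : ∀ y z, y ∈ A → z ∈ A → ¬ bA y z → ∀ w, G.E y z w → w ∈ ((A \ {y, z}) ∪ O) := by
    intro y z hy hz hb w hw
    simp only [hbA, not_or, not_exists] at hb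
    obtain ⟨_, b1, b2, b3⟩ := hb
    have hwB : w ∉ B := fun hwB => by
      have := hR y z w hy hz hwB hw b1 b2
      exact b3 w ⟨this, hwB, (G.rot w y z).2 hw⟩
    have e1 := G.ne13 hw
    have e2 := G.ne23 hw
    rw [Finset.mem_union, Finset.mem_sdiff, Finset.mem_insert, Finset.mem_singleton]
    rcases h.un w with h1 | h1 | h1
    · exact Or.inl ⟨h1, by rintro (e | e); exacts [e1 e.symm, e2 e.symm]⟩
    · exact absurd h1 hwB
    · exact Or.inr h1
  have nB : ∀ y z, y ∈ A → z ∈ B → ¬ bB y z → ∀ w, G.E y z w → w ∈ ((B \ {z}) ∪ O) := by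
    intro y z hy hz hb w hw
    simp only [hbB, not_or, not_exists] at hb
    obtain ⟨_, b1, b2, b3⟩ := hb
    have hwA : w ∉ A := fun hwA => by
      by_cases hwU : w ∈ U
      · exact b3 w ⟨hwU, hwA, (G.rot w y z).2 hw⟩
      · exact b2 (hR y w z hy hwA hz ((G.c2 y z w).1 hw) b1 hwU)
    have e2 := G.ne23 hw
    rw [Finset.mem_union, Finset.mem_sdiff, Finset.mem_singleton]
    rcases h.un w with h1 | h1 | h1
    · exact absurd h1 hwA
    · exact Or.inl ⟨h1, fun e => e2 e.symm⟩
    · exact Or.inr h1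
  obtain ⟨c, c1, b0, ⟨hcA, hc1, hb0, g1, g2, g3⟩, -, -, -⟩ : ∃ c c1 b0, (c ∈ A ∧ c1 ∈ A ∧ b0 ∈ B ∧ ¬ bA c c1 ∧ ¬ bB c b0 ∧ ¬ bB c1 b0) ∧
      c ∉ (∅ : Finset V) ∧ c1 ∉ (∅ : Finset V) ∧ b0 ∉ (∅ : Finset V) := by
    apply avoid3 (fun c c1 b0 => c ∈ A ∧ c1 ∈ A ∧ b0 ∈ B ∧ ¬ bA c c1 ∧ ¬ bB c b0 ∧ ¬ bB c1 b0)
    have pt : ∀ x y z : V, I (x ∈ A ∧ y ∈ A ∧ z ∈ B) ≤ I (x ∈ A ∧ y ∈ A ∧ z ∈ B ∧ ¬ bA x y ∧ ¬ bB x z ∧ ¬ bB y z) +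
        (I (x ∈ A ∧ y ∈ A ∧ bA x y) + (I (x ∈ A ∧ z ∈ B ∧ bB x z) + I (y ∈ A ∧ z ∈ B ∧ bB y z))) := by
      intro x y z
      apply Ile3
      clear_value bA bB
      tauto
    have hs := Finset.sum_le_sum fun a (_ : a ∈ (univ : Finset V)) => Finset.sum_le_sum fun b (_ : b ∈ (univ : Finset V)) =>
      Finset.sum_le_sum fun c (_ : c ∈ (univ : Finset V)) => pt a b c
    simp only [Finset.sum_add_distrib] at hs
    rw [s3_prod, s3_ab, s3_ac, s3_bc] at hs
    have h3 := h.cA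
    have h3' := h.cB
    clear_value bA bB
    set n : ℝ := (Fintype.card V : ℝ) with hnn
    have hn0 : 0 < n := by linarith
    have h4 := mul_le_mul_of_nonneg_left SA hn0.le
    have h5 := mul_le_mul_of_nonneg_left SB hn0.le
    have h6 : (0.499 * n) * (0.499 * n) * (0.499 * n) ≤ (A.card : ℝ) * A.card * B.card := by gcongr
    have h7 : 0 < n^3 := by positivity
    simp only [Finset.card_empty, Nat.cast_zero]
    linarith
  have hcc : c ≠ c1 := fun e => g1 (Or.inl e)
  have hcb : c ≠ b0 := fun e => g2 (Or.inl e)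
  have hcb1 : c1 ≠ b0 := fun e => g3 (Or.inl e)
  have ce := h.card_eq
  have sA : (A \ {c, c1}).card = A.card - 2 := by
    rw [Finset.card_sdiff_of_subset, Finset.card_pair hcc]
    intro w hw
    simp only [Finset.mem_insert, Finset.mem_singleton] at hw
    rcases hw with rfl | rfl <;> assumption
  have sA2 : 2 ≤ A.card := by
    rw [← Finset.card_pair hcc]
    apply Finset.card_le_card
    intro w hw
    simp only [Finset.mem_insert, Finset.mem_singleton] at hw
    rcases hw with rfl | rfl <;> assumption
  have sB : (B \ {b0}).card = B.card - 1 := by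
    rw [Finset.card_sdiff_of_subset (by simpa using hb0), Finset.card_singleton]
  have sB1 : 1 ≤ B.card := Finset.card_pos.2 ⟨b0, hb0⟩
  have q1 : Fintype.card V ≤ 2 * (A.card - 2 + O.card) + 2 := by
    refine (hc c c1 hcc).trans ?_
    have : (univ.filter fun z => G.E c c1 z).card ≤ ((A \ {c, c1}) ∪ O).card :=
      Finset.card_le_card fun w hw => nA c c1 hcA hc1 g1 w (Finset.mem_filter.1 hw).2
    have := Finset.card_union_le (A \ {c, c1}) O
    omega
  have q2 : Fintype.card V ≤ 2 * (B.card - 1 + O.card) + 2 := by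
    refine (hc c b0 hcb).trans ?_
    have : (univ.filter fun z => G.E c b0 z).card ≤ ((B \ {b0}) ∪ O).card :=
      Finset.card_le_card fun w hw => nB c b0 hcA hb0 g2 w (Finset.mem_filter.1 hw).2
    have := Finset.card_union_le (B \ {b0}) O
    omega
  by_cases hO2 : 2 ≤ O.card
  · obtain ⟨v, hv, v', hv', hvv⟩ := Finset.one_lt_card.1 (show 1 < O.card by omega)
    obtain ⟨X, hX, _, hXc, hXO⟩ := h.vgad hv ∅ (by simp) (by simp) hn
    obtain ⟨X', hX', hd, hXc', _⟩ := h.vgad hv' X (by omega) (fun hh => hvv (hXO v' hh hv').symm) hn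
    exact ⟨X ∪ X', (Finset.card_union_le _ _).trans (by omega), hX.two hX' hd.symm⟩
  obtain ⟨v, rfl⟩ := Finset.card_eq_one.1 (show O.card = 1 by omega)
  have hv : v ∈ ({v} : Finset V) := by simp
  rw [Finset.card_singleton] at q1 q2 ce
  have e1 : G.E c c1 v := by
    by_contra hh
    have : (univ.filter fun z => G.E c c1 z).card ≤ (A \ {c, c1}).card :=
      Finset.card_le_card fun w hw => by
        have h2 := (Finset.mem_filter.1 hw).2
        rcases Finset.mem_union.1 (nA c c1 hcA hc1 g1 w h2) with h1 | h1
        · exact h1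
        · rw [Finset.mem_singleton] at h1; subst h1; exact absurd h2 hh
    have := hc c c1 hcc
    omega
  have e2 : ∀ y, y ∈ A → ¬ bB y b0 → y ≠ b0 → G.E y b0 v := by
    intro y hy hg hne
    by_contra hh
    have : (univ.filter fun z => G.E y b0 z).card ≤ (B \ {b0}).card :=
      Finset.card_le_card fun w hw => by
        have h2 := (Finset.mem_filter.1 hw).2
        rcases Finset.mem_union.1 (nB y b0 hy hb0 hg w h2) with h1 | h1
        · exact h1
        · rw [Finset.mem_singleton] at h1; subst h1; exact absurd h2 hh
    have := hc y b0 hne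
    omega
  have hT1 : VT G A B v {c, c1, b0} 1 := by
    refine ⟨Tl.of_K (Or.inl ⟨(G.rot v c c1).2 e1, (G.rot v c b0).2 (e2 c hcA g2 hcb), (G.rot v c1 b0).2 (e2 c1 hc1 g3 hcb1)⟩), ?_, ?_, ?_, Finset.card_le_three⟩
    · intro w hw
      simp only [Finset.mem_insert, Finset.mem_singleton] at hw
      rcases hw with rfl | rfl | rfl <;> simp [*]
    · simp only [Finset.mem_insert, Finset.mem_singleton]
      rintro (rfl | rfl | rfl)
      exacts [h.dAO _ hcA hv, h.dAO _ hc1 hv, h.dBO _ hb0 hv]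
    · rw [Finset.insert_inter_of_notMem (h.dAB _ hcA), Finset.insert_inter_of_notMem (h.dAB _ hc1), Finset.singleton_inter_of_mem hb0, Finset.card_singleton]
  obtain ⟨T, hT, d0⟩ := h.vt0 hv {c, c1, b0} (Finset.card_le_three.trans (by norm_num)) hn
  have u1 := Finset.card_union_le {c, c1, b0} T
  have u2 := hT.2.2.2.2
  have u3 := hT1.2.2.2.2
  obtain ⟨T2, hT2, d2⟩ := h.vt2 hv ({c, c1, b0} ∪ T) (by omega) hn
  rw [Finset.disjoint_union_right] at d2
  refine ⟨_, ?_, hT.three hT1 hT2 d0 d2.2.symm d2.1.symm⟩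
  have u4 := hT2.2.2.2.2
  have u5 := Finset.card_insert_le v (T ∪ {c, c1, b0} ∪ T2)
  have u6 := Finset.card_union_le (T ∪ {c, c1, b0}) T2
  have u7 := Finset.card_union_le T {c, c1, b0}
  omega

end
end KF

open Finset

namespace KF
open Classical

/-- extremal case -/
lemma case2 : ∃ ε : ℝ, 0 < ε ∧ ε ≤ 1/10^7 ∧ ∃ N0 : ℕ,
    ∀ (V : Type) [Fintype V] (G : G3 V), N0 ≤ Fintype.card V → G.CD (1/2 - ε) →
    (∀ x y : V, x ≠ y → Fintype.card V ≤ 2 * (univ.filter fun z => G.E x y z).card + 2) →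
    ∀ A B O : Finset V, Ext G A B O ε → 4 ∣ Fintype.card V → Tl G univ := by
  obtain ⟨ε, hε0, hε1, has⟩ := assemble
  obtain ⟨c, hc0, hcε, N0, h⟩ := has 3 (1/20) (by norm_num) (by norm_num)
  obtain ⟨N1, hN1⟩ := exists_nat_gt (10^4 / c)
  refine ⟨ε, hε0, hε1, N0 + N1 + 10^13, ?_⟩
  intro V _ G hN hG hcd A B O hX h4
  have hn13 : (10:ℝ)^13 ≤ Fintype.card V := by
    exact_mod_cast (by omega : 10^13 ≤ Fintype.card V)
  have hcn : 10^4 ≤ c * (Fintype.card V : ℝ) := by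
    have h1 : (N1 : ℝ) ≤ Fintype.card V := by exact_mod_cast (by omega : N1 ≤ Fintype.card V)
    have h2 : 10^4 / c ≤ (Fintype.card V : ℝ) := by linarith
    rw [div_le_iff₀ hc0] at h2
    linarith
  obtain ⟨X, hXc, hXo⟩ := hX.adj hn13 (CD_mono hG (by linarith)) hcd
  have hXr : (X.card : ℝ) ≤ 20 := by exact_mod_cast hXc
  have hcA := hX.cA
  set n : ℝ := (Fintype.card V : ℝ) with hn
  have hcn' : c * n ≤ 1/10^7 * n := mul_le_mul_of_nonneg_right (hcε.trans hε1) (by linarith)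
  obtain ⟨s, hs1, hs2⟩ : ∃ s : ℕ, c / 10 * n ≤ s ∧ (s : ℝ) ≤ c / 10 * n + 1 :=
    ⟨⌈c / 10 * n⌉₊, Nat.le_ceil _, (Nat.ceil_lt_add_one (by linarith)).le⟩
  have hsA : s ≤ (A \ X).card := by
    have h1 : A.card ≤ (A \ X).card + X.card := by
      have := Finset.card_le_card (show A ⊆ (A \ X) ∪ X by intro v; simp; tauto)
      exact this.trans (Finset.card_union_le _ _)
    have h2 : (A.card : ℝ) ≤ (A \ X).card + X.card := by exact_mod_cast h1
    have h3 : (s : ℝ) ≤ ((A \ X).card : ℝ) := by linarith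
    exact_mod_cast h3
  obtain ⟨R, hRA, hRc⟩ := Finset.exists_subset_card_eq hsA
  have hRX : Disjoint X R := Finset.disjoint_right.2 fun v hv => (Finset.mem_sdiff.1 (hRA hv)).2
  have hFc : (X ∪ R).card = X.card + s := by rw [Finset.card_union_of_disjoint hRX, hRc]
  refine h V G (by omega) hG (gdX A B) (fun q hq => hX.gd q hq) O (X ∪ R) hX.cO ?_ ?_ h4
  · rw [hFc]; push_cast; linarith
  intro L0 hL0 hL0c h40
  obtain ⟨Y, hYX, hYT, hYs, hYr⟩ := hXo ((3 - (L0 ∩ B).card % 3) % 3) (Nat.mod_lt _ (by norm_num))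
  have hY4 := hYT.card
  have hYF : Y ⊆ X ∪ R := hYX.trans Finset.subset_union_left
  have eF : (X ∪ R) \ Y = R ∪ (X \ Y) := by
    ext v
    have : v ∈ R → v ∉ X := fun hv => Finset.disjoint_right.1 hRX hv
    have h2 : v ∈ Y → v ∈ X := fun hv => hYX hv
    simp only [Finset.mem_sdiff, Finset.mem_union]
    tauto
  have hLd : ∀ v ∈ L0, v ∉ O ∧ v ∉ X ∧ v ∉ R := by
    intro v hv
    have := Finset.disjoint_left.1 hL0 hv
    simp only [Finset.mem_union] at this
    tauto
  have hRA' : ∀ v ∈ R, v ∈ A := fun v hv => (Finset.mem_sdiff.1 (hRA hv)).1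
  have hLc : (L0 ∪ ((X ∪ R) \ Y)).card + Y.card = L0.card + (X ∪ R).card := by
    rw [Finset.card_union_of_disjoint, add_assoc, Finset.card_sdiff_add_card_eq_card hYF]
    exact Finset.disjoint_left.2 fun v hv hv2 => by
      have := hLd v hv
      simp only [Finset.mem_sdiff, Finset.mem_union] at hv2
      tauto
  have hLB : ((L0 ∪ ((X ∪ R) \ Y)) ∩ B).card = (L0 ∩ B).card + ((X \ Y) ∩ B).card := by
    rw [← Finset.card_union_of_disjoint]
    · congr 1
      ext v
      have h1 := hRA' v
      have h2 := hX.dAB v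
      rw [eF]
      simp only [Finset.mem_sdiff, Finset.mem_union, Finset.mem_inter]
      tauto
    · exact Finset.disjoint_left.2 fun v hv hv2 => by
        simp only [Finset.mem_sdiff, Finset.mem_inter] at hv hv2
        have := hLd v hv.1
        tauto
  have hLA : s ≤ ((L0 ∪ ((X ∪ R) \ Y)) ∩ A).card := by
    rw [← hRc]
    refine Finset.card_le_card fun v hv => ?_
    rw [eF]
    have := hRA' v hv
    simp only [Finset.mem_union, Finset.mem_inter]
    tauto
  have hb1 : (L0 ∩ B).card ≤ L0.card := Finset.card_le_card Finset.inter_subset_left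
  have hb2 : ((X \ Y) ∩ B).card ≤ X.card :=
    Finset.card_le_card (Finset.inter_subset_left.trans Finset.sdiff_subset)
  have hLs : L0.card + X.card ≤ s := by
    have : (L0.card : ℝ) + X.card ≤ s := by linarith
    exact_mod_cast this
  refine ⟨Y, hYF, hYT, (L0 ∪ ((X ∪ R) \ Y)).card / 4, ?_, ?_⟩
  · have h1 : (((L0 ∪ ((X ∪ R) \ Y)).card / 4 : ℕ) : ℝ) ≤ ((L0.card + (X.card + s) : ℕ) : ℝ) := by
      exact_mod_cast (by omega : (L0 ∪ ((X ∪ R) \ Y)).card / 4 ≤ L0.card + (X.card + s))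
    push_cast at h1
    linarith
  · refine hX.dec (((L0 ∪ ((X ∪ R) \ Y)) ∩ B).card / 3) _ _ ?_ ?_ ?_ ?_
    · intro v hv
      rw [eF] at hv
      simp only [Finset.mem_union] at hv ⊢
      rcases hv with hv | hv | hv
      · have := hLd v hv
        have := hX.un v
        tauto
      · exact Or.inl (hRA' v hv)
      · exact Finset.mem_union.1 (hYs hv)
    · omega
    · omega
    · omega

end KF

open Finset

namespace KF
open Classical

lemma CD_of_exact {V : Type} [Fintype V] {G : G3 V} {δ : ℝ} (hn : 1 ≤ δ * (Fintype.card V : ℝ))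
    (hc : ∀ x y : V, x ≠ y → Fintype.card V ≤ 2 * (univ.filter fun z => G.E x y z).card + 2) :
    G.CD (1/2 - δ) := by
  intro x y hxy
  rw [sum_I]
  have h : (Fintype.card V : ℝ) ≤ 2 * ((univ.filter fun z => G.E x y z).card : ℝ) + 2 := by
    exact_mod_cast hc x y hxy
  linarith

lemma main_G3 : ∃ N0 : ℕ, ∀ (V : Type) [Fintype V] (G : G3 V), N0 ≤ Fintype.card V → 4 ∣ Fintype.card V →
    (∀ x y : V, x ≠ y → Fintype.card V ≤ 2 * (univ.filter fun z => G.E x y z).card + 2) → Tl G univ := by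
  obtain ⟨ε1, hε1, hε1', h1⟩ := case1
  obtain ⟨ε2, hε2, hε2', N2, h2⟩ := case2
  obtain ⟨μ, hμ, h3⟩ := ext_of ε2 hε2
  obtain ⟨M, β, hβ, N3, h4⟩ := dichotomy μ ε1 hμ hε1
  obtain ⟨N4, h5⟩ := h1 M β hβ
  obtain ⟨N5, hN5⟩ := exists_nat_gt (1 / ε1)
  obtain ⟨N6, hN6⟩ := exists_nat_gt (1 / ε2)
  obtain ⟨N7, hN7⟩ := exists_nat_gt (1 / μ)
  refine ⟨N2 + N3 + N4 + N5 + N6 + N7, ?_⟩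
  intro V _ G hN hd hc
  have g5 : (N5 : ℝ) ≤ Fintype.card V := by exact_mod_cast (by omega : N5 ≤ Fintype.card V)
  have g6 : (N6 : ℝ) ≤ Fintype.card V := by exact_mod_cast (by omega : N6 ≤ Fintype.card V)
  have g7 : (N7 : ℝ) ≤ Fintype.card V := by exact_mod_cast (by omega : N7 ≤ Fintype.card V)
  have k : ∀ δ : ℝ, 0 < δ → 1 / δ ≤ (Fintype.card V : ℝ) → G.CD (1/2 - δ) := by
    intro δ hδ h
    refine CD_of_exact ?_ hc
    rw [div_le_iff₀ hδ] at h
    linarith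
  have c1 := k ε1 hε1 (by linarith)
  have c2 := k ε2 hε2 (by linarith)
  have c3 := k μ hμ (by linarith)
  rcases h4 V G (by omega) (CD_mono c1 (by linarith)) with ⟨O, hO, hr⟩ | ⟨A, hA, hA', hE⟩
  · exact h5 V G (by omega) c1 O hO hr hd
  · obtain ⟨A', B, O, hX⟩ := h3 V G (by linarith) c3 A hA hA' hE
    exact h2 V G (by omega) c2 hc A' B O hX hd

end KF

open Finset

namespace KF

/-- the 3-graph structure attached to an edge set -/
def ofH {n : ℕ} (H : Finset (Finset (Fin n))) (h3 : Is3Graph n H) : G3 (Fin n) where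
  E x y z := ({x, y, z} : Finset (Fin n)) ∈ H
  s1 := by
    intro x y z h
    rwa [Finset.insert_comm] at h
  s2 := by
    intro x y z h
    rwa [Finset.pair_comm] at h
  ne := by
    rintro x y z h rfl
    have h1 := h3 _ h
    rw [Finset.insert_eq_of_mem (by simp)] at h1
    have := Finset.card_le_two (a := x) (b := z)
    omega

lemma spans_of_K {n : ℕ} {H : Finset (Finset (Fin n))} {h3 : Is3Graph n H} {x y z t : Fin n}
    (h : (ofH H h3).K x y z t) : SpansK4m H {x, y, z, t} := by
  obtain ⟨h1, h2, h4, h5, h6, h7⟩ := (ofH H h3).K_ne h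
  have hc : ({x, y, z, t} : Finset (Fin n)).card = 4 := by
    rw [Finset.card_insert_of_notMem, Finset.card_insert_of_notMem, Finset.card_insert_of_notMem,
      Finset.card_singleton] <;> simp [*]
  refine ⟨hc, ?_⟩
  have key : ∀ a b c : Finset (Fin n), a ≠ b → a ≠ c → b ≠ c → a ∈ H → b ∈ H → c ∈ H →
      a ⊆ {x, y, z, t} → b ⊆ {x, y, z, t} → c ⊆ {x, y, z, t} →
      3 ≤ ((({x, y, z, t} : Finset (Fin n)).powersetCard 3).filter (· ∈ H)).card := by
    intro a b c ab ac bc ha hb hc sa sb sc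
    have e : ({a, b, c} : Finset (Finset (Fin n))).card = 3 := Finset.card_eq_three.2 ⟨a, b, c, ab, ac, bc, rfl⟩
    refine e.symm.le.trans (Finset.card_le_card fun s hs => ?_)
    simp only [Finset.mem_insert, Finset.mem_singleton] at hs
    rw [Finset.mem_filter, Finset.mem_powersetCard]
    rcases hs with rfl | rfl | rfl
    · exact ⟨⟨sa, h3 _ ha⟩, ha⟩
    · exact ⟨⟨sb, h3 _ hb⟩, hb⟩
    · exact ⟨⟨sc, h3 _ hc⟩, hc⟩
  have n1 : ∀ {a b : Finset (Fin n)} (v : Fin n), v ∈ a → v ∉ b → a ≠ b := by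
    rintro a b v h1 h2 rfl; exact h2 h1
  have s1 : ({x, y, z} : Finset (Fin n)) ⊆ {x, y, z, t} := by intro v; simp; tauto
  have s2 : ({x, y, t} : Finset (Fin n)) ⊆ {x, y, z, t} := by intro v; simp; tauto
  have s3 : ({x, z, t} : Finset (Fin n)) ⊆ {x, y, z, t} := by intro v; simp; tauto
  have s4 : ({y, z, t} : Finset (Fin n)) ⊆ {x, y, z, t} := by intro v; simp; tauto
  have d12 : ({x, y, z} : Finset (Fin n)) ≠ {x, y, t} := n1 z (by simp) (by simp; tauto)
  have d13 : ({x, y, z} : Finset (Fin n)) ≠ {x, z, t} := n1 y (by simp) (by simp; tauto)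
  have d14 : ({x, y, z} : Finset (Fin n)) ≠ {y, z, t} := n1 x (by simp) (by simp; tauto)
  have d23 : ({x, y, t} : Finset (Fin n)) ≠ {x, z, t} := n1 y (by simp) (by simp; tauto)
  have d24 : ({x, y, t} : Finset (Fin n)) ≠ {y, z, t} := n1 x (by simp) (by simp; tauto)
  have d34 : ({x, z, t} : Finset (Fin n)) ≠ {y, z, t} := n1 x (by simp) (by simp; tauto)
  rcases h with ⟨a, b, c⟩ | ⟨a, b, c⟩ | ⟨a, b, c⟩ | ⟨a, b, c⟩
  · exact key _ _ _ d12 d13 d23 a b c s1 s2 s3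
  · exact key _ _ _ d12 d14 d24 a b c s1 s2 s4
  · exact key _ _ _ d13 d14 d34 a b c s1 s3 s4
  · exact key _ _ _ d23 d24 d34 a b c s2 s3 s4

lemma factor_of_Tl {n : ℕ} {H : Finset (Finset (Fin n))} {h3 : Is3Graph n H} {X : Finset (Fin n)}
    (h : Tl (ofH H h3) X) : HasK4mFactorOn H X := by
  induction h with
  | empty => exact ⟨∅, by simp, by simp, by simp⟩
  | @cons S x y z t hS hK hd ih =>
    obtain ⟨P, p1, p2, p3⟩ := ih
    have hsub : ∀ T ∈ P, ∀ v ∈ T, v ∈ S := by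
      intro T hT v hv
      rw [← p3]
      exact Finset.mem_biUnion.2 ⟨T, hT, hv⟩
    have hdj : ∀ T ∈ P, Disjoint T ({x, y, z, t} : Finset (Fin n)) := by
      intro T hT
      refine Finset.disjoint_left.2 fun v hv hv2 => Finset.disjoint_left.1 hd (hsub T hT v hv) ?_
      simpa using hv2
    refine ⟨insert {x, y, z, t} P, ?_, ?_, ?_⟩
    · intro T hT
      rcases Finset.mem_insert.1 hT with rfl | hT
      · exact spans_of_K hK
      · exact p1 T hT
    · intro T hT T' hT' hne
      rcases Finset.mem_insert.1 hT with rfl | hT <;> rcases Finset.mem_insert.1 hT' with rfl | hT'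
      · exact absurd rfl hne
      · exact (hdj T' hT').symm
      · exact hdj T hT
      · exact p2 T hT T' hT' hne
    · rw [Finset.biUnion_insert, p3]
      ext v
      simp only [id, Finset.mem_union, Finset.mem_insert, Finset.mem_singleton]
      tauto

end KF

/-- exact codegree threshold for `K₄⁻`-factors. -/
theorem stmt_0 :
    ∃ n₀ : ℕ, ∀ n : ℕ, n₀ ≤ n → 4 ∣ n →
      ∀ H : Finset (Finset (Fin n)), Is3Graph n H →
        CodegLB H ((n : ℝ) / 2 - 1) →
        HasK4mFactorOn H Finset.univ := by
  obtain ⟨N0, h⟩ := KF.main_G3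
  refine ⟨N0, fun n hn h4 H h3 hc => ?_⟩
  refine KF.factor_of_Tl (h3 := h3) (h (Fin n) (KF.ofH H h3) (by simpa using hn) (by simpa using h4) ?_)
  intro x y hxy
  have h1 := hc x y hxy
  unfold degOn at h1
  have h2 : (n : ℝ) ≤ 2 * ((univ.filter fun z => ({x, y, z} : Finset (Fin n)) ∈ H).card : ℝ) + 2 := by linarith
  have h5 : n ≤ 2 * (univ.filter fun z => ({x, y, z} : Finset (Fin n)) ∈ H).card + 2 := by exact_mod_cast h2
  rw [Fintype.card_fin]
  convert h5 using 4
  ext z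
  simp only [Finset.mem_filter, Finset.mem_univ, true_and]
  exact Iff.rfl
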